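/- Let μ be a Borel probability measure on SL₂(ℝ) with a finite exponential moment whose support generates a Zariski dense subgroup, and let ν be the unique μ-stationary measure on X = ℙ(ℝ²), identified with ℝ/πℤ. Fix C₁ > 0. Suppose r is a C¹ function and φ a C² function on ℝ/πℤ (i.e. π-periodic functions on ℝ) such that |φ'| ≥ 1/C₁ on the support of r and ‖r‖_{C¹} ≤ C₁, ‖φ‖_{C²} ≤ C₁. Then ∫ e^{iξφ(θ)} r(θ) dν(θ) → 0 as |ξ| → ∞, uniformly with respect to C₁; that is, for every ε > 0 there exists Ξ > 0 (depending only on μ, C₁ and ε) such that for all |ξ| ≥ Ξ and all pairs (r, φ) satisfying the above conditions with constant C₁, one has |∫ e^{iξφ(θ)} r(θ) dν(θ)| ≤ ε. -/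

import Mathlib

open MeasureTheory Filter

noncomputable section

abbrev SL2 := Matrix.SpecialLinearGroup (Fin 2) ℝ

abbrev PX := Projectivization ℝ (Fin 2 → ℝ)

instance : TopologicalSpace SL2 := instTopologicalSpaceSubtype
instance : TopologicalSpace PX := instTopologicalSpaceQuotient
instance : MeasurableSpace SL2 := borel _
instance : MeasurableSpace PX := borel _

/-- Euclidean norm on ℝ². -/
def enorm2 (v : Fin 2 → ℝ) : ℝ := Real.sqrt (v 0 ^ 2 + v 1 ^ 2)

/-- Operator norm of g ∈ SL₂(ℝ) w.r.t. the Euclidean norm on ℝ². -/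
def opNorm (g : SL2) : ℝ :=
  ‖Matrix.toEuclideanCLM (𝕜 := ℝ) (n := Fin 2) (g : Matrix (Fin 2) (Fin 2) ℝ)‖

/-- Cartan projection κ(g) = log ‖g‖. -/
def kappa (g : SL2) : ℝ := Real.log (opNorm g)

/-- The projective action of SL₂(ℝ) on ℙ(ℝ²). -/
def act (g : SL2) (x : PX) : PX :=
  Projectivization.map ((Matrix.SpecialLinearGroup.toLin' g).toLinearMap)
    (LinearEquiv.injective _) x

/-- The norm cocycle σ(g, ℝv) = log (‖gv‖/‖v‖). -/
def cocycle (g : SL2) (x : PX) : ℝ :=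
  Real.log (enorm2 ((g : Matrix (Fin 2) (Fin 2) ℝ).mulVec x.rep) / enorm2 x.rep)

/-- The sine distance d(ℝv, ℝw) = |det(v,w)|/(‖v‖‖w‖) on ℙ(ℝ²). -/
def projDist (x y : PX) : ℝ :=
  |x.rep 0 * y.rep 1 - x.rep 1 * y.rep 0| / (enorm2 x.rep * enorm2 y.rep)

/-- An angle θ(x) ∈ ℝ representing x = ℝ(cos θ, sin θ). -/
def pangle (x : PX) : ℝ := Complex.arg (x.rep 0 + x.rep 1 * Complex.I)

/-- The (topological) support of a measure. -/
def measSupp (μ : Measure SL2) : Set SL2 :=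
  {g | ∀ U : Set SL2, IsOpen U → g ∈ U → 0 < μ U}

/-- μ has a finite exponential moment. -/
def HasExpMoment (μ : Measure SL2) : Prop :=
  ∃ ε₁ > (0 : ℝ), ∫⁻ g, ENNReal.ofReal (opNorm g ^ ε₁) ∂μ < ⊤

/-- The group generated by the support of μ is Zariski dense in SL₂(ℝ),
equivalently it is not solvable. -/
def ZariskiDense (μ : Measure SL2) : Prop :=
  ¬ IsSolvable (Subgroup.closure (measSupp μ))

/-- ν is μ-stationary: μ ∗ ν = ν. -/
def IsMuStationary (μ : Measure SL2) (ν : Measure PX) : Prop :=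
  μ.bind (fun g => ν.map (act g)) = ν

/-- The product g₁ ⋯ gₙ of a word (g₁, …, gₙ). -/
def word {n : ℕ} (g : Fin n → SL2) : SL2 := (List.ofFn g).prod

/-- The product measure μ^{⊗n} on words of length n. -/
def μpi (μ : Measure SL2) (n : ℕ) : Measure (Fin n → SL2) := Measure.pi fun _ => μ

noncomputable section

open scoped ENNReal NNReal Topology

instance instBorelSL2x : BorelSpace SL2 := ⟨rfl⟩
instance instBorelPXx : BorelSpace PX := ⟨rfl⟩
instance instTopGroupSL2x : IsTopologicalGroup SL2 := Matrix.SpecialLinearGroup.topologicalGroup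
instance instSCTMatx : SecondCountableTopology (Matrix (Fin 2) (Fin 2) ℝ) :=
  inferInstanceAs (SecondCountableTopology (Fin 2 → Fin 2 → ℝ))
instance instSCTSL2x : SecondCountableTopology SL2 :=
  TopologicalSpace.Subtype.secondCountableTopology {A : Matrix (Fin 2) (Fin 2) ℝ | A.det = 1}
instance instT2SL2x : T2Space SL2 :=
  inferInstanceAs (T2Space {A : Matrix (Fin 2) (Fin 2) ℝ // A.det = 1})

/-- Row action. -/
def ra (v : ℂ) (g : SL2) : ℂ := ⟨v.re * g 0 0 + v.im * g 1 0, v.re * g 0 1 + v.im * g 1 1⟩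
/-- Column action. -/
def ca (g : SL2) (x : ℂ) : ℂ := ⟨g 0 0 * x.re + g 0 1 * x.im, g 1 0 * x.re + g 1 1 * x.im⟩
/-- Dot product. -/
def dt (v x : ℂ) : ℝ := v.re * x.re + v.im * x.im
/-- Cross product. -/
def cr (v z : ℂ) : ℝ := v.re * z.im - v.im * z.re
/-- Frobenius norm. -/
def fr (g : SL2) : ℝ := Real.sqrt (g 0 0 ^ 2 + g 0 1 ^ 2 + g 1 0 ^ 2 + g 1 1 ^ 2)

lemma det1 (g : SL2) : g 0 0 * g 1 1 - g 0 1 * g 1 0 = 1 := by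
  have := g.det_coe
  rwa [Matrix.det_fin_two] at this

lemma mul_e (g h : SL2) (i j : Fin 2) : (g * h) i j = g i 0 * h 0 j + g i 1 * h 1 j := by
  show ((g * h : SL2) : Matrix (Fin 2) (Fin 2) ℝ) i j = _
  rw [Matrix.SpecialLinearGroup.coe_mul, Matrix.mul_apply, Fin.sum_univ_two]

lemma inv_e00 (g : SL2) : g⁻¹ 0 0 = g 1 1 := by
  simp [Matrix.SpecialLinearGroup.SL2_inv_expl]
lemma inv_e01 (g : SL2) : g⁻¹ 0 1 = - g 0 1 := by
  simp [Matrix.SpecialLinearGroup.SL2_inv_expl]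
lemma inv_e10 (g : SL2) : g⁻¹ 1 0 = - g 1 0 := by
  simp [Matrix.SpecialLinearGroup.SL2_inv_expl]
lemma inv_e11 (g : SL2) : g⁻¹ 1 1 = g 0 0 := by
  simp [Matrix.SpecialLinearGroup.SL2_inv_expl]
lemma one_e00 : (1 : SL2) 0 0 = 1 := by simp
lemma one_e01 : (1 : SL2) 0 1 = 0 := by simp
lemma one_e10 : (1 : SL2) 1 0 = 0 := by simp
lemma one_e11 : (1 : SL2) 1 1 = 1 := by simp

lemma sl2_ext {g h : SL2} (h00 : g 0 0 = h 0 0) (h01 : g 0 1 = h 0 1) (h10 : g 1 0 = h 1 0)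
    (h11 : g 1 1 = h 1 1) : g = h := by
  ext i j
  fin_cases i <;> fin_cases j <;> simpa

@[simp] lemma ra_re (v : ℂ) (g : SL2) : (ra v g).re = v.re * g 0 0 + v.im * g 1 0 := rfl
@[simp] lemma ra_im (v : ℂ) (g : SL2) : (ra v g).im = v.re * g 0 1 + v.im * g 1 1 := rfl
@[simp] lemma ca_re (g : SL2) (x : ℂ) : (ca g x).re = g 0 0 * x.re + g 0 1 * x.im := rfl
@[simp] lemma ca_im (g : SL2) (x : ℂ) : (ca g x).im = g 1 0 * x.re + g 1 1 * x.im := rfl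

lemma ra_mul (v : ℂ) (g h : SL2) : ra v (g * h) = ra (ra v g) h := by
  apply Complex.ext <;> simp only [ra_re, ra_im, mul_e] <;> ring
lemma ca_mul (g h : SL2) (x : ℂ) : ca (g * h) x = ca g (ca h x) := by
  apply Complex.ext <;> simp only [ca_re, ca_im, mul_e] <;> ring
lemma ra_one (v : ℂ) : ra v 1 = v := by
  apply Complex.ext <;> simp
lemma ca_one (v : ℂ) : ca 1 v = v := by
  apply Complex.ext <;> simp
lemma dt_ra (v : ℂ) (g : SL2) (x : ℂ) : dt (ra v g) x = dt v (ca g x) := by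
  simp only [dt, ra_re, ra_im, ca_re, ca_im]; ring
lemma cr_ra (v z : ℂ) (g : SL2) : cr (ra v g) (ra z g) = cr v z := by
  have := det1 g
  simp only [cr, ra_re, ra_im]
  linear_combination (v.re * z.im - v.im * z.re) * this
lemma cr_ca (v z : ℂ) (g : SL2) : cr (ca g v) (ca g z) = cr v z := by
  have := det1 g
  simp only [cr, ca_re, ca_im]
  linear_combination (v.re * z.im - v.im * z.re) * this
lemma ra_sub (v z : ℂ) (g : SL2) : ra (v - z) g = ra v g - ra z g := by
  apply Complex.ext <;> simp <;> ring
lemma ra_add (v z : ℂ) (g : SL2) : ra (v + z) g = ra v g + ra z g := by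
  apply Complex.ext <;> simp <;> ring
lemma ra_smul (c : ℝ) (v : ℂ) (g : SL2) : ra (c • v) g = c • ra v g := by
  apply Complex.ext <;> simp <;> ring
lemma ca_smul (c : ℝ) (v : ℂ) (g : SL2) : ca g (c • v) = c • ca g v := by
  apply Complex.ext <;> simp <;> ring
lemma ca_add (v z : ℂ) (g : SL2) : ca g (v + z) = ca g v + ca g z := by
  apply Complex.ext <;> simp <;> ring
lemma ra_neg (v : ℂ) (g : SL2) : ra (-v) g = - ra v g := by
  apply Complex.ext <;> simp <;> ring
lemma dt_smul_left (c : ℝ) (v x : ℂ) : dt (c • v) x = c * dt v x := by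
  simp [dt]; ring
lemma dt_smul_right (c : ℝ) (v x : ℂ) : dt v (c • x) = c * dt v x := by
  simp [dt]; ring
lemma cr_smul_left (c : ℝ) (v x : ℂ) : cr (c • v) x = c * cr v x := by
  simp [cr]; ring
lemma cr_smul_right (c : ℝ) (v x : ℂ) : cr v (c • x) = c * cr v x := by
  simp [cr]; ring
lemma nsq (v : ℂ) : ‖v‖ ^ 2 = v.re ^ 2 + v.im ^ 2 := by
  rw [Complex.sq_norm, Complex.normSq_apply]; ring
lemma dt_cr_sq (v x : ℂ) : dt v x ^ 2 + cr v x ^ 2 = ‖v‖ ^ 2 * ‖x‖ ^ 2 := by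
  rw [nsq, nsq, dt, cr]; ring
lemma abs_dt_le (v x : ℂ) : |dt v x| ≤ ‖v‖ * ‖x‖ := by
  apply abs_le_of_sq_le_sq _ (by positivity)
  rw [mul_pow, ← dt_cr_sq]; nlinarith [sq_nonneg (cr v x)]
lemma abs_cr_le (v x : ℂ) : |cr v x| ≤ ‖v‖ * ‖x‖ := by
  apply abs_le_of_sq_le_sq _ (by positivity)
  rw [mul_pow, ← dt_cr_sq]; nlinarith [sq_nonneg (dt v x)]

lemma fr_sq (g : SL2) : fr g ^ 2 = g 0 0 ^ 2 + g 0 1 ^ 2 + g 1 0 ^ 2 + g 1 1 ^ 2 :=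
  Real.sq_sqrt (by positivity)
lemma fr_nonneg (g : SL2) : 0 ≤ fr g := Real.sqrt_nonneg _
lemma fr_sq_ge (g : SL2) : 2 ≤ fr g ^ 2 := by
  rw [fr_sq]
  nlinarith [det1 g, sq_nonneg (g 0 0 - g 1 1), sq_nonneg (g 0 1 + g 1 0)]
lemma one_le_fr (g : SL2) : 1 ≤ fr g := by
  nlinarith [fr_sq_ge g, fr_nonneg g]
lemma fr_pos (g : SL2) : 0 < fr g := by linarith [one_le_fr g]
lemma fr_inv (g : SL2) : fr g⁻¹ = fr g := by
  unfold fr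
  rw [inv_e00, inv_e01, inv_e10, inv_e11]; congr 1; ring
lemma norm_ra_le (v : ℂ) (g : SL2) : ‖ra v g‖ ≤ ‖v‖ * fr g := by
  apply le_of_sq_le_sq _ (mul_nonneg (norm_nonneg _) (fr_nonneg g))
  rw [mul_pow, nsq, nsq, fr_sq, ra_re, ra_im]
  nlinarith [sq_nonneg (v.re * g 1 0 - v.im * g 0 0), sq_nonneg (v.re * g 1 1 - v.im * g 0 1)]
lemma norm_ca_le (v : ℂ) (g : SL2) : ‖ca g v‖ ≤ fr g * ‖v‖ := by
  apply le_of_sq_le_sq _ (mul_nonneg (fr_nonneg g) (norm_nonneg _))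
  rw [mul_pow, nsq, nsq, fr_sq, ca_re, ca_im]
  nlinarith [sq_nonneg (v.re * g 0 1 - v.im * g 0 0), sq_nonneg (v.re * g 1 1 - v.im * g 1 0)]
lemma norm_le_ra (v : ℂ) (g : SL2) : ‖v‖ ≤ ‖ra v g‖ * fr g := by
  have := norm_ra_le (ra v g) g⁻¹
  rwa [← ra_mul, mul_inv_cancel, ra_one, fr_inv] at this
lemma norm_le_ca (v : ℂ) (g : SL2) : ‖v‖ ≤ fr g * ‖ca g v‖ := by
  have := norm_ca_le (ca g v) g⁻¹
  rwa [← ca_mul, inv_mul_cancel, ca_one, fr_inv] at this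
lemma ra_ne_zero {v : ℂ} (hv : v ≠ 0) (g : SL2) : ra v g ≠ 0 := by
  intro h
  have := norm_le_ra v g
  rw [h, norm_zero, zero_mul] at this
  exact hv (norm_le_zero_iff.1 this)
lemma ca_ne_zero {v : ℂ} (hv : v ≠ 0) (g : SL2) : ca g v ≠ 0 := by
  intro h
  have := norm_le_ca v g
  rw [h, norm_zero, mul_zero] at this
  exact hv (norm_le_zero_iff.1 this)
lemma fr_mul (g h : SL2) : fr (g * h) ≤ fr g * fr h := by
  apply le_of_sq_le_sq _ (mul_nonneg (fr_nonneg g) (fr_nonneg h))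
  rw [mul_pow, fr_sq, fr_sq, fr_sq]
  simp only [mul_e]
  nlinarith [sq_nonneg (g 0 0 * h 1 0 - g 0 1 * h 0 0), sq_nonneg (g 0 0 * h 1 1 - g 0 1 * h 0 1),
    sq_nonneg (g 1 0 * h 1 0 - g 1 1 * h 0 0), sq_nonneg (g 1 0 * h 1 1 - g 1 1 * h 0 1)]

lemma cont_e (i j : Fin 2) : Continuous (fun g : SL2 => g i j) := by fun_prop
lemma cont_fr : Continuous fr := by
  unfold fr; fun_prop
lemma cont_ra : Continuous (fun p : ℂ × SL2 => ra p.1 p.2) := by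
  unfold ra
  simp only [Complex.mk_eq_add_mul_I]
  have := cont_e
  fun_prop
lemma cont_ca : Continuous (fun p : SL2 × ℂ => ca p.1 p.2) := by
  unfold ca
  simp only [Complex.mk_eq_add_mul_I]
  have := cont_e
  fun_prop
lemma Continuous.ra' {X : Type*} [TopologicalSpace X] {f : X → ℂ} {g : X → SL2} (hf : Continuous f)
    (hg : Continuous g) : Continuous (fun x => ra (f x) (g x)) := cont_ra.comp (hf.prodMk hg)
lemma Continuous.ca' {X : Type*} [TopologicalSpace X] {f : X → ℂ} {g : X → SL2} (hf : Continuous f)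
    (hg : Continuous g) : Continuous (fun x => ca (g x) (f x)) := cont_ca.comp (hg.prodMk hf)
lemma Measurable.ra' {X : Type*} [MeasurableSpace X] {f : X → ℂ} {g : X → SL2} (hf : Measurable f)
    (hg : Measurable g) : Measurable (fun x => ra (f x) (g x)) :=
  cont_ra.measurable.comp (hf.prodMk hg)
lemma Measurable.ca' {X : Type*} [MeasurableSpace X] {f : X → ℂ} {g : X → SL2} (hf : Measurable f)
    (hg : Measurable g) : Measurable (fun x => ca (g x) (f x)) :=
  cont_ca.measurable.comp (hg.prodMk hf)
lemma cont_dt : Continuous (fun p : ℂ × ℂ => dt p.1 p.2) := by unfold dt; fun_prop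
lemma Continuous.dt' {X : Type*} [TopologicalSpace X] {f g : X → ℂ} (hf : Continuous f)
    (hg : Continuous g) : Continuous (fun x => dt (f x) (g x)) := cont_dt.comp (hf.prodMk hg)
lemma Measurable.dt' {X : Type*} [MeasurableSpace X] {f g : X → ℂ} (hf : Measurable f)
    (hg : Measurable g) : Measurable (fun x => dt (f x) (g x)) :=
  cont_dt.measurable.comp (hf.prodMk hg)
lemma cont_cr : Continuous (fun p : ℂ × ℂ => cr p.1 p.2) := by unfold cr; fun_prop
lemma Continuous.cr' {X : Type*} [TopologicalSpace X] {f g : X → ℂ} (hf : Continuous f)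
    (hg : Continuous g) : Continuous (fun x => cr (f x) (g x)) := cont_cr.comp (hf.prodMk hg)
lemma Measurable.cr' {X : Type*} [MeasurableSpace X] {f g : X → ℂ} (hf : Measurable f)
    (hg : Measurable g) : Measurable (fun x => cr (f x) (g x)) :=
  cont_cr.measurable.comp (hf.prodMk hg)

lemma abs_e_le (g : SL2) (i j : Fin 2) : |g i j| ≤ fr g := by
  apply abs_le_of_sq_le_sq _ (fr_nonneg g)
  rw [fr_sq]
  fin_cases i <;> fin_cases j <;> simp <;> nlinarith [sq_nonneg (g 0 0), sq_nonneg (g 0 1), sq_nonneg (g 1 0), sq_nonneg (g 1 1)]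

end

noncomputable section

open scoped ENNReal NNReal Topology

lemma solv_of_comm {Γ : Subgroup SL2} (h : ∀ a ∈ Γ, ∀ b ∈ Γ, a * b = b * a) : Group.IsSolvable Γ := by
  apply Group.isSolvable_of_comm
  intro a b
  ext1
  exact h a a.2 b b.2

lemma cjm (k a b : SL2) : k⁻¹ * (a * b) * k = (k⁻¹ * a * k) * (k⁻¹ * b * k) := by group

lemma cjcomm {k a b : SL2} (h : (k⁻¹ * a * k) * (k⁻¹ * b * k) = (k⁻¹ * b * k) * (k⁻¹ * a * k)) :
    a * b = b * a := by
  rw [← cjm, ← cjm] at h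
  simpa using h

lemma solv_of_hom {Γ : Subgroup SL2} (f : Γ →* ℝ)
    (h : ∀ a b : Γ, f a = 1 → f b = 1 → (a : SL2) * b = b * a) : Group.IsSolvable Γ := by
  have : Group.IsSolvable f.toHomUnits.ker := by
    apply Group.isSolvable_of_comm
    rintro ⟨a, ha⟩ ⟨b, hb⟩
    ext1; ext1
    simp only [MonoidHom.mem_ker] at ha hb
    apply h
    · have := congrArg Units.val ha
      simpa using this
    · have := congrArg Units.val hb
      simpa using this
  exact Group.isSolvable_of_ker_le_range (f.toHomUnits.ker.subtype) f.toHomUnits (by simp)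

lemma solv_upper {Γ : Subgroup SL2} (k : SL2) (h : ∀ g ∈ Γ, (k⁻¹ * g * k) 1 0 = 0) :
    Group.IsSolvable Γ := by
  refine solv_of_hom (Γ := Γ) ⟨⟨fun g => (k⁻¹ * (g : SL2) * k) 0 0, ?_⟩, ?_⟩ ?_
  · simp
  · intro a b
    simp only [Subgroup.coe_mul]
    rw [cjm, mul_e (k⁻¹ * (a : SL2) * k), h b b.2]; ring
  · rintro ⟨a, ha⟩ ⟨b, hb⟩ h1 h2
    simp only [MonoidHom.coe_mk, OneHom.coe_mk] at h1 h2
    apply cjcomm (k := k)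
    have da := det1 (k⁻¹ * a * k)
    have db := det1 (k⁻¹ * b * k)
    rw [h a ha, h1] at da
    rw [h b hb, h2] at db
    have ea := h a ha
    have eb := h b hb
    revert da db ea eb h1 h2
    show ((k⁻¹ * a * k) 0 0 = 1 → _)
    generalize k⁻¹ * a * k = A
    generalize k⁻¹ * b * k = B
    intro h1 h2 da db ea eb
    have da' : A 1 1 = 1 := by linarith
    have db' : B 1 1 = 1 := by linarith
    apply sl2_ext <;> simp only [mul_e, ea, eb, h1, h2, da', db'] <;> ring

lemma solv_mono {Γ : Subgroup SL2} (k : SL2) (h : ∀ g ∈ Γ,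
    ((k⁻¹ * g * k) 0 1 = 0 ∧ (k⁻¹ * g * k) 1 0 = 0) ∨
    ((k⁻¹ * g * k) 0 0 = 0 ∧ (k⁻¹ * g * k) 1 1 = 0)) :
    Group.IsSolvable Γ := by
  refine solv_of_hom (Γ := Γ) ⟨⟨fun g => (k⁻¹ * (g : SL2) * k) 0 0 * (k⁻¹ * (g : SL2) * k) 1 1 +
    (k⁻¹ * (g : SL2) * k) 0 1 * (k⁻¹ * (g : SL2) * k) 1 0, ?_⟩, ?_⟩ ?_
  · simp
  · rintro ⟨a, ha⟩ ⟨b, hb⟩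
    simp only [Subgroup.coe_mul]
    rw [cjm]
    simp only [mul_e (k⁻¹ * a * k)]
    rcases h a ha with ⟨h1, h2⟩ | ⟨h1, h2⟩ <;> rcases h b hb with ⟨h3, h4⟩ | ⟨h3, h4⟩ <;>
      rw [h1, h2, h3, h4] <;> ring
  · rintro ⟨a, ha⟩ ⟨b, hb⟩ h1 h2
    simp only [MonoidHom.coe_mk, OneHom.coe_mk] at h1 h2
    apply cjcomm (k := k)
    have da := det1 (k⁻¹ * a * k)
    have db := det1 (k⁻¹ * b * k)
    rcases h a ha with ⟨h3, h4⟩ | ⟨h3, h4⟩ <;> rcases h b hb with ⟨h5, h6⟩ | ⟨h5, h6⟩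
    · revert h3 h4 h5 h6
      show ((k⁻¹ * a * k) 0 1 = 0 → _)
      generalize k⁻¹ * a * k = A
      generalize k⁻¹ * b * k = B
      intro h3 h4 h5 h6
      apply sl2_ext <;> simp only [mul_e, h3, h4, h5, h6] <;> ring
    all_goals
      rw [h3, h4] at h1 da; rw [h5, h6] at h2 db; exfalso; linarith

lemma exists_frame {x y : ℂ} (h : cr x y = 1) : ∃ k : SL2, k 0 0 = x.re ∧ k 1 0 = x.im ∧
    k 0 1 = y.re ∧ k 1 1 = y.im := by
  refine ⟨⟨!![x.re, y.re; x.im, y.im], ?_⟩, ?_⟩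
  · rw [Matrix.det_fin_two_of]; rw [cr] at h; linarith
  · simp

lemma solv_of_fix {Γ : Subgroup SL2} {x : ℂ} (hx : x ≠ 0) (h : ∀ g ∈ Γ, cr x (ca g x) = 0) :
    Group.IsSolvable Γ := by
  have hn : 0 < ‖x‖ ^ 2 := by positivity
  obtain ⟨k, h1, h2, h3, h4⟩ := exists_frame (x := x) (y := ⟨-x.im / ‖x‖^2, x.re / ‖x‖^2⟩) (by
    rw [cr]; simp only; field_simp; rw [nsq]; ring)
  apply solv_upper k
  intro g hg
  have := h g hg
  rw [cr, ca_re, ca_im] at this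
  simp only [mul_e, inv_e10, inv_e11, h1, h2]
  linarith

lemma solv_of_pair {Γ : Subgroup SL2} {x y : ℂ} (hxy : cr x y ≠ 0) (h : ∀ g ∈ Γ,
    (cr x (ca g x) = 0 ∧ cr y (ca g y) = 0) ∨ (cr y (ca g x) = 0 ∧ cr x (ca g y) = 0)) :
    Group.IsSolvable Γ := by
  obtain ⟨k, h1, h2, h3, h4⟩ := exists_frame (x := x) (y := (cr x y)⁻¹ • y) (by
    rw [cr_smul_right]; field_simp)
  apply solv_mono k
  intro g hg
  simp only [mul_e, inv_e10, inv_e11, inv_e00, inv_e01, h1, h2, h3, h4]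
  simp only [Complex.smul_re, Complex.smul_im, smul_eq_mul]
  rcases h g hg with ⟨h5, h6⟩ | ⟨h5, h6⟩
  · left
    simp only [cr, ca_re, ca_im] at h5 h6
    refine ⟨?_, ?_⟩
    · linear_combination -(cr x y)⁻¹ * (cr x y)⁻¹ * h6
    · linear_combination h5
  · right
    simp only [cr, ca_re, ca_im] at h5 h6
    refine ⟨?_, ?_⟩
    · linear_combination -(cr x y)⁻¹ * h5
    · linear_combination (cr x y)⁻¹ * h6

def tr2 (g : SL2) : ℝ := g 0 0 + g 1 1

lemma tr2_sq (g : SL2) : tr2 (g * g) = tr2 g ^ 2 - 2 := by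
  simp only [tr2, mul_e]; linear_combination -2 * det1 g

lemma abs_tr2_le (g : SL2) : |tr2 g| ≤ 2 * fr g := by
  rw [tr2]
  have := abs_add_le (g 0 0) (g 1 1)
  linarith [abs_e_le g 0 0, abs_e_le g 1 1]

lemma ell_real {t b c M L K : ℝ} (hell : t ^ 2 < -4 * (b * c)) (horth : M * t + L * c + K * b = 0)
    (hle : M ^ 2 + L * K ≤ 0) : M = 0 ∧ L = 0 ∧ K = 0 := by
  have hb : b ≠ 0 := by
    intro h0; rw [h0] at hell; nlinarith [sq_nonneg t]
  have hb2 : 0 < b ^ 2 := by positivity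
  have e1 : b ^ 2 * (M ^ 2 + L * K) = (b * M - L * t / 2) ^ 2
      + L ^ 2 * (- 4 * (b * c) - t ^ 2) / 4 := by
    linear_combination b * L * horth
  have e2 : b ^ 2 * (M ^ 2 + L * K) ≤ 0 := mul_nonpos_of_nonneg_of_nonpos hb2.le hle
  have hL0 : L = 0 := by
    by_contra hne
    have h1 : 0 < L ^ 2 := by positivity
    have h2 : 0 < L ^ 2 * (- 4 * (b * c) - t ^ 2) := mul_pos h1 (by linarith)
    linarith [sq_nonneg (b * M - L * t / 2)]
  subst hL0
  have hM0 : M = 0 := by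
    have h1 : (b * M) ^ 2 ≤ 0 := by
      have : (b * M - 0 * t / 2) ^ 2 = (b * M) ^ 2 := by ring
      rw [this] at e1; linarith
    have := pow_eq_zero_iff (two_ne_zero) |>.1 (le_antisymm h1 (sq_nonneg _))
    exact (mul_eq_zero.1 this).resolve_left hb
  subst hM0
  refine ⟨rfl, rfl, ?_⟩
  have : K * b = 0 := by linarith
  exact (mul_eq_zero.1 this).resolve_right hb

lemma comm_of_ell {g h : SL2} (hg : |tr2 g| < 2) (hc : tr2 (g * h * g⁻¹ * h⁻¹) ≤ 2) :
    g * h = h * g := by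
  have h1 := det1 g
  have h2 := det1 h
  have ht : tr2 (g * h * g⁻¹ * h⁻¹) - 2 = ((g * h) 0 0 - (h * g) 0 0) ^ 2 +
      ((g * h) 0 1 - (h * g) 0 1) * ((g * h) 1 0 - (h * g) 1 0) := by
    simp only [tr2, mul_e, inv_e00, inv_e01, inv_e10, inv_e11]
    generalize g 0 0 = a at *; generalize g 0 1 = b at *
    generalize g 1 0 = c at *; generalize g 1 1 = d at *
    generalize h 0 0 = p at *; generalize h 0 1 = q at *
    generalize h 1 0 = r at *; generalize h 1 1 = s at *
    linear_combination (2 * (p * s - q * r) ) * h1 + 2 * h2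
  set M := (g * h) 0 0 - (h * g) 0 0 with hM
  set L := (g * h) 0 1 - (h * g) 0 1 with hL
  set K := (g * h) 1 0 - (h * g) 1 0 with hK
  have hM' : (g * h) 1 1 - (h * g) 1 1 = - M := by
    rw [hM]; simp only [mul_e]; ring
  have horth : M * (g 0 0 - g 1 1) + L * g 1 0 + K * g 0 1 = 0 := by
    rw [hM, hL, hK]; simp only [mul_e]; ring
  have hell : (g 0 0 - g 1 1) ^ 2 < - 4 * (g 0 1 * g 1 0) := by
    have := sq_lt_sq' (abs_lt.1 hg).1 (abs_lt.1 hg).2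
    rw [tr2] at this
    nlinarith
  obtain ⟨hM0, hL0, hK0⟩ := ell_real hell horth (by linarith)
  apply sl2_ext
  · linarith
  · linarith
  · linarith
  · linarith

lemma ell_ne {g : SL2} (hg : |tr2 g| < 2) : g 0 1 ≠ 0 := by
  intro h0
  have := sq_lt_sq' (abs_lt.1 hg).1 (abs_lt.1 hg).2
  have h1 := det1 g
  rw [tr2] at this
  rw [h0] at h1
  nlinarith [sq_nonneg (g 0 0 - g 1 1)]

lemma comm_trans {g h k : SL2} (hb : g 0 1 ≠ 0) (h1 : g * h = h * g) (h2 : g * k = k * g) :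
    h * k = k * h := by
  have key : ∀ h : SL2, g * h = h * g → h 1 0 = (h 0 1 / g 0 1) * g 1 0 ∧
      h 0 0 - h 1 1 = (h 0 1 / g 0 1) * (g 0 0 - g 1 1) := by
    intro h hh
    have e1 := congrArg (fun m : SL2 => m 0 0) hh
    have e2 := congrArg (fun m : SL2 => m 0 1) hh
    simp only [mul_e] at e1 e2
    constructor
    · field_simp; linarith
    · field_simp; linarith
  obtain ⟨a1, a2⟩ := key h h1
  obtain ⟨b1, b2⟩ := key k h2
  set s := h 0 1 / g 0 1 with hs
  set t := k 0 1 / g 0 1 with ht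
  have a3 : h 0 1 = s * g 0 1 := by rw [hs]; field_simp
  have b3 : k 0 1 = t * g 0 1 := by rw [ht]; field_simp
  clear_value s t
  apply sl2_ext <;> simp only [mul_e, a3, b3, a1, b1]
  · ring
  · linear_combination t * g 0 1 * a2 - s * g 0 1 * b2
  · linear_combination s * g 1 0 * b2 - t * g 1 0 * a2
  · ring

lemma solv_of_ell {Γ : Subgroup SL2} (h : ∀ g ∈ Γ, |tr2 g| < 2 ∨ (∀ k : SL2, g * k = k * g))
    (h' : ∀ g ∈ Γ, tr2 g ≤ 2) : Group.IsSolvable Γ := by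
  by_cases hex : ∃ g ∈ Γ, |tr2 g| < 2
  · obtain ⟨g, hg, ht⟩ := hex
    have hcom : ∀ k ∈ Γ, g * k = k * g := fun k hk => comm_of_ell ht
      (h' _ (Γ.mul_mem (Γ.mul_mem (Γ.mul_mem hg hk) (Γ.inv_mem hg)) (Γ.inv_mem hk)))
    exact solv_of_comm fun a ha b hb => comm_trans (ell_ne ht) (hcom a ha) (hcom b hb)
  · push Not at hex
    apply solv_of_comm
    intro a ha b hb
    rcases h a ha with h1 | h1
    · exact absurd h1 (not_lt.2 (hex a ha))
    · exact h1 b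

lemma pow_parab {h : SL2} (ht : tr2 h = 2) (n : ℕ) :
    (h ^ n) 0 0 = 1 + n * (h 0 0 - 1) ∧ (h ^ n) 0 1 = n * h 0 1 ∧
    (h ^ n) 1 0 = n * h 1 0 ∧ (h ^ n) 1 1 = 1 + n * (h 1 1 - 1) := by
  rw [tr2] at ht
  have hd := det1 h
  have h11 : h 1 1 = 2 - h 0 0 := by linarith
  rw [h11] at hd ⊢
  induction n with
  | zero => simp
  | succ n ih =>
    obtain ⟨i1, i2, i3, i4⟩ := ih
    rw [pow_succ]
    simp only [mul_e, i1, i2, i3, i4, h11]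
    push_cast
    refine ⟨?_, ?_, ?_, ?_⟩
    · linear_combination -(n : ℝ) * hd
    · ring
    · ring
    · linear_combination -(n : ℝ) * hd

lemma eq_zero_of_bdd {x R : ℝ} (h : ∀ n : ℕ, |n * x| ≤ R) : x = 0 := by
  by_contra hx
  have hx' : 0 < |x| := abs_pos.2 hx
  obtain ⟨n, hn⟩ := exists_nat_gt (R / |x|)
  have := h n
  rw [abs_mul, Nat.abs_cast] at this
  rw [div_lt_iff₀ hx'] at hn
  linarith

lemma parab_bdd {h : SL2} (ht : tr2 h = 2) {R : ℝ} (hR : ∀ n : ℕ, fr (h ^ n) ≤ R) : h = 1 := by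
  have hp := pow_parab ht
  have e01 : h 0 1 = 0 := by
    apply eq_zero_of_bdd (R := R); intro n
    rw [← (hp n).2.1]; exact (abs_e_le _ _ _).trans (hR n)
  have e10 : h 1 0 = 0 := by
    apply eq_zero_of_bdd (R := R); intro n
    rw [← (hp n).2.2.1]; exact (abs_e_le _ _ _).trans (hR n)
  have e00 : h 0 0 - 1 = 0 := by
    apply eq_zero_of_bdd (R := R + 1); intro n
    have h1 := (abs_e_le (h ^ n) 0 0).trans (hR n)
    rw [(hp n).1] at h1
    have := abs_sub (1 + n * (h 0 0 - 1)) (1:ℝ)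
    simp only [add_sub_cancel_left, abs_one] at this
    linarith
  rw [tr2] at ht
  apply sl2_ext <;> simp <;> linarith

lemma hyp_unb {g : SL2} (ht : 2 < |tr2 g|) (n : ℕ) :
    (n : ℝ) * (|tr2 g| - 2) ≤ |tr2 (g ^ (2 ^ n))| := by
  have key : ∀ n : ℕ, 2 + 2 ^ n * (|tr2 g| - 2) ≤ |tr2 (g ^ (2 ^ n))| := by
    intro n
    induction n with
    | zero => simp
    | succ n ih =>
      have e : g ^ 2 ^ (n + 1) = g ^ 2 ^ n * g ^ 2 ^ n := by rw [← pow_add]; congr 1; ring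
      rw [e, tr2_sq]
      have h0 : (0:ℝ) < 2 ^ n * (|tr2 g| - 2) := by
        have : 0 < |tr2 g| - 2 := by linarith
        positivity
      rw [← sq_abs]
      refine le_trans ?_ (le_abs_self _)
      rw [pow_succ]
      nlinarith
  refine le_trans ?_ (key n)
  have : (n : ℝ) ≤ 2 ^ n := by exact_mod_cast Nat.lt_two_pow_self.le
  nlinarith

lemma bdd_powers {g : SL2} {R : ℝ} (hR : ∀ n : ℕ, fr (g ^ n) ≤ R) :
    |tr2 g| < 2 ∨ ((∀ k : SL2, g * k = k * g) ∧ tr2 g ≤ 2) := by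
  rcases lt_trichotomy |tr2 g| 2 with h | h | h
  · exact Or.inl h
  · right
    have hs : tr2 (g * g) = 2 := by rw [tr2_sq, ← sq_abs, h]; norm_num
    have h1 : g * g = 1 := by
      apply parab_bdd hs (R := R)
      intro n
      rw [← pow_two, ← pow_mul]; exact hR _
    refine ⟨?_, by rw [← h]; exact le_abs_self _⟩
    have e00 := congrArg (fun m : SL2 => m 0 0) h1
    have e01 := congrArg (fun m : SL2 => m 0 1) h1
    have e10 := congrArg (fun m : SL2 => m 1 0) h1
    have e11 := congrArg (fun m : SL2 => m 1 1) h1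
    simp only [mul_e, one_e00, one_e01, one_e10, one_e11] at e00 e01 e10 e11
    have htn : tr2 g ≠ 0 := by intro h0; rw [h0] at h; norm_num at h
    rw [tr2] at htn
    have f01 : g 0 1 = 0 := by
      apply mul_right_cancel₀ htn; linarith
    have f10 : g 1 0 = 0 := by
      apply mul_right_cancel₀ htn; linarith
    have hd := det1 g
    have f00 : g 0 0 = g 1 1 := by
      have : (g 0 0 - g 1 1) * (g 0 0 + g 1 1) = 0 := by linear_combination e00 - e11
      rcases mul_eq_zero.1 this with h | h
      · linarith
      · exact absurd h htn
    intro k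
    apply sl2_ext <;> simp only [mul_e, f01, f10, f00] <;> ring
  · exfalso
    obtain ⟨n, hn⟩ := exists_nat_gt (2 * R / (|tr2 g| - 2))
    rw [div_lt_iff₀ (by linarith)] at hn
    have h1 := hyp_unb h n
    have h2 := abs_tr2_le (g ^ (2 ^ n))
    have h3 := hR (2 ^ n)
    linarith

lemma solv_of_bddpow {Γ : Subgroup SL2} (h : ∀ g ∈ Γ, ∃ R : ℝ, ∀ n : ℕ, fr (g ^ n) ≤ R) :
    Group.IsSolvable Γ := by
  apply solv_of_ell
  · intro g hg
    obtain ⟨R, hR⟩ := h g hg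
    rcases bdd_powers hR with h | h
    · exact Or.inl h
    · exact Or.inr h.1
  · intro g hg
    obtain ⟨R, hR⟩ := h g hg
    rcases bdd_powers hR with h | h
    · exact (abs_lt.1 h).2.le
    · exact h.2

/-- if a power of `g` is scalar (fixes three lines) its powers are bounded -/
lemma fix3 {g : SL2} {x y z : ℂ} (hxy : cr x y ≠ 0) (hxz : cr x z ≠ 0) (hyz : cr y z ≠ 0)
    (hx : cr x (ca g x) = 0) (hy : cr y (ca g y) = 0) (hz : cr z (ca g z) = 0) :
    g * g = 1 := by
  -- quadratic form q(x) = cr x (g x) vanishes on three lines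
  have q : ∀ x : ℂ, cr x (ca g x) = g 1 0 * x.re ^ 2 + (g 1 1 - g 0 0) * (x.re * x.im)
      - g 0 1 * x.im ^ 2 := by
    intro x; simp only [cr, ca_re, ca_im]; ring
  rw [q] at hx hy hz
  rw [cr] at hxy hxz hyz
  have e1 : g 1 0 = 0 := by
    have : g 1 0 * ((x.re * y.im - x.im * y.re) * (x.re * z.im - x.im * z.re) * (y.re * z.im - y.im * z.re)) = 0 := by
      linear_combination (y.im * z.im * (y.re * z.im - y.im * z.re)) * hx
        - (x.im * z.im * (x.re * z.im - x.im * z.re)) * hy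
        + (x.im * y.im * (x.re * y.im - x.im * y.re)) * hz
    rcases mul_eq_zero.1 this with h | h
    · exact h
    · exact absurd h (mul_ne_zero (mul_ne_zero hxy hxz) hyz)
  have e2 : g 0 1 = 0 := by
    have : g 0 1 * ((x.re * y.im - x.im * y.re) * (x.re * z.im - x.im * z.re) * (y.re * z.im - y.im * z.re)) = 0 := by
      linear_combination -(y.re * z.re * (y.re * z.im - y.im * z.re)) * hx
        + (x.re * z.re * (x.re * z.im - x.im * z.re)) * hy
        - (x.re * y.re * (x.re * y.im - x.im * y.re)) * hz
    rcases mul_eq_zero.1 this with h | h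
    · exact h
    · exact absurd h (mul_ne_zero (mul_ne_zero hxy hxz) hyz)
  have hd := det1 g
  rw [e1, e2] at hx hy hz hd
  have e3 : g 1 1 = g 0 0 := by
    by_contra hne
    have hne' : g 1 1 - g 0 0 ≠ 0 := sub_ne_zero.2 hne
    have f : ∀ u : ℂ, 0 * u.re ^ 2 + (g 1 1 - g 0 0) * (u.re * u.im) - 0 * u.im ^ 2 = 0 →
        u.re = 0 ∨ u.im = 0 := by
      intro u hu
      have : (g 1 1 - g 0 0) * (u.re * u.im) = 0 := by linarith
      rcases mul_eq_zero.1 this with h | h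
      · exact absurd h hne'
      · exact mul_eq_zero.1 h
    rcases f x hx with h1 | h1 <;> rcases f y hy with h2 | h2 <;> rcases f z hz with h3 | h3 <;>
      simp [h1, h2, h3] at hxy hxz hyz
  apply sl2_ext <;> simp only [mul_e, one_e00, one_e01, one_e10, one_e11, e1, e2] <;>
    (try rw [e3] at hd) <;> (try rw [e3]) <;> linarith

lemma bddpow_of_pow {g : SL2} {k : ℕ} (hk : 0 < k) (h : g ^ k = 1) :
    ∃ R : ℝ, ∀ n : ℕ, fr (g ^ n) ≤ R := by
  refine ⟨∑ i ∈ Finset.range k, fr (g ^ i), fun n => ?_⟩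
  have : g ^ n = g ^ (n % k) := by
    conv_lhs => rw [← Nat.div_add_mod n k, pow_add, pow_mul, h, one_pow, one_mul]
  rw [this]
  exact Finset.single_le_sum (f := fun i => fr (g ^ i)) (fun i _ => fr_nonneg _)
    (Finset.mem_range.2 (Nat.mod_lt n hk))

end

noncomputable section

open scoped ENNReal NNReal Topology

/-- The basic data: a law on SL2 and a stationary measure on the (punctured) plane. -/
structure Stp (μ : Measure SL2) (N : Measure ℂ) : Prop where
  pmu : IsProbabilityMeasure μ
  pN : IsProbabilityMeasure N
  sect : ∀ᵐ x ∂N, x.re = 1 ∨ x = Complex.I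
  stat : ∀ f : ℂ → ℝ≥0∞, Measurable f → (∀ (c : ℝ) (x : ℂ), c ≠ 0 → f (c • x) = f x) →
    ∫⁻ x, f x ∂N = ∫⁻ h, ∫⁻ x, f (ca h x) ∂N ∂μ
  mom : ∃ ε₁ > (0 : ℝ), ∫⁻ g, ENNReal.ofReal (fr g ^ ε₁) ∂μ < ⊤
  ns : ¬ Group.IsSolvable (Subgroup.closure (measSupp μ))

lemma parallel {x y : ℂ} (hx : x ≠ 0) (h : cr x y = 0) : ∃ c : ℝ, y = c • x := by
  have hn : ‖x‖ ^ 2 ≠ 0 := by positivity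
  refine ⟨dt x y / ‖x‖ ^ 2, ?_⟩
  rw [cr] at h
  apply Complex.ext <;> simp only [Complex.smul_re, Complex.smul_im, smul_eq_mul, dt] <;>
    rw [div_mul_eq_mul_div, eq_div_iff hn, nsq]
  · linear_combination -x.im * h
  · linear_combination x.re * h

lemma cr_self (x : ℂ) : cr x x = 0 := by rw [cr]; ring
lemma cr_symm (x y : ℂ) : cr x y = - cr y x := by rw [cr, cr]; ring
lemma cr_trans {x y z : ℂ} (hx : x ≠ 0) (hy : cr x y = 0) (hz : cr x z = 0) : cr y z = 0 := by
  obtain ⟨c, rfl⟩ := parallel hx hy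
  obtain ⟨d, rfl⟩ := parallel hx hz
  rw [cr_smul_left, cr_smul_right, cr_self]; ring

lemma cr_pow {g : SL2} {x : ℂ} (hx : x ≠ 0) (h : cr x (ca g x) = 0) (n : ℕ) :
    cr x (ca (g ^ n) x) = 0 := by
  obtain ⟨c, hc⟩ := parallel hx h
  have : ca (g ^ n) x = c ^ n • x := by
    induction n with
    | zero => rw [pow_zero, ca_one, pow_zero, one_smul]
    | succ n ih => rw [pow_succ, ca_mul, hc, ca_smul, ih, smul_smul, pow_succ, mul_comm]
  rw [this, cr_smul_right, cr_self, mul_zero]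

def sxx (x : ℂ) : ℂ := if x.re = 0 then Complex.I else ⟨1, x.im / x.re⟩

lemma sxx_ne (x : ℂ) : sxx x ≠ 0 := by
  unfold sxx; split_ifs with h
  · exact Complex.I_ne_zero
  · intro h; have := congrArg Complex.re h; simp at this

lemma cr_sxx (x : ℂ) : cr x (sxx x) = 0 := by
  unfold sxx; split_ifs with h
  · simp [cr, h]
  · simp [cr]; field_simp; ring

lemma ae_ne_zero {μ N} (S : Stp μ N) : ∀ᵐ x ∂N, x ≠ 0 := by
  filter_upwards [S.sect] with x hx h0
  subst h0
  rcases hx with h | h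
  · simp at h
  · exact Complex.I_ne_zero h.symm

lemma cr_sect {x y : ℂ} (hx : x ≠ 0) (hy : y.re = 1 ∨ y = Complex.I) : cr x y = 0 ↔ y = sxx x := by
  constructor
  · intro h
    unfold sxx
    rcases hy with hy | hy
    · rw [cr, hy] at h
      have hre : x.re ≠ 0 := by
        intro h0; rw [h0] at h
        apply hx; apply Complex.ext
        · exact h0
        · simp at h; simpa using h
      rw [if_neg hre]
      apply Complex.ext
      · exact hy
      · simp only; field_simp; linarith
    · subst hy
      have : x.re = 0 := by simpa [cr] using h
      rw [if_pos this]
  · rintro rfl; exact cr_sxx x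

lemma line_eq {μ N} (S : Stp μ N) {x : ℂ} (hx : x ≠ 0) : N {y | cr x y = 0} = N {sxx x} := by
  apply measure_congr
  filter_upwards [S.sect] with y hy
  exact propext (cr_sect hx hy)

lemma meas_line (x : ℂ) : MeasurableSet {y : ℂ | cr x y = 0} :=
  measurableSet_eq_fun (measurable_const.cr' measurable_id) measurable_const

/-- closed sets of full measure contain the support -/
lemma supp_sub {μ : Measure SL2} {p : SL2 → Prop} (hc : IsClosed {g | p g}) (h : ∀ᵐ g ∂μ, p g)
    {g : SL2} (hg : g ∈ measSupp μ) : p g := by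
  by_contra hn
  have := hg {g | p g}ᶜ hc.isOpen_compl hn
  rw [ae_iff] at h
  exact absurd h this.ne'

lemma m_stat {μ N} (S : Stp μ N) (x : ℂ) :
    N {y | cr x y = 0} = ∫⁻ h, N {y | cr (ca h⁻¹ x) y = 0} ∂μ := by
  have h1 := S.stat ({y | cr x y = 0}.indicator 1) (measurable_one.indicator (meas_line x)) (by
    intro c y hc
    simp only [Set.indicator, Set.mem_setOf_eq, cr_smul_right, mul_eq_zero, hc, false_or, Pi.one_apply])
  rw [lintegral_indicator_one (meas_line x)] at h1
  rw [h1]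
  congr 1
  ext h
  rw [← lintegral_indicator_one (meas_line _)]
  congr 1
  ext y
  simp only [Set.indicator, Set.mem_setOf_eq]
  have : cr x (ca h y) = cr (ca h⁻¹ x) y := by
    rw [← cr_ca _ y h, ← ca_mul, mul_inv_cancel, ca_one]
  rw [this]
  simp only [Pi.one_apply]

theorem atomless {μ N} (S : Stp μ N) {x : ℂ} (hx : x ≠ 0) : N {y | cr x y = 0} = 0 := by
  have := S.pmu
  have := S.pN
  by_contra hne
  apply S.ns
  set c := N {y | cr x y = 0} with hc
  have hfin : Set.Finite {p : ℂ | c ≤ N {p}} := by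
    have := Measure.finite_const_le_meas_of_disjoint_iUnion (μ := N) (ι := ℂ) (As := fun p => {p})
      (pos_iff_ne_zero.2 hne) (fun i => measurableSet_singleton i) (by
        intro i j hij; simpa [Function.onFun] using hij) (measure_ne_top _ _)
    exact this
  obtain ⟨p0, hp0, hmax⟩ := Set.exists_max_image {p : ℂ | c ≤ N {p}} (fun p => N {p}) hfin
    ⟨sxx x, by rw [Set.mem_setOf_eq, hc, line_eq S hx]⟩
  set M := N {p0} with hM
  have hMc : c ≤ M := hp0
  have hmax' : ∀ p, N {p} ≤ M := by
    intro p
    by_cases h : c ≤ N {p}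
    · exact hmax p h
    · exact (not_le.1 h).le.trans hMc
  set F := {p : ℂ | N {p} = M} with hF
  have hFfin : F.Finite := hfin.subset (by
    intro p hp; rw [Set.mem_setOf_eq]; rw [hF, Set.mem_setOf_eq] at hp; rw [hp]; exact hMc)
  have hMpos : M ≠ 0 := ne_of_gt (lt_of_lt_of_le (pos_iff_ne_zero.2 hne) hMc)
  let T : Set ℂ := {y | y ≠ 0 ∧ sxx y ∈ F}
  have hmle : ∀ y : ℂ, y ≠ 0 → N {z | cr y z = 0} ≤ M := by
    intro y hy; rw [line_eq S hy]; exact hmax' _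
  have hsx : ∀ y z : ℂ, y ≠ 0 → z ≠ 0 → cr y z = 0 → sxx y = sxx z := by
    intro y z hy hz h
    have h1 : cr z (sxx y) = 0 := cr_trans hy h (cr_sxx y)
    refine (cr_sect hz ?_).1 h1
    unfold sxx; split_ifs <;> simp
  -- p0 in T
  have hsp : p0.re = 1 ∨ p0 = Complex.I := by
    by_contra hcon
    apply hMpos
    have := S.sect
    rw [ae_iff] at this
    rw [hM]
    exact measure_mono_null (by simpa using hcon) this
  have hp0ne : p0 ≠ 0 := by
    rintro rfl
    rcases hsp with h | h
    · simp at h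
    · exact Complex.I_ne_zero h.symm
  have hp0T : p0 ∈ T := by
    refine ⟨hp0ne, ?_⟩
    have : p0 = sxx p0 := (cr_sect hp0ne hsp).1 (cr_self _)
    rw [← this]; exact hM.symm
  -- support preserves T
  have hclosed : ∀ y : ℂ, y ≠ 0 → IsClosed {g : SL2 | ca g⁻¹ y ∈ T} := by
    intro y hy
    have : {g : SL2 | ca g⁻¹ y ∈ T} = ⋃ p ∈ F ∩ {p | p.re = 1 ∨ p = Complex.I}, {g : SL2 | cr p (ca g⁻¹ y) = 0} := by
      ext g
      simp only [Set.mem_setOf_eq, Set.mem_iUnion, exists_prop, T]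
      constructor
      · rintro ⟨h1, h2⟩
        refine ⟨_, ⟨h2, ?_⟩, ?_⟩
        · show (sxx _).re = 1 ∨ sxx _ = Complex.I
          unfold sxx; split_ifs <;> simp
        · rw [cr_symm, cr_sxx, neg_zero]
      · rintro ⟨p, ⟨h1, h2⟩, h3⟩
        refine ⟨ca_ne_zero hy _, ?_⟩
        rw [← (cr_sect (ca_ne_zero hy _) h2).1 (by rw [cr_symm, h3, neg_zero])]
        exact h1
    rw [this]
    apply (hFfin.inter_of_left _).isClosed_biUnion
    intro p _
    exact isClosed_eq (continuous_const.cr' (continuous_const.ca' continuous_inv)) continuous_const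
  have hsupp : ∀ g ∈ measSupp μ, ∀ y ∈ T, ca g⁻¹ y ∈ T := by
    intro g hg y hy
    refine supp_sub (p := fun g => ca g⁻¹ y ∈ T) (hclosed y hy.1) ?_ hg
    have hst := m_stat S y
    rw [line_eq S hy.1, show N {sxx y} = M from hy.2] at hst
    have hmeas : Measurable (fun h : SL2 => N {z | cr (ca h⁻¹ y) z = 0}) := by
      have hms : MeasurableSet {q : SL2 × ℂ | cr (ca q.1⁻¹ y) q.2 = 0} :=
        measurableSet_eq_fun ((measurable_const.ca' measurable_fst.inv).cr' measurable_snd)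
          measurable_const
      exact measurable_measure_prodMk_left hms
    have hae := ae_eq_of_ae_le_of_lintegral_le (μ := μ) (f := fun h : SL2 => N {z | cr (ca h⁻¹ y) z = 0})
      (g := fun _ => M) (Eventually.of_forall fun h => hmle _ (ca_ne_zero hy.1 _))
      (by rw [← hst]; exact measure_ne_top _ _) aemeasurable_const (by rw [← hst]; simp)
    filter_upwards [hae] with h hh
    refine ⟨ca_ne_zero hy.1 _, ?_⟩
    rw [line_eq S (ca_ne_zero hy.1 _)] at hh
    exact hh
  -- pigeonhole
  have hph : ∀ g : SL2, (∀ y ∈ T, ca g y ∈ T) → ∀ y ∈ T, ∃ k : ℕ, 0 < k ∧ cr y (ca (g ^ k) y) = 0 := by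
    intro g hg y hy
    have hall : ∀ n : ℕ, ca (g ^ n) y ∈ T := by
      intro n
      induction n with
      | zero => rwa [pow_zero, ca_one]
      | succ n ih => rw [pow_succ', ca_mul]; exact hg _ ih
    obtain ⟨i, j, hij, he⟩ := hFfin.exists_lt_map_eq_of_forall_mem (f := fun n : ℕ => sxx (ca (g ^ n) y))
      (fun n => (hall n).2)
    refine ⟨j - i, by omega, ?_⟩
    rw [← cr_ca _ _ (g ^ i), ← ca_mul, ← pow_add, Nat.add_sub_cancel' hij.le]
    have h1 := cr_sxx (ca (g ^ i) y)
    have h2 := cr_sxx (ca (g ^ j) y)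
    rw [← he] at h2
    exact cr_trans (sxx_ne _) (by rw [cr_symm, h1, neg_zero]) (by rw [cr_symm, h2, neg_zero])
  have hTcr : ∀ y z : ℂ, y ∈ T → z ≠ 0 → cr y z = 0 → z ∈ T := by
    intro y z hy hz h
    exact ⟨hz, by rw [← hsx y z hy.1 hz h]; exact hy.2⟩
  have hinv : ∀ g : SL2, (∀ y ∈ T, ca g y ∈ T) → ∀ y ∈ T, ca g⁻¹ y ∈ T := by
    intro g hg y hy
    obtain ⟨k, hk, h⟩ := hph g hg y hy
    have hall : ∀ n : ℕ, ca (g ^ n) y ∈ T := by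
      intro n
      induction n with
      | zero => rwa [pow_zero, ca_one]
      | succ n ih => rw [pow_succ', ca_mul]; exact hg _ ih
    apply hTcr (ca (g ^ (k - 1)) y) _ (hall _) (ca_ne_zero hy.1 _)
    rw [← cr_ca _ _ g, ← ca_mul, ← ca_mul, mul_inv_cancel, ca_one, ← pow_succ', Nat.sub_add_cancel hk,
      cr_symm, h, neg_zero]
  have hΓ : ∀ g ∈ Subgroup.closure (measSupp μ), ∀ y ∈ T, ca g y ∈ T := by
    intro g hg
    induction hg using Subgroup.closure_induction with
    | mem g hg =>
      have := hinv g⁻¹ (hsupp g hg)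
      rwa [inv_inv] at this
    | one => intro y hy; rwa [ca_one]
    | mul a b _ _ ha hb => intro y hy; rw [ca_mul]; exact ha _ (hb _ hy)
    | inv a _ ha => exact hinv a ha
  -- cases
  by_cases h1 : ∀ y ∈ T, cr p0 y = 0
  · exact solv_of_fix hp0ne fun g hg => h1 _ (hΓ g hg _ hp0T)
  push Not at h1
  obtain ⟨y, hyT, hxy⟩ := h1
  by_cases h2 : ∀ z ∈ T, cr p0 z = 0 ∨ cr y z = 0
  · apply solv_of_pair hxy
    intro g hg
    have hne : cr (ca g p0) (ca g y) ≠ 0 := by rwa [cr_ca]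
    rcases h2 _ (hΓ g hg _ hp0T) with h3 | h3 <;> rcases h2 _ (hΓ g hg _ hyT) with h4 | h4
    · exact absurd (cr_trans hp0ne h3 h4) hne
    · exact Or.inl ⟨h3, h4⟩
    · exact Or.inr ⟨h3, h4⟩
    · exact absurd (cr_trans hyT.1 h3 h4) hne
  push Not at h2
  obtain ⟨z, hzT, hxz, hyz⟩ := h2
  apply solv_of_bddpow
  intro g hg
  obtain ⟨k1, hk1, e1⟩ := hph g (hΓ g hg) _ hp0T
  obtain ⟨k2, hk2, e2⟩ := hph g (hΓ g hg) _ hyT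
  obtain ⟨k3, hk3, e3⟩ := hph g (hΓ g hg) _ hzT
  have f1 := cr_pow hp0ne e1 (k2 * k3)
  have f2 := cr_pow hyT.1 e2 (k1 * k3)
  have f3 := cr_pow hzT.1 e3 (k1 * k2)
  rw [← pow_mul] at f1 f2 f3
  rw [show k2 * (k1 * k3) = k1 * (k2 * k3) by ring] at f2
  rw [show k3 * (k1 * k2) = k1 * (k2 * k3) by ring] at f3
  have := fix3 hxy hxz hyz f1 f2 f3
  rw [← pow_add] at this
  exact bddpow_of_pow (by positivity) this

/-- lines `v·x = 0` are null -/
theorem dt_null {μ N} (S : Stp μ N) {v : ℂ} (hv : v ≠ 0) : N {x | dt v x = 0} = 0 := by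
  have h := atomless S (x := ⟨-v.im, v.re⟩) (by
    intro h; apply hv
    have h1 := congrArg Complex.re h
    have h2 := congrArg Complex.im h
    simp at h1 h2
    exact Complex.ext h2 h1)
  convert h using 3
  ext x
  simp only [dt, cr, Set.mem_setOf_eq]
  constructor <;> intro h <;> linarith

end

noncomputable section

open scoped ENNReal NNReal Topology

lemma small_v {μ N} (S : Stp μ N) {v : ℂ} (hv : v ≠ 0) {η : ℝ} (hη : 0 < η) :
    ∃ t > (0:ℝ), N {x | |dt v x| ≤ t * ‖x‖} ≤ ENNReal.ofReal η := by
  have := S.pN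
  let A : ℕ → Set ℂ := fun n => {x | |dt v x| ≤ (1 / ((n:ℝ) + 1)) * ‖x‖}
  have hmeas : ∀ n, MeasurableSet (A n) := fun n =>
    measurableSet_le (measurable_const.dt' measurable_id).abs (measurable_const.mul measurable_norm)
  have hanti : Antitone A := by
    intro m n hmn x hx
    simp only [A, Set.mem_setOf_eq] at hx ⊢
    refine hx.trans (mul_le_mul_of_nonneg_right ?_ (norm_nonneg _))
    exact Nat.one_div_le_one_div hmn
  have hlim := tendsto_measure_iInter_atTop (μ := N) (fun n => (hmeas n).nullMeasurableSet) hanti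
    ⟨0, measure_ne_top _ _⟩
  have hz : N (⋂ n, A n) = 0 := by
    refine measure_mono_null ?_ (dt_null S hv)
    intro x hx
    simp only [Set.mem_iInter, A, Set.mem_setOf_eq] at hx ⊢
    have h1 : Tendsto (fun n : ℕ => (1 / ((n:ℝ) + 1)) * ‖x‖) atTop (𝓝 (0 * ‖x‖)) :=
      tendsto_one_div_add_atTop_nhds_zero_nat.mul_const _
    rw [zero_mul] at h1
    have := ge_of_tendsto' h1 hx
    exact abs_nonpos_iff.1 this
  rw [hz] at hlim
  obtain ⟨n, hn⟩ := (hlim.eventually (Iic_mem_nhds (a := ENNReal.ofReal η) (by simpa using hη))).exists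
  exact ⟨1 / ((n:ℝ) + 1), by positivity, hn⟩

theorem omega_small {μ N} (S : Stp μ N) {η : ℝ} (hη : 0 < η) :
    ∃ δ > (0:ℝ), ∀ v : ℂ, v ≠ 0 → N {x | |dt v x| ≤ δ * ‖v‖ * ‖x‖} ≤ ENNReal.ofReal η := by
  have hcomp : IsCompact (Metric.sphere (0:ℂ) 1) := isCompact_sphere 0 1
  have key : ∃ δ > (0:ℝ), ∀ v ∈ Metric.sphere (0:ℂ) 1, N {x | |dt v x| ≤ δ * ‖x‖} ≤ ENNReal.ofReal η := by
    refine hcomp.induction_on (p := fun s => ∃ δ > (0:ℝ), ∀ v ∈ s, N {x | |dt v x| ≤ δ * ‖x‖} ≤ ENNReal.ofReal η) ?_ ?_ ?_ ?_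
    · exact ⟨1, one_pos, by simp⟩
    · rintro s t hst ⟨δ, h1, h2⟩
      exact ⟨δ, h1, fun v hv => h2 v (hst hv)⟩
    · rintro s t ⟨δ, h1, h2⟩ ⟨δ', h3, h4⟩
      refine ⟨min δ δ', lt_min h1 h3, ?_⟩
      rintro v (hv | hv)
      · refine (measure_mono ?_).trans (h2 v hv)
        intro x hx
        exact le_trans hx (mul_le_mul_of_nonneg_right (min_le_left _ _) (norm_nonneg _))
      · refine (measure_mono ?_).trans (h4 v hv)
        intro x hx
        exact le_trans hx (mul_le_mul_of_nonneg_right (min_le_right _ _) (norm_nonneg _))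
    · intro v hv
      have hv0 : v ≠ 0 := by
        rintro rfl; simp at hv
      obtain ⟨t, ht, h⟩ := small_v S hv0 hη
      refine ⟨Metric.ball v (t / 2), mem_nhdsWithin_of_mem_nhds (Metric.ball_mem_nhds v (by positivity)),
        t / 2, by positivity, ?_⟩
      intro w hw
      refine (measure_mono ?_).trans h
      intro x hx
      simp only [Set.mem_setOf_eq] at hx ⊢
      have h1 : dt v x = dt w x - dt (w - v) x := by simp [dt]; ring
      have h2 : |dt (w - v) x| ≤ t / 2 * ‖x‖ := by
        refine (abs_dt_le _ _).trans (mul_le_mul_of_nonneg_right ?_ (norm_nonneg _))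
        rw [Metric.mem_ball, dist_eq_norm] at hw; exact hw.le
      rw [h1]
      refine (abs_sub _ _).trans ?_
      linarith
  obtain ⟨δ, hδ, h⟩ := key
  refine ⟨δ, hδ, fun v hv => ?_⟩
  have hn : 0 < ‖v‖ := norm_pos_iff.2 hv
  refine le_trans (le_of_eq ?_) (h (‖v‖⁻¹ • v) (by simp [norm_smul, hn.ne']))
  congr 1
  ext x
  simp only [Set.mem_setOf_eq, dt_smul_left, abs_mul, abs_inv, abs_norm]
  rw [inv_mul_le_iff₀ hn]
  constructor <;> intro h <;> linarith

lemma meas_sxx : Measurable sxx := by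
  have : sxx = fun x => if x.re = 0 then Complex.I else (1 + ((x.im / x.re : ℝ) : ℂ) * Complex.I) := by
    ext x
    unfold sxx
    split_ifs
    · rfl
    · apply Complex.ext <;> simp
  rw [this]
  refine Measurable.ite ?_ measurable_const ?_
  · exact measurableSet_eq_fun Complex.measurable_re measurable_const
  · fun_prop

lemma sxx_smul {c : ℝ} (hc : c ≠ 0) (x : ℂ) : sxx (c • x) = sxx x := by
  unfold sxx
  simp only [Complex.smul_re, Complex.smul_im, smul_eq_mul, mul_eq_zero, hc, false_or]
  split_ifs
  · rfl
  · rw [mul_div_mul_left _ _ hc]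

def Hom0 {E : Type*} (f : ℂ → E) : Prop := ∀ (c : ℝ) (x : ℂ), c ≠ 0 → f (c • x) = f x

lemma Hom0.sxx {E : Type*} {f : ℂ → E} (hf : Hom0 f) {x : ℂ} (hx : x ≠ 0) : f (sxx x) = f x := by
  obtain ⟨c, hc⟩ := parallel hx (cr_sxx x)
  rw [hc, hf]
  rintro rfl
  exact sxx_ne x (by simpa using hc)

lemma sxx_sect {μ N} (S : Stp μ N) : ∀ᵐ x ∂N, sxx x = x := by
  filter_upwards [S.sect, ae_ne_zero S] with x hx h0
  exact ((cr_sect h0 hx).1 (cr_self x)).symm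

lemma map_sxx {μ N} (S : Stp μ N) : (μ.prod N).map (fun p => sxx (ca p.1 p.2)) = N := by
  have := S.pN
  have := S.pmu
  have hm : Measurable (fun p : SL2 × ℂ => sxx (ca p.1 p.2)) :=
    meas_sxx.comp cont_ca.measurable
  ext A hA
  rw [Measure.map_apply hm hA, ← lintegral_indicator_one (hm hA), lintegral_prod _
    (measurable_one.indicator (hm hA)).aemeasurable]
  have h1 := S.stat (fun x => A.indicator 1 (sxx x)) ((measurable_one.indicator hA).comp meas_sxx)
    (fun c x hc => by rw [sxx_smul hc])
  refine Eq.trans ?_ (h1.symm.trans ?_)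
  · rfl
  · rw [← lintegral_indicator_one hA]
    apply lintegral_congr_ae
    filter_upwards [sxx_sect S] with x hx
    rw [hx]

lemma ae_prod_ne {μ N} (S : Stp μ N) : ∀ᵐ p ∂(μ.prod N), ca p.1 p.2 ≠ 0 := by
  have := S.pN
  have := S.pmu
  have : ∀ᵐ p ∂(μ.prod N), p.2 ≠ 0 :=
    (Measure.quasiMeasurePreserving_snd (μ := μ) (ν := N)).ae (ae_ne_zero S)
  filter_upwards [this] with p hp
  exact ca_ne_zero hp _

lemma stat_int {μ N} (S : Stp μ N) {f : ℂ → ℂ} (hf : Measurable f) (h0 : Hom0 f)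
    {C : ℝ} (hC : ∀ x, ‖f x‖ ≤ C) : ∫ x, f x ∂N = ∫ h, ∫ x, f (ca h x) ∂N ∂μ := by
  have := S.pN
  have := S.pmu
  have hm : Measurable (fun p : SL2 × ℂ => sxx (ca p.1 p.2)) :=
    meas_sxx.comp cont_ca.measurable
  conv_lhs => rw [← map_sxx S]
  rw [integral_map hm.aemeasurable hf.aestronglyMeasurable]
  have : ∫ p, f (sxx (ca p.1 p.2)) ∂(μ.prod N) = ∫ p, f (ca p.1 p.2) ∂(μ.prod N) := by
    apply integral_congr_ae
    filter_upwards [ae_prod_ne S] with p hp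
    exact h0.sxx hp
  rw [this, integral_prod]
  refine Integrable.of_bound (C := C) (hf.comp cont_ca.measurable).aestronglyMeasurable ?_
  exact Eventually.of_forall fun p => hC _

lemma stat_intR {μ N} (S : Stp μ N) {f : ℂ → ℝ} (hf : Measurable f) (h0 : Hom0 f)
    {C : ℝ} (hC : ∀ x, |f x| ≤ C) : ∫ x, f x ∂N = ∫ h, ∫ x, f (ca h x) ∂N ∂μ := by
  have h := stat_int S (f := fun x => (f x : ℂ)) (by fun_prop) (fun c x hc => by simp only [h0 c x hc])
    (C := C) (by simpa using hC)
  simp only [integral_complex_ofReal] at h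
  exact_mod_cast h

/-- convolution powers -/
def mun (μ : Measure SL2) : ℕ → Measure SL2
  | 0 => Measure.dirac 1
  | n + 1 => (mun μ n).mconv μ

instance mun_prob (μ : Measure SL2) [IsProbabilityMeasure μ] (n : ℕ) : IsProbabilityMeasure (mun μ n) := by
  induction n with
  | zero => unfold mun; infer_instance
  | succ n ih => unfold mun; infer_instance

lemma mun_succ' (μ : Measure SL2) [IsProbabilityMeasure μ] (n : ℕ) :
    mun μ (n + 1) = μ.mconv (mun μ n) := by
  induction n with
  | zero => simp [mun]
  | succ n ih => rw [mun, ih, Measure.mconv_assoc, ← mun, ih]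

lemma lint_mun (μ : Measure SL2) [IsProbabilityMeasure μ] (n : ℕ) {f : SL2 → ℝ≥0∞} (hf : Measurable f) :
    ∫⁻ g, f g ∂(mun μ (n + 1)) = ∫⁻ g, ∫⁻ h, f (g * h) ∂μ ∂(mun μ n) := by
  rw [mun, Measure.lintegral_mconv hf]

lemma lint_mun' (μ : Measure SL2) [IsProbabilityMeasure μ] (n : ℕ) {f : SL2 → ℝ≥0∞} (hf : Measurable f) :
    ∫⁻ g, f g ∂(mun μ (n + 1)) = ∫⁻ h, ∫⁻ g, f (h * g) ∂(mun μ n) ∂μ := by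
  rw [mun_succ', Measure.lintegral_mconv hf]

lemma int_mun (μ : Measure SL2) [IsProbabilityMeasure μ] (n : ℕ) {f : SL2 → ℝ}
    (hf : Integrable f (mun μ (n+1))) :
    ∫ g, f g ∂(mun μ (n + 1)) = ∫ g, ∫ h, f (g * h) ∂μ ∂(mun μ n) := by
  rw [mun]; rw [mun] at hf
  exact integral_mconv hf

/-- test functions -/
structure TF (f : ℂ → ℝ) : Prop where
  meas : Measurable f
  cont : ∀ x, x ≠ 0 → ContinuousAt f x
  bdd : ∀ x, |f x| ≤ 1
  hom : Hom0 f

lemma TF.comp {f : ℂ → ℝ} (hf : TF f) (g : SL2) : TF (fun x => f (ca g x)) where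
  meas := hf.meas.comp (measurable_id.ca' measurable_const)
  cont := fun x hx => (hf.cont _ (ca_ne_zero hx g)).comp
    (f := fun x => ca g x) (continuous_id.ca' continuous_const).continuousAt
  bdd := fun x => hf.bdd _
  hom := fun c x hc => by simp only [ca_smul, hf.hom _ _ hc]

def bp (δ : ℝ) (u x : ℂ) : ℝ := max 0 (min 1 (2 - |dt u x| / (δ * ‖x‖)))

lemma bp_TF {δ : ℝ} (hδ : 0 < δ) (u : ℂ) : TF (bp δ u) where
  meas := by
    unfold bp
    have : Measurable (fun x => dt u x) := measurable_const.dt' measurable_id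
    fun_prop
  cont := fun x hx => by
    unfold bp
    have : Continuous (fun x => dt u x) := continuous_const.dt' continuous_id
    have h2 : δ * ‖x‖ ≠ 0 := by positivity
    have : ContinuousAt (fun x => |dt u x| / (δ * ‖x‖)) x :=
      ContinuousAt.div (by fun_prop) (by fun_prop) h2
    fun_prop
  bdd := fun x => by
    unfold bp
    rw [abs_of_nonneg (le_max_left _ _)]
    exact max_le zero_le_one (min_le_left _ _)
  hom := fun c x hc => by
    unfold bp
    rw [dt_smul_right, norm_smul, abs_mul, Real.norm_eq_abs]
    have : |c| ≠ 0 := abs_ne_zero.2 hc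
    rw [show δ * (|c| * ‖x‖) = |c| * (δ * ‖x‖) by ring, mul_div_mul_left _ _ this]

lemma exists_row (g : SL2) : ∃ u : ℂ, ‖u‖ = 1 ∧ fr g ^ 2 ≤ 2 * ‖ra u g‖ ^ 2 := by
  by_cases h : g 1 0 ^ 2 + g 1 1 ^ 2 ≤ g 0 0 ^ 2 + g 0 1 ^ 2
  · refine ⟨1, by simp, ?_⟩
    rw [nsq, fr_sq]; simp; linarith
  · refine ⟨Complex.I, by simp, ?_⟩
    rw [nsq, fr_sq]; simp; linarith
lemma exists_col (g : SL2) : ∃ u : ℂ, ‖u‖ = 1 ∧ fr g ^ 2 ≤ 2 * ‖ca g u‖ ^ 2 := by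
  by_cases h : g 0 1 ^ 2 + g 1 1 ^ 2 ≤ g 0 0 ^ 2 + g 1 0 ^ 2
  · refine ⟨1, by simp, ?_⟩
    rw [nsq, fr_sq]; simp; linarith
  · refine ⟨Complex.I, by simp, ?_⟩
    rw [nsq, fr_sq]; simp; linarith

lemma dt_I (v x : ℂ) : dt (Complex.I * v) x = cr v x := by
  simp [dt, cr]; ring

lemma NI_step {μ N} (S : Stp μ N) {δ : ℝ} (hδ : 0 < δ)
    (hom : ∀ v : ℂ, v ≠ 0 → N {x | |dt v x| ≤ (2 * δ) * ‖v‖ * ‖x‖} ≤ ENNReal.ofReal (1 / 8)) (h : SL2)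
    (hinv : ∀ f, TF f → ∫ x, f (ca h x) ∂N = ∫ x, f x ∂N) : fr h ^ 2 ≤ 1 / δ ^ 2 := by
  have := S.pN
  by_contra hcon
  push Not at hcon
  have hfr := fr_pos h
  obtain ⟨r, hr1, hr2⟩ := exists_row h
  obtain ⟨w, hw1, hw2⟩ := exists_col h
  have hw0 : w ≠ 0 := by rintro rfl; simp at hw1
  have hr0 : r ≠ 0 := by rintro rfl; simp at hr1
  have hhw : 0 < ‖ca h w‖ := norm_pos_iff.2 (ca_ne_zero hw0 h)
  set u : ℂ := ‖ca h w‖⁻¹ • (Complex.I * ca h w) with hu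
  have hu1 : ‖u‖ = 1 := by
    rw [hu, norm_smul, norm_mul, Complex.norm_I, one_mul, norm_inv, norm_norm, inv_mul_cancel₀ hhw.ne']
  have hu0 : u ≠ 0 := by rw [← norm_pos_iff, hu1]; exact one_pos
  have hux : ∀ x, |dt u (ca h x)| ≤ ‖x‖ / ‖ca h w‖ := by
    intro x
    rw [hu, dt_smul_left, dt_I, cr_ca, abs_mul, abs_inv, abs_norm, div_eq_inv_mul]
    refine mul_le_mul_of_nonneg_left ?_ (by positivity)
    have := abs_cr_le w x
    rwa [hw1, one_mul] at this
  have hf := bp_TF hδ u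
  have h1 := hinv _ hf
  -- upper bound
  have hup : ∫ x, bp δ u x ∂N ≤ 1 / 8 := by
    have hA : MeasurableSet {x : ℂ | |dt u x| ≤ 2 * δ * ‖u‖ * ‖x‖} :=
      measurableSet_le (measurable_const.dt' measurable_id).abs (measurable_const.mul measurable_norm)
    calc ∫ x, bp δ u x ∂N ≤ ∫ x, {x : ℂ | |dt u x| ≤ 2 * δ * ‖u‖ * ‖x‖}.indicator 1 x ∂N := by
          apply integral_mono_ae
          · exact Integrable.of_bound (C := 1) hf.meas.aestronglyMeasurable (Eventually.of_forall hf.bdd)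
          · exact (integrable_const (1:ℝ)).indicator hA
          · filter_upwards [ae_ne_zero S] with x hx
            by_cases hx2 : |dt u x| ≤ 2 * δ * ‖u‖ * ‖x‖
            · rw [Set.indicator_of_mem (by exact hx2)]
              exact (abs_le.1 (hf.bdd x)).2
            · rw [Set.indicator_of_notMem (by exact hx2)]
              unfold bp
              have hpos : 0 < δ * ‖x‖ := by positivity
              rw [hu1] at hx2
              have : 2 ≤ |dt u x| / (δ * ‖x‖) := by
                rw [le_div_iff₀ hpos]; linarith
              rw [max_eq_left]
              exact (min_le_right _ _).trans (by linarith)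
      _ = N.real {x : ℂ | |dt u x| ≤ 2 * δ * ‖u‖ * ‖x‖} := integral_indicator_one hA
      _ ≤ 1 / 8 := ENNReal.toReal_le_of_le_ofReal (by norm_num) (hom u hu0)
  have hlo : 7 / 8 ≤ ∫ x, bp δ u (ca h x) ∂N := by
    have hA : MeasurableSet {x : ℂ | |dt (ra r h) x| ≤ 2 * δ * ‖ra r h‖ * ‖x‖} :=
      measurableSet_le (measurable_const.dt' measurable_id).abs (measurable_const.mul measurable_norm)
    have hm := hom (ra r h) (ra_ne_zero hr0 h)
    have hm' : N.real {x : ℂ | |dt (ra r h) x| ≤ 2 * δ * ‖ra r h‖ * ‖x‖} ≤ 1 / 8 :=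
      ENNReal.toReal_le_of_le_ofReal (by norm_num) hm
    have hc : N.real {x : ℂ | |dt (ra r h) x| ≤ 2 * δ * ‖ra r h‖ * ‖x‖}ᶜ =
        1 - N.real {x : ℂ | |dt (ra r h) x| ≤ 2 * δ * ‖ra r h‖ * ‖x‖} := probReal_compl_eq_one_sub hA
    calc (7:ℝ) / 8 ≤ N.real {x : ℂ | |dt (ra r h) x| ≤ 2 * δ * ‖ra r h‖ * ‖x‖}ᶜ := by rw [hc]; linarith
      _ = ∫ x, {x : ℂ | |dt (ra r h) x| ≤ 2 * δ * ‖ra r h‖ * ‖x‖}ᶜ.indicator 1 x ∂N :=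
          (integral_indicator_one hA.compl).symm
      _ ≤ ∫ x, bp δ u (ca h x) ∂N := by
          apply integral_mono_ae
          · exact (integrable_const (1:ℝ)).indicator hA.compl
          · exact Integrable.of_bound (C := 1) (hf.comp h).meas.aestronglyMeasurable
              (Eventually.of_forall (hf.comp h).bdd)
          · filter_upwards [ae_ne_zero S] with x hx
            by_cases hx2 : |dt (ra r h) x| ≤ 2 * δ * ‖ra r h‖ * ‖x‖
            · rw [Set.indicator_of_notMem (by simpa using hx2)]
              exact le_max_left _ _
            · rw [Set.indicator_of_mem (by simpa using hx2)]
              have hxp : 0 < ‖x‖ := norm_pos_iff.2 hx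
              have hhx : 0 < ‖ca h x‖ := norm_pos_iff.2 (ca_ne_zero hx h)
              unfold bp
              suffices |dt u (ca h x)| / (δ * ‖ca h x‖) ≤ 1 by
                rw [min_eq_left (by linarith)]; exact le_max_right _ _
              rw [div_le_one (by positivity)]
              refine (hux x).trans ?_
              rw [div_le_iff₀ hhw]
              push Not at hx2
              rw [dt_ra] at hx2
              have h3 := abs_dt_le r (ca h x)
              rw [hr1, one_mul] at h3
              have h4 : fr h ^ 2 ≤ 2 * (‖ra r h‖ * ‖ca h w‖) := by
                have : (fr h ^ 2) ^ 2 ≤ (2 * (‖ra r h‖ * ‖ca h w‖)) ^ 2 := by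
                  have := mul_le_mul hr2 hw2 (by positivity) (by positivity)
                  nlinarith
                exact le_of_sq_le_sq this (by positivity)
              rw [div_lt_iff₀ (by positivity)] at hcon
              have h5 : 2 * δ * ‖ra r h‖ * ‖x‖ ≤ ‖ca h x‖ := by linarith
              calc ‖x‖ ≤ (fr h ^ 2 * δ ^ 2) * ‖x‖ := by nlinarith
                _ ≤ (2 * (‖ra r h‖ * ‖ca h w‖) * δ ^ 2) * ‖x‖ := by gcongr
                _ = δ * (2 * δ * ‖ra r h‖ * ‖x‖) * ‖ca h w‖ := by ring
                _ ≤ δ * ‖ca h x‖ * ‖ca h w‖ := by gcongr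
  linarith

theorem NI {μ N} (S : Stp μ N) : ∃ f, TF f ∧ ∃ h ∈ measSupp μ,
    ∫ x, f (ca h x) ∂N ≠ ∫ x, f x ∂N := by
  by_contra hcon
  push Not at hcon
  apply S.ns
  obtain ⟨δ, hδ, hom⟩ := omega_small S (η := 1 / 8) (by norm_num)
  have hΓ : ∀ h ∈ Subgroup.closure (measSupp μ), ∀ f, TF f → ∫ x, f (ca h x) ∂N = ∫ x, f x ∂N := by
    intro g hg
    induction hg using Subgroup.closure_induction with
    | mem g hg => intro f hf; exact hcon f hf g hg
    | one => intro f hf; simp [ca_one]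
    | mul a b _ _ ha hb =>
      intro f hf
      simp only [ca_mul]
      rw [hb _ (hf.comp a), ha f hf]
    | inv a _ ha =>
      intro f hf
      have := ha _ (hf.comp a⁻¹)
      simp only [← ca_mul, inv_mul_cancel, ca_one] at this
      exact this.symm
  have hb : ∀ h ∈ Subgroup.closure (measSupp μ), fr h ≤ 1 + 1 / (δ / 2) ^ 2 := by
    intro h hh
    have := NI_step S (δ := δ / 2) (by positivity) (by
      intro v hv; rw [show 2 * (δ / 2) = δ by ring]; exact hom v hv) h (hΓ h hh)
    nlinarith [sq_nonneg (fr h - 1), one_le_fr h]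
  apply solv_of_bddpow
  intro g hg
  exact ⟨_, fun n => hb _ (Subgroup.pow_mem _ hg n)⟩

end

noncomputable section

open scoped ENNReal NNReal Topology

def qf (N : Measure ℂ) (f : ℂ → ℝ) (g : SL2) : ℝ := ∫ x, f (ca g x) ∂N

lemma qf_cont {μ N} (S : Stp μ N) {f : ℂ → ℝ} (hf : TF f) : Continuous (qf N f) := by
  have := S.pN
  unfold qf
  apply continuous_of_dominated (bound := fun _ => 1)
  · intro g; exact (hf.comp g).meas.aestronglyMeasurable
  · intro g; exact Eventually.of_forall fun x => hf.bdd _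
  · exact integrable_const _
  · filter_upwards [ae_ne_zero S] with x hx
    rw [continuous_iff_continuousAt]
    intro g
    exact (hf.cont _ (ca_ne_zero hx g)).comp (f := fun g => ca g x)
      (continuous_const.ca' continuous_id).continuousAt

lemma qf_bdd {μ N} (S : Stp μ N) {f : ℂ → ℝ} (hf : TF f) (g : SL2) : |qf N f g| ≤ 1 := by
  have := S.pN
  have := norm_integral_le_of_norm_le_const (μ := N) (f := fun x => f (ca g x)) (C := 1)
    (Eventually.of_forall fun x => hf.bdd _)
  simpa [qf] using this

lemma qf_harm {μ N} (S : Stp μ N) {f : ℂ → ℝ} (hf : TF f) (g : SL2) :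
    ∫ h, qf N f (g * h) ∂μ = qf N f g := by
  have := stat_intR S (hf.comp g).meas (hf.comp g).hom (C := 1) (hf.comp g).bdd
  unfold qf
  rw [this]
  simp only [ca_mul]

def Qf (μ : Measure SL2) (N : Measure ℂ) (f : ℂ → ℝ) (g : SL2) : ℝ :=
  ∫ h, (qf N f (g * h) - qf N f g) ^ 2 ∂μ

lemma Qf_aux {μ N} (S : Stp μ N) {f : ℂ → ℝ} (hf : TF f) (g h : SL2) :
    ‖(qf N f (g * h) - qf N f g) ^ 2‖ ≤ 4 := by
  have h1 := abs_le.1 (qf_bdd S hf g)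
  have h2 := abs_le.1 (qf_bdd S hf (g * h))
  rw [Real.norm_eq_abs, abs_of_nonneg (sq_nonneg _)]
  nlinarith

lemma Qf_cont {μ N} (S : Stp μ N) {f : ℂ → ℝ} (hf : TF f) : Continuous (Qf μ N f) := by
  have := S.pmu
  have hq := qf_cont S hf
  unfold Qf
  apply continuous_of_dominated (bound := fun _ => 4)
  · intro g
    have : Continuous fun h => (qf N f (g * h) - qf N f g) ^ 2 := by fun_prop
    exact this.aestronglyMeasurable
  · intro g; exact Eventually.of_forall fun x => Qf_aux S hf g x
  · exact integrable_const _
  · filter_upwards with h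
    fun_prop

lemma Qf_nonneg (μ N) (f : ℂ → ℝ) (g : SL2) : 0 ≤ Qf μ N f g :=
  integral_nonneg fun _ => sq_nonneg _

lemma Qf_pos {μ N} (S : Stp μ N) (g : SL2) : ∃ f, TF f ∧ 0 < Qf μ N f g := by
  have := S.pmu
  obtain ⟨f, hf, h, hh, hne⟩ := NI S
  refine ⟨_, hf.comp g⁻¹, ?_⟩
  have hf' := hf.comp g⁻¹
  rcases (Qf_nonneg μ N (fun x => f (ca g⁻¹ x)) g).eq_or_lt with h0 | h0
  · exfalso
    apply hne
    have hq := qf_cont S hf'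
    have hc : Continuous fun h => (qf N (fun x => f (ca g⁻¹ x)) (g * h) - qf N (fun x => f (ca g⁻¹ x)) g) ^ 2 := by
      fun_prop
    have hae := (integral_eq_zero_iff_of_nonneg (μ := μ) (fun h => sq_nonneg _)
      (Integrable.of_bound (C := 4) hc.aestronglyMeasurable
        (Eventually.of_forall fun x => Qf_aux S hf' g x))).1 h0.symm
    have := supp_sub (p := fun h => (qf N (fun x => f (ca g⁻¹ x)) (g * h) - qf N (fun x => f (ca g⁻¹ x)) g) ^ 2 = 0)
      (isClosed_eq hc continuous_const) hae hh
    have := sub_eq_zero.1 (pow_eq_zero_iff two_ne_zero |>.1 this)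
    unfold qf at this
    simpa only [← ca_mul, inv_mul_cancel, inv_mul_cancel_left, ca_one] using this
  · exact h0

lemma Qf_mun {μ N} (S : Stp μ N) {f : ℂ → ℝ} (hf : TF f) (n : ℕ) :
    ∫ g, Qf μ N f g ∂(mun μ n) = ∫ g, qf N f g ^ 2 ∂(mun μ (n+1)) - ∫ g, qf N f g ^ 2 ∂(mun μ n) := by
  have := S.pmu
  have hq := qf_cont S hf
  have hb : ∀ g, ‖qf N f g ^ 2‖ ≤ 1 := by
    intro g
    have h1 := abs_le.1 (qf_bdd S hf g)
    rw [Real.norm_eq_abs, abs_of_nonneg (sq_nonneg _)]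
    nlinarith
  have hi2 : ∀ m : Measure SL2, IsProbabilityMeasure m → Integrable (fun g => qf N f g ^ 2) m := by
    intro m hm
    exact Integrable.of_bound (C := 1) (hq.pow 2).aestronglyMeasurable (Eventually.of_forall hb)
  rw [int_mun _ _ (hi2 _ inferInstance)]
  have hI1 : Continuous fun g => ∫ h, qf N f (g * h) ^ 2 ∂μ := by
    apply continuous_of_dominated (bound := fun _ => 1)
    · intro g
      have : Continuous fun h => qf N f (g * h) ^ 2 := by fun_prop
      exact this.aestronglyMeasurable
    · intro g; exact Eventually.of_forall fun x => hb _
    · exact integrable_const _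
    · filter_upwards with h
      fun_prop
  rw [← integral_sub]
  · congr 1
    ext g
    unfold Qf
    have e : ∀ h, (qf N f (g * h) - qf N f g) ^ 2 = qf N f (g * h) ^ 2 - 2 * qf N f g * qf N f (g * h)
        + qf N f g ^ 2 := by intro h; ring
    simp only [e]
    have i1 : Integrable (fun h => qf N f (g * h) ^ 2) μ :=
      Integrable.of_bound (C := 1) (by
        have : Continuous fun h => qf N f (g * h) ^ 2 := by fun_prop
        exact this.aestronglyMeasurable) (Eventually.of_forall fun h => hb _)
    have i2 : Integrable (fun h => 2 * qf N f g * qf N f (g * h)) μ := by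
      apply Integrable.const_mul
      exact Integrable.of_bound (C := 1) (by
        have : Continuous fun h => qf N f (g * h) := by fun_prop
        exact this.aestronglyMeasurable) (Eventually.of_forall fun h => qf_bdd S hf _)
    have i3 : Integrable (fun h => qf N f (g * h) ^ 2 - 2 * qf N f g * qf N f (g * h)) μ := i1.sub i2
    rw [integral_add i3 (integrable_const _), integral_sub i1 i2, integral_const_mul, qf_harm S hf]
    simp
    ring
  · refine Integrable.of_bound (C := 1) hI1.aestronglyMeasurable (Eventually.of_forall fun g => ?_)
    have := norm_integral_le_of_norm_le_const (μ := μ) (f := fun h => qf N f (g * h) ^ 2) (C := 1)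
      (Eventually.of_forall fun x => hb _)
    simpa using this
  · exact hi2 _ inferInstance

lemma Qf_tendsto {μ N} (S : Stp μ N) {f : ℂ → ℝ} (hf : TF f) :
    Tendsto (fun n => ∫ g, Qf μ N f g ∂(mun μ n)) atTop (𝓝 0) := by
  have := S.pmu
  have hmono : Monotone fun n => ∫ g, qf N f g ^ 2 ∂(mun μ n) := by
    apply monotone_nat_of_le_succ
    intro n
    have h1 := Qf_mun S hf n
    have h2 : 0 ≤ ∫ g, Qf μ N f g ∂(mun μ n) := integral_nonneg fun g => Qf_nonneg _ _ _ _
    linarith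
  have hb : ∀ g, ‖qf N f g ^ 2‖ ≤ 1 := by
    intro g
    have h1 := abs_le.1 (qf_bdd S hf g)
    rw [Real.norm_eq_abs, abs_of_nonneg (sq_nonneg _)]
    nlinarith
  have hbdd : BddAbove (Set.range fun n => ∫ g, qf N f g ^ 2 ∂(mun μ n)) := by
    refine ⟨1, ?_⟩
    rintro _ ⟨n, rfl⟩
    have := norm_integral_le_of_norm_le_const (μ := mun μ n) (f := fun h => qf N f h ^ 2) (C := 1)
      (Eventually.of_forall fun x => hb _)
    simp only [probReal_univ, mul_one] at this
    exact (le_abs_self _).trans this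
  have hl := tendsto_atTop_ciSup hmono hbdd
  have := (hl.comp (tendsto_add_atTop_nat 1)).sub hl
  rw [sub_self] at this
  refine this.congr fun n => ?_
  rw [Qf_mun S hf n]; rfl

lemma compact_fr (R : ℝ) : IsCompact {g : SL2 | fr g ≤ R} := by
  have hemb : Topology.IsClosedEmbedding (fun g : SL2 => (g : Matrix (Fin 2) (Fin 2) ℝ)) := by
    refine ⟨Topology.IsEmbedding.subtypeVal, ?_⟩
    have : Set.range (fun g : SL2 => (g : Matrix (Fin 2) (Fin 2) ℝ)) = {A | A.det = 1} := by
      exact Subtype.range_coe_subtype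
    rw [this]
    exact isClosed_eq (continuous_id.matrix_det) continuous_const
  have hK : IsCompact (Set.univ.pi fun _ : Fin 2 => Set.univ.pi fun _ : Fin 2 => Set.Icc (-R) R :
      Set (Fin 2 → Fin 2 → ℝ)) :=
    isCompact_univ_pi fun _ => isCompact_univ_pi fun _ => isCompact_Icc
  have := hemb.isCompact_preimage hK
  refine this.of_isClosed_subset (isClosed_le cont_fr continuous_const) ?_
  intro g hg
  intro i _ j _
  exact abs_le.1 ((abs_e_le g i j).trans hg)

theorem escape {μ N} (S : Stp μ N) (R : ℝ) :
    Tendsto (fun n => mun μ n {g | fr g ≤ R}) atTop (𝓝 0) := by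
  have := S.pmu
  refine (compact_fr R).induction_on (p := fun s => Tendsto (fun n => mun μ n s) atTop (𝓝 0)) ?_ ?_ ?_ ?_
  · simp
  · intro s t hst ht
    exact tendsto_of_tendsto_of_tendsto_of_le_of_le tendsto_const_nhds ht (fun n => zero_le)
      (fun n => measure_mono hst)
  · intro s t hs ht
    have := hs.add ht
    rw [add_zero] at this
    exact tendsto_of_tendsto_of_tendsto_of_le_of_le tendsto_const_nhds this (fun n => zero_le)
      (fun n => measure_union_le _ _)
  · intro g _
    obtain ⟨f, hf, hpos⟩ := Qf_pos S g
    have hc := Qf_cont S hf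
    set c := Qf μ N f g / 2 with hcdef
    have hcpos : 0 < c := by positivity
    refine ⟨{g | c < Qf μ N f g}, mem_nhdsWithin_of_mem_nhds
      ((isOpen_lt continuous_const hc).mem_nhds (by show c < _; rw [hcdef]; linarith)), ?_⟩
    have hlim := (Qf_tendsto S hf).const_mul c⁻¹
    rw [mul_zero] at hlim
    have hlim' := ENNReal.tendsto_ofReal hlim
    rw [ENNReal.ofReal_zero] at hlim'
    refine tendsto_of_tendsto_of_tendsto_of_le_of_le tendsto_const_nhds hlim' (fun n => zero_le) ?_
    intro n
    have hintg : Integrable (Qf μ N f) (mun μ n) := by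
      refine Integrable.of_bound (C := 4) hc.aestronglyMeasurable (Eventually.of_forall fun g => ?_)
      have := norm_integral_le_of_norm_le_const (μ := μ) (f := fun h => (qf N f (g * h) - qf N f g) ^ 2) (C := 4)
        (Eventually.of_forall fun x => Qf_aux S hf g x)
      simpa [Qf] using this
    have hmk := mul_meas_ge_le_integral_of_nonneg (μ := mun μ n)
      (Eventually.of_forall fun g => Qf_nonneg μ N f g) hintg c
    have h2 : (mun μ n).real {g | c < Qf μ N f g} ≤ c⁻¹ * ∫ g, Qf μ N f g ∂(mun μ n) := by
      rw [← div_eq_inv_mul, le_div_iff₀ hcpos, mul_comm]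
      refine le_trans (mul_le_mul_of_nonneg_left ?_ hcpos.le) hmk
      exact measureReal_mono (fun g (hg : c < Qf μ N f g) => (show c ≤ Qf μ N f g from le_of_lt hg))
    show mun μ n {g | c < Qf μ N f g} ≤ ENNReal.ofReal (c⁻¹ * ∫ g, Qf μ N f g ∂(mun μ n))
    rw [← ofReal_measureReal]
    exact ENNReal.ofReal_le_ofReal h2

end

noncomputable section

open scoped ENNReal NNReal Topology

def lf (g : SL2) : ℝ := Real.log (fr g)

lemma lf_nonneg (g : SL2) : 0 ≤ lf g := Real.log_nonneg (one_le_fr g)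

lemma lf_mul (g h : SL2) : lf (g * h) ≤ lf g + lf h := by
  unfold lf
  rw [← Real.log_mul (fr_pos g).ne' (fr_pos h).ne']
  exact Real.log_le_log (fr_pos _) (fr_mul g h)

lemma cont_lf : Continuous lf := cont_fr.log fun g => (fr_pos g).ne'

lemma lf_sq_le {a : ℝ} (ha : 0 < a) (g : SL2) : lf g ^ 2 ≤ (4 / a ^ 2) * fr g ^ a := by
  have h1 : lf g ≤ fr g ^ (a / 2) / (a / 2) := Real.log_le_rpow_div (fr_nonneg g) (by positivity)
  have h2 : (fr g ^ (a / 2)) ^ 2 = fr g ^ a := by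
    rw [← Real.rpow_natCast, ← Real.rpow_mul (fr_nonneg g)]; norm_num
  calc lf g ^ 2 ≤ (fr g ^ (a / 2) / (a / 2)) ^ 2 := pow_le_pow_left₀ (lf_nonneg g) h1 2
    _ = _ := by rw [div_pow, h2]; field_simp; norm_num

lemma meas_frp (a : ℝ) : Measurable fun g => fr g ^ a :=
  cont_fr.measurable.pow_const a

lemma mom_fin {μ : Measure SL2} [IsProbabilityMeasure μ] {a : ℝ} (ha : 0 ≤ a)
    (h : ∫⁻ g, ENNReal.ofReal (fr g ^ a) ∂μ < ⊤) (n : ℕ) :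
    ∫⁻ g, ENNReal.ofReal (fr g ^ a) ∂(mun μ n) < ⊤ := by
  induction n with
  | zero =>
    rw [mun, lintegral_dirac' _ (meas_frp a).ennreal_ofReal]; exact ENNReal.ofReal_lt_top
  | succ n ih =>
    rw [lint_mun _ _ (meas_frp a).ennreal_ofReal]
    calc ∫⁻ g, ∫⁻ h, ENNReal.ofReal (fr (g * h) ^ a) ∂μ ∂(mun μ n)
        ≤ ∫⁻ g, ∫⁻ h, ENNReal.ofReal (fr g ^ a) * ENNReal.ofReal (fr h ^ a) ∂μ ∂(mun μ n) := by
          gcongr with g h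
          rw [← ENNReal.ofReal_mul (Real.rpow_nonneg (fr_nonneg g) a),
            ← Real.mul_rpow (fr_nonneg g) (fr_nonneg h)]
          exact ENNReal.ofReal_le_ofReal (Real.rpow_le_rpow (fr_nonneg _) (fr_mul g h) ha)
      _ = (∫⁻ g, ENNReal.ofReal (fr g ^ a) ∂(mun μ n)) * ∫⁻ g, ENNReal.ofReal (fr g ^ a) ∂μ := by
          simp_rw [lintegral_const_mul _ (meas_frp a).ennreal_ofReal]
          rw [lintegral_mul_const _ (meas_frp a).ennreal_ofReal]
      _ < ⊤ := ENNReal.mul_lt_top ih h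

lemma mun_one (μ : Measure SL2) [IsProbabilityMeasure μ] : mun μ 1 = μ := by simp [mun]

lemma frp_int {μ N} (S : Stp μ N) : ∃ a > (0:ℝ), ∀ n, Integrable (fun g => fr g ^ a) (mun μ n) := by
  have := S.pmu
  obtain ⟨a, ha, h⟩ := S.mom
  refine ⟨a, ha, fun n => ⟨(meas_frp a).aestronglyMeasurable, ?_⟩⟩
  rw [hasFiniteIntegral_iff_ofReal (Eventually.of_forall fun g => Real.rpow_nonneg (fr_nonneg g) a)]
  exact mom_fin ha.le h n

lemma lf2_int {μ N} (S : Stp μ N) (n : ℕ) : Integrable (fun g => lf g ^ 2) (mun μ n) := by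
  obtain ⟨a, ha, h⟩ := frp_int S
  refine ((h n).const_mul (4 / a ^ 2)).mono' (cont_lf.pow 2).aestronglyMeasurable ?_
  filter_upwards with g
  rw [Real.norm_eq_abs, abs_of_nonneg (sq_nonneg _)]
  exact lf_sq_le ha g

lemma lf_int {μ N} (S : Stp μ N) (n : ℕ) : Integrable lf (mun μ n) := by
  have := S.pmu
  refine ((lf2_int S n).add (integrable_const 1)).mono' cont_lf.aestronglyMeasurable ?_
  filter_upwards with g
  rw [Real.norm_eq_abs, abs_of_nonneg (lf_nonneg g)]
  simp only [Pi.add_apply]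
  nlinarith [sq_nonneg (lf g - 1)]

lemma lf2_bound {μ N} (S : Stp μ N) (n : ℕ) :
    ∫ g, lf g ^ 2 ∂(mun μ (n + 1)) ≤ ((n:ℝ) + 1) ^ 2 * ∫ g, lf g ^ 2 ∂μ := by
  have := S.pmu
  induction n with
  | zero => simp [mun_one]
  | succ n ih =>
    have hmu : Integrable (fun g => lf g ^ 2) μ := by simpa [mun_one] using lf2_int S 1
    set s := ∫ g, lf g ^ 2 ∂μ
    rw [int_mun _ _ (lf2_int S _)]
    set m : ℝ := (n:ℝ) + 1 with hm
    have hm0 : 0 < m := by positivity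
    have key : ∀ g h, lf (g * h) ^ 2 ≤ (1 + 1/m) * lf g ^ 2 + (1 + m) * lf h ^ 2 := by
      intro g h
      have h1 := lf_mul g h
      have h2 : lf (g * h) ^ 2 ≤ (lf g + lf h) ^ 2 := pow_le_pow_left₀ (lf_nonneg _) h1 2
      have h3 : 0 ≤ (1/m) * (lf g - m * lf h) ^ 2 := by positivity
      have h4 : (1/m) * (lf g - m * lf h) ^ 2 = (1/m) * lf g ^ 2 - 2 * lf g * lf h + m * lf h ^ 2 := by
        field_simp
        ring
      nlinarith
    have inner : ∀ g, ∫ h, lf (g * h) ^ 2 ∂μ ≤ (1 + 1/m) * lf g ^ 2 + (1 + m) * s := by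
      intro g
      calc ∫ h, lf (g * h) ^ 2 ∂μ ≤ ∫ h, ((1 + 1/m) * lf g ^ 2 + (1 + m) * lf h ^ 2) ∂μ :=
            integral_mono_of_nonneg (Eventually.of_forall fun _ => sq_nonneg _)
              ((integrable_const _).add (hmu.const_mul _)) (Eventually.of_forall fun h => key g h)
        _ = _ := by
            rw [integral_add (integrable_const _) (hmu.const_mul _), integral_const_mul]; simp [s, integral_const_mul]
    calc ∫ g, ∫ h, lf (g * h) ^ 2 ∂μ ∂(mun μ (n+1))
        ≤ ∫ g, ((1 + 1/m) * lf g ^ 2 + (1 + m) * s) ∂(mun μ (n+1)) :=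
          integral_mono_of_nonneg (Eventually.of_forall fun g => integral_nonneg fun _ => sq_nonneg _)
              (((lf2_int S _).const_mul _).add (integrable_const _)) (Eventually.of_forall inner)
      _ = (1 + 1/m) * ∫ g, lf g ^ 2 ∂(mun μ (n+1)) + (1 + m) * s := by
            rw [integral_add ((lf2_int S _).const_mul _) (integrable_const _), integral_const_mul]; simp
      _ ≤ (1 + 1/m) * (m ^ 2 * s) + (1 + m) * s := by gcongr
      _ = ((n + 1 : ℕ) + 1 : ℝ) ^ 2 * s := by
            push_cast; rw [← hm]; field_simp; ring

/-- the norm cocycle -/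
def sg (g : SL2) (x : ℂ) : ℝ := Real.log (‖ca g x‖ / ‖x‖)

lemma sg_le {x : ℂ} (hx : x ≠ 0) (g : SL2) : |sg g x| ≤ lf g := by
  have h0 : 0 < ‖x‖ := norm_pos_iff.2 hx
  have h1 : 0 < ‖ca g x‖ := norm_pos_iff.2 (ca_ne_zero hx g)
  have h2 := norm_ca_le x g
  have h3 := norm_le_ca x g
  unfold sg lf
  rw [abs_le]
  constructor
  · rw [← Real.log_inv]
    apply Real.log_le_log (inv_pos.2 (fr_pos g))
    rw [le_div_iff₀ h0, inv_mul_le_iff₀ (fr_pos g)]; exact h3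
  · apply Real.log_le_log (by positivity)
    rw [div_le_iff₀ h0]; exact h2

lemma sg_mul {x : ℂ} (hx : x ≠ 0) (g h : SL2) : sg (g * h) x = sg g (ca h x) + sg h x := by
  have h0 : ‖x‖ ≠ 0 := norm_ne_zero_iff.2 hx
  have h1 : ‖ca h x‖ ≠ 0 := norm_ne_zero_iff.2 (ca_ne_zero hx h)
  have h2 : ‖ca g (ca h x)‖ ≠ 0 := norm_ne_zero_iff.2 (ca_ne_zero (ca_ne_zero hx h) g)
  unfold sg
  rw [ca_mul, ← Real.log_mul (by positivity) (by positivity)]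
  congr 1
  field_simp

lemma sg_hom (g : SL2) : Hom0 (sg g) := by
  intro c x hc
  unfold sg
  rw [ca_smul, norm_smul, norm_smul, mul_div_mul_left _ _ (norm_ne_zero_iff.2 hc)]

lemma meas_sg2 : Measurable (fun p : SL2 × ℂ => sg p.1 p.2) := by
  unfold sg
  exact ((measurable_snd.ca' measurable_fst).norm.div measurable_snd.norm).log

lemma meas_sg (g : SL2) : Measurable (sg g) := meas_sg2.comp (measurable_const.prodMk measurable_id)

def Ls (N : Measure ℂ) (g : SL2) : ℝ := ∫ x, sg g x ∂N

lemma sg_intN {μ N} (S : Stp μ N) (g : SL2) : Integrable (sg g) N := by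
  have := S.pN
  refine Integrable.of_bound (C := lf g) (meas_sg g).aestronglyMeasurable ?_
  filter_upwards [ae_ne_zero S] with x hx using sg_le hx g

lemma Ls_le {μ N} (S : Stp μ N) (g : SL2) : |Ls N g| ≤ lf g := by
  have := S.pN
  have := norm_integral_le_of_norm_le_const (μ := N) (f := sg g) (C := lf g) (by
    filter_upwards [ae_ne_zero S] with x hx using sg_le hx g)
  simpa [Ls] using this

lemma meas_Ls {μ N} (S : Stp μ N) : StronglyMeasurable (Ls N) := by
  have := S.pN
  exact StronglyMeasurable.integral_prod_right (f := fun g x => sg g x) meas_sg2.stronglyMeasurable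

lemma Ls_int {μ N} (S : Stp μ N) (n : ℕ) : Integrable (Ls N) (mun μ n) :=
  (lf_int S n).mono' (meas_Ls S).aestronglyMeasurable (Eventually.of_forall fun g => Ls_le S g)

lemma sg_intP {μ N} (S : Stp μ N) (n : ℕ) :
    Integrable (fun p : SL2 × ℂ => sg p.1 p.2) ((mun μ n).prod N) := by
  have := S.pN
  have := S.pmu
  refine Integrable.mono' (g := fun p => lf p.1) ((lf_int S n).comp_fst N) meas_sg2.aestronglyMeasurable ?_
  have : ∀ᵐ p ∂((mun μ n).prod N), p.2 ≠ 0 := by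
    have := (Measure.quasiMeasurePreserving_snd (μ := mun μ n) (ν := N)).ae (ae_ne_zero S)
    exact this
  filter_upwards [this] with p hp using sg_le hp _

def alp (μ : Measure SL2) (N : Measure ℂ) : ℝ := ∫ g, Ls N g ∂μ

lemma alp_eq {μ N} (S : Stp μ N) : alp μ N = ∫ g, Ls N g ∂μ := rfl

lemma sg_le' (g : SL2) (x : ℂ) : |sg g x| ≤ lf g := by
  by_cases hx : x = 0
  · subst hx; simp [sg, lf_nonneg]
  · exact sg_le hx g

lemma Ls_harm {μ N} (S : Stp μ N) (g : SL2) : ∫ h, Ls N (g * h) ∂μ = Ls N g + alp μ N := by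
  have := S.pmu
  have := S.pN
  have e : ∀ h, Ls N (g * h) = (∫ x, sg g (ca h x) ∂N) + Ls N h := by
    intro h
    unfold Ls
    rw [← integral_add _ (sg_intN S h)]
    · apply integral_congr_ae
      filter_upwards [ae_ne_zero S] with x hx using sg_mul hx g h
    · refine Integrable.of_bound (C := lf g) ?_ (Eventually.of_forall fun x => sg_le' g _)
      exact ((meas_sg g).comp (measurable_id.ca' measurable_const)).aestronglyMeasurable
  simp only [e]
  rw [integral_add, ← stat_intR S (meas_sg g) (sg_hom g) (C := lf g) (sg_le' g)]
  · rfl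
  · have hm : StronglyMeasurable (fun h => ∫ x, sg g (ca h x) ∂N) :=
      StronglyMeasurable.integral_prod_right (f := fun h x => sg g (ca h x))
        ((meas_sg g).comp (measurable_snd.ca' measurable_fst)).stronglyMeasurable
    refine Integrable.of_bound (C := lf g) hm.aestronglyMeasurable (Eventually.of_forall fun h => ?_)
    have := norm_integral_le_of_norm_le_const (μ := N) (f := fun x => sg g (ca h x)) (C := lf g)
      (Eventually.of_forall fun x => sg_le' g _)
    simpa using this
  · simpa [mun_one] using Ls_int S 1

lemma Ls_mun {μ N} (S : Stp μ N) (n : ℕ) : ∫ g, Ls N g ∂(mun μ n) = n * alp μ N := by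
  have := S.pmu
  have := S.pN
  induction n with
  | zero =>
    rw [mun, integral_dirac]
    rw [Nat.cast_zero, zero_mul]
    unfold Ls
    apply integral_eq_zero_of_ae
    filter_upwards [ae_ne_zero S] with x hx
    rw [sg, ca_one, div_self (norm_ne_zero_iff.2 hx)]; simp
  | succ n ih =>
    rw [int_mun _ _ (Ls_int S _)]
    simp only [Ls_harm S]
    rw [integral_add (Ls_int S n) (integrable_const _), ih]
    simp; ring

lemma Ls_ge {μ N} (S : Stp μ N) : ∃ C, ∀ g, lf g / 2 - C ≤ Ls N g := by
  have := S.pN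
  obtain ⟨δ, hδ, h⟩ := omega_small S (η := 1/4) (by norm_num)
  refine ⟨|Real.log (δ / 2)|, fun g => ?_⟩
  obtain ⟨u, hu, hug⟩ := exists_row g
  have hu0 : u ≠ 0 := by rintro rfl; simp at hu
  set B : Set ℂ := {x | |dt (ra u g) x| ≤ δ * ‖ra u g‖ * ‖x‖} with hB
  have hBm : MeasurableSet B := measurableSet_le (measurable_const.dt' measurable_id).abs
    (measurable_const.mul measurable_norm)
  have hNB : N.real B ≤ 1/4 := by
    have := ENNReal.toReal_mono ENNReal.ofReal_ne_top (h _ (ra_ne_zero hu0 g))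
    rwa [ENNReal.toReal_ofReal (by norm_num)] at this
  have hru : fr g / 2 ≤ ‖ra u g‖ := by
    have := norm_nonneg (ra u g)
    have := fr_nonneg g
    nlinarith
  have pt : ∀ x, x ≠ 0 → lf g - |Real.log (δ / 2)| - B.indicator (fun _ => 2 * lf g) x ≤ sg g x := by
    intro x hx
    by_cases hxB : x ∈ B
    · rw [Set.indicator_of_mem hxB]
      have := abs_le.1 (sg_le' g x)
      have := abs_nonneg (Real.log (δ / 2))
      linarith
    · rw [Set.indicator_of_notMem hxB]
      have hx' : δ * ‖ra u g‖ * ‖x‖ < |dt (ra u g) x| := not_le.1 hxB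
      have h1 : |dt (ra u g) x| ≤ ‖ca g x‖ := by
        rw [dt_ra]; exact (abs_dt_le _ _).trans (by rw [hu, one_mul])
      have hx0 : 0 < ‖x‖ := norm_pos_iff.2 hx
      have h2 : fr g * (δ / 2) ≤ ‖ca g x‖ / ‖x‖ := by
        rw [le_div_iff₀ hx0]
        calc fr g * (δ / 2) * ‖x‖ = δ * (fr g / 2) * ‖x‖ := by ring
          _ ≤ δ * ‖ra u g‖ * ‖x‖ := by gcongr
          _ ≤ _ := hx'.le.trans h1
      have h3 := Real.log_le_log (by have := fr_pos g; positivity) h2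
      rw [Real.log_mul (fr_pos g).ne' (by positivity)] at h3
      have := neg_abs_le (Real.log (δ / 2))
      unfold sg lf
      linarith
  have hi : Integrable (fun x => B.indicator (fun _ => 2 * lf g) x) N :=
    (integrable_const _).indicator hBm
  have := integral_mono_ae ((integrable_const (lf g - |Real.log (δ / 2)|)).sub hi) (sg_intN S g) (by
    filter_upwards [ae_ne_zero S] with x hx using pt x hx)
  simp only [Pi.sub_apply] at this
  rw [integral_sub (integrable_const _) hi, integral_indicator_const _ hBm] at this
  simp only [integral_const, probReal_univ, one_smul, smul_eq_mul] at this
  have h5 : N.real B * (2 * lf g) ≤ 1/4 * (2 * lf g) := by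
    have := lf_nonneg g
    gcongr
  unfold Ls
  linarith

lemma alp_pos {μ N} (S : Stp μ N) : 0 < alp μ N := by
  have := S.pN
  have := S.pmu
  obtain ⟨C, hC⟩ := Ls_ge S
  set T := 4 * |C| + 4 with hT
  have hT0 : 0 < T := by positivity
  have hesc := escape S (Real.exp T)
  obtain ⟨n, hn⟩ := (hesc.eventually (Iic_mem_nhds (a := ENNReal.ofReal (1/4)) (by simp))).exists
  have hn' : (mun μ n).real {g | fr g ≤ Real.exp T} ≤ 1/4 := by
    have := ENNReal.toReal_mono ENNReal.ofReal_ne_top hn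
    rwa [ENNReal.toReal_ofReal (by norm_num)] at this
  set B : Set SL2 := {g | fr g ≤ Real.exp T} with hB
  have hBm : MeasurableSet B := measurableSet_le cont_fr.measurable measurable_const
  have pt : ∀ g, T - B.indicator (fun _ => T) g ≤ lf g := by
    intro g
    by_cases hg : g ∈ B
    · rw [Set.indicator_of_mem hg]; linarith [lf_nonneg g]
    · rw [Set.indicator_of_notMem hg]
      have : Real.exp T < fr g := not_le.1 hg
      unfold lf
      rw [sub_zero, Real.le_log_iff_exp_le (fr_pos g)]; exact this.le
  have hi : Integrable (fun x => B.indicator (fun _ => T) x) (mun μ n) :=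
    (integrable_const _).indicator hBm
  have h1 := integral_mono ((integrable_const T).sub hi) (lf_int S n) pt
  simp only [Pi.sub_apply] at h1
  rw [integral_sub (integrable_const _) hi, integral_indicator_const _ hBm] at h1
  simp only [integral_const, probReal_univ, one_smul, smul_eq_mul] at h1
  have h2 := integral_mono (((lf_int S n).div_const 2).sub (integrable_const C)) (Ls_int S n) hC
  simp only [Pi.sub_apply] at h2
  rw [integral_sub ((lf_int S n).div_const 2) (integrable_const _), integral_div, Ls_mun S] at h2
  simp only [integral_const, probReal_univ, one_smul] at h2
  have h3 : (mun μ n).real B * T ≤ 1/4 * T := by gcongr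
  have h4 := le_abs_self C
  have h5 : 0 < (n:ℝ) * alp μ N := by
    have := abs_nonneg C
    linarith
  exact pos_of_mul_pos_right h5 (Nat.cast_nonneg n)

lemma stat_mun {μ N} (S : Stp μ N) {f : ℂ → ℝ≥0∞} (hf : Measurable f)
    (h0 : ∀ (c : ℝ) (x : ℂ), c ≠ 0 → f (c • x) = f x) (n : ℕ) :
    ∫⁻ x, f x ∂N = ∫⁻ h, ∫⁻ x, f (ca h x) ∂N ∂(mun μ n) := by
  have := S.pN
  have := S.pmu
  have hm : Measurable (fun h => ∫⁻ x, f (ca h x) ∂N) :=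
    Measurable.lintegral_prod_right' (f := fun p : SL2 × ℂ => f (ca p.1 p.2)) (hf.comp cont_ca.measurable)
  induction n with
  | zero =>
    rw [mun, lintegral_dirac' _ hm]; simp only [ca_one]
  | succ n ih =>
    rw [lint_mun _ _ hm, ih]
    congr 1
    ext g
    rw [S.stat (fun x => f (ca g x)) (hf.comp (measurable_id.ca' measurable_const))
      (fun c x hc => by rw [ca_smul, h0 c _ hc])]
    simp only [ca_mul]

theorem drift {μ N} (S : Stp μ N) : ∃ n : ℕ, 0 < n ∧ ∃ c > (0:ℝ), ∀ v : ℂ, ‖v‖ = 1 →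
    c ≤ ∫ g, Real.log ‖ra v g‖ ∂(mun μ n) := by
  have := S.pN
  have := S.pmu
  have hα := alp_pos S
  set α := alp μ N
  set s := ∫ g, lf g ^ 2 ∂μ with hs
  have hs0 : 0 ≤ s := integral_nonneg fun g => sq_nonneg _
  set κ := 2 * (s + 1) / α with hκ
  have hκ0 : 0 < κ := by positivity
  set η := α / (16 * κ) with hη
  have hη0 : 0 < η := by positivity
  obtain ⟨δ, hδ, hom⟩ := omega_small S hη0
  set T := |Real.log δ| with hT
  obtain ⟨n, hn⟩ := exists_nat_gt ((T + 1) / (α / 4))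
  have hn0 : 0 < n := by
    have : (0:ℝ) < n := lt_of_le_of_lt (by positivity) hn
    exact_mod_cast this
  have hn1 : T + 1 < n * (α / 4) := by rwa [div_lt_iff₀ (by positivity)] at hn
  refine ⟨n, hn0, 1, one_pos, ?_⟩
  intro v hv
  have hv0 : v ≠ 0 := by rintro rfl; simp at hv
  have hnr : (0:ℝ) < n := by exact_mod_cast hn0
  set B : Set (SL2 × ℂ) := {p | |dt v (ca p.1 p.2)| ≤ δ * ‖v‖ * ‖ca p.1 p.2‖} with hB
  have hBm : MeasurableSet B := measurableSet_le (measurable_const.dt' cont_ca.measurable).abs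
    (measurable_const.mul cont_ca.measurable.norm)
  have hPB : ((mun μ n).prod N).real B ≤ η := by
    have h1 : ((mun μ n).prod N) B = N {x | |dt v x| ≤ δ * ‖v‖ * ‖x‖} := by
      have hA : MeasurableSet {x | |dt v x| ≤ δ * ‖v‖ * ‖x‖} :=
        measurableSet_le (measurable_const.dt' measurable_id).abs (measurable_const.mul measurable_norm)
      rw [← lintegral_indicator_one hA, stat_mun S (measurable_one.indicator hA) _ n,
        Measure.prod_apply hBm]
      · congr 1
        ext g
        rw [← lintegral_indicator_one (measurable_prodMk_left hBm)]
        rfl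
      · intro c x hc
        have h6 : (|dt v (c • x)| ≤ δ * ‖v‖ * ‖c • x‖) ↔ (|dt v x| ≤ δ * ‖v‖ * ‖x‖) := by
          rw [dt_smul_right, norm_smul, abs_mul, Real.norm_eq_abs]
          have h5 : δ * ‖v‖ * (|c| * ‖x‖) = |c| * (δ * ‖v‖ * ‖x‖) := by ring
          rw [h5, mul_le_mul_iff_right₀ (abs_pos.2 hc)]
        simp only [Set.indicator, Set.mem_setOf_eq, h6, Pi.one_apply]
    have := ENNReal.toReal_mono ENNReal.ofReal_ne_top (h1.le.trans (hom v hv0))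
    rwa [ENNReal.toReal_ofReal hη0.le] at this
  have pt : ∀ p : SL2 × ℂ, p.2 ≠ 0 → -T + sg p.1 p.2 - (lf p.1 ^ 2 / (2 * κ * n) +
      B.indicator (fun _ => 2 * κ * n) p) ≤ Real.log ‖ra v p.1‖ := by
    rintro ⟨g, x⟩ hx
    simp only at hx ⊢
    have hra0 : 0 < ‖ra v g‖ := norm_pos_iff.2 (ra_ne_zero hv0 g)
    by_cases hp : (g, x) ∈ B
    · rw [Set.indicator_of_mem hp]
      have h1 := (abs_le.1 (sg_le' g x)).2
      have h2 : - lf g ≤ Real.log ‖ra v g‖ := by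
        have := norm_le_ra v g
        rw [hv] at this
        have h3 := Real.log_le_log one_pos this
        rw [Real.log_one, Real.log_mul hra0.ne' (fr_pos g).ne'] at h3
        unfold lf; linarith
      have h3 : 2 * lf g ≤ lf g ^ 2 / (2 * κ * n) + 2 * κ * n := by
        have h6 : 0 < 2 * κ * n := by positivity
        have h7 : lf g ^ 2 / (2 * κ * n) + 2 * κ * n - 2 * lf g = (lf g - 2 * κ * n) ^ 2 / (2 * κ * n) := by
          field_simp; ring
        have : 0 ≤ (lf g - 2 * κ * n) ^ 2 / (2 * κ * n) := by positivity
        linarith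
      have : 0 ≤ T := abs_nonneg _
      linarith
    · rw [Set.indicator_of_notMem hp]
      have hx' : δ * ‖v‖ * ‖ca g x‖ < |dt v (ca g x)| := not_le.1 hp
      rw [hv, mul_one, ← dt_ra] at hx'
      have hx0 : 0 < ‖x‖ := norm_pos_iff.2 hx
      have hca0 : 0 < ‖ca g x‖ := norm_pos_iff.2 (ca_ne_zero hx g)
      have h1 : δ * (‖ca g x‖ / ‖x‖) ≤ ‖ra v g‖ := by
        rw [← mul_div_assoc, div_le_iff₀ hx0]
        exact hx'.le.trans (abs_dt_le _ _)
      have h2 := Real.log_le_log (by positivity) h1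
      rw [Real.log_mul hδ.ne' (by positivity)] at h2
      have := neg_abs_le (Real.log δ)
      have : 0 ≤ lf g ^ 2 / (2 * κ * n) := by positivity
      unfold sg
      linarith
  have hne : ∀ᵐ p ∂((mun μ n).prod N), p.2 ≠ 0 :=
    (Measure.quasiMeasurePreserving_snd (μ := mun μ n) (ν := N)).ae (ae_ne_zero S)
  have hl : Integrable (fun g => Real.log ‖ra v g‖) (mun μ n) := by
    refine (lf_int S n).mono' (measurable_const.ra' measurable_id).norm.log.aestronglyMeasurable ?_
    filter_upwards with g
    have hra0 : 0 < ‖ra v g‖ := norm_pos_iff.2 (ra_ne_zero hv0 g)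
    rw [Real.norm_eq_abs, abs_le]
    constructor
    · have := norm_le_ra v g
      rw [hv] at this
      have h3 := Real.log_le_log one_pos this
      rw [Real.log_one, Real.log_mul hra0.ne' (fr_pos g).ne'] at h3
      unfold lf; linarith
    · have := norm_ra_le v g
      rw [hv, one_mul] at this
      exact Real.log_le_log hra0 this
  have i2 : Integrable (fun p : SL2 × ℂ => lf p.1 ^ 2 / (2 * κ * n)) ((mun μ n).prod N) :=
    ((lf2_int S n).div_const _).comp_fst N
  have i3 : Integrable (fun p => B.indicator (fun _ => 2 * κ * n) p) ((mun μ n).prod N) :=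
    (integrable_const _).indicator hBm
  have i4 : Integrable (fun p : SL2 × ℂ => -T + sg p.1 p.2) ((mun μ n).prod N) :=
    (integrable_const _).add (sg_intP S n)
  have i5 : Integrable (fun p : SL2 × ℂ => lf p.1 ^ 2 / (2 * κ * n) + B.indicator (fun _ => 2 * κ * n) p)
    ((mun μ n).prod N) := i2.add i3
  have h1 := integral_mono_ae (i4.sub i5) (hl.comp_fst N) (by
    filter_upwards [hne] with p hp using pt p hp)
  simp only [Pi.sub_apply] at h1
  rw [integral_sub i4 i5, integral_add i2 i3, integral_add (integrable_const _) (sg_intP S n),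
    integral_indicator_const _ hBm, integral_prod _ (sg_intP S n),
    integral_prod _ i2, integral_prod _ (hl.comp_fst N)] at h1
  simp only [integral_const, probReal_univ, one_smul, smul_eq_mul, one_mul] at h1
  rw [integral_div] at h1
  have h2 : ∫ x, ∫ y, sg x y ∂N ∂(mun μ n) = n * α := Ls_mun S n
  rw [h2] at h1
  have h3 : ∫ g, lf g ^ 2 ∂(mun μ n) ≤ (n:ℝ) ^ 2 * s := by
    obtain ⟨m, rfl⟩ : ∃ m, n = m + 1 := ⟨n - 1, by omega⟩
    have := lf2_bound S m
    push_cast; exact this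
  have h4 : (∫ g, lf g ^ 2 ∂(mun μ n)) / (2 * κ * n) ≤ n * (α / 4) := by
    rw [div_le_iff₀ (by positivity)]
    have : n * (α / 4) * (2 * κ * n) = (n:ℝ) ^ 2 * (s + 1) := by
      rw [hκ]; field_simp; ring
    rw [this]
    nlinarith [sq_nonneg (n:ℝ)]
  have h5 : ((mun μ n).prod N).real B * (2 * κ * n) ≤ η * (2 * κ * n) := by gcongr
  have h6 : η * (2 * κ * n) = n * (α / 8) := by rw [hη]; field_simp; ring
  nlinarith

end

noncomputable section

open scoped ENNReal NNReal Topology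

lemma exp_quad (t : ℝ) : Real.exp (-t) ≤ 1 - t + t ^ 2 * Real.exp |t| := by
  have h1 : 1 ≤ Real.exp |t| := Real.one_le_exp (abs_nonneg t)
  rcases le_total |t| 1 with h | h
  · have := abs_le.1 (Real.abs_exp_sub_one_sub_id_le (x := -t) (by rwa [abs_neg]))
    nlinarith [sq_nonneg t]
  · rcases le_total 0 t with h0 | h0
    · rw [abs_of_nonneg h0] at h h1 ⊢
      have : Real.exp (-t) ≤ 1 := Real.exp_le_one_iff.2 (by linarith)
      nlinarith [sq_nonneg t]
    · rw [abs_of_nonpos h0] at h h1 ⊢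
      have : 1 ≤ t ^ 2 := by nlinarith
      nlinarith

/-- The power weight. -/
def Na (a : ℝ) (v : ℂ) : ℝ≥0∞ := ENNReal.ofReal (‖v‖ ^ (-a))

lemma meas_Na (a : ℝ) : Measurable (Na a) :=
  (measurable_norm.pow_const _).ennreal_ofReal

lemma Na_ne_top (a : ℝ) (v : ℂ) : Na a v ≠ ⊤ := ENNReal.ofReal_ne_top

lemma Na_zero {a : ℝ} (ha : 0 < a) : Na a 0 = 0 := by
  rw [Na, norm_zero, Real.zero_rpow (by linarith), ENNReal.ofReal_zero]

lemma ra_zero (g : SL2) : ra 0 g = 0 := by apply Complex.ext <;> simp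

lemma Na_ra {a : ℝ} (ha : 0 < a) (v : ℂ) (g : SL2) :
    Na a (ra v g) ≤ ENNReal.ofReal (fr g ^ a) * Na a v := by
  by_cases hv : v = 0
  · subst hv; rw [ra_zero, Na_zero ha]; exact zero_le
  rw [Na, Na, ← ENNReal.ofReal_mul (Real.rpow_nonneg (fr_nonneg g) a)]
  apply ENNReal.ofReal_le_ofReal
  have h0 : 0 < ‖v‖ := norm_pos_iff.2 hv
  have h1 : 0 < ‖ra v g‖ := norm_pos_iff.2 (ra_ne_zero hv g)
  have h2 := norm_le_ra v g
  have h3 := Real.rpow_le_rpow h0.le h2 ha.le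
  rw [Real.mul_rpow h1.le (fr_nonneg g)] at h3
  rw [Real.rpow_neg h0.le, Real.rpow_neg h1.le, ← div_eq_mul_inv, le_div_iff₀ (by positivity),
    inv_mul_le_iff₀ (by positivity)]
  exact h3

lemma contr {μ N} (S : Stp μ N) : ∃ a : ℝ, 0 < a ∧ a ≤ 1 ∧ (∫⁻ g, ENNReal.ofReal (fr g ^ a) ∂μ < ⊤) ∧
    ∃ n : ℕ, 0 < n ∧ ∃ ρ : ℝ, 0 < ρ ∧ ρ < 1 ∧
    ∀ v, ∫⁻ g, Na a (ra v g) ∂(mun μ n) ≤ ENNReal.ofReal ρ * Na a v := by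
  have := S.pmu
  obtain ⟨n, hn, c, hc, hd⟩ := drift S
  obtain ⟨e, he, hi⟩ := frp_int S
  set b := e / 2 with hb
  have hb0 : 0 < b := by positivity
  set K := (4 / b ^ 2) * ∫ g, fr g ^ e ∂(mun μ n) with hK
  have hK0 : 0 ≤ K := mul_nonneg (by positivity) (integral_nonneg fun g => Real.rpow_nonneg (fr_nonneg g) _)
  set a := min (min b (1/2)) (min (c / (2 * (K + 1))) (1 / (2*c))) with ha
  have ha0 : 0 < a := by
    rw [ha]; refine lt_min (lt_min hb0 (by norm_num)) (lt_min (by positivity) (by positivity))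
  have hab : a ≤ b := (min_le_left _ _).trans (min_le_left _ _)
  have hah : a ≤ 1/2 := (min_le_left _ _).trans (min_le_right _ _)
  have hac : a * (K + 1) ≤ c / 2 := by
    have : a ≤ c / (2 * (K + 1)) := (min_le_right _ _).trans (min_le_left _ _)
    rw [le_div_iff₀ (by positivity)] at this
    linarith
  have hac' : a * c ≤ 1 / 2 := by
    have : a ≤ 1 / (2 * c) := (min_le_right _ _).trans (min_le_right _ _)
    rw [le_div_iff₀ (by positivity)] at this
    linarith
  refine ⟨a, ha0, by linarith, ?_, n, hn, 1 - a * c / 2, by linarith, by linarith [mul_pos ha0 hc], ?_⟩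
  · refine lt_of_le_of_lt (lintegral_mono fun g => ENNReal.ofReal_le_ofReal ?_) (b := ∫⁻ g, ENNReal.ofReal (fr g ^ e) ∂μ) ?_
    · exact Real.rpow_le_rpow_of_exponent_le (one_le_fr g) (by linarith)
    · have := hi 1
      rw [mun_one] at this
      exact (hasFiniteIntegral_iff_ofReal (Eventually.of_forall fun g => Real.rpow_nonneg (fr_nonneg g) e)).1 this.2
  · have unit : ∀ v : ℂ, ‖v‖ = 1 → ∫⁻ g, Na a (ra v g) ∂(mun μ n) ≤ ENNReal.ofReal (1 - a * c / 2) := by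
      intro v hv
      have hv0 : v ≠ 0 := by rintro rfl; simp at hv
      have hlog : ∀ g, |Real.log ‖ra v g‖| ≤ lf g := by
        intro g
        have hra0 : 0 < ‖ra v g‖ := norm_pos_iff.2 (ra_ne_zero hv0 g)
        rw [abs_le]
        constructor
        · have := norm_le_ra v g
          rw [hv] at this
          have h3 := Real.log_le_log one_pos this
          rw [Real.log_one, Real.log_mul hra0.ne' (fr_pos g).ne'] at h3
          unfold lf; linarith
        · have := norm_ra_le v g
          rw [hv, one_mul] at this
          exact Real.log_le_log hra0 this
      have pt : ∀ g, ‖ra v g‖ ^ (-a) ≤ 1 - a * Real.log ‖ra v g‖ + a ^ 2 * ((4 / b ^ 2) * fr g ^ e) := by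
        intro g
        have hra0 : 0 < ‖ra v g‖ := norm_pos_iff.2 (ra_ne_zero hv0 g)
        set y := Real.log ‖ra v g‖ with hy
        have h1 : ‖ra v g‖ ^ (-a) = Real.exp (-(a * y)) := by
          rw [Real.rpow_def_of_pos hra0, hy]; congr 1; ring
        rw [h1]
        refine (exp_quad _).trans ?_
        have h2 : (a * y) ^ 2 * Real.exp |a * y| ≤ a ^ 2 * ((4 / b ^ 2) * fr g ^ e) := by
          have h3 : y ^ 2 ≤ lf g ^ 2 := by rw [← sq_abs y]; exact pow_le_pow_left₀ (abs_nonneg _) (hlog g) 2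
          have h4 : Real.exp |a * y| ≤ fr g ^ b := by
            rw [Real.rpow_def_of_pos (fr_pos g), abs_mul, abs_of_pos ha0]
            apply Real.exp_le_exp.2
            have := hlog g
            have := lf_nonneg g
            calc a * |y| ≤ a * lf g := by gcongr
              _ ≤ b * lf g := by gcongr
              _ = _ := by unfold lf; ring
          have h5 := lf_sq_le hb0 g
          calc (a * y) ^ 2 * Real.exp |a * y| = a ^ 2 * (y ^ 2 * Real.exp |a * y|) := by ring
            _ ≤ a ^ 2 * (((4 / b ^ 2) * fr g ^ b) * fr g ^ b) := by
              have := fr_pos g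
              gcongr
              exact h3.trans h5
            _ = _ := by
              rw [mul_assoc (4 / b ^ 2), ← Real.rpow_add (fr_pos g), show b + b = e by rw [hb]; ring]
        linarith
      have hl : Integrable (fun g => Real.log ‖ra v g‖) (mun μ n) := by
        refine (lf_int S n).mono' (measurable_const.ra' measurable_id).norm.log.aestronglyMeasurable ?_
        filter_upwards with g using hlog g
      have i1 : Integrable (fun g => 1 - a * Real.log ‖ra v g‖) (mun μ n) :=
        (integrable_const _).sub (hl.const_mul a)
      have i2 : Integrable (fun g => a ^ 2 * ((4 / b ^ 2) * fr g ^ e)) (mun μ n) :=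
        ((hi n).const_mul _).const_mul _
      have i3 : Integrable (fun g => 1 - a * Real.log ‖ra v g‖ + a ^ 2 * ((4 / b ^ 2) * fr g ^ e)) (mun μ n) :=
        i1.add i2
      calc ∫⁻ g, Na a (ra v g) ∂(mun μ n)
          ≤ ∫⁻ g, ENNReal.ofReal (1 - a * Real.log ‖ra v g‖ + a ^ 2 * ((4 / b ^ 2) * fr g ^ e)) ∂(mun μ n) :=
            lintegral_mono fun g => ENNReal.ofReal_le_ofReal (pt g)
        _ = ENNReal.ofReal (∫ g, (1 - a * Real.log ‖ra v g‖ + a ^ 2 * ((4 / b ^ 2) * fr g ^ e)) ∂(mun μ n)) :=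
            (ofReal_integral_eq_lintegral_ofReal i3 (Eventually.of_forall fun g =>
              (Real.rpow_nonneg (norm_nonneg _) _).trans (pt g))).symm
        _ ≤ _ := by
            apply ENNReal.ofReal_le_ofReal
            rw [integral_add i1 i2, integral_sub (integrable_const _) (hl.const_mul a), integral_const_mul,
              integral_const_mul, integral_const_mul, ← hK]
            simp only [integral_const, probReal_univ, one_smul]
            have := hd v hv
            have h7 : a * c ≤ a * ∫ g, Real.log ‖ra v g‖ ∂(mun μ n) := by gcongr
            have h8 : a * (a * (K + 1)) ≤ a * (c / 2) := by gcongr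
            nlinarith [sq_nonneg a]
    intro v
    by_cases hv : v = 0
    · subst hv; simp [ra_zero, Na_zero ha0]
    have h0 : 0 < ‖v‖ := norm_pos_iff.2 hv
    have e1 : ∀ g, Na a (ra v g) = Na a v * Na a (ra (‖v‖⁻¹ • v) g) := by
      intro g
      rw [Na, Na, Na, ra_smul, norm_smul, norm_inv, norm_norm,
        ← ENNReal.ofReal_mul (Real.rpow_nonneg h0.le _), ← Real.mul_rpow h0.le (by positivity)]
      congr 2
      field_simp
    simp only [e1]
    have hms : Measurable fun g => Na a (ra (‖v‖⁻¹ • v) g) := (meas_Na a).comp (measurable_const.ra' measurable_id)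
    rw [lintegral_const_mul _ hms, mul_comm]
    gcongr
    apply unit
    rw [norm_smul, norm_inv, norm_norm, inv_mul_cancel₀ h0.ne']

lemma mun_add (μ : Measure SL2) [IsProbabilityMeasure μ] (k n : ℕ) :
    mun μ (k + n) = (mun μ k).mconv (mun μ n) := by
  induction n with
  | zero => simp [mun]
  | succ n ih => rw [← add_assoc, mun, ih, Measure.mconv_assoc, ← mun]

/-- The Green measure. -/
def GG (μ : Measure SL2) : Measure SL2 := Measure.sum (mun μ)

instance GG_sf (μ : Measure SL2) [IsProbabilityMeasure μ] : SFinite (GG μ) := by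
  unfold GG; infer_instance

lemma lint_GG (μ : Measure SL2) (f : SL2 → ℝ≥0∞) : ∫⁻ g, f g ∂(GG μ) = ∑' n, ∫⁻ g, f g ∂(mun μ n) := by
  rw [GG, lintegral_sum_measure]

lemma GG_rec (μ : Measure SL2) [IsProbabilityMeasure μ] {f : SL2 → ℝ≥0∞} (hf : Measurable f) :
    ∫⁻ g, f g ∂(GG μ) = f 1 + ∫⁻ h, ∫⁻ g, f (h * g) ∂(GG μ) ∂μ := by
  rw [lint_GG, tsum_eq_zero_add' ENNReal.summable, mun, lintegral_dirac' _ hf]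
  congr 1
  simp_rw [lint_GG]
  rw [lintegral_tsum]
  · congr 1; ext n; rw [lint_mun' _ _ hf]
  · intro n
    exact (Measurable.lintegral_prod_right' (f := fun p : SL2 × SL2 => f (p.1 * p.2))
      (hf.comp measurable_mul)).aemeasurable

lemma tsum_block {x : ℕ → ℝ≥0∞} {n : ℕ} {ρ : ℝ} (hρ0 : 0 < ρ) (hρ : ρ < 1) (hx : ∀ k, x k ≠ ⊤)
    (h : ∀ k, x (n + k) ≤ ENNReal.ofReal ρ * x k) :
    ∑' k, x k ≤ ENNReal.ofReal (1 - ρ)⁻¹ * ∑ k ∈ Finset.range n, x k := by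
  apply ENNReal.tsum_le_of_sum_range_le
  intro m
  lift x to ℕ → ℝ≥0 using hx
  have h' : ∀ k, (x (n + k) : ℝ) ≤ ρ * x k := by
    intro k
    have := ENNReal.toReal_mono (by finiteness) (h k)
    rwa [ENNReal.toReal_mul, ENNReal.toReal_ofReal hρ0.le] at this
  have key : (∑ k ∈ Finset.range m, (x k : ℝ)) ≤ (1 - ρ)⁻¹ * ∑ k ∈ Finset.range n, (x k : ℝ) := by
    have h1 : ∑ k ∈ Finset.range m, (x k : ℝ) ≤ ∑ k ∈ Finset.range (n + m), (x k : ℝ) :=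
      Finset.sum_le_sum_of_subset_of_nonneg (by
        intro k hk; simp at hk ⊢; omega) (fun _ _ _ => NNReal.coe_nonneg _)
    rw [Finset.sum_range_add] at h1
    have h2 : ∑ k ∈ Finset.range m, (x (n + k) : ℝ) ≤ ρ * ∑ k ∈ Finset.range m, (x k : ℝ) := by
      rw [Finset.mul_sum]; exact Finset.sum_le_sum fun k _ => h' k
    rw [le_inv_mul_iff₀ (by linarith)]
    linarith
  have h3 : (0:ℝ) ≤ (1 - ρ)⁻¹ := inv_nonneg.2 (by linarith)
  rw [← ENNReal.coe_finset_sum, ← ENNReal.coe_finset_sum, ENNReal.ofReal, ← ENNReal.coe_mul, ENNReal.coe_le_coe]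
  rw [← NNReal.coe_le_coe]
  push_cast
  rw [Real.coe_toNNReal _ h3]
  exact key

/-- Bundled potential-theoretic constants. -/
structure Pot (μ : Measure SL2) (a : ℝ) (C : ℝ≥0) : Prop where
  pos : 0 < a
  le : a ≤ 1
  mom : ∫⁻ g, ENNReal.ofReal (fr g ^ a) ∂μ ≤ C
  gr : ∀ v, ∫⁻ g, Na a (ra v g) ∂(GG μ) ≤ C * Na a v

theorem exists_Pot {μ N} (S : Stp μ N) : ∃ a C, Pot μ a C := by
  have := S.pmu
  obtain ⟨a, ha0, ha1, hm, n, hn, ρ, hρ0, hρ, hc⟩ := contr S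
  set D : ℝ≥0∞ := ENNReal.ofReal (1 - ρ)⁻¹ * ∑ k ∈ Finset.range n, ∫⁻ g, ENNReal.ofReal (fr g ^ a) ∂(mun μ k) with hD
  have hDt : D ≠ ⊤ := by
    refine ENNReal.mul_ne_top ENNReal.ofReal_ne_top ?_
    exact ENNReal.sum_ne_top.2 fun k _ => (mom_fin ha0.le hm k).ne
  have hb : ∀ k v, ∫⁻ g, Na a (ra v g) ∂(mun μ k) ≤ (∫⁻ g, ENNReal.ofReal (fr g ^ a) ∂(mun μ k)) * Na a v := by
    intro k v
    rw [← lintegral_mul_const _ (meas_frp a).ennreal_ofReal]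
    exact lintegral_mono fun g => Na_ra ha0 v g
  refine ⟨a, (D + ∫⁻ g, ENNReal.ofReal (fr g ^ a) ∂μ).toNNReal, ha0, ha1, ?_, ?_⟩
  · rw [ENNReal.coe_toNNReal (ENNReal.add_ne_top.2 ⟨hDt, hm.ne⟩)]
    exact le_add_self
  · intro v
    rw [ENNReal.coe_toNNReal (ENNReal.add_ne_top.2 ⟨hDt, hm.ne⟩), lint_GG]
    have := tsum_block (x := fun k => ∫⁻ g, Na a (ra v g) ∂(mun μ k)) (n := n) hρ0 hρ
      (fun k => ((hb k v).trans_lt (ENNReal.mul_lt_top (mom_fin ha0.le hm k) (Na_ne_top a v).lt_top)).ne) ?_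
    · refine this.trans ?_
      have h2 : ENNReal.ofReal (1 - ρ)⁻¹ * ∑ k ∈ Finset.range n, ∫⁻ g, Na a (ra v g) ∂(mun μ k) ≤ D * Na a v := by
        rw [hD, mul_assoc, Finset.sum_mul]
        gcongr with k
        exact hb k v
      refine h2.trans ?_
      gcongr
      exact le_self_add
    · intro k
      have hmeas : Measurable fun g => Na a (ra v g) := (meas_Na a).comp (measurable_const.ra' measurable_id)
      rw [add_comm, mun_add, Measure.lintegral_mconv hmeas, ← lintegral_const_mul _ hmeas]
      refine lintegral_mono fun g => ?_
      simp only [ra_mul]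
      exact hc (ra v g)

end

noncomputable section

open scoped ENNReal NNReal Topology

/-- partial Green sums -/
def Sn (μ : Measure SL2) (n : ℕ) (φ : SL2 → ℝ≥0∞) (g : SL2) : ℝ≥0∞ :=
  ∑ k ∈ Finset.range n, ∫⁻ h, φ (g * h) ∂(mun μ k)

lemma meas_pk (μ : Measure SL2) [IsProbabilityMeasure μ] (k : ℕ) {φ : SL2 → ℝ≥0∞} (hφ : Measurable φ) :
    Measurable fun g => ∫⁻ h, φ (g * h) ∂(mun μ k) :=
  Measurable.lintegral_prod_right' (f := fun p : SL2 × SL2 => φ (p.1 * p.2)) (hφ.comp measurable_mul)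

lemma meas_Sn (μ : Measure SL2) [IsProbabilityMeasure μ] (n : ℕ) {φ : SL2 → ℝ≥0∞} (hφ : Measurable φ) :
    Measurable (Sn μ n φ) := by
  unfold Sn
  exact Finset.measurable_fun_sum _ fun k _ => meas_pk μ k hφ

lemma pk_succ (μ : Measure SL2) [IsProbabilityMeasure μ] (k : ℕ) {φ : SL2 → ℝ≥0∞} (hφ : Measurable φ) (g : SL2) :
    ∫⁻ h, φ (g * h) ∂(mun μ (k+1)) = ∫⁻ h, ∫⁻ h', φ (g * h * h') ∂(mun μ k) ∂μ := by
  rw [lint_mun' μ k (f := fun h => φ (g * h)) (hφ.comp (measurable_const_mul g))]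
  simp only [mul_assoc]

lemma mcm {φ : SL2 → ℝ≥0∞} (hφ : Measurable φ) (g : SL2) : Measurable fun h => φ (g * h) :=
  hφ.comp (measurable_const_mul g)

lemma Sn_succ (μ : Measure SL2) [IsProbabilityMeasure μ] (n : ℕ) {φ : SL2 → ℝ≥0∞} (hφ : Measurable φ) (g : SL2) :
    Sn μ (n+1) φ g = φ g + ∫⁻ h, Sn μ n φ (g * h) ∂μ := by
  unfold Sn
  rw [Finset.sum_range_succ', add_comm]
  congr 1
  · rw [mun, lintegral_dirac' _ (mcm hφ g), mul_one]
  · rw [lintegral_finset_sum]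
    · simp only [pk_succ μ _ hφ]
    · intro k _
      exact (meas_pk μ k hφ).comp (measurable_const_mul g)

lemma Sn_le (μ : Measure SL2) (n : ℕ) (φ : SL2 → ℝ≥0∞) (g : SL2) :
    Sn μ n φ g ≤ ∫⁻ h, φ (g * h) ∂(GG μ) := by
  rw [lint_GG]; exact ENNReal.sum_le_tsum _

lemma GG_le_of_Sn (μ : Measure SL2) {φ : SL2 → ℝ≥0∞} {g : SL2} {c : ℝ≥0∞} (h : ∀ n, Sn μ n φ g ≤ c) :
    ∫⁻ h, φ (g * h) ∂(GG μ) ≤ c := by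
  rw [lint_GG]; exact ENNReal.tsum_le_of_sum_range_le h

/-- annulus -/
def An (s t : ℝ) : Set ℂ := {v | s ≤ ‖v‖ ∧ ‖v‖ ≤ t}

lemma meas_An (s t : ℝ) : MeasurableSet (An s t) :=
  (measurableSet_le measurable_const measurable_norm).inter (measurableSet_le measurable_norm measurable_const)

def iA (s t : ℝ) (v : ℂ) : ℝ≥0∞ := (An s t).indicator 1 v

lemma meas_iA (s t : ℝ) : Measurable (iA s t) := measurable_one.indicator (meas_An s t)

lemma iA_mem {s t : ℝ} {v : ℂ} (h : v ∈ An s t) : iA s t v = 1 := Set.indicator_of_mem h _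
lemma iA_not {s t : ℝ} {v : ℂ} (h : v ∉ An s t) : iA s t v = 0 := Set.indicator_of_notMem h _
lemma iA_le_one (s t : ℝ) (v : ℂ) : iA s t v ≤ 1 := by
  by_cases h : v ∈ An s t
  · rw [iA_mem h]
  · rw [iA_not h]; exact zero_le

lemma iA_le_Na {a s t : ℝ} (ha : 0 < a) (hs : 0 < s) (v : ℂ) : iA s t v ≤ ENNReal.ofReal (t ^ a) * Na a v := by
  by_cases h : v ∈ An s t
  · rw [iA_mem h]
    have h0 : 0 < ‖v‖ := hs.trans_le h.1
    rw [Na, ← ENNReal.ofReal_mul (Real.rpow_nonneg (h0.le.trans h.2) _), ← ENNReal.ofReal_one]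
    apply ENNReal.ofReal_le_ofReal
    rw [Real.rpow_neg h0.le, ← div_eq_mul_inv, one_le_div₀ (by positivity)]
    exact Real.rpow_le_rpow h0.le h.2 ha.le
  · rw [iA_not h]; exact zero_le

lemma Na_le {a s : ℝ} (ha : 0 < a) (hs : 0 < s) {v : ℂ} (h : s ≤ ‖v‖) : Na a v ≤ ENNReal.ofReal (s ^ (-a)) := by
  rw [Na]
  apply ENNReal.ofReal_le_ofReal
  exact Real.rpow_le_rpow_of_nonpos hs h (by linarith)

lemma U_iA_le {μ a C} (P : Pot μ a C) {s t : ℝ} (hs : 0 < s) (v : ℂ) :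
    ∫⁻ g, iA s t (ra v g) ∂(GG μ) ≤ ENNReal.ofReal (t ^ a) * (C * Na a v) := by
  have hm : Measurable fun g => Na a (ra v g) := (meas_Na a).comp (measurable_const.ra' measurable_id)
  calc ∫⁻ g, iA s t (ra v g) ∂(GG μ) ≤ ∫⁻ g, ENNReal.ofReal (t ^ a) * Na a (ra v g) ∂(GG μ) :=
        lintegral_mono fun g => iA_le_Na P.pos hs _
    _ = ENNReal.ofReal (t ^ a) * ∫⁻ g, Na a (ra v g) ∂(GG μ) := lintegral_const_mul _ hm
    _ ≤ _ := by gcongr; exact P.gr v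

/-- P2 -/
lemma U_An1 {μ a C} [IsProbabilityMeasure μ] (P : Pot μ a C) {s : ℝ} (hs : 0 < s) (v : ℂ) :
    ∫⁻ g, iA s (s * Real.exp 1) (ra v g) ∂(GG μ) ≤ 3 * C := by
  have hφ : Measurable fun g => iA s (s * Real.exp 1) (ra v g) :=
    (meas_iA _ _).comp (measurable_const.ra' measurable_id)
  have inW : ∀ w, w ∈ An s (s * Real.exp 1) → ∫⁻ g, iA s (s * Real.exp 1) (ra w g) ∂(GG μ) ≤ 3 * C := by
    intro w hw
    refine (U_iA_le P hs w).trans ?_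
    calc ENNReal.ofReal ((s * Real.exp 1) ^ a) * (C * Na a w)
        ≤ ENNReal.ofReal ((s * Real.exp 1) ^ a) * (C * ENNReal.ofReal (s ^ (-a))) := by
          gcongr; exact Na_le P.pos hs hw.1
      _ = ENNReal.ofReal ((s * Real.exp 1) ^ a * s ^ (-a)) * C := by
          rw [ENNReal.ofReal_mul (by positivity)]; ring
      _ ≤ 3 * C := by
          gcongr
          rw [Real.mul_rpow hs.le (Real.exp_pos 1).le, mul_right_comm, ← Real.rpow_add hs]
          simp only [add_neg_cancel, Real.rpow_zero, one_mul]
          have : Real.exp 1 ^ a ≤ 3 := by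
            calc Real.exp 1 ^ a ≤ Real.exp 1 ^ (1:ℝ) :=
                  Real.rpow_le_rpow_of_exponent_le (Real.one_le_exp zero_le_one) P.le
              _ ≤ 3 := by rw [Real.rpow_one]; exact Real.exp_one_lt_three.le
          calc ENNReal.ofReal (Real.exp 1 ^ a) ≤ ENNReal.ofReal 3 := ENNReal.ofReal_le_ofReal this
            _ = 3 := by simp
  have key : ∀ n g, Sn μ n (fun g => iA s (s * Real.exp 1) (ra v g)) g ≤ 3 * C := by
    intro n
    induction n with
    | zero => intro g; simp [Sn]
    | succ n ih =>
      intro g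
      by_cases hg : ra v g ∈ An s (s * Real.exp 1)
      · refine (Sn_le _ _ _ _).trans ?_
        simp only [ra_mul]
        exact inW _ hg
      · rw [Sn_succ μ n hφ, iA_not hg, zero_add]
        calc ∫⁻ h, Sn μ n (fun g => iA s (s * Real.exp 1) (ra v g)) (g * h) ∂μ ≤ ∫⁻ h, 3 * C ∂μ :=
              lintegral_mono fun h => ih _
          _ = 3 * C := by simp
  have := GG_le_of_Sn μ (g := 1) fun n => key n 1
  simpa only [one_mul] using this

lemma U_An {μ a C} [IsProbabilityMeasure μ] (P : Pot μ a C) {s : ℝ} (hs : 0 < s) (m : ℕ) (v : ℂ) :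
    ∫⁻ g, iA s (s * Real.exp m) (ra v g) ∂(GG μ) ≤ (m + 1) * (3 * C) := by
  induction m with
  | zero =>
    refine le_trans (lintegral_mono fun g => ?_) ((U_An1 P hs v).trans (by simp))
    unfold iA
    refine Set.indicator_le_indicator_of_subset ?_ (fun _ => zero_le) _
    intro w hw
    exact ⟨hw.1, hw.2.trans (by
      have : Real.exp (0:ℕ) ≤ Real.exp 1 := Real.exp_le_exp.2 (by simp)
      gcongr)⟩
  | succ m ih =>
    have hs' : 0 < s * Real.exp m := by positivity
    have hm1 : Measurable fun g => iA s (s * Real.exp m) (ra v g) :=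
      (meas_iA _ _).comp (measurable_const.ra' measurable_id)
    calc ∫⁻ g, iA s (s * Real.exp ((m+1 : ℕ))) (ra v g) ∂(GG μ)
        ≤ ∫⁻ g, (iA s (s * Real.exp m) (ra v g) + iA (s * Real.exp m) (s * Real.exp m * Real.exp 1) (ra v g)) ∂(GG μ) := by
          refine lintegral_mono fun g => ?_
          by_cases h1 : ra v g ∈ An s (s * Real.exp ((m+1 : ℕ)))
          · rw [iA_mem h1]
            rcases le_total ‖ra v g‖ (s * Real.exp m) with h | h
            · rw [iA_mem (s := s) (t := s * Real.exp m) ⟨h1.1, h⟩]; exact le_self_add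
            · rw [iA_mem (s := s * Real.exp m) (t := s * Real.exp m * Real.exp 1) ⟨h, by
                have := h1.2
                push_cast at this
                rw [Real.exp_add] at this
                linarith⟩]; exact le_add_self
          · rw [iA_not h1]; exact zero_le
      _ ≤ (m + 1) * (3 * C) + 3 * C := by
          rw [lintegral_add_left hm1]
          exact add_le_add ih (U_An1 P hs' v)
      _ = _ := by push_cast; ring

/-- P3 -/
lemma sub_rep {μ a C} [IsProbabilityMeasure μ] (P : Pot μ a C) {v : ℂ} {R0 R1 : ℝ}
    (hR : R0 ≤ R1) (hv : v ≠ 0) (hv1 : ‖v‖ < R0)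
    {f : SL2 → ℝ≥0∞} (hf : Measurable f) (hf1 : ∀ g, f g ≤ 1) (hsub : ∀ g, f g ≤ ∫⁻ h, f (g * h) ∂μ) :
    f 1 ≤ ∫⁻ g, (iA R0 R1 (ra v g) * f g +
      (if ‖ra v g‖ < R0 then μ {h | R1 < ‖ra (ra v g) h‖} else 0)) ∂(GG μ) := by
  set ψ : SL2 → ℝ≥0∞ := fun g => iA R0 R1 (ra v g) * f g +
      (if ‖ra v g‖ < R0 then μ {h | R1 < ‖ra (ra v g) h‖} else 0) with hψ
  have hrm : Measurable fun g => ra v g := measurable_const.ra' measurable_id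
  have hbm : Measurable fun g => μ {h | R1 < ‖ra (ra v g) h‖} := by
    have : MeasurableSet {p : SL2 × SL2 | R1 < ‖ra (ra v p.1) p.2‖} :=
      measurableSet_lt measurable_const ((hrm.comp measurable_fst).ra' measurable_snd).norm
    exact measurable_measure_prodMk_left this
  have hψm : Measurable ψ := by
    refine (((meas_iA _ _).comp hrm).mul hf).add (Measurable.ite ?_ hbm measurable_const)
    exact measurableSet_lt hrm.norm measurable_const
  set χ : SL2 → ℝ≥0∞ := fun g => {w : ℂ | ‖w‖ ≤ R1}.indicator 1 (ra v g) with hχ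
  have hχm : Measurable χ := (measurable_one.indicator (measurableSet_le measurable_norm measurable_const)).comp hrm
  have key : ∀ n g, f g * χ g ≤ Sn μ n ψ g + ∫⁻ h, χ (g * h) ∂(mun μ n) := by
    intro n
    induction n with
    | zero =>
      intro g
      rw [mun, lintegral_dirac' _ (mcm hχm g), mul_one]
      calc f g * χ g ≤ 1 * χ g := by gcongr; exact hf1 g
        _ ≤ _ := by simp
    | succ n ih =>
      intro g
      by_cases h1 : ‖ra v g‖ ≤ R1
      · have e1 : χ g = 1 := Set.indicator_of_mem (s := {w : ℂ | ‖w‖ ≤ R1}) h1 _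
        rw [e1, mul_one, Sn_succ μ n hψm, pk_succ μ n hχm]
        by_cases h2 : ‖ra v g‖ < R0
        · have e2 : μ {h | R1 < ‖ra (ra v g) h‖} ≤ ψ g := by
            simp only [hψ, if_pos h2]; exact le_add_self
          have hset : MeasurableSet {h | R1 < ‖ra (ra v g) h‖} :=
            measurableSet_lt measurable_const (measurable_const.ra' measurable_id).norm
          have hfm : Measurable fun h => f (g * h) * χ (g * h) :=
            (hf.comp (measurable_const_mul g)).mul (hχm.comp (measurable_const_mul g))
          calc f g ≤ ∫⁻ h, f (g * h) ∂μ := hsub g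
            _ ≤ ∫⁻ h, (f (g * h) * χ (g * h) + {h | R1 < ‖ra (ra v g) h‖}.indicator 1 h) ∂μ := by
                refine lintegral_mono fun h => ?_
                by_cases h3 : ‖ra v (g * h)‖ ≤ R1
                · have e3 : χ (g * h) = 1 := Set.indicator_of_mem (s := {w : ℂ | ‖w‖ ≤ R1}) h3 _
                  rw [e3, mul_one]; exact le_self_add
                · have h4 : h ∈ {h | R1 < ‖ra (ra v g) h‖} := by
                    rw [ra_mul] at h3; exact not_le.1 h3
                  rw [Set.indicator_of_mem h4]
                  exact (hf1 _).trans le_add_self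
            _ = ∫⁻ h, f (g * h) * χ (g * h) ∂μ + μ {h | R1 < ‖ra (ra v g) h‖} := by
                rw [lintegral_add_left hfm, lintegral_indicator_one hset]
            _ ≤ ∫⁻ h, (Sn μ n ψ (g * h) + ∫⁻ h', χ (g * h * h') ∂(mun μ n)) ∂μ + ψ g := by
                gcongr with h
                exact ih _
            _ = ∫⁻ h, Sn μ n ψ (g * h) ∂μ + ∫⁻ h, ∫⁻ h', χ (g * h * h') ∂(mun μ n) ∂μ + ψ g := by
                rw [lintegral_add_left (mcm (meas_Sn μ n hψm) g)]
            _ = _ := by ring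
        · have e4 : f g ≤ ψ g := by
            simp only [hψ]
            rw [iA_mem ⟨not_lt.1 h2, h1⟩, one_mul]; exact le_self_add
          rw [add_assoc]
          exact e4.trans le_self_add
      · have e1 : χ g = 0 := Set.indicator_of_notMem (s := {w : ℂ | ‖w‖ ≤ R1}) h1 _
        rw [e1, mul_zero]; exact zero_le
  have hχ1 : χ 1 = 1 := Set.indicator_of_mem (s := {w : ℂ | ‖w‖ ≤ R1}) (by
    show ‖ra v 1‖ ≤ R1
    rw [ra_one]; exact hv1.le.trans hR) _
  have hlim : Tendsto (fun n => ∫⁻ h, χ h ∂(mun μ n)) atTop (𝓝 0) := by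
    have hsum : ∑' n, ∫⁻ g, Na a (ra v g) ∂(mun μ n) ≠ ⊤ := by
      rw [← lint_GG]
      exact ((P.gr v).trans_lt (ENNReal.mul_lt_top ENNReal.coe_lt_top (Na_ne_top a v).lt_top)).ne
    have h1 := ENNReal.tendsto_atTop_zero_of_tsum_ne_top hsum
    have h2 := ENNReal.Tendsto.const_mul h1 (Or.inr (ENNReal.ofReal_ne_top (r := R1 ^ a)))
    rw [mul_zero] at h2
    refine tendsto_of_tendsto_of_tendsto_of_le_of_le tendsto_const_nhds h2 (fun _ => zero_le) ?_
    intro n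
    have hm : Measurable fun g => Na a (ra v g) := (meas_Na a).comp hrm
    simp only
    rw [← lintegral_const_mul _ hm]
    refine lintegral_mono fun g => ?_
    by_cases h1 : ‖ra v g‖ ≤ R1
    · have e1 : χ g = 1 := Set.indicator_of_mem (s := {w : ℂ | ‖w‖ ≤ R1}) h1 _
      have h0 : 0 < ‖ra v g‖ := norm_pos_iff.2 (ra_ne_zero hv g)
      rw [e1, ← iA_mem (s := ‖ra v g‖) (t := R1) ⟨le_rfl, h1⟩]
      exact iA_le_Na P.pos h0 _
    · have e1 : χ g = 0 := Set.indicator_of_notMem (s := {w : ℂ | ‖w‖ ≤ R1}) h1 _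
      rw [e1]; exact zero_le
  have hlim2 := hlim.const_add (∫⁻ g, ψ g ∂(GG μ))
  rw [add_zero] at hlim2
  refine ge_of_tendsto' hlim2 fun n => ?_
  have := key n 1
  rw [hχ1, mul_one] at this
  simp only [one_mul] at this
  refine this.trans ?_
  gcongr
  have := Sn_le μ n ψ 1
  simpa only [one_mul] using this

lemma mra (v : ℂ) : Measurable fun g => ra v g := measurable_const.ra' measurable_id

/-- P4 -/
lemma U_tail {μ a C} [IsProbabilityMeasure μ] (P : Pot μ a C) : ∃ D : ℝ≥0, ∀ (R0 K : ℝ) (v : ℂ), 0 < R0 →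
    ∫⁻ g, (if ‖ra v g‖ < R0 then μ {h | R0 * Real.exp K < ‖ra (ra v g) h‖} else 0) ∂(GG μ) ≤
      D * ENNReal.ofReal (Real.exp (-(a * K))) := by
  have ha := P.pos
  set q : ℝ≥0∞ := ∑' j : ℕ, ENNReal.ofReal (Real.exp (-a)) ^ j with hq
  have hq1 : q ≠ ⊤ := by
    rw [hq, ENNReal.tsum_geometric]
    refine ENNReal.inv_ne_top.2 (tsub_pos_of_lt ?_).ne'
    rw [← ENNReal.ofReal_one]
    exact (ENNReal.ofReal_lt_ofReal_iff one_pos).2 (by rw [← Real.exp_zero]; exact Real.exp_lt_exp.2 (by linarith))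
  refine ⟨(C * (q * (3 * C))).toNNReal, ?_⟩
  intro R0 K v hR0
  rw [ENNReal.coe_toNNReal (by finiteness)]
  set E : ℝ≥0∞ := ENNReal.ofReal (Real.exp (-(a * K))) with hE
  have pt : ∀ w : ℂ, (if ‖w‖ < R0 then μ {h | R0 * Real.exp K < ‖ra w h‖} else 0) ≤
      ∑' j : ℕ, C * E * ENNReal.ofReal (Real.exp (-a)) ^ j *
        iA (R0 * Real.exp (-(j+1:ℝ))) (R0 * Real.exp (-(j+1:ℝ)) * Real.exp 1) w := by
    intro w
    split_ifs with hw
    swap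
    · exact zero_le
    by_cases hw0 : w = 0
    · subst hw0
      have : {h | R0 * Real.exp K < ‖ra 0 h‖} = ∅ := by
        ext h; simp [ra_zero]; positivity
      rw [this]; simp
    have hwp : 0 < ‖w‖ := norm_pos_iff.2 hw0
    set L := Real.log (R0 / ‖w‖) with hL
    have hLp : 0 ≤ L := Real.log_nonneg ((one_le_div₀ hwp).2 hw.le)
    have heL : Real.exp (-L) = ‖w‖ / R0 := by
      rw [Real.exp_neg, hL, Real.exp_log (by positivity), inv_div]
    set j := ⌊L⌋₊ with hj
    have hj1 : (j:ℝ) ≤ L := Nat.floor_le hLp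
    have hj2 : L < j + 1 := Nat.lt_floor_add_one L
    have hmem : w ∈ An (R0 * Real.exp (-(j+1:ℝ))) (R0 * Real.exp (-(j+1:ℝ)) * Real.exp 1) := by
      have hwe : ‖w‖ = R0 * Real.exp (-L) := by rw [heL]; field_simp
      constructor
      · rw [hwe]; gcongr
      · rw [hwe, mul_assoc, ← Real.exp_add]
        gcongr
        linarith
    refine le_trans ?_ (ENNReal.le_tsum j)
    rw [iA_mem hmem, mul_one]
    have hsub : μ {h | R0 * Real.exp K < ‖ra w h‖} ≤
        ∫⁻ h, ENNReal.ofReal (Real.exp (-(a * K)) * Real.exp (-a) ^ j) * ENNReal.ofReal (fr h ^ a) ∂μ := by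
      have hset : MeasurableSet {h | R0 * Real.exp K < ‖ra w h‖} :=
        measurableSet_lt measurable_const (mra w).norm
      rw [← lintegral_indicator_one hset]
      refine lintegral_mono fun h => ?_
      by_cases hh : h ∈ {h | R0 * Real.exp K < ‖ra w h‖}
      swap
      · rw [Set.indicator_of_notMem hh]; exact zero_le
      rw [Set.indicator_of_mem hh, ← ENNReal.ofReal_mul (by positivity), Pi.one_apply, ← ENNReal.ofReal_one]
      apply ENNReal.ofReal_le_ofReal
      have h1 : R0 * Real.exp K < ‖ra w h‖ := hh
      have h2 := norm_ra_le w h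
      have h3 : 1 ≤ (Real.exp (-K) * Real.exp (-L)) * fr h := by
        rw [heL, Real.exp_neg]
        have : R0 * Real.exp K < ‖w‖ * fr h := h1.trans_le h2
        have he := Real.exp_pos K
        rw [show (Real.exp K)⁻¹ * (‖w‖ / R0) * fr h = (‖w‖ * fr h) / (R0 * Real.exp K) by field_simp]
        rw [one_le_div₀ (by positivity)]; exact this.le
      have h4 : 1 ≤ ((Real.exp (-K) * Real.exp (-L)) * fr h) ^ a := Real.one_le_rpow h3 ha.le
      rw [Real.mul_rpow (by positivity) (fr_nonneg h), ← Real.exp_add, ← Real.exp_mul] at h4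
      refine h4.trans ?_
      have hfa := Real.rpow_nonneg (fr_nonneg h) a
      refine mul_le_mul_of_nonneg_right ?_ hfa
      rw [← Real.exp_nat_mul, ← Real.exp_add]
      apply Real.exp_le_exp.2
      nlinarith
    refine hsub.trans ?_
    rw [lintegral_const_mul _ (meas_frp a).ennreal_ofReal, ENNReal.ofReal_mul (by positivity),
      ENNReal.ofReal_pow (by positivity)]
    calc _ ≤ E * ENNReal.ofReal (Real.exp (-a)) ^ j * C := by gcongr; exact P.mom
      _ = _ := by ring
  calc _ ≤ ∫⁻ g, ∑' j : ℕ, C * E * ENNReal.ofReal (Real.exp (-a)) ^ j *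
        iA (R0 * Real.exp (-(j+1:ℝ))) (R0 * Real.exp (-(j+1:ℝ)) * Real.exp 1) (ra v g) ∂(GG μ) :=
        lintegral_mono fun g => pt (ra v g)
    _ = ∑' j : ℕ, C * E * ENNReal.ofReal (Real.exp (-a)) ^ j *
        ∫⁻ g, iA (R0 * Real.exp (-(j+1:ℝ))) (R0 * Real.exp (-(j+1:ℝ)) * Real.exp 1) (ra v g) ∂(GG μ) := by
        rw [lintegral_tsum]
        · congr 1; ext j
          rw [lintegral_const_mul]
          exact (meas_iA _ _).comp (mra v)
        · intro j
          exact (((meas_iA _ _).comp (mra v)).const_mul _).aemeasurable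
    _ ≤ ∑' j : ℕ, C * E * ENNReal.ofReal (Real.exp (-a)) ^ j * (3 * C) := by
        gcongr with j
        exact U_An1 P (by positivity) v
    _ = C * (q * (3 * C)) * E := by
        rw [ENNReal.tsum_mul_right, ENNReal.tsum_mul_left, ← hq]; ring

/-- the coefficient of z along v -/
def bet (v z : ℂ) : ℝ := dt z v / ‖v‖ ^ 2

lemma meas_bet (v z : ℂ) : Measurable fun g => bet (ra v g) (ra z g) :=
  ((mra z).dt' (mra v)).div ((mra v).norm.pow_const 2)

lemma decomp {v : ℂ} (hv : v ≠ 0) (z : ℂ) :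
    z = bet v z • v + (cr v z / ‖v‖ ^ 2) • (Complex.I * v) := by
  have h0 : ‖v‖ ^ 2 ≠ 0 := by positivity
  unfold bet cr dt
  apply Complex.ext
  · simp only [Complex.add_re, Complex.smul_re, Complex.mul_re, Complex.I_re, Complex.I_im, smul_eq_mul]
    field_simp
    rw [nsq]; ring
  · simp only [Complex.add_im, Complex.smul_im, Complex.mul_im, Complex.I_re, Complex.I_im, smul_eq_mul]
    field_simp
    rw [nsq]; ring

lemma bet_diff {v : ℂ} (hv : v ≠ 0) (z : ℂ) (h : SL2) :
    |bet (ra v h) (ra z h) - bet v z| ≤ |cr v z| * fr h ^ 2 / ‖v‖ ^ 2 := by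
  have h0 : 0 < ‖v‖ := norm_pos_iff.2 hv
  have h1 : 0 < ‖ra v h‖ := norm_pos_iff.2 (ra_ne_zero hv h)
  have e : bet (ra v h) (ra z h) - bet v z =
      (cr v z / ‖v‖ ^ 2) * (dt (ra (Complex.I * v) h) (ra v h) / ‖ra v h‖ ^ 2) := by
    have hd := decomp hv z
    have : bet (ra v h) (ra z h) = bet v z +
      (cr v z / ‖v‖ ^ 2) * (dt (ra (Complex.I * v) h) (ra v h) / ‖ra v h‖ ^ 2) := by
      have hz : ra z h = bet v z • ra v h + (cr v z / ‖v‖ ^ 2) • ra (Complex.I * v) h := by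
        rw [← ra_smul, ← ra_smul, ← ra_add, ← hd]
      rw [show bet (ra v h) (ra z h) = dt (ra z h) (ra v h) / ‖ra v h‖ ^ 2 from rfl, hz]
      have h3 : ∀ (p q : ℝ) (x y w : ℂ), dt (p • x + q • y) w = p * dt x w + q * dt y w := by
        intro p q x y w; simp [dt]; ring
      rw [h3]
      have h4 : dt (ra v h) (ra v h) = ‖ra v h‖ ^ 2 := by rw [nsq, dt]; ring
      rw [h4]
      field_simp
    rw [this]; ring
  rw [e, abs_mul, abs_div, abs_div, abs_of_pos (by positivity : 0 < ‖v‖ ^ 2),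
    abs_of_pos (by positivity : 0 < ‖ra v h‖ ^ 2)]
  have h2 : |dt (ra (Complex.I * v) h) (ra v h)| ≤ fr h ^ 2 * ‖ra v h‖ ^ 2 := by
    refine (abs_dt_le _ _).trans ?_
    have h5 : ‖ra (Complex.I * v) h‖ ≤ ‖v‖ * fr h := by
      have := norm_ra_le (Complex.I * v) h
      simpa using this
    have h6 := norm_le_ra v h
    have hf := fr_pos h
    calc ‖ra (Complex.I * v) h‖ * ‖ra v h‖ ≤ (‖v‖ * fr h) * ‖ra v h‖ := by gcongr
      _ ≤ ((‖ra v h‖ * fr h) * fr h) * ‖ra v h‖ := by gcongr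
      _ = _ := by ring
  calc |cr v z| / ‖v‖ ^ 2 * (|dt (ra (Complex.I * v) h) (ra v h)| / ‖ra v h‖ ^ 2)
      ≤ |cr v z| / ‖v‖ ^ 2 * (fr h ^ 2) := by
        gcongr
        rw [div_le_iff₀ (by positivity)]; exact h2
    _ = _ := by ring

/-- P7 -/
lemma U_bet {μ a C} [IsProbabilityMeasure μ] (P : Pot μ a C) {s t : ℝ} {D : ℝ≥0}
    (hD : ∀ v, ∫⁻ g, iA s t (ra v g) ∂(GG μ) ≤ D) {v : ℂ} (hv : v ≠ 0) (z : ℂ) (b0 : ℝ) :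
    ∫⁻ g, iA s t (ra v g) * ENNReal.ofReal (|bet (ra v g) (ra z g) - b0| ^ (a/2)) ∂(GG μ) ≤
      ENNReal.ofReal (|bet v z - b0| ^ (a/2)) * D +
        ENNReal.ofReal (|cr v z| ^ (a/2)) * (D * C * (C * Na a v)) := by
  have ha := P.pos
  have ha2 : 0 ≤ a / 2 := by positivity
  set φ : SL2 → ℝ≥0∞ := fun g => iA s t (ra v g) * ENNReal.ofReal (|bet (ra v g) (ra z g) - b0| ^ (a/2)) with hφ
  set X : SL2 → ℝ≥0∞ := fun g => ENNReal.ofReal (|bet (ra v g) (ra z g) - b0| ^ (a/2)) with hX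
  set u1 : SL2 → ℝ≥0∞ := fun g => ∫⁻ h, iA s t (ra v (g * h)) ∂(GG μ) with hu1
  set u2 : SL2 → ℝ≥0∞ := fun g => ∫⁻ h, Na a (ra v (g * h)) ∂(GG μ) with hu2
  set κ : ℝ≥0∞ := ENNReal.ofReal (|cr v z| ^ (a/2)) with hκ
  have mX : Measurable X := by
    have := meas_bet v z
    fun_prop
  have mi : Measurable fun g => iA s t (ra v g) := (meas_iA _ _).comp (mra v)
  have mN : Measurable fun g => Na a (ra v g) := (meas_Na _).comp (mra v)
  have mφ : Measurable φ := mi.mul mX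
  have mu1 : Measurable u1 := Measurable.lintegral_prod_right'
    (f := fun p : SL2 × SL2 => iA s t (ra v (p.1 * p.2))) (mi.comp measurable_mul)
  have mu2 : Measurable u2 := Measurable.lintegral_prod_right'
    (f := fun p : SL2 × SL2 => Na a (ra v (p.1 * p.2))) (mN.comp measurable_mul)
  have r1 : ∀ g, u1 g = iA s t (ra v g) + ∫⁻ h, u1 (g * h) ∂μ := by
    intro g
    simp only [hu1]
    rw [GG_rec μ (mcm mi g)]
    simp only [mul_one, mul_assoc]
  have r2 : ∀ g, u2 g = Na a (ra v g) + ∫⁻ h, u2 (g * h) ∂μ := by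
    intro g
    simp only [hu2]
    rw [GG_rec μ (mcm mN g)]
    simp only [mul_one, mul_assoc]
  have b1 : ∀ g, u1 g ≤ D := by
    intro g; simp only [hu1, ra_mul]; exact hD _
  have step : ∀ g h, X (g * h) ≤ X g + κ * Na a (ra v g) * ENNReal.ofReal (fr h ^ a) := by
    intro g h
    have hvg := ra_ne_zero hv g
    have h0 : 0 < ‖ra v g‖ := norm_pos_iff.2 hvg
    have h1 := bet_diff hvg (ra z g) h
    rw [cr_ra, ← ra_mul, ← ra_mul] at h1
    simp only [hX, hκ, Na]
    rw [← ENNReal.ofReal_mul (by positivity), ← ENNReal.ofReal_mul (by positivity),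
      ← ENNReal.ofReal_add (by positivity) (mul_nonneg (by positivity) (Real.rpow_nonneg (fr_nonneg h) _))]
    apply ENNReal.ofReal_le_ofReal
    have h2 : |bet (ra v (g * h)) (ra z (g * h)) - b0| ≤ |bet (ra v g) (ra z g) - b0| +
        |cr v z| * fr h ^ 2 / ‖ra v g‖ ^ 2 := by
      have := abs_add_le (bet (ra v g) (ra z g) - b0) (bet (ra v (g * h)) (ra z (g * h)) - bet (ra v g) (ra z g))
      rw [show (bet (ra v g) (ra z g) - b0) + (bet (ra v (g * h)) (ra z (g * h)) - bet (ra v g) (ra z g)) =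
        bet (ra v (g * h)) (ra z (g * h)) - b0 by ring] at this
      linarith
    have hfr := fr_pos h
    refine (Real.rpow_le_rpow (abs_nonneg _) h2 ha2).trans ?_
    refine (Real.rpow_add_le_add_rpow (abs_nonneg _) (by positivity) ha2 (by linarith [P.le])).trans ?_
    gcongr
    rw [Real.div_rpow (by positivity) (by positivity), Real.mul_rpow (by positivity) (by positivity),
      ← Real.rpow_natCast, ← Real.rpow_natCast, ← Real.rpow_mul hfr.le, ← Real.rpow_mul h0.le,
      Real.rpow_neg h0.le, div_eq_mul_inv]
    have : ((2:ℕ):ℝ) * (a / 2) = a := by push_cast; ring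
    rw [this]
    apply le_of_eq; ring
  have key : ∀ n g, Sn μ n φ g ≤ X g * u1 g + κ * (D * C * u2 g) := by
    intro n
    induction n with
    | zero => intro g; simp [Sn]
    | succ n ih =>
      intro g
      rw [Sn_succ μ n mφ]
      have m1 : Measurable fun h => X g * u1 (g * h) := (mcm mu1 g).const_mul _
      have m2 : Measurable fun h => κ * (D * C * u2 (g * h)) := ((mcm mu2 g).const_mul _).const_mul _
      calc φ g + ∫⁻ h, Sn μ n φ (g * h) ∂μ
          ≤ φ g + ∫⁻ h, (X g * u1 (g * h) + (κ * (D * C * u2 (g * h)) +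
              κ * Na a (ra v g) * D * ENNReal.ofReal (fr h ^ a))) ∂μ := by
            gcongr with h
            calc Sn μ n φ (g * h) ≤ X (g * h) * u1 (g * h) + κ * (D * C * u2 (g * h)) := ih _
              _ ≤ (X g + κ * Na a (ra v g) * ENNReal.ofReal (fr h ^ a)) * u1 (g * h) + κ * (D * C * u2 (g * h)) := by
                  gcongr; exact step g h
              _ = X g * u1 (g * h) + (κ * (D * C * u2 (g * h)) +
                    κ * Na a (ra v g) * u1 (g * h) * ENNReal.ofReal (fr h ^ a)) := by ring
              _ ≤ _ := by gcongr; exact b1 _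
        _ = φ g + (X g * ∫⁻ h, u1 (g * h) ∂μ + (κ * (D * C * ∫⁻ h, u2 (g * h) ∂μ) +
              κ * Na a (ra v g) * D * ∫⁻ h, ENNReal.ofReal (fr h ^ a) ∂μ)) := by
            rw [lintegral_add_left m1, lintegral_add_left m2, lintegral_const_mul _ (mcm mu1 g),
              lintegral_const_mul _ ((mcm mu2 g).const_mul _), lintegral_const_mul _ (mcm mu2 g),
              lintegral_const_mul _ (meas_frp a).ennreal_ofReal]
        _ ≤ φ g + (X g * ∫⁻ h, u1 (g * h) ∂μ + (κ * (D * C * ∫⁻ h, u2 (g * h) ∂μ) +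
              κ * Na a (ra v g) * D * C)) := by
            gcongr; exact P.mom
        _ = X g * u1 g + κ * (D * C * u2 g) := by
            rw [r1 g, r2 g]
            simp only [hφ, hX]
            ring
  have h1 := GG_le_of_Sn μ (g := 1) fun n => key n 1
  simp only [one_mul] at h1
  refine h1.trans ?_
  have h2 : X 1 = ENNReal.ofReal (|bet v z - b0| ^ (a/2)) := by simp only [hX, ra_one]
  rw [h2]
  gcongr
  · exact b1 1
  · have := P.gr v
    simpa only [hu2, one_mul] using this

end

noncomputable section
open scoped ENNReal NNReal Topology

/-- potential of a nonnegative function -/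
def UL (μ : Measure SL2) (w : ℂ → ℝ) (v : ℂ) : ℝ≥0∞ := ∫⁻ g, ENNReal.ofReal (w (ra v g)) ∂(GG μ)

def UU (μ : Measure SL2) (w : ℂ → ℝ) (v : ℂ) : ℝ := (UL μ w v).toReal

lemma meas_wra {w : ℂ → ℝ} (hw : Measurable w) (v : ℂ) : Measurable fun g => ENNReal.ofReal (w (ra v g)) :=
  (hw.comp (mra v)).ennreal_ofReal

lemma meas_UL (μ : Measure SL2) [IsProbabilityMeasure μ] {w : ℂ → ℝ} (hw : Measurable w) :
    Measurable (UL μ w) :=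
  Measurable.lintegral_prod_right' (f := fun p : ℂ × SL2 => ENNReal.ofReal (w (ra p.1 p.2)))
    ((hw.comp (measurable_fst.ra' measurable_snd)).ennreal_ofReal)

lemma UL_rec (μ : Measure SL2) [IsProbabilityMeasure μ] {w : ℂ → ℝ} (hw : Measurable w) (v : ℂ) :
    UL μ w v = ENNReal.ofReal (w v) + ∫⁻ h, UL μ w (ra v h) ∂μ := by
  rw [UL, GG_rec μ (meas_wra hw v), ra_one]
  simp only [UL, ra_mul]

lemma UU_rec (μ : Measure SL2) [IsProbabilityMeasure μ] {w : ℂ → ℝ} (hw : Measurable w) {D : ℝ≥0}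
    (hD : ∀ v, UL μ w v ≤ D) {v : ℂ} (hv : w v = 0) :
    UU μ w v = ∫ h, UU μ w (ra v h) ∂μ := by
  unfold UU
  rw [integral_toReal]
  · rw [UL_rec μ hw v, hv, ENNReal.ofReal_zero, zero_add]
  · exact ((meas_UL μ hw).comp (mra v)).aemeasurable
  · exact ae_of_all _ fun h => (hD _).trans_lt ENNReal.coe_lt_top

lemma rpow_sub_add {x y p : ℝ} (hx : 0 ≤ x) (hy : 0 ≤ y) (hp : 0 ≤ p) (hp1 : p ≤ 1) :
    (x + y) ^ p ≤ x ^ p + y ^ p := by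
  lift x to ℝ≥0 using hx
  lift y to ℝ≥0 using hy
  exact_mod_cast NNReal.rpow_add_le_add_rpow x y hp hp1

lemma norm_le_bet {v : ℂ} (hv : v ≠ 0) (z : ℂ) : ‖z‖ ≤ |bet v z| * ‖v‖ + |cr v z| / ‖v‖ := by
  have h0 : 0 < ‖v‖ := norm_pos_iff.2 hv
  calc ‖z‖ = ‖bet v z • v + (cr v z / ‖v‖ ^ 2) • (Complex.I * v)‖ := by rw [← decomp hv z]
    _ ≤ ‖bet v z • v‖ + ‖(cr v z / ‖v‖ ^ 2) • (Complex.I * v)‖ := norm_add_le _ _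
    _ = _ := by
      rw [norm_smul, norm_smul, norm_mul, Complex.norm_I, one_mul, Real.norm_eq_abs, Real.norm_eq_abs,
        abs_div, abs_of_pos (by positivity : 0 < ‖v‖ ^ 2)]
      field_simp

lemma abs_bet_le {v : ℂ} (hv : v ≠ 0) (z : ℂ) : |bet v z| ≤ ‖z‖ / ‖v‖ := by
  have h0 : 0 < ‖v‖ := norm_pos_iff.2 hv
  rw [bet, abs_div, abs_of_pos (by positivity : 0 < ‖v‖ ^ 2), div_le_div_iff₀ (by positivity) h0]
  have := abs_dt_le z v
  nlinarith

lemma U_diff {μ a C} [IsProbabilityMeasure μ] (P : Pot μ a C) {s t : ℝ} (hs : 0 < s) (ht : 0 < t) {D : ℝ≥0}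
    (hD : ∀ v, ∫⁻ g, iA s t (ra v g) ∂(GG μ) ≤ D) : ∃ Q : ℝ≥0, ∀ (η : ℝ) (v z : ℂ), 0 < η → v ≠ 0 →
    ‖z‖ ≤ η * ‖v‖ → ∫⁻ g, iA s t (ra v g) * ENNReal.ofReal (‖ra z g‖ ^ (a/2)) ∂(GG μ) ≤
      Q * ENNReal.ofReal (η ^ (a/2)) := by
  have ha := P.pos
  have ha1 := P.le
  have ha2 : 0 < a / 2 := by positivity
  refine ⟨(ENNReal.ofReal (t ^ (a/2)) * (D + D * C * C) + ENNReal.ofReal (s ^ (-(a/2))) *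
    (ENNReal.ofReal (t ^ a) * C)).toNNReal, ?_⟩
  intro η v z hη hv hz
  rw [ENNReal.coe_toNNReal (by finiteness)]
  have h0 : 0 < ‖v‖ := norm_pos_iff.2 hv
  set κ := ENNReal.ofReal (|cr v z| ^ (a/2)) with hκ
  set E := ENNReal.ofReal (η ^ (a/2)) with hE
  have hb : ENNReal.ofReal (|bet v z - 0| ^ (a/2)) ≤ E := by
    apply ENNReal.ofReal_le_ofReal
    rw [sub_zero]
    refine Real.rpow_le_rpow (abs_nonneg _) ?_ ha2.le
    exact (abs_bet_le hv z).trans ((div_le_iff₀ h0).2 hz)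
  have hk : κ * Na a v ≤ E := by
    rw [hκ, hE, Na, ← ENNReal.ofReal_mul (by positivity)]
    apply ENNReal.ofReal_le_ofReal
    have h1 : |cr v z| ≤ η * ‖v‖ ^ 2 := (abs_cr_le v z).trans (by nlinarith)
    calc |cr v z| ^ (a/2) * ‖v‖ ^ (-a) ≤ (η * ‖v‖ ^ 2) ^ (a/2) * ‖v‖ ^ (-a) := by
          gcongr
      _ = η ^ (a/2) := by
          rw [Real.mul_rpow hη.le (by positivity), ← Real.rpow_natCast, ← Real.rpow_mul h0.le, mul_assoc,
            ← Real.rpow_add h0]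
          have : ((2:ℕ):ℝ) * (a/2) + -a = 0 := by push_cast; ring
          rw [this, Real.rpow_zero, mul_one]
  have pt : ∀ g, iA s t (ra v g) * ENNReal.ofReal (‖ra z g‖ ^ (a/2)) ≤
      ENNReal.ofReal (t ^ (a/2)) * (iA s t (ra v g) * ENNReal.ofReal (|bet (ra v g) (ra z g) - 0| ^ (a/2)))
      + (ENNReal.ofReal (s ^ (-(a/2))) * κ) * iA s t (ra v g) := by
    intro g
    by_cases hg : ra v g ∈ An s t
    swap
    · rw [iA_not hg]; simp
    rw [iA_mem hg, one_mul, one_mul, mul_one, hκ, ← ENNReal.ofReal_mul (by positivity),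
      ← ENNReal.ofReal_mul (by positivity), ← ENNReal.ofReal_add (by positivity) (by positivity)]
    apply ENNReal.ofReal_le_ofReal
    have h1 := norm_le_bet (ra_ne_zero hv g) (ra z g)
    rw [cr_ra, sub_zero] at *
    have hg0 : 0 < ‖ra v g‖ := norm_pos_iff.2 (ra_ne_zero hv g)
    calc ‖ra z g‖ ^ (a/2) ≤ (t * |bet (ra v g) (ra z g)| + s⁻¹ * |cr v z|) ^ (a/2) := by
          refine Real.rpow_le_rpow (norm_nonneg _) (h1.trans ?_) ha2.le
          refine add_le_add ?_ ?_
          · rw [mul_comm]; exact mul_le_mul_of_nonneg_right hg.2 (abs_nonneg _)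
          · rw [div_eq_mul_inv, mul_comm]
            exact mul_le_mul_of_nonneg_right (inv_anti₀ hs hg.1) (abs_nonneg _)
      _ ≤ _ := by
          refine (rpow_sub_add (by positivity) (by positivity) ha2.le (by linarith)).trans ?_
          rw [Real.mul_rpow ht.le (abs_nonneg _), Real.mul_rpow (by positivity) (abs_nonneg _),
            Real.inv_rpow hs.le, Real.rpow_neg hs.le]
  have mi : Measurable fun g => iA s t (ra v g) := (meas_iA s t).comp (mra v)
  have mb : Measurable fun g => iA s t (ra v g) * ENNReal.ofReal (|bet (ra v g) (ra z g) - 0| ^ (a/2)) :=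
    mi.mul ((((meas_bet v z).sub_const 0).abs).pow_const _).ennreal_ofReal
  calc _ ≤ _ := lintegral_mono pt
    _ = ENNReal.ofReal (t ^ (a/2)) * ∫⁻ g, iA s t (ra v g) * ENNReal.ofReal (|bet (ra v g) (ra z g) - 0| ^ (a/2)) ∂(GG μ)
      + (ENNReal.ofReal (s ^ (-(a/2))) * κ) * ∫⁻ g, iA s t (ra v g) ∂(GG μ) := by
        rw [lintegral_add_left (mb.const_mul _), lintegral_const_mul _ mb, lintegral_const_mul _ mi]
    _ ≤ ENNReal.ofReal (t ^ (a/2)) * (E * D + κ * (D * C * (C * Na a v)))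
      + (ENNReal.ofReal (s ^ (-(a/2))) * κ) * (ENNReal.ofReal (t ^ a) * (C * Na a v)) := by
        gcongr
        · refine (U_bet P hD hv z 0).trans ?_
          gcongr
        · exact U_iA_le P hs v
    _ = ENNReal.ofReal (t ^ (a/2)) * (E * D + (D * C * C) * (κ * Na a v))
      + ENNReal.ofReal (s ^ (-(a/2))) * (ENNReal.ofReal (t ^ a) * C) * (κ * Na a v) := by ring
    _ ≤ ENNReal.ofReal (t ^ (a/2)) * (E * D + (D * C * C) * E)
      + ENNReal.ofReal (s ^ (-(a/2))) * (ENNReal.ofReal (t ^ a) * C) * E := by gcongr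
    _ = _ := by ring

lemma exists_iA_bd {μ a C} [IsProbabilityMeasure μ] (P : Pot μ a C) {s t : ℝ} (hs : 0 < s) :
    ∃ D : ℝ≥0, ∀ v, ∫⁻ g, iA s t (ra v g) ∂(GG μ) ≤ D := by
  obtain ⟨m, hm⟩ := exists_nat_ge (Real.log (t / s))
  refine ⟨(m + 1) * (3 * C), fun v => ?_⟩
  refine le_trans (lintegral_mono fun g => ?_) ((U_An P hs m v).trans (by push_cast; rfl))
  by_cases h : ra v g ∈ An s t
  · rw [iA_mem h, iA_mem]
    refine ⟨h.1, h.2.trans ?_⟩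
    rcases le_or_gt t 0 with ht | ht
    · exact ht.trans (by positivity)
    rw [Real.log_le_iff_le_exp (by positivity), div_le_iff₀ hs] at hm
    linarith
  · rw [iA_not h]; exact zero_le

/-- data of a test function -/
structure Wt (w : ℂ → ℝ) (s t : ℝ) : Prop where
  cont : Continuous w
  nn : ∀ v, 0 ≤ w v
  s0 : 0 < s
  t0 : 0 < t
  supp : ∀ v, v ∉ An s t → w v = 0

lemma Wt.hcs {w : ℂ → ℝ} {s t : ℝ} (W : Wt w s t) : HasCompactSupport w := by
  refine HasCompactSupport.intro (isCompact_closedBall (0:ℂ) t) fun v hv => W.supp v fun h => hv ?_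
  simpa using h.2

lemma Wt.bdd {w : ℂ → ℝ} {s t : ℝ} (W : Wt w s t) : ∃ B > 0, ∀ v, w v ≤ B := by
  obtain ⟨B, hB⟩ := W.cont.bounded_above_of_compact_support W.hcs
  exact ⟨max B 1, by positivity, fun v => ((le_abs_self _).trans (hB v)).trans (le_max_left _ _)⟩

lemma UL_bdd {μ a C} [IsProbabilityMeasure μ] (P : Pot μ a C) {w : ℂ → ℝ} {s t : ℝ} (W : Wt w s t) :
    ∃ D : ℝ≥0, ∀ v, UL μ w v ≤ D := by
  obtain ⟨D, hD⟩ := exists_iA_bd P (t := t) W.s0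
  obtain ⟨B, hB0, hB⟩ := W.bdd
  refine ⟨B.toNNReal * D, fun v => ?_⟩
  calc UL μ w v ≤ ∫⁻ g, ENNReal.ofReal B * iA s t (ra v g) ∂(GG μ) := by
        refine lintegral_mono fun g => ?_
        by_cases h : ra v g ∈ An s t
        · rw [iA_mem h, mul_one]; exact ENNReal.ofReal_le_ofReal (hB _)
        · rw [W.supp _ h]; simp
    _ = ENNReal.ofReal B * ∫⁻ g, iA s t (ra v g) ∂(GG μ) := lintegral_const_mul _ ((meas_iA s t).comp (mra v))
    _ ≤ ENNReal.ofReal B * D := by gcongr; exact hD v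
    _ = _ := by push_cast; rfl

lemma UL_equi {μ a C} [IsProbabilityMeasure μ] (P : Pot μ a C) {w : ℂ → ℝ} {s t : ℝ} (W : Wt w s t)
    {ε : ℝ} (hε : 0 < ε) : ∃ η > 0, ∀ v y : ℂ, v ≠ 0 → y ≠ 0 → ‖v - y‖ ≤ η * ‖v‖ → ‖v - y‖ ≤ η * ‖y‖ →
      UL μ w v ≤ UL μ w y + ENNReal.ofReal ε := by
  have ha := P.pos
  have ha2 : 0 < a / 2 := by positivity
  obtain ⟨D, hD⟩ := exists_iA_bd P (t := t) W.s0
  obtain ⟨B, hB0, hB⟩ := W.bdd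
  obtain ⟨Q, hQ⟩ := U_diff P W.s0 W.t0 hD
  have huc := W.hcs.uniformContinuous_of_continuous W.cont
  set η' := ε / (4 * (D + 1)) with hη'
  have hη'0 : 0 < η' := by positivity
  obtain ⟨δ, hδ, hu⟩ := Metric.uniformContinuous_iff.1 huc η' hη'0
  set L := B / δ ^ (a/2) with hL
  have hL0 : 0 < L := by positivity
  set q := ε / (4 * (L * (Q + 1))) with hq
  have hq0 : 0 < q := by positivity
  refine ⟨q ^ (a/2)⁻¹, by positivity, ?_⟩
  intro v y hv hy h1 h2
  have hqq : (q ^ (a/2)⁻¹) ^ (a/2) = q := by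
    rw [← Real.rpow_mul hq0.le, inv_mul_cancel₀ ha2.ne', Real.rpow_one]
  have k1 := hQ _ v (v - y) (by positivity) hv h1
  have k2 := hQ _ y (v - y) (by positivity) hy h2
  rw [hqq] at k1 k2
  have pw : ∀ v y : ℂ, w v - w y ≤ η' + L * ‖v - y‖ ^ (a/2) := by
    intro v y
    rcases lt_or_ge ‖v - y‖ δ with h | h
    · have := hu (a := v) (b := y) (by rwa [dist_eq_norm])
      rw [Real.dist_eq] at this
      have h3 := le_abs_self (w v - w y)
      have : 0 ≤ L * ‖v - y‖ ^ (a/2) := by positivity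
      linarith
    · have h3 : δ ^ (a/2) ≤ ‖v - y‖ ^ (a/2) := Real.rpow_le_rpow hδ.le h ha2.le
      have h4 : B ≤ L * ‖v - y‖ ^ (a/2) := by
        rw [hL, div_mul_eq_mul_div, le_div_iff₀ (by positivity)]
        gcongr
      have := hB v
      have := W.nn y
      linarith
  have pt : ∀ g, ENNReal.ofReal (w (ra v g)) ≤ ENNReal.ofReal (w (ra y g)) +
      (ENNReal.ofReal η' * (iA s t (ra v g) + iA s t (ra y g)) +
       ENNReal.ofReal L * (iA s t (ra v g) * ENNReal.ofReal (‖ra (v-y) g‖ ^ (a/2)) +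
         iA s t (ra y g) * ENNReal.ofReal (‖ra (v-y) g‖ ^ (a/2)))) := by
    intro g
    have key : ENNReal.ofReal (w (ra v g)) ≤ ENNReal.ofReal (w (ra y g)) +
        (ENNReal.ofReal η' + ENNReal.ofReal L * ENNReal.ofReal (‖ra (v-y) g‖ ^ (a/2))) := by
      rw [← ENNReal.ofReal_mul hL0.le, ← ENNReal.ofReal_add hη'0.le (by positivity),
        ← ENNReal.ofReal_add (W.nn _) (by positivity)]
      apply ENNReal.ofReal_le_ofReal
      have := pw (ra v g) (ra y g)
      rw [← ra_sub] at this
      linarith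
    by_cases hvg : ra v g ∈ An s t
    · refine key.trans ?_
      rw [iA_mem hvg]
      gcongr
      · rw [mul_add, mul_one]; exact le_self_add
      · rw [one_mul]; exact le_self_add
    · rw [W.supp _ hvg]; simp
  have mi : ∀ v, Measurable fun g => iA s t (ra v g) := fun v => (meas_iA s t).comp (mra v)
  have mn : Measurable fun g => ENNReal.ofReal (‖ra (v-y) g‖ ^ (a/2)) :=
    ((mra _).norm.pow_const _).ennreal_ofReal
  calc UL μ w v ≤ _ := lintegral_mono pt
    _ = UL μ w y + (ENNReal.ofReal η' * ((∫⁻ g, iA s t (ra v g) ∂(GG μ)) + ∫⁻ g, iA s t (ra y g) ∂(GG μ)) +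
       ENNReal.ofReal L * ((∫⁻ g, iA s t (ra v g) * ENNReal.ofReal (‖ra (v-y) g‖ ^ (a/2)) ∂(GG μ)) +
         ∫⁻ g, iA s t (ra y g) * ENNReal.ofReal (‖ra (v-y) g‖ ^ (a/2)) ∂(GG μ))) := by
        have m1 : Measurable fun g => iA s t (ra v g) + iA s t (ra y g) := (mi v).add (mi y)
        have m2 : ∀ v, Measurable fun g => iA s t (ra v g) * ENNReal.ofReal (‖ra (v-y) g‖ ^ (a/2)) := fun v =>
          (mi v).mul ((mra _).norm.pow_const _).ennreal_ofReal
        have m3 : Measurable fun g => iA s t (ra y g) * ENNReal.ofReal (‖ra (v-y) g‖ ^ (a/2)) := (mi y).mul mn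
        have m4 : Measurable fun g => iA s t (ra v g) * ENNReal.ofReal (‖ra (v-y) g‖ ^ (a/2)) +
          iA s t (ra y g) * ENNReal.ofReal (‖ra (v-y) g‖ ^ (a/2)) := (m2 v).add m3
        rw [lintegral_add_left (meas_wra W.cont.measurable y),
          lintegral_add_left (m1.const_mul _),
          lintegral_const_mul _ m1, lintegral_add_left (mi v),
          lintegral_const_mul _ m4, lintegral_add_left (m2 v)]
        rfl
    _ ≤ UL μ w y + (ENNReal.ofReal η' * (D + D) +
       ENNReal.ofReal L * (Q * ENNReal.ofReal q + Q * ENNReal.ofReal q)) := by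
        gcongr
        · exact hD v
        · exact hD y
    _ ≤ _ := by
        gcongr
        rw [← ENNReal.ofReal_coe_nnreal (p := D), ← ENNReal.ofReal_coe_nnreal (p := Q)]
        rw [← ENNReal.ofReal_add (by positivity) (by positivity), ← ENNReal.ofReal_mul (by positivity),
          ← ENNReal.ofReal_mul (by positivity), ← ENNReal.ofReal_add (by positivity) (by positivity),
          ← ENNReal.ofReal_mul (by positivity), ← ENNReal.ofReal_add (by positivity) (by positivity)]
        apply ENNReal.ofReal_le_ofReal
        have e1 : η' * (D + D) ≤ ε / 2 := by
          rw [hη', div_mul_eq_mul_div, div_le_div_iff₀ (by positivity) (by positivity)]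
          nlinarith [D.coe_nonneg]
        have e2 : L * (Q * q + Q * q) ≤ ε / 2 := by
          rw [hq, show L * (Q * (ε / (4 * (L * (Q + 1)))) + Q * (ε / (4 * (L * (Q + 1))))) = (Q:ℝ) * ε / (2 * (Q + 1)) by
            field_simp; ring, div_le_div_iff₀ (by positivity) (by positivity)]
          nlinarith [Q.coe_nonneg]
        linarith

lemma UU_equi {μ a C} [IsProbabilityMeasure μ] (P : Pot μ a C) {w : ℂ → ℝ} {s t : ℝ} (W : Wt w s t)
    {ε : ℝ} (hε : 0 < ε) : ∃ η > 0, ∀ v y : ℂ, ‖v - y‖ ≤ η * ‖v‖ → |UU μ w v - UU μ w y| ≤ ε := by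
  obtain ⟨η, hη, h⟩ := UL_equi P W hε
  obtain ⟨D, hD⟩ := UL_bdd P W
  refine ⟨min (1/2) (η/2), by positivity, ?_⟩
  intro v y hvy
  by_cases hv : v = 0
  · subst hv
    have : y = 0 := by simpa using hvy
    subst this; simp [hε.le]
  have hv0 : 0 < ‖v‖ := norm_pos_iff.2 hv
  have h1 : ‖v - y‖ ≤ 1/2 * ‖v‖ := hvy.trans (by gcongr; exact min_le_left _ _)
  have h2 : ‖v - y‖ ≤ η/2 * ‖v‖ := hvy.trans (by gcongr; exact min_le_right _ _)
  have h3 : ‖v‖ ≤ ‖v - y‖ + ‖y‖ := by simpa using norm_add_le (v - y) y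
  have hy0 : 0 < ‖y‖ := by linarith
  have hy : y ≠ 0 := norm_pos_iff.1 hy0
  have h4 : ‖v - y‖ ≤ η * ‖v‖ := by nlinarith
  have h5 : ‖v - y‖ ≤ η * ‖y‖ := by nlinarith
  have a1 := h v y hv hy h4 h5
  have a2 := h y v hy hv (by rwa [norm_sub_rev]) (by rwa [norm_sub_rev])
  have f1 : UL μ w v ≠ ⊤ := ((hD v).trans_lt ENNReal.coe_lt_top).ne
  have f2 : UL μ w y ≠ ⊤ := ((hD y).trans_lt ENNReal.coe_lt_top).ne
  have b1 := ENNReal.toReal_mono (by finiteness) a1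
  have b2 := ENNReal.toReal_mono (by finiteness) a2
  rw [ENNReal.toReal_add (by assumption) (by finiteness), ENNReal.toReal_ofReal hε.le] at b1 b2
  unfold UU
  rw [abs_le]; constructor <;> linarith

end

noncomputable section
open scoped ENNReal NNReal Topology

/-- the monoid generated by the support -/
def Sg (μ : Measure SL2) : Submonoid SL2 := Submonoid.closure (measSupp μ)

lemma sub_Sg {μ : Measure SL2} {g : SL2} (h : g ∈ measSupp μ) : g ∈ Sg μ := Submonoid.subset_closure h

lemma supp_ae (μ : Measure SL2) : ∀ᵐ g ∂μ, g ∈ measSupp μ := by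
  rw [ae_iff]
  apply measure_null_of_locally_null
  intro g hg
  simp only [measSupp, Set.mem_setOf_eq, not_forall] at hg
  obtain ⟨U, hU, hgU, h⟩ := hg
  exact ⟨U, mem_nhdsWithin_of_mem_nhds (hU.mem_nhds hgU), by simpa using h⟩

lemma Sg_unb {μ N} (S : Stp μ N) (R : ℝ) : ∃ g ∈ Sg μ, R < fr g := by
  have := S.pmu
  by_contra! hb
  have hset : ∀ k : SL2, MeasurableSet {g | R < fr (k * g)} := fun k =>
    measurableSet_lt measurable_const (cont_fr.measurable.comp (measurable_const_mul k))
  have key : ∀ n : ℕ, ∀ k ∈ Sg μ, mun μ n {g | R < fr (k * g)} = 0 := by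
    intro n
    induction n with
    | zero =>
      intro k hk
      rw [mun, Measure.dirac_apply' _ (hset k)]
      simp [hb k hk]
    | succ n ih =>
      intro k hk
      rw [← lintegral_indicator_one (hset k), lint_mun' μ n (measurable_one.indicator (hset k)),
        lintegral_eq_zero_of_ae_eq_zero]
      filter_upwards [supp_ae μ] with h hh
      have := ih (k * h) ((Sg μ).mul_mem hk (sub_Sg hh))
      rw [← lintegral_indicator_one (hset (k * h))] at this
      rw [Pi.zero_apply, ← this]
      congr 1; ext g
      simp [Set.indicator, mul_assoc]
  have h1 : ∀ n, mun μ n {g | fr g ≤ R} = 1 := by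
    intro n
    have := key n 1 (one_mem _)
    simp only [one_mul] at this
    rw [← prob_compl_eq_zero_iff (measurableSet_le cont_fr.measurable measurable_const)]
    convert this using 2
    ext g; simp
  have h2 := escape S R
  simp only [h1] at h2
  exact absurd (tendsto_nhds_unique h2 tendsto_const_nhds) (by simp)

lemma nofix_x {μ N} (S : Stp μ N) {x : ℂ} (hx : x ≠ 0) : ∃ d ∈ Sg μ, cr x (ca d x) ≠ 0 := by
  by_contra! hb
  apply S.ns
  apply solv_of_fix hx
  intro g hg
  induction hg using Subgroup.closure_induction with
  | mem g hg => exact hb g (sub_Sg hg)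
  | one => rw [ca_one, cr_self]
  | mul g h _ _ h1 h2 =>
    obtain ⟨c, hc⟩ := parallel hx h2
    rw [ca_mul, hc, ca_smul, cr_smul_right, h1, mul_zero]
  | inv g _ h1 =>
    have : cr x (ca g⁻¹ x) = cr (ca g x) (ca g (ca g⁻¹ x)) := by rw [cr_ca]
    rw [this, ← ca_mul, mul_inv_cancel, ca_one, cr_symm, h1, neg_zero]

lemma nofix_low {μ N} (S : Stp μ N) (k : SL2) : ∃ d ∈ Sg μ, (k⁻¹ * d * k) 1 0 ≠ 0 := by
  by_contra! hb
  apply S.ns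
  apply solv_upper k
  intro g hg
  induction hg using Subgroup.closure_induction with
  | mem g hg => exact hb g (sub_Sg hg)
  | one => simp
  | mul g h _ _ h1 h2 => rw [cjm, mul_e, h1, h2]; ring
  | inv g _ h1 =>
    rw [show k⁻¹ * g⁻¹ * k = (k⁻¹ * g * k)⁻¹ by group, inv_e10, h1, neg_zero]

def wsw : SL2 := ⟨!![0, -1; 1, 0], by simp⟩

lemma nofix_up {μ N} (S : Stp μ N) (k : SL2) : ∃ d ∈ Sg μ, (k⁻¹ * d * k) 0 1 ≠ 0 := by
  obtain ⟨d, hd, h⟩ := nofix_low S (k * wsw)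
  refine ⟨d, hd, fun h0 => h ?_⟩
  rw [show (k * wsw)⁻¹ * d * (k * wsw) = wsw⁻¹ * ((k⁻¹ * d * k) * wsw) by group, mul_e, mul_e, mul_e,
    inv_e10, inv_e11, h0]
  simp [wsw]

lemma nomono {μ N} (S : Stp μ N) (k : SL2) : ∃ d ∈ Sg μ, ¬ (((k⁻¹ * d * k) 0 1 = 0 ∧ (k⁻¹ * d * k) 1 0 = 0) ∨
    ((k⁻¹ * d * k) 0 0 = 0 ∧ (k⁻¹ * d * k) 1 1 = 0)) := by
  by_contra! hb
  apply S.ns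
  apply solv_mono k
  intro g hg
  induction hg using Subgroup.closure_induction with
  | mem g hg => exact hb g (sub_Sg hg)
  | one => simp
  | mul g h _ _ h1 h2 =>
    rw [cjm]; simp only [mul_e (k⁻¹ * g * k)]
    rcases h1 with ⟨a1, a2⟩ | ⟨a1, a2⟩ <;> rcases h2 with ⟨b1, b2⟩ | ⟨b1, b2⟩ <;> rw [a1, a2, b1, b2] <;> simp
  | inv g _ h1 =>
    rw [show k⁻¹ * g⁻¹ * k = (k⁻¹ * g * k)⁻¹ by group, inv_e00, inv_e01, inv_e10, inv_e11]
    rcases h1 with ⟨a1, a2⟩ | ⟨a1, a2⟩ <;> rw [a1, a2] <;> simp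

/-- existence of a hyperbolic element -/
lemma exists_hyp {μ N} (S : Stp μ N) : ∃ g ∈ Sg μ, 2 < |tr2 g| := by
  by_contra! hb
  choose A hA hAn using fun n : ℕ => Sg_unb S n
  let q : ℕ → ℂ × ℂ := fun n => ((fr (A n))⁻¹ • ra 1 (A n), (fr (A n))⁻¹ • ra Complex.I (A n))
  have hq : ∀ n, ‖(q n).1‖ ^ 2 + ‖(q n).2‖ ^ 2 = 1 := by
    intro n
    have h0 := fr_pos (A n)
    simp only [q, norm_smul, mul_pow, norm_inv, Real.norm_eq_abs, abs_of_pos h0]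
    rw [nsq, nsq, ← mul_add, inv_pow, inv_mul_eq_one₀ (by positivity), fr_sq]
    simp; ring
  have hq1 : ∀ n, q n ∈ Metric.closedBall (0 : ℂ × ℂ) 1 := by
    intro n
    have := hq n
    rw [mem_closedBall_zero_iff, Prod.norm_def, max_le_iff]
    constructor <;> nlinarith [norm_nonneg (q n).1, norm_nonneg (q n).2]
  obtain ⟨⟨p, r⟩, -, φ, hφ, hlim⟩ := (isCompact_closedBall (0 : ℂ × ℂ) 1).tendsto_subseq hq1
  have l1 : Tendsto (fun n => (q (φ n)).1) atTop (𝓝 p) := (continuous_fst.tendsto _).comp hlim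
  have l2 : Tendsto (fun n => (q (φ n)).2) atTop (𝓝 r) := (continuous_snd.tendsto _).comp hlim
  have hn : ‖p‖ ^ 2 + ‖r‖ ^ 2 = 1 := by
    have := (l1.norm.pow 2).add (l2.norm.pow 2)
    simp only [hq] at this
    exact (tendsto_nhds_unique this tendsto_const_nhds)
  have hfr : Tendsto (fun n => (fr (A (φ n)))⁻¹) atTop (𝓝 0) := by
    apply Tendsto.inv_tendsto_atTop
    refine tendsto_atTop_mono (fun n => (hAn (φ n)).le) ?_
    exact tendsto_natCast_atTop_atTop.comp hφ.tendsto_atTop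
  have hcr : cr p r = 0 := by
    have c1 : Tendsto (fun n => cr (q (φ n)).1 (q (φ n)).2) atTop (𝓝 (cr p r)) := by
      have hc : Continuous fun z : ℂ × ℂ => cr z.1 z.2 := continuous_fst.cr' continuous_snd
      exact (hc.tendsto (p, r)).comp hlim
    have c2 : ∀ n, cr (q (φ n)).1 (q (φ n)).2 = (fr (A (φ n)))⁻¹ * (fr (A (φ n)))⁻¹ := by
      intro n
      simp only [q]
      rw [cr_smul_left, cr_smul_right, cr_ra]
      simp [cr]
    simp only [c2] at c1
    have := hfr.mul hfr
    rw [mul_zero] at this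
    exact tendsto_nhds_unique c1 this
  have htr : ∀ τ ∈ Sg μ, dt p (ca τ 1) + dt r (ca τ Complex.I) = 0 := by
    intro τ hτ
    have d1 : Tendsto (fun n => dt (q (φ n)).1 (ca τ 1) + dt (q (φ n)).2 (ca τ Complex.I)) atTop
        (𝓝 (dt p (ca τ 1) + dt r (ca τ Complex.I))) := by
      have hc : Continuous fun z : ℂ × ℂ => dt z.1 (ca τ 1) + dt z.2 (ca τ Complex.I) :=
        (continuous_fst.dt' continuous_const).add (continuous_snd.dt' continuous_const)
      exact (hc.tendsto (p, r)).comp hlim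
    have d2 : ∀ n, dt (q (φ n)).1 (ca τ 1) + dt (q (φ n)).2 (ca τ Complex.I) =
        (fr (A (φ n)))⁻¹ * tr2 (A (φ n) * τ) := by
      intro n
      simp only [q]
      rw [dt_smul_left, dt_smul_left, ← mul_add]
      congr 1
      simp [dt, tr2, mul_e]
    simp only [d2] at d1
    have d3 : Tendsto (fun n => (fr (A (φ n)))⁻¹ * tr2 (A (φ n) * τ)) atTop (𝓝 0) := by
      apply squeeze_zero_norm (a := fun n => (fr (A (φ n)))⁻¹ * 2)
      · intro n
        have h0 := fr_pos (A (φ n))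
        rw [norm_mul, norm_inv, Real.norm_eq_abs, abs_of_pos h0, Real.norm_eq_abs]
        gcongr
        exact hb _ ((Sg μ).mul_mem (hA _) hτ)
      · simpa using hfr.mul_const 2
    exact tendsto_nhds_unique d1 d3
  have fin : ∀ (p' x : ℂ), p' ≠ 0 → x ≠ 0 → (∀ τ ∈ Sg μ, dt p' (ca τ x) = 0) → False := by
    intro p' x hp' hx h
    obtain ⟨d, hd, hne⟩ := nofix_x S hx
    apply hne
    have a1 := h d hd
    have a2 := h 1 (one_mem _)
    rw [ca_one] at a2
    have e1 : cr (Complex.I * p') x = 0 := by simp [cr, dt] at *; linarith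
    have e2 : cr (Complex.I * p') (ca d x) = 0 := by
      rw [dt] at a1; rw [cr]; simp only [Complex.mul_re, Complex.mul_im, Complex.I_re, Complex.I_im]; linarith
    obtain ⟨c, hc⟩ := parallel (x := Complex.I * p') (by simpa using hp') e1
    rw [hc, cr_smul_left, ← hc, e2, mul_zero]
  by_cases hp : p = 0
  · subst hp
    have hr : r ≠ 0 := by rintro rfl; simp at hn
    refine fin r Complex.I hr Complex.I_ne_zero fun τ hτ => ?_
    have := htr τ hτ
    simpa [dt] using this
  · obtain ⟨c, hc⟩ := parallel hp hcr
    refine fin p (1 + c • Complex.I) hp ?_ fun τ hτ => ?_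
    · intro h
      have := congrArg Complex.re h
      simp at this
    · have := htr τ hτ
      rw [hc, dt_smul_left, ← dt_smul_right, ← ca_smul] at this
      rw [ca_add]
      rw [← this]; simp only [dt, Complex.add_re, Complex.add_im]; ring

lemma ca_CH (g : SL2) (y : ℂ) : ca g (ca g y) = tr2 g • ca g y - y := by
  have := det1 g
  apply Complex.ext
  · simp [tr2]
    linear_combination (-y.re) * this
  · simp [tr2]
    linear_combination (-y.im) * this

/-- diagonalizing frame -/
lemma hyp_frame {g : SL2} {l : ℝ} (hl : 1 < l) (ht : tr2 g = l + l⁻¹) : ∃ k : SL2,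
    (k⁻¹ * g * k) 0 0 = l ∧ (k⁻¹ * g * k) 0 1 = 0 ∧ (k⁻¹ * g * k) 1 0 = 0 ∧ (k⁻¹ * g * k) 1 1 = l⁻¹ := by
  have hl0 : 0 < l := by linarith
  have hli : l⁻¹ < 1 := inv_lt_one_of_one_lt₀ hl
  have hll : l * l⁻¹ = 1 := mul_inv_cancel₀ hl0.ne'
  obtain ⟨y, hy⟩ : ∃ y, cr y (ca g y) ≠ 0 := by
    by_contra! h
    have h1 := h 1
    have h2 := h Complex.I
    have h3 := h (1 + Complex.I)
    simp [cr] at h1 h2 h3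
    have hd := det1 g
    have h4 : g 0 0 = g 1 1 := by linarith
    rw [h1, h2, h4] at hd
    rw [tr2, h4] at ht
    have : (l - l⁻¹) ^ 2 = 0 := by
      have : (l + l⁻¹) ^ 2 = 4 := by rw [← ht]; linear_combination 4 * hd
      linear_combination this - 4 * hll
    nlinarith
  have CH := ca_CH g y
  rw [ht] at CH
  set z := ca g y with hz
  set x := z - l⁻¹ • y with hx
  set x' := l • y - z with hx'
  have gx : ca g x = l • x := by
    rw [hx, sub_eq_add_neg, ← neg_smul, ca_add, ca_smul, CH, ← hz]
    have : l • l⁻¹ • y = y := by rw [smul_smul, hll, one_smul]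
    rw [smul_add, neg_smul, neg_smul, smul_neg, this, add_smul]; abel
  have gx' : ca g x' = l⁻¹ • x' := by
    rw [hx', sub_eq_add_neg, ca_add, ca_smul, ← hz, ← neg_one_smul ℝ z, ca_smul, CH]
    have : l⁻¹ • l • y = y := by rw [smul_smul, mul_comm, hll, one_smul]
    rw [smul_add, this, neg_one_smul, neg_one_smul, smul_neg, add_smul]; abel
  have hc : cr x x' ≠ 0 := by
    have : cr x x' = -(l - l⁻¹) * cr y z := by
      simp only [hx, hx', cr, Complex.sub_re, Complex.sub_im, Complex.smul_re, Complex.smul_im, smul_eq_mul]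
      ring
    rw [this]
    exact mul_ne_zero (by linarith) hy
  obtain ⟨k, h1, h2, h3, h4⟩ := exists_frame (x := x) (y := (cr x x')⁻¹ • x') (by
    rw [cr_smul_right]; field_simp)
  have e : ∀ j, (k⁻¹ * g * k) 0 j = k 1 1 * (g 0 0 * k 0 j + g 0 1 * k 1 j) - k 0 1 * (g 1 0 * k 0 j + g 1 1 * k 1 j) := by
    intro j; rw [mul_assoc, mul_e, mul_e, mul_e, inv_e00, inv_e01]; ring
  have e' : ∀ j, (k⁻¹ * g * k) 1 j = -k 1 0 * (g 0 0 * k 0 j + g 0 1 * k 1 j) + k 0 0 * (g 1 0 * k 0 j + g 1 1 * k 1 j) := by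
    intro j; rw [mul_assoc, mul_e, mul_e, mul_e, inv_e10, inv_e11]
  have gr := congrArg Complex.re gx
  have gi := congrArg Complex.im gx
  have gr' := congrArg Complex.re gx'
  have gi' := congrArg Complex.im gx'
  rw [ca_re, Complex.smul_re, smul_eq_mul, ← h1, ← h2] at gr
  rw [ca_im, Complex.smul_im, smul_eq_mul, ← h1, ← h2] at gi
  rw [Complex.smul_re, smul_eq_mul] at h3
  rw [Complex.smul_im, smul_eq_mul] at h4
  have gr2 : g 0 0 * k 0 1 + g 0 1 * k 1 1 = l⁻¹ * k 0 1 := by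
    rw [ca_re, Complex.smul_re, smul_eq_mul] at gr'
    rw [h3, h4]; linear_combination (cr x x')⁻¹ * gr'
  have gi2 : g 1 0 * k 0 1 + g 1 1 * k 1 1 = l⁻¹ * k 1 1 := by
    rw [ca_im, Complex.smul_im, smul_eq_mul] at gi'
    rw [h3, h4]; linear_combination (cr x x')⁻¹ * gi'
  have hd := det1 k
  refine ⟨k, ?_, ?_, ?_, ?_⟩
  · rw [e, gr, gi]; linear_combination l * hd
  · rw [e, gr2, gi2]; ring
  · rw [e', gr, gi]; ring
  · rw [e', gr2, gi2]; linear_combination l⁻¹ * hd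

end

noncomputable section
open scoped ENNReal NNReal Topology

lemma ev_ne {l p q : ℝ} (hl : 1 < l) (h : p ≠ 0 ∨ q ≠ 0) : ∀ᶠ n : ℕ in atTop, p * l ^ n + q * l⁻¹ ^ n ≠ 0 := by
  have hl0 : 0 < l := by linarith
  by_cases hp : p = 0
  · subst hp
    have hq : q ≠ 0 := by simpa using h
    filter_upwards with n
    simp only [zero_mul, zero_add]; positivity
  · have hp' : 0 < |p| := abs_pos.2 hp
    filter_upwards [(tendsto_pow_atTop_atTop_of_one_lt hl).eventually_gt_atTop (|q| / |p|)] with n hn h0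
    rw [div_lt_iff₀ hp'] at hn
    have h1 : p * l ^ n = -(q * l⁻¹ ^ n) := by linarith
    have h2 := congrArg abs h1
    have h3 : (0:ℝ) < l⁻¹ ^ n := by positivity
    have h4 : l⁻¹ ^ n ≤ 1 := pow_le_one₀ (by positivity) (inv_le_one_of_one_le₀ hl.le)
    rw [abs_neg, abs_mul, abs_mul, abs_of_pos (by positivity : 0 < l ^ n), abs_of_pos h3] at h2
    nlinarith [abs_nonneg q]

/-- diagonal conjugate -/
structure Dg (k g : SL2) (l : ℝ) : Prop where
  l1 : 1 < l
  e00 : (k⁻¹ * g * k) 0 0 = l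
  e01 : (k⁻¹ * g * k) 0 1 = 0
  e10 : (k⁻¹ * g * k) 1 0 = 0
  e11 : (k⁻¹ * g * k) 1 1 = l⁻¹

lemma cjpow (k g : SL2) (n : ℕ) : k⁻¹ * g ^ n * k = (k⁻¹ * g * k) ^ n := by
  induction n with
  | zero => simp
  | succ n ih => rw [pow_succ, cjm, ih, pow_succ]

lemma Dg.pow {k g : SL2} {l : ℝ} (D : Dg k g l) (n : ℕ) : (k⁻¹ * g ^ n * k) 0 0 = l ^ n ∧
    (k⁻¹ * g ^ n * k) 0 1 = 0 ∧ (k⁻¹ * g ^ n * k) 1 0 = 0 ∧ (k⁻¹ * g ^ n * k) 1 1 = l⁻¹ ^ n := by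
  induction n with
  | zero => simp
  | succ n ih =>
    obtain ⟨h1, h2, h3, h4⟩ := ih
    rw [pow_succ, cjm]
    simp only [mul_e (k⁻¹ * g ^ n * k)]
    rw [h1, h2, h3, h4, D.e00, D.e01, D.e10, D.e11]
    refine ⟨by ring, by ring, by ring, by ring⟩

lemma bool_prod {μ : Measure SL2} {k g : SL2} {l : ℝ} (D : Dg k g l) (hg : g ∈ Sg μ) {d1 d2 : SL2}
    (h1 : d1 ∈ Sg μ) (h2 : d2 ∈ Sg μ) : ∃ d ∈ Sg μ, ∀ i j, (((k⁻¹ * d1 * k) i 0 ≠ 0 ∧ (k⁻¹ * d2 * k) 0 j ≠ 0) ∨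
      ((k⁻¹ * d1 * k) i 1 ≠ 0 ∧ (k⁻¹ * d2 * k) 1 j ≠ 0)) → (k⁻¹ * d * k) i j ≠ 0 := by
  have key : ∀ᶠ n : ℕ in atTop, ∀ i j, (((k⁻¹ * d1 * k) i 0 ≠ 0 ∧ (k⁻¹ * d2 * k) 0 j ≠ 0) ∨
      ((k⁻¹ * d1 * k) i 1 ≠ 0 ∧ (k⁻¹ * d2 * k) 1 j ≠ 0)) → (k⁻¹ * (d1 * (g ^ n * d2)) * k) i j ≠ 0 := by
    rw [eventually_all]; intro i
    rw [eventually_all]; intro j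
    by_cases h : ((k⁻¹ * d1 * k) i 0 ≠ 0 ∧ (k⁻¹ * d2 * k) 0 j ≠ 0) ∨
      ((k⁻¹ * d1 * k) i 1 ≠ 0 ∧ (k⁻¹ * d2 * k) 1 j ≠ 0)
    swap
    · filter_upwards with n hn; exact absurd hn h
    have h' : (k⁻¹ * d1 * k) i 0 * (k⁻¹ * d2 * k) 0 j ≠ 0 ∨ (k⁻¹ * d1 * k) i 1 * (k⁻¹ * d2 * k) 1 j ≠ 0 :=
      h.imp (fun h => mul_ne_zero h.1 h.2) (fun h => mul_ne_zero h.1 h.2)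
    filter_upwards [ev_ne D.l1 h'] with n hn _
    obtain ⟨p1, p2, p3, p4⟩ := D.pow n
    rw [cjm, cjm, mul_e (k⁻¹ * d1 * k), mul_e (k⁻¹ * g ^ n * k), mul_e (k⁻¹ * g ^ n * k), p1, p2, p3, p4]
    convert hn using 1; ring
  obtain ⟨n, hn⟩ := key.exists
  exact ⟨_, (Sg μ).mul_mem h1 ((Sg μ).mul_mem ((Sg μ).pow_mem hg n) h2), hn⟩

lemma exists_good {μ N} (S : Stp μ N) {k g : SL2} {l : ℝ} (D : Dg k g l) (hg : g ∈ Sg μ) :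
    ∃ d ∈ Sg μ, (k⁻¹ * d * k) 0 0 ≠ 0 ∧ (k⁻¹ * d * k) 0 1 ≠ 0 ∧ (k⁻¹ * d * k) 1 0 ≠ 0 := by
  obtain ⟨r, hr, hm⟩ := nomono S k
  obtain ⟨d1, hd1, hb⟩ := nofix_up S k
  obtain ⟨d2, hd2, hc⟩ := nofix_low S k
  have dr := det1 (k⁻¹ * r * k)
  have dd1 := det1 (k⁻¹ * d1 * k)
  have dd2 := det1 (k⁻¹ * d2 * k)
  by_cases h10 : (k⁻¹ * r * k) 1 0 = 0
  · have h01 : (k⁻¹ * r * k) 0 1 ≠ 0 := fun h => hm (Or.inl ⟨h, h10⟩)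
    have h00 : (k⁻¹ * r * k) 0 0 ≠ 0 := by intro h; rw [h, h10] at dr; simp at dr
    have h11 : (k⁻¹ * r * k) 1 1 ≠ 0 := by intro h; rw [h, h10] at dr; simp at dr
    obtain ⟨d, hd, h⟩ := bool_prod D hg hr hd2
    refine ⟨d, hd, h 0 0 (Or.inr ⟨h01, hc⟩), ?_, h 1 0 (Or.inr ⟨h11, hc⟩)⟩
    apply h
    by_cases hb2 : (k⁻¹ * d2 * k) 0 1 = 0
    · right; refine ⟨h01, fun h0 => ?_⟩
      rw [hb2, h0] at dd2; simp at dd2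
    · exact Or.inl ⟨h00, hb2⟩
  by_cases h01 : (k⁻¹ * r * k) 0 1 = 0
  · have h00 : (k⁻¹ * r * k) 0 0 ≠ 0 := by intro h; rw [h, h01] at dr; simp at dr
    have h11 : (k⁻¹ * r * k) 1 1 ≠ 0 := by intro h; rw [h, h01] at dr; simp at dr
    obtain ⟨d, hd, h⟩ := bool_prod D hg hd1 hr
    refine ⟨d, hd, h 0 0 (Or.inr ⟨hb, h10⟩), h 0 1 (Or.inr ⟨hb, h11⟩), ?_⟩
    apply h
    by_cases hc1 : (k⁻¹ * d1 * k) 1 0 = 0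
    · right; refine ⟨fun h0 => ?_, h10⟩
      rw [hc1, h0] at dd1; simp at dd1
    · exact Or.inl ⟨hc1, h00⟩
  by_cases h00 : (k⁻¹ * r * k) 0 0 = 0
  · have h11 : (k⁻¹ * r * k) 1 1 ≠ 0 := fun h => hm (Or.inr ⟨h00, h⟩)
    obtain ⟨d, hd, h⟩ := bool_prod D hg hr hr
    exact ⟨d, hd, h 0 0 (Or.inr ⟨h01, h10⟩), h 0 1 (Or.inr ⟨h01, h11⟩), h 1 0 (Or.inr ⟨h11, h10⟩)⟩
  · exact ⟨r, hr, h00, h01, h10⟩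

/-- larger root of x + 1/x = s -/
def Lm (s : ℝ) : ℝ := (s + Real.sqrt (s ^ 2 - 4)) / 2

lemma Lm_spec {s : ℝ} (hs : 2 < s) : 1 < Lm s ∧ Lm s + (Lm s)⁻¹ = s := by
  have h0 : 0 ≤ s ^ 2 - 4 := by nlinarith
  have h1 := Real.sq_sqrt h0
  have h2 := Real.sqrt_nonneg (s ^ 2 - 4)
  have h3 : 1 < Lm s := by rw [Lm]; linarith
  refine ⟨h3, ?_⟩
  have h4 : Lm s * Lm s + 1 = s * Lm s := by rw [Lm]; linear_combination h1 / 4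
  have h5 : Lm s ≠ 0 := by linarith
  field_simp
  linarith

/-- log eigenvalues -/
def Hs (μ : Measure SL2) : Set ℝ := {a | 0 < a ∧ ∃ g ∈ Sg μ, tr2 g = Real.exp a + (Real.exp a)⁻¹}

lemma Hs_mem {μ : Measure SL2} {g : SL2} (hg : g ∈ Sg μ) (ht : 2 < |tr2 g|) :
    2 * Real.log (Lm |tr2 g|) ∈ Hs μ := by
  obtain ⟨h1, h2⟩ := Lm_spec ht
  refine ⟨by have := Real.log_pos h1; linarith, g * g, (Sg μ).mul_mem hg hg, ?_⟩
  have e : Real.exp (2 * Real.log (Lm |tr2 g|)) = Lm |tr2 g| ^ 2 := by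
    rw [two_mul, Real.exp_add, Real.exp_log (by linarith)]; ring
  rw [tr2_sq, e, ← sq_abs]
  have h3 : Lm |tr2 g| * (Lm |tr2 g|)⁻¹ = 1 := mul_inv_cancel₀ (by linarith)
  set x := Lm |tr2 g|
  rw [← h2, ← inv_pow]
  linear_combination 2 * h3

lemma small_y {a d l ε : ℝ} (ha : 0 < a) (hl : 1 < l) (had : a * d ≠ 1) (hε : 0 < ε) : ∃ n : ℕ,
    2 < a * l ^ n + d * l⁻¹ ^ n ∧ 2 < a * l ^ (n+1) + d * l⁻¹ ^ (n+1) ∧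
    0 < |Real.log (Lm (a * l ^ (n+1) + d * l⁻¹ ^ (n+1))) - Real.log (Lm (a * l ^ n + d * l⁻¹ ^ n)) - Real.log l| ∧
    |Real.log (Lm (a * l ^ (n+1) + d * l⁻¹ ^ (n+1))) - Real.log (Lm (a * l ^ n + d * l⁻¹ ^ n)) - Real.log l| < ε := by
  have hl0 : 0 < l := by linarith
  have hli : l⁻¹ < 1 := inv_lt_one_of_one_lt₀ hl
  have hli0 : 0 < l⁻¹ := by positivity
  have hll : l * l⁻¹ = 1 := mul_inv_cancel₀ hl0.ne'
  have hlln : ∀ n : ℕ, l ^ n * l⁻¹ ^ n = 1 := fun n => by rw [← mul_pow, hll, one_pow]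
  set s : ℕ → ℝ := fun n => a * l ^ n + d * l⁻¹ ^ n with hs
  have t1 : Tendsto (fun n : ℕ => l ^ n) atTop atTop := tendsto_pow_atTop_atTop_of_one_lt hl
  have t2 : Tendsto (fun n : ℕ => l⁻¹ ^ n) atTop (𝓝 0) := tendsto_pow_atTop_nhds_zero_of_lt_one hli0.le hli
  have ts : Tendsto s atTop atTop :=
    (t1.const_mul_atTop ha).atTop_add (C := d * 0) (t2.const_mul d)
  have ev := ts.eventually_gt_atTop 2
  have tR : Tendsto (fun n => Lm (s n) * l⁻¹ ^ n) atTop (𝓝 a) := by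
    have r1 : Tendsto (fun n : ℕ => a + d * (l⁻¹ ^ n * l⁻¹ ^ n)) atTop (𝓝 a) := by
      simpa using (((t2.mul t2).const_mul d).const_add a)
    have r2 : Tendsto (fun n : ℕ => a + d * (l⁻¹ ^ n * l⁻¹ ^ n) - l⁻¹ ^ n) atTop (𝓝 a) := by
      simpa using r1.sub t2
    refine tendsto_of_tendsto_of_tendsto_of_le_of_le' r2 r1 ?_ ?_
    · filter_upwards [ev] with n hn
      obtain ⟨h1, h2⟩ := Lm_spec hn
      have h3 : (Lm (s n))⁻¹ < 1 := inv_lt_one_of_one_lt₀ h1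
      have h4 : (0:ℝ) < l⁻¹ ^ n := by positivity
      have h5 : Lm (s n) = s n - (Lm (s n))⁻¹ := by linarith
      rw [h5]
      have := hlln n
      have h6 : s n * l⁻¹ ^ n = a + d * (l⁻¹ ^ n * l⁻¹ ^ n) := by
        simp only [hs]; linear_combination a * this
      nlinarith
    · filter_upwards [ev] with n hn
      obtain ⟨h1, h2⟩ := Lm_spec hn
      have h3 : 0 < (Lm (s n))⁻¹ := by positivity
      have h4 : (0:ℝ) < l⁻¹ ^ n := by positivity
      have h5 : Lm (s n) ≤ s n := by linarith
      have := hlln n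
      have h6 : s n * l⁻¹ ^ n = a + d * (l⁻¹ ^ n * l⁻¹ ^ n) := by
        simp only [hs]; linear_combination a * this
      rw [← h6]; gcongr
  have tL : Tendsto (fun n => Real.log (Lm (s n) * l⁻¹ ^ n)) atTop (𝓝 (Real.log a)) := tR.log ha.ne'
  have tD : Tendsto (fun n => Real.log (Lm (s (n+1)) * l⁻¹ ^ (n+1)) - Real.log (Lm (s n) * l⁻¹ ^ n)) atTop (𝓝 0) := by
    simpa using (tL.comp (tendsto_add_atTop_nat 1)).sub tL
  obtain ⟨n, h1, h2, h3⟩ := (ev.and (((tendsto_add_atTop_nat 1).eventually ev).and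
    ((tendsto_order.1 tD.abs).2 ε (by simpa using hε)))).exists
  obtain ⟨p1, p2⟩ := Lm_spec h1
  obtain ⟨q1, q2⟩ := Lm_spec h2
  have e : Real.log (Lm (s (n+1)) * l⁻¹ ^ (n+1)) - Real.log (Lm (s n) * l⁻¹ ^ n) =
      Real.log (Lm (s (n+1))) - Real.log (Lm (s n)) - Real.log l := by
    rw [Real.log_mul (by linarith) (by positivity), Real.log_mul (by linarith) (by positivity),
      Real.log_pow, Real.log_pow, Real.log_inv]
    push_cast; ring
  rw [e] at h3
  refine ⟨n, h1, h2, ?_, h3⟩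
  rw [abs_pos]
  intro h0
  apply had
  have h4 : Lm (s (n+1)) = Lm (s n) * l := by
    have : Real.log (Lm (s (n+1))) = Real.log (Lm (s n) * l) := by
      rw [Real.log_mul (by linarith) (by linarith)]; linarith
    exact Real.log_injOn_pos (by simp; linarith) (by simp; nlinarith) this
  rw [h4] at q2
  set x := Lm (s n) with hx
  have hx0 : 0 < x := by linarith
  have hxx : x * x⁻¹ = 1 := mul_inv_cancel₀ hx0.ne'
  rw [mul_inv] at q2
  simp only [hs] at p2 q2
  have w := hlln n
  set A := l ^ n
  set B := l⁻¹ ^ n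
  rw [pow_succ, pow_succ] at q2
  have hne : l - l⁻¹ ≠ 0 := by linarith
  have i1 : (l - l⁻¹) * (x⁻¹ - d * B) = 0 := by
    have : x⁻¹ = a * A + d * B - x := by linarith
    linear_combination l * p2 - q2
  have i2 : (l - l⁻¹) * (x - a * A) = 0 := by
    linear_combination q2 - l⁻¹ * p2
  have j1 : x⁻¹ = d * B := by have := (mul_eq_zero.1 i1).resolve_left hne; linarith
  have j2 : x = a * A := by have := (mul_eq_zero.1 i2).resolve_left hne; linarith
  have : (a * A) * (d * B) = 1 := by rw [← j1, ← j2]; exact hxx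
  linear_combination this - a * d * w

lemma tr2_cj (k g : SL2) : tr2 (k⁻¹ * g * k) = tr2 g := by
  have := det1 k
  rw [tr2, tr2, mul_assoc, mul_e, mul_e, mul_e, mul_e, mul_e, mul_e, inv_e00, inv_e01, inv_e10, inv_e11]
  linear_combination (g 0 0 + g 1 1) * this

theorem Hs_small {μ N} (S : Stp μ N) {ε : ℝ} (hε : 0 < ε) :
    ∃ a ∈ AddSubgroup.closure (Hs μ), 0 < a ∧ a < ε := by
  obtain ⟨g0, hg0, ht0⟩ := exists_hyp S
  obtain ⟨hb0, g, hg, ht⟩ := Hs_mem hg0 ht0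
  have hbm : 2 * Real.log (Lm |tr2 g0|) ∈ AddSubgroup.closure (Hs μ) :=
    AddSubgroup.subset_closure ⟨hb0, g, hg, ht⟩
  set b := 2 * Real.log (Lm |tr2 g0|)
  have hl : 1 < Real.exp b := Real.one_lt_exp_iff.2 hb0
  obtain ⟨k, k1, k2, k3, k4⟩ := hyp_frame hl ht
  have D : Dg k g (Real.exp b) := ⟨hl, k1, k2, k3, k4⟩
  obtain ⟨d, hd, d1, d2, d3⟩ := exists_good S D hg
  set m := k⁻¹ * d * k with hm
  have dm := det1 m
  have hbc : m 0 1 * m 1 0 ≠ 0 := mul_ne_zero d2 d3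
  obtain ⟨c, hc, ha⟩ : ∃ c : ℝ, |c| = 1 ∧ 0 < c * m 0 0 := by
    rcases lt_or_gt_of_ne d1 with h | h
    · exact ⟨-1, by simp, by linarith⟩
    · exact ⟨1, by simp, by linarith⟩
  have hcc : c * c = 1 := by rw [← abs_mul_abs_self, hc]; norm_num
  have had : (c * m 0 0) * (c * m 1 1) ≠ 1 := by
    intro h
    apply hbc
    have : m 0 0 * m 1 1 = 1 := by linear_combination h - m 0 0 * m 1 1 * hcc
    linarith
  obtain ⟨n, h1, h2, h3, h4⟩ := small_y ha hl had (half_pos hε)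
  have tr : ∀ n : ℕ, c * m 0 0 * Real.exp b ^ n + c * m 1 1 * (Real.exp b)⁻¹ ^ n = c * tr2 (g ^ n * d) := by
    intro n
    obtain ⟨p1, p2, p3, p4⟩ := D.pow n
    rw [← tr2_cj k, cjm, ← hm, tr2, mul_e (k⁻¹ * g ^ n * k), mul_e (k⁻¹ * g ^ n * k), p1, p2, p3, p4]; ring
  have tra : ∀ n : ℕ, 2 < c * tr2 (g ^ n * d) → c * tr2 (g ^ n * d) = |tr2 (g ^ n * d)| := by
    intro n hn
    rw [← abs_of_pos (by linarith : 0 < c * tr2 (g ^ n * d)), abs_mul, hc, one_mul]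
  rw [tr, tr] at h3 h4
  rw [tr] at h1 h2
  rw [tra _ h1, tra _ h2] at h3 h4
  rw [tra _ h1] at h1
  rw [tra _ h2] at h2
  have m1 := AddSubgroup.subset_closure (Hs_mem ((Sg μ).mul_mem ((Sg μ).pow_mem hg n) hd) h1)
  have m2 := AddSubgroup.subset_closure (Hs_mem ((Sg μ).mul_mem ((Sg μ).pow_mem hg (n+1)) hd) h2)
  rw [Real.log_exp] at h3 h4
  set X := Real.log (Lm |tr2 (g ^ n * d)|)
  set Y := Real.log (Lm |tr2 (g ^ (n+1) * d)|)
  have m3 : 2 * (Y - X - b) ∈ AddSubgroup.closure (Hs μ) := by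
    have := sub_mem (sub_mem m2 m1) (add_mem hbm hbm)
    convert this using 1; ring
  refine ⟨|2 * (Y - X - b)|, ?_, ?_, ?_⟩
  · rcases abs_choice (2 * (Y - X - b)) with h | h <;> rw [h]
    · exact m3
    · exact neg_mem m3
  · rw [abs_mul]; positivity
  · rw [abs_mul, abs_of_pos (by norm_num : (0:ℝ) < 2)]; linarith

end

noncomputable section
open scoped ENNReal NNReal Topology

structure Hm (μ : Measure SL2) (u : ℂ → ℝ) (B s0 : ℝ) : Prop where
  meas : Measurable u
  B0 : 0 < B
  bdd : ∀ v, |u v| ≤ B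
  sp : 0 < s0
  equi : ∀ ε > 0, ∃ η > 0, ∀ v y : ℂ, ‖v - y‖ ≤ η * ‖v‖ → |u v - u y| ≤ ε
  harm : ∀ v, ‖v‖ < s0 → u v = ∫ h, u (ra v h) ∂μ

def Dl (u : ℂ → ℝ) (l : ℝ) (v : ℂ) : ℝ := u (l • v) - u v

lemma Hm.int {μ : Measure SL2} [IsProbabilityMeasure μ] {u : ℂ → ℝ} {B s0 : ℝ} (H : Hm μ u B s0) (v : ℂ) :
    Integrable (fun h => u (ra v h)) μ :=
  Integrable.of_bound (H.meas.comp (mra v)).aestronglyMeasurable B (ae_of_all _ fun h => H.bdd _)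

lemma Hm.neg {μ : Measure SL2} {u : ℂ → ℝ} {B s0 : ℝ} (H : Hm μ u B s0) : Hm μ (fun v => - u v) B s0 where
  meas := H.meas.neg
  B0 := H.B0
  bdd v := by rw [abs_neg]; exact H.bdd v
  sp := H.sp
  equi ε hε := by
    obtain ⟨η, hη, h⟩ := H.equi ε hε
    refine ⟨η, hη, fun v y hvy => ?_⟩
    rw [neg_sub_neg, abs_sub_comm]; exact h v y hvy
  harm v hv := by rw [integral_neg, ← H.harm v hv]

lemma Hm.dl {μ : Measure SL2} [IsProbabilityMeasure μ] {u : ℂ → ℝ} {B s0 : ℝ} (H : Hm μ u B s0) {l : ℝ} (hl : 1 < l) :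
    Hm μ (Dl u l) (2 * B) (s0 / l) where
  meas := (H.meas.comp (measurable_const_smul l)).sub H.meas
  B0 := by have := H.B0; positivity
  bdd v := by
    unfold Dl
    have h1 := abs_le.1 (H.bdd (l • v))
    have h2 := abs_le.1 (H.bdd v)
    rw [abs_le]; constructor <;> linarith
  sp := by have := H.sp; positivity
  equi ε hε := by
    obtain ⟨η, hη, h⟩ := H.equi (ε/2) (half_pos hε)
    refine ⟨η, hη, fun v y hvy => ?_⟩
    unfold Dl
    have h1 := abs_le.1 (h v y hvy)
    have h2 := abs_le.1 (h (l • v) (l • y) (by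
      rw [← smul_sub, norm_smul, norm_smul]
      have : 0 ≤ ‖l‖ := norm_nonneg _
      nlinarith))
    rw [abs_le]; constructor <;> linarith
  harm v hv := by
    have hl0 : 0 < l := by linarith
    rw [lt_div_iff₀ hl0] at hv
    unfold Dl
    have h1 := H.harm (l • v) (by rw [norm_smul, Real.norm_eq_abs, abs_of_pos hl0]; linarith)
    have h2 := H.harm v (by nlinarith [norm_nonneg v])
    have h3 := H.int (l • v)
    simp only [ra_smul] at h1 h3
    rw [integral_sub h3 (H.int v), ← h1, ← h2]

lemma fr_tail (μ : Measure SL2) [IsProbabilityMeasure μ] {ε : ℝ} (hε : 0 < ε) : ∃ R : ℝ, 0 < R ∧ μ.real {g | R < fr g} ≤ ε := by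
  have h : Tendsto (fun n : ℕ => μ {g | (n:ℝ) < fr g}) atTop (𝓝 (μ (⋂ n : ℕ, {g | (n:ℝ) < fr g}))) := by
    apply tendsto_measure_iInter_atTop
    · intro n; exact (measurableSet_lt measurable_const cont_fr.measurable).nullMeasurableSet
    · intro m n hmn g hg
      simp only [Set.mem_setOf_eq] at hg ⊢
      have : (m:ℝ) ≤ n := by exact_mod_cast hmn
      linarith
    · exact ⟨0, measure_ne_top _ _⟩
  have h0 : (⋂ n : ℕ, {g : SL2 | (n:ℝ) < fr g}) = ∅ := by
    ext g
    simp only [Set.mem_iInter, Set.mem_setOf_eq, Set.mem_empty_iff_false, iff_false, not_forall, not_lt]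
    exact exists_nat_ge _
  rw [h0, measure_empty] at h
  obtain ⟨n, hn1, hn2⟩ := ((h.eventually_lt_const (ENNReal.ofReal_pos.2 hε)).and (eventually_gt_atTop 0)).exists
  exact ⟨n, by exact_mod_cast hn2, ENNReal.toReal_le_of_le_ofReal hε.le hn1.le⟩

lemma ra_close (v : ℂ) (h h' : SL2) : ‖ra v h - ra v h'‖ ≤
    ‖v‖ * (|h 0 0 - h' 0 0| + |h 1 0 - h' 1 0| + |h 0 1 - h' 0 1| + |h 1 1 - h' 1 1|) := by
  refine (Complex.norm_le_abs_re_add_abs_im _).trans ?_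
  have e1 : (ra v h - ra v h').re = v.re * (h 0 0 - h' 0 0) + v.im * (h 1 0 - h' 1 0) := by simp; ring
  have e2 : (ra v h - ra v h').im = v.re * (h 0 1 - h' 0 1) + v.im * (h 1 1 - h' 1 1) := by simp; ring
  rw [e1, e2]
  have a1 := Complex.abs_re_le_norm v
  have a2 := Complex.abs_im_le_norm v
  have t1 := abs_add_le (v.re * (h 0 0 - h' 0 0)) (v.im * (h 1 0 - h' 1 0))
  have t2 := abs_add_le (v.re * (h 0 1 - h' 0 1)) (v.im * (h 1 1 - h' 1 1))
  simp only [abs_mul] at t1 t2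
  have m1 := mul_le_mul_of_nonneg_right a1 (abs_nonneg (h 0 0 - h' 0 0))
  have m2 := mul_le_mul_of_nonneg_right a2 (abs_nonneg (h 1 0 - h' 1 0))
  have m3 := mul_le_mul_of_nonneg_right a1 (abs_nonneg (h 0 1 - h' 0 1))
  have m4 := mul_le_mul_of_nonneg_right a2 (abs_nonneg (h 1 1 - h' 1 1))
  linarith

def Stepp (D : ℂ → ℝ) (M : ℝ) (g : SL2) : Prop := ∀ η > 0, ∃ η' > 0, ∃ s' > 0, ∀ v : ℂ, v ≠ 0 → ‖v‖ < s' →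
  M - η' ≤ D v → M - η ≤ D (ra v g)

lemma step_mem {μ : Measure SL2} [IsProbabilityMeasure μ] {D : ℂ → ℝ} {B s0 M : ℝ} (H : Hm μ D B s0)
    (hM : ∀ ρ > 0, ∃ s > 0, ∀ v, v ≠ 0 → ‖v‖ < s → D v ≤ M + ρ) {h : SL2} (hh : h ∈ measSupp μ) :
    Stepp D M h := by
  intro η hη
  obtain ⟨η0, hη0, he⟩ := H.equi (η/2) (half_pos hη)
  set O : Set SL2 := {h' | |h 0 0 - h' 0 0| + |h 1 0 - h' 1 0| + |h 0 1 - h' 0 1| + |h 1 1 - h' 1 1| < η0 / fr h} with hO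
  have hOo : IsOpen O := by
    refine isOpen_lt ?_ continuous_const
    have := fun i j => cont_e i j
    fun_prop
  have hpO : 0 < μ.real O := by
    rw [measureReal_def]
    exact ENNReal.toReal_pos (hh O hOo (by simp [hO]; exact div_pos hη0 (fr_pos h))).ne' (measure_ne_top _ _)
  set p := μ.real O with hp
  set B' := B + |M| with hB'
  have hB'0 : 0 < B' := by have := H.B0; positivity
  obtain ⟨R, hR, hRt⟩ := fr_tail μ (ε := p * η / 8 / B') (by positivity)
  obtain ⟨s, hs, hD⟩ := hM (p * η / 8) (by positivity)
  refine ⟨p * η / 8 / 2, by positivity, min s0 (s / R), lt_min H.sp (by positivity), fun v hv hvs hDv => ?_⟩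
  by_contra hlt
  push Not at hlt
  have hpt : ∀ h', D (ra v h') ≤ (M + p * η / 8) - O.indicator (fun _ => η / 2) h' +
      {g | R < fr g}.indicator (fun _ => B') h' := by
    intro h'
    have i2 : 0 ≤ {g | R < fr g}.indicator (fun _ => B') h' := Set.indicator_nonneg (fun _ _ => hB'0.le) _
    by_cases h1 : h' ∈ O
    · rw [Set.indicator_of_mem h1]
      have h2 : ‖ra v h - ra v h'‖ ≤ η0 * ‖ra v h‖ := by
        refine (ra_close v h h').trans ?_
        have h3 := norm_le_ra v h
        have h4 : (|h 0 0 - h' 0 0| + |h 1 0 - h' 1 0| + |h 0 1 - h' 0 1| + |h 1 1 - h' 1 1|) ≤ η0 / fr h := le_of_lt h1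
        calc _ ≤ ‖v‖ * (η0 / fr h) := mul_le_mul_of_nonneg_left h4 (norm_nonneg _)
          _ ≤ (‖ra v h‖ * fr h) * (η0 / fr h) := mul_le_mul_of_nonneg_right h3 (div_nonneg hη0.le (fr_nonneg h))
          _ = _ := by have := fr_pos h; field_simp
      have h5 := abs_le.1 (he _ _ h2)
      have : 0 < p * η / 8 := by positivity
      linarith
    · rw [Set.indicator_of_notMem h1]
      by_cases h2 : R < fr h'
      · rw [Set.indicator_of_mem (by exact h2)]
        have := (abs_le.1 (H.bdd (ra v h'))).2
        have h3 := neg_abs_le M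
        have : 0 < p * η / 8 := by positivity
        linarith
      · have h3 := hD (ra v h') (ra_ne_zero hv h') (by
          refine (norm_ra_le v h').trans_lt ?_
          have h4 := hvs.trans_le (min_le_right _ _)
          rw [lt_div_iff₀ hR] at h4
          push Not at h2
          nlinarith [norm_nonneg v])
        linarith
  have h1 := H.harm v (hvs.trans_le (min_le_left _ _))
  have mO := hOo.measurableSet
  have mR : MeasurableSet {g : SL2 | R < fr g} := measurableSet_lt measurable_const cont_fr.measurable
  have iO : Integrable (O.indicator fun _ => η / 2) μ := (integrable_const _).indicator mO
  have iR : Integrable ({g : SL2 | R < fr g}.indicator fun _ => B') μ := (integrable_const _).indicator mR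
  have h2 : D v ≤ (M + p * η / 8) - p * (η / 2) + μ.real {g | R < fr g} * B' := by
    rw [h1]
    refine (integral_mono (H.int v) (((integrable_const _).sub iO).add iR) hpt).trans ?_
    apply le_of_eq
    simp only [Pi.add_apply, Pi.sub_apply]
    have i3 : Integrable (fun x => M + p * η / 8 - O.indicator (fun _ => η / 2) x) μ := (integrable_const _).sub iO
    rw [integral_add i3 iR, integral_sub (integrable_const _) iO,
      integral_indicator_const _ mO, integral_indicator_const _ mR]
    simp [hp]
  rw [le_div_iff₀ hB'0] at hRt
  have : 0 < p * η := by positivity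
  linarith

lemma step_Sg {μ : Measure SL2} [IsProbabilityMeasure μ] {D : ℂ → ℝ} {B s0 M : ℝ} (H : Hm μ D B s0)
    (hM : ∀ ρ > 0, ∃ s > 0, ∀ v, v ≠ 0 → ‖v‖ < s → D v ≤ M + ρ) {h : SL2} (hh : h ∈ Sg μ) :
    Stepp D M h := by
  induction hh using Submonoid.closure_induction with
  | mem x hx => exact step_mem H hM hx
  | one => intro η hη; exact ⟨η, hη, 1, one_pos, fun v _ _ h => by rwa [ra_one]⟩
  | mul x y _ _ hx hy =>
    intro η hη
    obtain ⟨η1, h1, s1, hs1, k1⟩ := hy η hη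
    obtain ⟨η2, h2, s2, hs2, k2⟩ := hx η1 h1
    refine ⟨η2, h2, min s2 (s1 / fr x), lt_min hs2 (div_pos hs1 (fr_pos x)), fun v hv hvs hd => ?_⟩
    rw [ra_mul]
    refine k1 _ (ra_ne_zero hv x) ((norm_ra_le v x).trans_lt ?_) (k2 v hv (hvs.trans_le (min_le_left _ _)) hd)
    have := hvs.trans_le (min_le_right _ _)
    rwa [lt_div_iff₀ (fr_pos x)] at this

lemma step_fin {μ : Measure SL2} [IsProbabilityMeasure μ] {D : ℂ → ℝ} {M : ℝ} (f : ℕ → SL2)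
    (hf : ∀ i, Stepp D M (f i)) (n : ℕ) {η : ℝ} (hη : 0 < η) : ∃ η' > 0, ∃ s' > 0, ∀ v : ℂ, v ≠ 0 → ‖v‖ < s' →
    M - η' ≤ D v → ∀ i < n, M - η ≤ D (ra v (f i)) := by
  induction n with
  | zero => exact ⟨1, one_pos, 1, one_pos, fun v _ _ _ i hi => absurd hi (by omega)⟩
  | succ n ih =>
    obtain ⟨a, ha, s, hs, k⟩ := ih
    obtain ⟨a', ha', s', hs', k'⟩ := hf n η hη
    refine ⟨min a a', lt_min ha ha', min s s', lt_min hs hs', fun v hv hvs hd i hi => ?_⟩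
    rcases Nat.lt_succ_iff_lt_or_eq.1 hi with hi | rfl
    · exact k v hv (hvs.trans_le (min_le_left _ _)) (by linarith [min_le_left a a']) i hi
    · exact k' v hv (hvs.trans_le (min_le_right _ _)) (by linarith [min_le_right a a'])

lemma pow_dir {k g : SL2} {l : ℝ} (Dd : Dg k g l) {c : ℝ} (hc : 0 < c) {η : ℝ} (hη : 0 < η) : ∃ k0 : ℕ, ∀ j ≥ k0, ∀ v : ℂ,
    c * ‖ra v k‖ ≤ |(ra v k).re| →
    ‖(l ^ j * (ra v k).re) • ra 1 k⁻¹ - ra v (g ^ j)‖ ≤ η * ‖(l ^ j * (ra v k).re) • ra 1 k⁻¹‖ := by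
  have hl0 : 0 < l := by linarith [Dd.l1]
  have hk := fr_pos k
  obtain ⟨k0, hk0⟩ := (eventually_atTop.1 ((tendsto_pow_atTop_atTop_of_one_lt Dd.l1).eventually_ge_atTop (fr k ^ 2 / (η * c) + 1)))
  refine ⟨k0, fun j hj v hv => ?_⟩
  have hlj := hk0 j hj
  set p := ra v k with hp
  obtain ⟨p1, p2, p3, p4⟩ := Dd.pow j
  have e1 : ra v (g ^ j) = (l ^ j * p.re) • ra 1 k⁻¹ + (l⁻¹ ^ j * p.im) • ra Complex.I k⁻¹ := by
    have : ra v (g ^ j) = ra (ra p (k⁻¹ * g ^ j * k)) k⁻¹ := by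
      rw [hp, ← ra_mul, ← ra_mul]; congr 1; group
    rw [this]
    have e2 : ra p (k⁻¹ * g ^ j * k) = (l ^ j * p.re) • (1:ℂ) + (l⁻¹ ^ j * p.im) • Complex.I := by
      apply Complex.ext
      · rw [ra_re, p1, p3]; simp only [Complex.add_re, Complex.smul_re, Complex.one_re, Complex.I_re, smul_eq_mul]; ring
      · rw [ra_im, p2, p4]; simp only [Complex.add_im, Complex.smul_im, Complex.one_im, Complex.I_im, smul_eq_mul]; ring
    rw [e2, ra_add, ra_smul, ra_smul]
  rw [e1, sub_add_cancel_left, norm_neg, norm_smul, norm_smul, Real.norm_eq_abs, Real.norm_eq_abs, abs_mul, abs_mul]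
  have n1 : ‖ra Complex.I k⁻¹‖ ≤ fr k := by have := norm_ra_le Complex.I k⁻¹; rwa [Complex.norm_I, one_mul, fr_inv] at this
  have n2 : 1 ≤ ‖ra 1 k⁻¹‖ * fr k := by have := norm_le_ra 1 k⁻¹; rwa [norm_one, fr_inv] at this
  have n3 := Complex.abs_im_le_norm p
  have hlp : 0 < l ^ j := by positivity
  rw [abs_of_pos hlp, inv_pow, abs_of_pos (inv_pos.2 hlp)]
  have hli : (l ^ j)⁻¹ ≤ 1 := inv_le_one_of_one_le₀ (by have : 0 < fr k ^ 2 / (η * c) := by positivity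
                                                        linarith)
  have q1 : fr k ^ 2 ≤ l ^ j * (η * c) := by
    rw [← div_le_iff₀ (by positivity)]; linarith
  have q2 : (l ^ j)⁻¹ * |p.im| * ‖ra Complex.I k⁻¹‖ ≤ ‖p‖ * fr k := by
    have : (l ^ j)⁻¹ * |p.im| ≤ 1 * ‖p‖ := mul_le_mul hli n3 (abs_nonneg _) zero_le_one
    rw [one_mul] at this
    exact mul_le_mul this n1 (norm_nonneg _) (norm_nonneg _)
  refine q2.trans ?_
  have q3 : l ^ j * |p.re| * (‖ra 1 k⁻¹‖ * fr k) ≥ l ^ j * |p.re| := le_mul_of_one_le_right (by positivity) n2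
  have q4 : l ^ j * (c * ‖p‖) ≤ l ^ j * |p.re| := mul_le_mul_of_nonneg_left hv hlp.le
  have q5 : fr k ^ 2 * ‖p‖ ≤ l ^ j * (η * c) * ‖p‖ := mul_le_mul_of_nonneg_right q1 (norm_nonneg _)
  have : (‖p‖ * fr k) * fr k ≤ (η * (l ^ j * |p.re| * ‖ra 1 k⁻¹‖)) * fr k := by
    calc _ = fr k ^ 2 * ‖p‖ := by ring
      _ ≤ η * (l ^ j * (c * ‖p‖)) := by linarith
      _ ≤ η * (l ^ j * |p.re| * (‖ra 1 k⁻¹‖ * fr k)) := mul_le_mul_of_nonneg_left (q4.trans q3) hη.le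
      _ = _ := by ring
  exact le_of_mul_le_mul_right this hk

lemma exists_cone {k m : SL2} (hm : (k⁻¹ * m * k) 1 0 ≠ 0) : ∃ c > 0, ∀ v : ℂ, c * ‖ra v k‖ ≤ |(ra v k).re| ∨
    c * ‖ra (ra v m) k‖ ≤ |(ra (ra v m) k).re| := by
  set q := k⁻¹ * m * k with hq
  have hf := fr_pos q
  have h10 : 0 < |q 1 0| := abs_pos.2 hm
  refine ⟨min (1/2) (|q 1 0| / (4 * fr q)), by positivity, fun v => ?_⟩
  set c := min (1/2) (|q 1 0| / (4 * fr q)) with hc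
  have c1 : c ≤ 1/2 := min_le_left _ _
  have c2 : c * (4 * fr q) ≤ |q 1 0| := by rw [← le_div_iff₀ (by positivity)]; exact min_le_right _ _
  have c0 : 0 < c := by positivity
  set p := ra v k with hp
  have e : ra (ra v m) k = ra p q := by
    rw [hp, hq, ← ra_mul, ← ra_mul]; congr 1; group
  rw [e]
  by_cases h : c * ‖p‖ ≤ |p.re|
  · exact Or.inl h
  push Not at h
  right
  have h1 := Complex.norm_le_abs_re_add_abs_im p
  have h2 : ‖p‖ / 2 ≤ |p.im| := by nlinarith [norm_nonneg p]
  have h3 := norm_ra_le p q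
  have h4 : |q 0 0| ≤ fr q := abs_e_le q 0 0
  rw [ra_re]
  have h5 : |p.im * q 1 0| ≤ |p.re * q 0 0 + p.im * q 1 0| + |p.re * q 0 0| := by
    have := abs_sub (p.re * q 0 0 + p.im * q 1 0) (p.re * q 0 0)
    simpa using this
  rw [abs_mul, abs_mul] at h5
  have h6 : |p.re| * |q 0 0| ≤ c * ‖p‖ * fr q := mul_le_mul h.le h4 (abs_nonneg _) (by positivity)
  have h7 : ‖p‖ / 2 * (c * (4 * fr q)) ≤ |p.im| * |q 1 0| := mul_le_mul h2 c2 (by positivity) (abs_nonneg _)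
  have h8 : c * ‖ra p q‖ ≤ c * (‖p‖ * fr q) := mul_le_mul_of_nonneg_left h3 c0.le
  linarith

theorem wr_up {μ : Measure SL2} {N : Measure ℂ} (S : Stp μ N) {u : ℂ → ℝ} {B s0 : ℝ} (H : Hm μ u B s0)
    {k g : SL2} {l : ℝ} (Dd : Dg k g l) (hg : g ∈ Sg μ) {ρ : ℝ} (hρ : 0 < ρ) :
    ∃ s > 0, ∀ v : ℂ, v ≠ 0 → ‖v‖ < s → u (l • v) - u v ≤ ρ := by
  haveI := S.pmu
  have HD := H.dl Dd.l1
  set D := Dl u l with hD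
  set T : Set ℝ := {m | ∃ s > 0, ∀ v : ℂ, v ≠ 0 → ‖v‖ < s → D v ≤ m} with hT
  have hTb : BddBelow T := by
    refine ⟨-(2 * B), ?_⟩
    rintro m ⟨s, hs, h⟩
    have h1 := h ((s/2 : ℝ) : ℂ) (by simp [hs.ne']) (by rw [Complex.norm_real, Real.norm_eq_abs, abs_of_pos (half_pos hs)]; linarith)
    have := (abs_le.1 (HD.bdd ((s/2 : ℝ) : ℂ))).1
    linarith
  have hTn : T.Nonempty := ⟨2 * B, 1, one_pos, fun v _ _ => (abs_le.1 (HD.bdd v)).2⟩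
  set M := sInf T with hMd
  have hM : ∀ ρ > 0, ∃ s > 0, ∀ v, v ≠ 0 → ‖v‖ < s → D v ≤ M + ρ := by
    intro ρ hρ
    obtain ⟨m, ⟨s, hs, hm⟩, hlt⟩ := exists_lt_of_csInf_lt hTn (lt_add_of_pos_right M hρ)
    exact ⟨s, hs, fun v hv hvs => (hm v hv hvs).trans hlt.le⟩
  suffices hM0 : M ≤ 0 by
    obtain ⟨s, hs, h⟩ := hM ρ hρ
    exact ⟨s, hs, fun v hv hvs => (h v hv hvs).trans (by linarith)⟩
  by_contra hpos
  push Not at hpos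
  obtain ⟨m, hmS, hm⟩ := nofix_low S k
  obtain ⟨c, hc, hcone⟩ := exists_cone hm
  obtain ⟨η, hη, he⟩ := HD.equi (M/4) (by positivity)
  obtain ⟨k0, hk0⟩ := pow_dir Dd hc hη
  obtain ⟨J, hJ⟩ := exists_nat_gt (4 * B / M)
  rw [div_lt_iff₀ hpos] at hJ
  have hM4 : 0 < M / 4 := by positivity
  obtain ⟨a1, ha1, s1, hs1, f1⟩ := step_fin (μ := μ) (fun j => g ^ j)
    (fun j => step_Sg HD hM ((Sg μ).pow_mem hg j)) (k0 + J) hM4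
  obtain ⟨a2, ha2, s2, hs2, f2⟩ := step_fin (μ := μ) (fun j => m * g ^ j)
    (fun j => step_Sg HD hM ((Sg μ).mul_mem hmS ((Sg μ).pow_mem hg j))) (k0 + J) hM4
  have hnT : M - min a1 a2 ∉ T := by
    intro h
    have := csInf_le hTb h
    have : 0 < min a1 a2 := lt_min ha1 ha2
    linarith
  simp only [hT, Set.mem_setOf_eq, not_exists, not_and, not_forall, not_le] at hnT
  obtain ⟨v, hv, hvs, hDv⟩ := hnT (min s1 s2) (lt_min hs1 hs2)
  have g1 := f1 v hv (hvs.trans_le (min_le_left _ _)) (by linarith [min_le_left a1 a2])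
  have g2 := f2 v hv (hvs.trans_le (min_le_right _ _)) (by linarith [min_le_right a1 a2])
  have key : ∀ y : ℂ, c * ‖ra y k‖ ≤ |(ra y k).re| → ¬ (∀ j < k0 + J, M - M / 4 ≤ D (ra y (g ^ j))) := by
    intro y hy hall
    set e : ℕ → ℂ := fun j => (l ^ j * (ra y k).re) • ra 1 k⁻¹ with hedef
    have e1 : ∀ j, D (e j) = u (e (j+1)) - u (e j) := by
      intro j
      rw [hD, Dl, hedef]
      simp only [smul_smul]
      congr 3
      ring
    have e2 : ∀ i < J, M / 2 ≤ u (e (k0 + i + 1)) - u (e (k0 + i)) := by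
      intro i hi
      rw [← e1]
      have h1 := hall (k0 + i) (by omega)
      have h2 := abs_le.1 (he _ _ (hk0 (k0 + i) (by omega) y hy))
      change _ ∧ D (e (k0 + i)) - _ ≤ _ at h2
      have h3 : -(M/4) ≤ D (e (k0 + i)) - D (ra y (g ^ (k0 + i))) := h2.1
      linarith
    have e3 : ∀ n ≤ J, n * (M / 2) ≤ u (e (k0 + n)) - u (e k0) := by
      intro n
      induction n with
      | zero => intro _; simp
      | succ n ih =>
        intro hn
        have h1 := ih (by omega)
        have h2 := e2 n (by omega)
        push_cast
        rw [← add_assoc]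
        linarith
    have h1 := e3 J le_rfl
    have h2 := abs_le.1 (H.bdd (e (k0 + J)))
    have h3 := abs_le.1 (H.bdd (e k0))
    linarith
  rcases hcone v with h | h
  · exact key v h g1
  · exact key (ra v m) h fun j hj => by rw [← ra_mul]; exact g2 j hj

def Per (u : ℂ → ℝ) (a : ℝ) : Prop := ∀ ρ > 0, ∃ s > 0, ∀ v : ℂ, v ≠ 0 → ‖v‖ < s → |u (Real.exp a • v) - u v| ≤ ρ

lemma per_zero (u : ℂ → ℝ) : Per u 0 := fun ρ hρ => ⟨1, one_pos, fun v _ _ => by simp [hρ.le]⟩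

lemma per_add {u : ℂ → ℝ} {a b : ℝ} (ha : Per u a) (hb : Per u b) : Per u (a + b) := by
  intro ρ hρ
  obtain ⟨s, hs, h1⟩ := ha (ρ/2) (half_pos hρ)
  obtain ⟨t, ht, h2⟩ := hb (ρ/2) (half_pos hρ)
  refine ⟨min (s / Real.exp b) t, by positivity, fun v hv hvs => ?_⟩
  have k1 := hvs.trans_le (min_le_left _ _)
  rw [lt_div_iff₀ (Real.exp_pos _)] at k1
  have k2 := abs_le.1 (h1 (Real.exp b • v) (smul_ne_zero (Real.exp_pos _).ne' hv) (by
    rw [norm_smul, Real.norm_eq_abs, abs_of_pos (Real.exp_pos _)]; linarith))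
  have k3 := abs_le.1 (h2 v hv (hvs.trans_le (min_le_right _ _)))
  rw [smul_smul, ← Real.exp_add] at k2
  rw [abs_le]; constructor <;> linarith

lemma per_neg {u : ℂ → ℝ} {a : ℝ} (ha : Per u a) : Per u (-a) := by
  intro ρ hρ
  obtain ⟨s, hs, h1⟩ := ha ρ hρ
  refine ⟨s / Real.exp (-a), by positivity, fun v hv hvs => ?_⟩
  rw [lt_div_iff₀ (Real.exp_pos _)] at hvs
  have k2 := h1 (Real.exp (-a) • v) (smul_ne_zero (Real.exp_pos _).ne' hv) (by
    rw [norm_smul, Real.norm_eq_abs, abs_of_pos (Real.exp_pos _)]; linarith)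
  rw [smul_smul, ← Real.exp_add, add_neg_cancel, Real.exp_zero, one_smul, abs_sub_comm] at k2
  exact k2

lemma per_Hs {μ : Measure SL2} {N : Measure ℂ} (S : Stp μ N) {u : ℂ → ℝ} {B s0 : ℝ} (H : Hm μ u B s0)
    {a : ℝ} (ha : a ∈ Hs μ) : Per u a := by
  obtain ⟨h0, g, hg, ht⟩ := ha
  obtain ⟨k, hk⟩ := hyp_frame (Real.one_lt_exp_iff.2 h0) ht
  have Dd : Dg k g (Real.exp a) := ⟨Real.one_lt_exp_iff.2 h0, hk.1, hk.2.1, hk.2.2.1, hk.2.2.2⟩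
  intro ρ hρ
  obtain ⟨s, hs, h1⟩ := wr_up S H Dd hg hρ
  obtain ⟨t, ht, h2⟩ := wr_up S H.neg Dd hg hρ
  refine ⟨min s t, lt_min hs ht, fun v hv hvs => ?_⟩
  have k1 := h1 v hv (hvs.trans_le (min_le_left _ _))
  have k2 := h2 v hv (hvs.trans_le (min_le_right _ _))
  rw [abs_le]; constructor <;> linarith

lemma per_closure {μ : Measure SL2} {N : Measure ℂ} (S : Stp μ N) {u : ℂ → ℝ} {B s0 : ℝ} (H : Hm μ u B s0)
    {a : ℝ} (ha : a ∈ AddSubgroup.closure (Hs μ)) : Per u a := by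
  induction ha using AddSubgroup.closure_induction with
  | mem x hx => exact per_Hs S H hx
  | zero => exact per_zero u
  | add x y _ _ hx hy => exact per_add hx hy
  | neg x _ hx => exact per_neg hx

lemma Hm_UU {μ : Measure SL2} {a C} [IsProbabilityMeasure μ] (P : Pot μ a C) {w : ℂ → ℝ} {s t : ℝ} (W : Wt w s t) :
    ∃ B, Hm μ (UU μ w) B s := by
  obtain ⟨D, hD⟩ := UL_bdd P W
  refine ⟨D + 1, (meas_UL μ W.cont.measurable).ennreal_toReal, by positivity, fun v => ?_, W.s0, fun ε hε => UU_equi P W hε,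
    fun v hv => UU_rec μ W.cont.measurable hD (W.supp v fun h => absurd h.1 (by linarith))⟩
  rw [UU, abs_of_nonneg ENNReal.toReal_nonneg]
  have := ENNReal.toReal_mono ENNReal.coe_ne_top (hD v)
  rw [ENNReal.coe_toReal] at this
  linarith

/-- scale invariance of potentials near zero -/
theorem UU_scale {μ : Measure SL2} {N : Measure ℂ} (S : Stp μ N) {a C} (P : Pot μ a C) {w : ℂ → ℝ} {s t : ℝ} (W : Wt w s t)
    {ε : ℝ} (hε : 0 < ε) : ∃ s' > 0, ∀ v : ℂ, v ≠ 0 → ‖v‖ < s' → ∀ b : ℝ, 0 ≤ b → b ≤ 1 →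
      |UU μ w (Real.exp b • v) - UU μ w v| ≤ ε := by
  haveI := S.pmu
  obtain ⟨B, H⟩ := Hm_UU P W
  obtain ⟨η, hη, he⟩ := H.equi (ε/2) (half_pos hε)
  obtain ⟨κ, hκ, hκ2⟩ : ∃ κ > 0, ∀ d : ℝ, 0 ≤ d → d < κ → |Real.exp d - 1| ≤ η := by
    have : ContinuousAt Real.exp 0 := Real.continuous_exp.continuousAt
    obtain ⟨κ, hκ, h⟩ := Metric.continuousAt_iff.1 this η hη
    refine ⟨κ, hκ, fun d hd hdk => ?_⟩
    have := h (x := d) (by rwa [Real.dist_eq, sub_zero, abs_of_nonneg hd])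
    rw [Real.dist_eq, Real.exp_zero] at this
    exact this.le
  obtain ⟨a0, ha0, ha1, ha2⟩ := Hs_small S hκ
  obtain ⟨n, hn⟩ := exists_nat_gt (1 / a0)
  rw [div_lt_iff₀ ha1] at hn
  have hper : ∀ m : ℕ, Per (UU μ w) (m * a0) := fun m => per_closure S H (by
    have := AddSubgroup.nsmul_mem _ ha0 m
    rwa [nsmul_eq_mul] at this)
  have hall : ∀ m : ℕ, ∃ s' > 0, ∀ j < m, ∀ v : ℂ, v ≠ 0 → ‖v‖ < s' →
      |UU μ w (Real.exp (j * a0) • v) - UU μ w v| ≤ ε / 2 := by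
    intro m
    induction m with
    | zero => exact ⟨1, one_pos, fun j hj => absurd hj (by omega)⟩
    | succ m ih =>
      obtain ⟨s1, h1, k1⟩ := ih
      obtain ⟨s2, h2, k2⟩ := hper m (ε/2) (half_pos hε)
      refine ⟨min s1 s2, lt_min h1 h2, fun j hj v hv hvs => ?_⟩
      rcases Nat.lt_succ_iff_lt_or_eq.1 hj with hj | rfl
      · exact k1 j hj v hv (hvs.trans_le (min_le_left _ _))
      · exact k2 v hv (hvs.trans_le (min_le_right _ _))
  obtain ⟨s', hs', hs⟩ := hall (n + 1)
  refine ⟨s', hs', fun v hv hvs b hb hb1 => ?_⟩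
  set j := ⌊b / a0⌋₊ with hj
  have j1 : (j:ℝ) * a0 ≤ b := by rw [← le_div_iff₀ ha1]; exact Nat.floor_le (by positivity)
  have j2 : b < (j + 1) * a0 := by rw [← div_lt_iff₀ ha1]; exact Nat.lt_floor_add_one _
  have j3 : j < n + 1 := by
    have : (j:ℝ) * a0 < n * a0 := by linarith
    have : (j:ℝ) < n := lt_of_mul_lt_mul_right this ha1.le
    have : j < n := by exact_mod_cast this
    omega
  have h1 := abs_le.1 (hs j j3 v hv hvs)
  have h2 := abs_le.1 (he (Real.exp (j * a0) • v) (Real.exp b • v) (by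
    have : Real.exp b = Real.exp (b - j * a0) * Real.exp (j * a0) := by rw [← Real.exp_add]; congr 1; ring
    rw [this, mul_smul, ← norm_neg, neg_sub]
    have : Real.exp (b - j * a0) • Real.exp (j * a0) • v - Real.exp (j * a0) • v =
      (Real.exp (b - j * a0) - 1) • Real.exp (j * a0) • v := by rw [sub_smul, one_smul]
    rw [this, norm_smul]
    exact mul_le_mul_of_nonneg_right (hκ2 _ (by linarith) (by linarith)) (norm_nonneg _)))
  rw [abs_le]; constructor <;> linarith

end

noncomputable section
open scoped ENNReal NNReal Topology

def ph (v x : ℂ) : ℝ := cr v x / dt v x / ‖v‖ ^ 2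

lemma ph_smul (c : ℝ) (hc : c ≠ 0) (v x : ℂ) : ph (c • v) x = ph v x / c ^ 2 := by
  unfold ph
  rw [cr_smul_left, dt_smul_left, norm_smul, Real.norm_eq_abs, mul_pow, sq_abs, mul_div_mul_left _ _ hc]
  rw [div_div, div_div, div_div]; congr 1; ring

def kI (N : Measure ℂ) (v : ℂ) : ℂ := ∫ x, Complex.exp (Complex.I * (ph v x : ℝ)) ∂N

def kk (N : Measure ℂ) (v : ℂ) : ℝ := ‖kI N v‖ ^ 2

lemma meas_ph : Measurable fun p : ℂ × ℂ => ph p.1 p.2 :=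
  ((measurable_fst.cr' measurable_snd).div (measurable_fst.dt' measurable_snd)).div (measurable_fst.norm.pow_const 2)

lemma meas_ph1 (v : ℂ) : Measurable (ph v) := meas_ph.comp (measurable_const.prodMk measurable_id)

lemma norm_expI (t : ℝ) : ‖Complex.exp (Complex.I * (t:ℝ))‖ = 1 := by
  rw [mul_comm]; exact Complex.norm_exp_ofReal_mul_I t

lemma kI_le (N : Measure ℂ) [IsProbabilityMeasure N] (v : ℂ) : ‖kI N v‖ ≤ 1 := by
  refine (norm_integral_le_of_norm_le_const (C := 1) (ae_of_all _ fun x => (norm_expI _).le)).trans ?_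
  simp

lemma kk_nonneg (N : Measure ℂ) (v : ℂ) : 0 ≤ kk N v := by unfold kk; positivity

lemma cont_kI {μ N} (S : Stp μ N) {v : ℂ} (hv : v ≠ 0) : ContinuousAt (kI N) v := by
  haveI := S.pN
  refine continuousAt_of_dominated (bound := fun _ => 1) ?_ ?_ (integrable_const _) ?_
  · refine Eventually.of_forall fun y => Measurable.aestronglyMeasurable ?_
    have := meas_ph1 y
    fun_prop
  · exact Eventually.of_forall fun y => ae_of_all _ fun x => (norm_expI _).le
  · have h0 : ∀ᵐ x ∂N, dt v x ≠ 0 := by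
      rw [ae_iff]; simpa using dt_null S hv
    filter_upwards [h0] with x hx
    have h1 : ContinuousAt (fun y => ph y x) v := by
      unfold ph
      refine ContinuousAt.div (ContinuousAt.div ?_ ?_ hx) ?_ ?_
      · exact (continuous_id.cr' continuous_const).continuousAt
      · exact (continuous_id.dt' continuous_const).continuousAt
      · fun_prop
      · have := norm_pos_iff.2 hv; positivity
    have h2 : Continuous fun t : ℝ => Complex.exp (Complex.I * (t:ℝ)) := by fun_prop
    exact ContinuousAt.comp (g := fun t : ℝ => Complex.exp (Complex.I * (t:ℝ))) h2.continuousAt h1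

lemma meas_kI (N : Measure ℂ) [IsProbabilityMeasure N] : Measurable (kI N) := by
  have h : StronglyMeasurable fun p : ℂ × ℂ => Complex.exp (Complex.I * (ph p.1 p.2 : ℝ)) := by
    have := meas_ph
    exact Measurable.stronglyMeasurable (by fun_prop)
  exact (h.integral_prod_right' (ν := N)).measurable

/-- oscillatory integral -/
lemma osc_bd {l : ℝ} (hl : l ≠ 0) : ‖∫ S in (0:ℝ)..1, Complex.exp (Complex.I * ((l * Real.exp (-(2 * S)) : ℝ) : ℂ))‖ ≤
    2 * Real.exp 2 / |l| := by
  set E : ℝ → ℂ := fun S => Complex.exp (Complex.I * ((l * Real.exp (-(2 * S)) : ℝ) : ℂ)) with hE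
  set G : ℝ → ℂ := fun S => E S * ((Real.exp (2 * S) : ℝ) : ℂ) * (-(2 * Complex.I * l))⁻¹ with hG
  have hcl : (l : ℂ) ≠ 0 := by exact_mod_cast hl
  have hEc : Continuous E := by rw [hE]; fun_prop
  have hGc : Continuous G := by rw [hG]; fun_prop
  have hder : ∀ S, HasDerivAt G (E S + 2 * G S) S := by
    intro S
    have d1 : HasDerivAt (fun S : ℝ => l * Real.exp (-(2 * S))) (l * (Real.exp (-(2 * S)) * (-(2 * 1)))) S :=
      ((((hasDerivAt_id S).const_mul 2).neg).exp).const_mul l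
    have d2 : HasDerivAt E (E S * (Complex.I * ((l * (Real.exp (-(2 * S)) * (-(2 * 1))) : ℝ) : ℂ))) S :=
      ((d1.ofReal_comp).const_mul Complex.I).cexp
    have d3 : HasDerivAt (fun S : ℝ => ((Real.exp (2 * S) : ℝ) : ℂ)) ((Real.exp (2 * S) * (2 * 1) : ℝ) : ℂ) S :=
      ((((hasDerivAt_id S).const_mul 2)).exp).ofReal_comp
    have d4 := (d2.mul d3).mul_const (-(2 * Complex.I * l))⁻¹
    refine d4.congr_deriv ?_
    have e1 : ((Real.exp (-(2 * S)) : ℝ) : ℂ) * ((Real.exp (2 * S) : ℝ) : ℂ) = 1 := by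
      rw [← Complex.ofReal_mul, ← Real.exp_add]; simp
    have e2 : (-(2 * Complex.I * (l:ℂ))) * (-(2 * Complex.I * l))⁻¹ = 1 :=
      mul_inv_cancel₀ (neg_ne_zero.2 (mul_ne_zero (mul_ne_zero two_ne_zero Complex.I_ne_zero) hcl))
    simp only [hG]
    push_cast
    push_cast at e1
    linear_combination (E S * (-(2 * Complex.I * (l:ℂ))) * (-(2 * Complex.I * l))⁻¹) * e1 + E S * e2
  have hftc := intervalIntegral.integral_eq_sub_of_hasDerivAt (a := 0) (b := 1) (fun S _ => hder S)
    ((hEc.add (continuous_const.mul hGc)).intervalIntegrable _ _)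
  have i2 : IntervalIntegrable (fun S => 2 * G S) volume 0 1 := (continuous_const.mul hGc).intervalIntegrable _ _
  rw [intervalIntegral.integral_add (hEc.intervalIntegrable _ _) i2,
    intervalIntegral.integral_const_mul] at hftc
  have hGb : ∀ S : ℝ, S ≤ 1 → ‖G S‖ ≤ Real.exp 2 / (2 * |l|) := by
    intro S hS
    simp only [hG, hE, norm_mul, norm_inv, norm_neg, norm_expI, Complex.norm_real, Real.norm_eq_abs, Complex.norm_I]
    rw [abs_of_pos (Real.exp_pos _)]
    have : Real.exp (2 * S) ≤ Real.exp 2 := Real.exp_le_exp.2 (by linarith)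
    rw [one_mul, ← div_eq_mul_inv]
    simp only [Complex.norm_ofNat, mul_one]
    exact div_le_div_of_nonneg_right this (by positivity)
  have hI : ‖∫ S in (0:ℝ)..1, G S‖ ≤ Real.exp 2 / (2 * |l|) := by
    have := intervalIntegral.norm_integral_le_of_norm_le_const (a := (0:ℝ)) (b := 1) (f := G) (C := Real.exp 2 / (2 * |l|))
      (fun S hS => hGb S (by rw [Set.uIoc_of_le zero_le_one] at hS; exact hS.2))
    simpa using this
  have e : (∫ S in (0:ℝ)..1, E S) = G 1 - G 0 - 2 * ∫ S in (0:ℝ)..1, G S := by rw [← hftc]; ring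
  rw [e]
  refine (norm_sub_le _ _).trans ?_
  have h1 := norm_sub_le (G 1) (G 0)
  have h2 := hGb 1 le_rfl
  have h3 := hGb 0 zero_le_one
  rw [norm_mul, Complex.norm_ofNat]
  have : 2 * Real.exp 2 / |l| = 4 * (Real.exp 2 / (2 * |l|)) := by
    have := abs_pos.2 hl
    field_simp; ring
  rw [this]; linarith

lemma ph_sub {v x y : ℂ} (hv : v ≠ 0) (hx : dt v x ≠ 0) (hy : dt v y ≠ 0) :
    |cr x y| ≤ |ph v x - ph v y| * (‖v‖ ^ 2 * (‖x‖ * ‖y‖)) := by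
  have hn : ‖v‖ ^ 2 ≠ 0 := by have := norm_pos_iff.2 hv; positivity
  have e : (ph v x - ph v y) * (dt v x * dt v y) = - cr x y := by
    unfold ph
    field_simp
    rw [nsq]
    simp only [cr, dt]; ring
  have h := congrArg abs e
  rw [abs_neg, abs_mul, abs_mul] at h
  rw [← h]
  refine mul_le_mul_of_nonneg_left ?_ (abs_nonneg _)
  calc _ ≤ (‖v‖ * ‖x‖) * (‖v‖ * ‖y‖) := mul_le_mul (abs_dt_le v x) (abs_dt_le v y) (abs_nonneg _) (by positivity)
    _ = _ := by ring

lemma ph_bad {μ N} (S : Stp μ N) {η : ℝ} (hη : 0 < η) : ∃ δ > 0, ∀ v : ℂ, v ≠ 0 →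
    (N.prod N) {p | |ph v p.1 - ph v p.2| < δ / ‖v‖ ^ 2} ≤ ENNReal.ofReal η := by
  haveI := S.pN
  obtain ⟨δ, hδ, h⟩ := omega_small S hη
  refine ⟨δ, hδ, fun v hv => ?_⟩
  have hm : MeasurableSet {p : ℂ × ℂ | |ph v p.1 - ph v p.2| < δ / ‖v‖ ^ 2} := by
    have h1 : Measurable fun p : ℂ × ℂ => ph v p.1 := (meas_ph1 v).comp measurable_fst
    have h2 : Measurable fun p : ℂ × ℂ => ph v p.2 := (meas_ph1 v).comp measurable_snd
    exact measurableSet_lt ((h1.sub h2).abs) measurable_const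
  rw [Measure.prod_apply hm]
  have h0 : ∀ᵐ x ∂N, dt v x ≠ 0 := by
    rw [ae_iff]; simpa using dt_null S hv
  have hb : ∀ᵐ x ∂N, N (Prod.mk x ⁻¹' {p : ℂ × ℂ | |ph v p.1 - ph v p.2| < δ / ‖v‖ ^ 2}) ≤ ENNReal.ofReal η := by
    filter_upwards [h0, ae_ne_zero S] with x hx hx0
    refine le_trans (measure_mono_ae ?_) (h (Complex.I * x) (mul_ne_zero Complex.I_ne_zero hx0))
    filter_upwards [h0] with y hy hmem
    change |ph v x - ph v y| < δ / ‖v‖ ^ 2 at hmem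
    change |dt (Complex.I * x) y| ≤ δ * ‖Complex.I * x‖ * ‖y‖
    rw [dt_I, norm_mul, Complex.norm_I, one_mul]
    have hn := norm_pos_iff.2 hv
    rw [lt_div_iff₀ (by positivity)] at hmem
    refine (ph_sub hv hx hy).trans ?_
    nlinarith [mul_nonneg (norm_nonneg x) (norm_nonneg y)]
  refine (lintegral_mono_ae hb).trans ?_
  simp

lemma kk_double (N : Measure ℂ) [IsProbabilityMeasure N] (v : ℂ) : ((kk N v : ℝ) : ℂ) =
    ∫ p, Complex.exp (Complex.I * ((ph v p.1 - ph v p.2 : ℝ) : ℂ)) ∂(N.prod N) := by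
  have : ∀ p : ℂ × ℂ, Complex.exp (Complex.I * ((ph v p.1 - ph v p.2 : ℝ) : ℂ)) =
      Complex.exp (Complex.I * (ph v p.1 : ℝ)) * (starRingEnd ℂ) (Complex.exp (Complex.I * (ph v p.2 : ℝ))) := by
    intro p
    rw [← Complex.exp_conj, ← Complex.exp_add]
    congr 1
    simp; ring
  simp_rw [this]
  rw [integral_prod_mul (f := fun x => Complex.exp (Complex.I * (ph v x : ℝ)))
    (g := fun x => (starRingEnd ℂ) (Complex.exp (Complex.I * (ph v x : ℝ)))), integral_conj]
  rw [kk]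
  push_cast
  exact (Complex.mul_conj' _).symm

lemma kk_avg {μ N} (S : Stp μ N) {η : ℝ} (hη : 0 < η) : ∃ δ > 0, ∀ v : ℂ, v ≠ 0 →
    ∫⁻ b in Set.Ioc (0:ℝ) 1, ENNReal.ofReal (kk N (Real.exp b • v)) ≤ ENNReal.ofReal (η + 2 * Real.exp 2 * ‖v‖ ^ 2 / δ) := by
  haveI := S.pN
  obtain ⟨δ, hδ, h⟩ := ph_bad S hη
  refine ⟨δ, hδ, fun v hv => ?_⟩
  have hn := norm_pos_iff.2 hv
  have hkm : Measurable fun b : ℝ => kk N (Real.exp b • v) :=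
    ((meas_kI N).comp (by fun_prop : Measurable fun b : ℝ => Real.exp b • v)).norm.pow_const 2
  have hk1 : ∀ v, kk N v ≤ 1 := fun v => by unfold kk; exact pow_le_one₀ (norm_nonneg _) (kI_le N v)
  have hki : Integrable (fun b : ℝ => kk N (Real.exp b • v)) (volume.restrict (Set.Ioc (0:ℝ) 1)) :=
    Integrable.of_bound hkm.aestronglyMeasurable 1 (ae_of_all _ fun b => by
      rw [Real.norm_eq_abs, abs_of_nonneg (kk_nonneg _ _)]; exact hk1 _)
  rw [← ofReal_integral_eq_lintegral_ofReal hki (ae_of_all _ fun b => kk_nonneg _ _)]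
  apply ENNReal.ofReal_le_ofReal
  set L : ℂ × ℂ → ℝ := fun p => ph v p.1 - ph v p.2 with hL
  have hLm : Measurable L := ((meas_ph1 v).comp measurable_fst).sub ((meas_ph1 v).comp measurable_snd)
  set J : ℂ × ℂ → ℂ := fun p => ∫ b in Set.Ioc (0:ℝ) 1, Complex.exp (Complex.I * ((L p * Real.exp (-(2 * b)) : ℝ) : ℂ)) with hJ
  have e1 : ((∫ b in Set.Ioc (0:ℝ) 1, kk N (Real.exp b • v) : ℝ) : ℂ) = ∫ p, J p ∂(N.prod N) := by
    rw [← integral_complex_ofReal]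
    have : ∀ b : ℝ, ((kk N (Real.exp b • v) : ℝ) : ℂ) = ∫ p, Complex.exp (Complex.I * ((L p * Real.exp (-(2 * b)) : ℝ) : ℂ)) ∂(N.prod N) := by
      intro b
      rw [kk_double]
      congr 1; ext p
      rw [ph_smul _ (Real.exp_pos b).ne', ph_smul _ (Real.exp_pos b).ne', hL, Real.exp_neg]
      have : Real.exp b ^ 2 = Real.exp (2 * b) := by rw [← Real.exp_nat_mul]; norm_num
      rw [this, ← sub_div, div_eq_mul_inv]
    simp_rw [this]
    rw [integral_integral_swap]
    refine Integrable.of_bound (C := 1) (Measurable.aestronglyMeasurable ?_) (ae_of_all _ fun q => (norm_expI _).le)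
    simp only [Function.uncurry_def]
    fun_prop
  have hJ1 : ∀ p, ‖J p‖ ≤ 1 := by
    intro p
    refine (norm_integral_le_of_norm_le_const (C := 1) (ae_of_all _ fun x => (norm_expI _).le)).trans ?_
    simp
  have hJ2 : ∀ p, L p ≠ 0 → ‖J p‖ ≤ 2 * Real.exp 2 / |L p| := by
    intro p hp
    have := osc_bd hp
    rwa [intervalIntegral.integral_of_le zero_le_one] at this
  have e2 : ∫ b in Set.Ioc (0:ℝ) 1, kk N (Real.exp b • v) ≤ ‖∫ p, J p ∂(N.prod N)‖ := by
    rw [← e1, Complex.norm_real]; exact le_abs_self _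
  set A := {p : ℂ × ℂ | |ph v p.1 - ph v p.2| < δ / ‖v‖ ^ 2} with hA
  have hAm : MeasurableSet A := measurableSet_lt hLm.abs measurable_const
  refine e2.trans ?_
  have hpt : ∀ p, ‖J p‖ ≤ A.indicator (fun _ => (1:ℝ)) p + 2 * Real.exp 2 * ‖v‖ ^ 2 / δ := by
    intro p
    by_cases hp : p ∈ A
    · rw [Set.indicator_of_mem hp]
      have : 0 ≤ 2 * Real.exp 2 * ‖v‖ ^ 2 / δ := by positivity
      linarith [hJ1 p]
    · rw [Set.indicator_of_notMem hp, zero_add]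
      have hp' : δ / ‖v‖ ^ 2 ≤ |L p| := not_lt.1 hp
      have h3 : 0 < |L p| := lt_of_lt_of_le (by positivity) hp'
      refine (hJ2 p (abs_pos.1 h3)).trans ?_
      rw [div_le_div_iff₀ h3 hδ]
      rw [div_le_iff₀ (by positivity)] at hp'
      have : 0 < Real.exp 2 := Real.exp_pos _
      nlinarith
  have hintg : Integrable (fun p => A.indicator (fun _ => (1:ℝ)) p + 2 * Real.exp 2 * ‖v‖ ^ 2 / δ) (N.prod N) :=
    ((integrable_const _).indicator hAm).add (integrable_const _)
  refine (norm_integral_le_of_norm_le hintg (ae_of_all _ hpt)).trans ?_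
  rw [integral_add ((integrable_const _).indicator hAm) (integrable_const _), integral_indicator_const _ hAm]
  have h5 : (N.prod N).real A ≤ η := ENNReal.toReal_le_of_le_ofReal hη.le (h v hv)
  simp only [smul_eq_mul, mul_one, integral_const, probReal_univ, one_mul]
  linarith

/-- cutoff -/
def cut (s t y : ℝ) : ℝ := max 0 (min 1 (min (2 * y / s - 1) (2 - y / t)))

lemma cut_cont (s t : ℝ) : Continuous (cut s t) := by unfold cut; fun_prop

lemma cut_nn (s t y : ℝ) : 0 ≤ cut s t y := le_max_left _ _

lemma cut_le (s t y : ℝ) : cut s t y ≤ 1 := max_le zero_le_one (min_le_left _ _)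

lemma cut_one {s t y : ℝ} (hs : 0 < s) (ht : 0 < t) (h1 : s ≤ y) (h2 : y ≤ t) : cut s t y = 1 := by
  unfold cut
  have a1 : 1 ≤ y / s := (one_le_div₀ hs).2 h1
  have a2 : y / t ≤ 1 := (div_le_one₀ ht).2 h2
  rw [min_eq_left (le_min (by rw [mul_div_assoc]; linarith) (by linarith))]
  exact max_eq_right zero_le_one

lemma cut_zero1 {s t y : ℝ} (hs : 0 < s) (h : y ≤ s / 2) : cut s t y = 0 := by
  unfold cut
  apply max_eq_left
  refine (min_le_right _ _).trans ((min_le_left _ _).trans ?_)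
  have : 2 * y / s ≤ 1 := (div_le_one₀ hs).2 (by linarith)
  linarith

lemma cut_zero2 {s t y : ℝ} (ht : 0 < t) (h : 2 * t ≤ y) : cut s t y = 0 := by
  unfold cut
  apply max_eq_left
  refine (min_le_right _ _).trans ((min_le_right _ _).trans ?_)
  have : 2 ≤ y / t := by rwa [le_div_iff₀ ht]
  linarith

def ww (N : Measure ℂ) (s t : ℝ) (v : ℂ) : ℝ := cut s t ‖v‖ * kk N v

lemma Wt_ww {μ N} (S : Stp μ N) {s t : ℝ} (hs : 0 < s) (ht : 0 < t) : Wt (ww N s t) (s/2) (2*t) where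
  cont := by
    rw [continuous_iff_continuousAt]
    intro v
    by_cases hv : v = 0
    · have : ww N s t =ᶠ[𝓝 v] fun _ => 0 := by
        have : ∀ᶠ y in 𝓝 v, ‖y‖ < s / 2 := by
          have hc : ContinuousAt (fun y : ℂ => ‖y‖) v := continuous_norm.continuousAt
          exact hc.eventually_lt_const (by simp only [hv, norm_zero]; positivity)
        filter_upwards [this] with y hy
        rw [ww, cut_zero1 hs hy.le, zero_mul]
      exact (continuousAt_const.congr this.symm)
    · exact (((cut_cont s t).comp continuous_norm).continuousAt).mul ((cont_kI S hv).norm.pow 2)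
  nn v := mul_nonneg (cut_nn _ _ _) (kk_nonneg _ _)
  s0 := by positivity
  t0 := by positivity
  supp v hv := by
    simp only [An, Set.mem_setOf_eq, not_and_or, not_le] at hv
    rcases hv with h | h
    · rw [ww, cut_zero1 hs h.le, zero_mul]
    · rw [ww, cut_zero2 ht h.le, zero_mul]

lemma ww_le {N : Measure ℂ} (s t : ℝ) (v : ℂ) : ww N s t v ≤ kk N v :=
  mul_le_of_le_one_left (kk_nonneg _ _) (cut_le _ _ _)

/-- (P8) -/
theorem P8 {μ N} (S : Stp μ N) {a C} (P : Pot μ a C) (K : ℕ) {ε : ℝ} (hε : 0 < ε) : ∃ s > 0, ∃ s' > 0,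
    ∀ v : ℂ, v ≠ 0 → ‖v‖ < s' → UL μ (ww N s (s * Real.exp K)) v ≤ ENNReal.ofReal ε := by
  haveI := S.pmu
  haveI := S.pN
  set Q : ℝ := (K + 4 + 1) * (3 * C) with hQ
  have hQ0 : 0 ≤ Q := by positivity
  obtain ⟨δ, hδ, hk⟩ := kk_avg S (η := ε / (4 * (Q + 1))) (by positivity)
  -- choose T
  obtain ⟨T, hT, hT2⟩ : ∃ T > 0, 2 * Real.exp 2 * (2 * T) ^ 2 / δ ≤ ε / (4 * (Q + 1)) := by
    refine ⟨Real.sqrt (ε / (4 * (Q + 1)) * δ / (8 * Real.exp 2)), Real.sqrt_pos.2 (by positivity), ?_⟩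
    rw [mul_pow, Real.sq_sqrt (by positivity)]
    apply le_of_eq
    field_simp; norm_num
  set s := T * Real.exp (-K) with hs
  have hs0 : 0 < s := by positivity
  have hsT : s * Real.exp K = T := by rw [hs, mul_assoc, ← Real.exp_add]; simp
  have W := Wt_ww S hs0 hT
  obtain ⟨s', hs', hsc⟩ := UU_scale S P W (half_pos hε)
  obtain ⟨D, hD⟩ := UL_bdd P W
  refine ⟨s, hs0, s', hs', fun v hv hvs => ?_⟩
  rw [hsT]
  set w := ww N s T with hw
  have hwm : Measurable w := W.cont.measurable
  have h1 : ∀ b : ℝ, b ∈ Set.Ioc (0:ℝ) 1 → UL μ w v ≤ UL μ w (Real.exp b • v) + ENNReal.ofReal (ε / 2) := by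
    intro b hb
    have h := (abs_le.1 (hsc v hv hvs b hb.1.le hb.2)).1
    unfold UU at h
    have f1 : UL μ w v ≠ ⊤ := ((hD _).trans_lt ENNReal.coe_lt_top).ne
    have f2 : UL μ w (Real.exp b • v) ≠ ⊤ := ((hD _).trans_lt ENNReal.coe_lt_top).ne
    rw [← ENNReal.ofReal_toReal f1, ← ENNReal.ofReal_toReal f2, ← ENNReal.ofReal_add ENNReal.toReal_nonneg (by positivity)]
    exact ENNReal.ofReal_le_ofReal (by linarith)
  have h2 : UL μ w v ≤ (∫⁻ b in Set.Ioc (0:ℝ) 1, UL μ w (Real.exp b • v)) + ENNReal.ofReal (ε / 2) := by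
    calc UL μ w v = ∫⁻ b in Set.Ioc (0:ℝ) 1, UL μ w v := by simp
      _ ≤ ∫⁻ b in Set.Ioc (0:ℝ) 1, (UL μ w (Real.exp b • v) + ENNReal.ofReal (ε / 2)) :=
        setLIntegral_mono' measurableSet_Ioc h1
      _ = _ := by rw [lintegral_add_right _ measurable_const]; simp
  have h3 : ∫⁻ b in Set.Ioc (0:ℝ) 1, UL μ w (Real.exp b • v) =
      ∫⁻ g, (∫⁻ b in Set.Ioc (0:ℝ) 1, ENNReal.ofReal (w (Real.exp b • ra v g))) ∂(GG μ) := by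
    unfold UL
    simp_rw [ra_smul]
    rw [lintegral_lintegral_swap]
    apply Measurable.aemeasurable
    simp only [Function.uncurry_def]
    have : Measurable fun p : ℝ × SL2 => ra v p.2 := (mra v).comp measurable_snd
    have h' : Measurable fun p : ℝ × SL2 => Real.exp p.1 • ra v p.2 := by fun_prop
    exact (hwm.comp h').ennreal_ofReal
  set s1 := s / 2 * Real.exp (-1) with hs1
  have h4 : ∀ y : ℂ, y ≠ 0 → ∫⁻ b in Set.Ioc (0:ℝ) 1, ENNReal.ofReal (w (Real.exp b • y)) ≤
      iA s1 (s1 * Real.exp ((K + 4 : ℕ))) y * ENNReal.ofReal (ε / (2 * (Q + 1))) := by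
    intro y hy
    by_cases hmem : y ∈ An s1 (2 * T)
    · have hmem' : y ∈ An s1 (s1 * Real.exp ((K + 4 : ℕ))) := by
        refine ⟨hmem.1, hmem.2.trans ?_⟩
        rw [hs1, hs]
        have : T * Real.exp (-K) / 2 * Real.exp (-1) * Real.exp ((K + 4 : ℕ)) = T / 2 * Real.exp 3 := by
          have : Real.exp 3 = Real.exp (-K) * Real.exp (-1) * Real.exp ((K + 4 : ℕ)) := by
            rw [← Real.exp_add, ← Real.exp_add]; congr 1; push_cast; ring
          rw [this]; ring
        rw [this]
        have : (4:ℝ) ≤ Real.exp 3 := by have := Real.add_one_le_exp (3:ℝ); linarith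
        nlinarith
      rw [iA_mem hmem', one_mul]
      calc _ ≤ ∫⁻ b in Set.Ioc (0:ℝ) 1, ENNReal.ofReal (kk N (Real.exp b • y)) :=
            lintegral_mono fun b => ENNReal.ofReal_le_ofReal (ww_le _ _ _)
        _ ≤ _ := hk y hy
        _ ≤ _ := by
          apply ENNReal.ofReal_le_ofReal
          have h5 : 2 * Real.exp 2 * ‖y‖ ^ 2 / δ ≤ 2 * Real.exp 2 * (2 * T) ^ 2 / δ := by
            have := hmem.2
            gcongr
          have : ε / (2 * (Q + 1)) = ε / (4 * (Q + 1)) + ε / (4 * (Q + 1)) := by field_simp; norm_num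
          linarith
    · have : ∀ b ∈ Set.Ioc (0:ℝ) 1, ENNReal.ofReal (w (Real.exp b • y)) = 0 := by
        intro b hb
        rw [W.supp, ENNReal.ofReal_zero]
        rintro ⟨k1, k2⟩
        apply hmem
        rw [norm_smul, Real.norm_eq_abs, abs_of_pos (Real.exp_pos _)] at k1 k2
        constructor
        · rw [hs1]
          have e1 : Real.exp b ≤ Real.exp 1 := Real.exp_le_exp.2 hb.2
          have e2 : Real.exp 1 * Real.exp (-1) = 1 := by rw [← Real.exp_add]; simp
          have e3 : s / 2 ≤ Real.exp 1 * ‖y‖ := k1.trans (mul_le_mul_of_nonneg_right e1 (norm_nonneg _))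
          calc s / 2 * Real.exp (-1) ≤ (Real.exp 1 * ‖y‖) * Real.exp (-1) := mul_le_mul_of_nonneg_right e3 (Real.exp_pos _).le
            _ = (Real.exp 1 * Real.exp (-1)) * ‖y‖ := by ring
            _ = ‖y‖ := by rw [e2, one_mul]
        · have e1 : 1 ≤ Real.exp b := Real.one_le_exp hb.1.le
          nlinarith [norm_nonneg y]
      rw [setLIntegral_congr_fun measurableSet_Ioc this]
      simp
  have h5 : ∫⁻ g, (∫⁻ b in Set.Ioc (0:ℝ) 1, ENNReal.ofReal (w (Real.exp b • ra v g))) ∂(GG μ) ≤ ENNReal.ofReal (ε / 2) := by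
    calc _ ≤ ∫⁻ g, iA s1 (s1 * Real.exp ((K + 4 : ℕ))) (ra v g) * ENNReal.ofReal (ε / (2 * (Q + 1))) ∂(GG μ) :=
          lintegral_mono fun g => h4 _ (ra_ne_zero hv g)
      _ = (∫⁻ g, iA s1 (s1 * Real.exp ((K + 4 : ℕ))) (ra v g) ∂(GG μ)) * ENNReal.ofReal (ε / (2 * (Q + 1))) := by
          exact lintegral_mul_const _ ((meas_iA _ _).comp (mra v))
      _ ≤ ENNReal.ofReal Q * ENNReal.ofReal (ε / (2 * (Q + 1))) := by
          gcongr
          refine (U_An P (by positivity) (K + 4) v).trans (le_of_eq ?_)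
          rw [hQ, ENNReal.ofReal_mul (by positivity), ENNReal.ofReal_mul (by norm_num), ENNReal.ofReal_coe_nnreal]
          congr 2
          · rw [show ((K:ℝ) + 4 + 1) = ((K + 4 + 1 : ℕ) : ℝ) by push_cast; ring, ENNReal.ofReal_natCast]; push_cast; ring
          · norm_num
      _ ≤ _ := by
          rw [← ENNReal.ofReal_mul hQ0]
          apply ENNReal.ofReal_le_ofReal
          rw [mul_div_assoc', div_le_div_iff₀ (by positivity) (by norm_num)]
          nlinarith
  calc UL μ w v ≤ _ := h2
    _ ≤ ENNReal.ofReal (ε / 2) + ENNReal.ofReal (ε / 2) := by rw [h3]; gcongr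
    _ = _ := by rw [← ENNReal.ofReal_add (by positivity) (by positivity)]; congr 1; ring

end

noncomputable section
open scoped ENNReal NNReal Topology

structure AP (C : ℝ) (r φ dφ : ℝ → ℝ) : Prop where
  rc : Continuous r
  pc : Continuous φ
  rb : ∀ y, |r y| ≤ C
  rl : ∀ y z, |r y - r z| ≤ C * |y - z|
  tay : ∀ b y, |φ y - φ b - dφ b * (y - b)| ≤ C * (y - b) ^ 2
  dl : ∀ y z, |dφ y - dφ z| ≤ C * |y - z|
  low : ∀ y, r y ≠ 0 → 1 / C ≤ |dφ y|

def Ph (ξ : ℝ) (r φ : ℝ → ℝ) (y : ℝ) : ℂ := Complex.exp (Complex.I * ((ξ * φ y : ℝ) : ℂ)) * (r y : ℂ)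

lemma Ph_norm (ξ : ℝ) (r φ : ℝ → ℝ) (y : ℝ) : ‖Ph ξ r φ y‖ = |r y| := by
  rw [Ph, norm_mul, norm_expI, one_mul, Complex.norm_real, Real.norm_eq_abs]

lemma Ph_cont {C : ℝ} {r φ dφ : ℝ → ℝ} (A : AP C r φ dφ) (ξ : ℝ) : Continuous (Ph ξ r φ) := by
  have := A.rc
  have := A.pc
  unfold Ph; fun_prop

def FF (N : Measure ℂ) (Φ : ℝ → ℂ) (v z : ℂ) : ℂ := ∫ x, Φ (dt z x / dt v x) ∂N

lemma FF_le (N : Measure ℂ) [IsProbabilityMeasure N] {Φ : ℝ → ℂ} {C : ℝ} (hC : ∀ y, ‖Φ y‖ ≤ C) (v z : ℂ) :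
    ‖FF N Φ v z‖ ≤ C := by
  refine (norm_integral_le_of_norm_le_const (C := C) (ae_of_all _ fun x => hC _)).trans ?_
  simp

lemma FF_harm {μ N} (S : Stp μ N) {Φ : ℝ → ℂ} (hΦ : Measurable Φ) {C : ℝ} (hC : ∀ y, ‖Φ y‖ ≤ C) (v z : ℂ) :
    FF N Φ v z = ∫ h, FF N Φ (ra v h) (ra z h) ∂μ := by
  unfold FF
  rw [stat_int S (f := fun x => Φ (dt z x / dt v x)) ?_ ?_ (fun x => hC _)]
  · simp only [dt_ra]
  · exact hΦ.comp ((measurable_const.dt' measurable_id).div (measurable_const.dt' measurable_id))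
  · intro c x hc
    simp only [dt_smul_right, mul_div_mul_left _ _ hc]

lemma FF_meas (N : Measure ℂ) [IsProbabilityMeasure N] {Φ : ℝ → ℂ} (hΦ : Measurable Φ) (v z : ℂ) :
    Measurable fun g => FF N Φ (ra v g) (ra z g) := by
  have h : StronglyMeasurable fun p : SL2 × ℂ => Φ (dt (ra z p.1) p.2 / dt (ra v p.1) p.2) :=
    Measurable.stronglyMeasurable (hΦ.comp ((((mra z).comp measurable_fst).dt' measurable_snd).div
      (((mra v).comp measurable_fst).dt' measurable_snd)))
  exact (h.integral_prod_right' (ν := N)).measurable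

lemma sq_int_le {α : Type*} [MeasurableSpace α] (μ : Measure α) [IsProbabilityMeasure μ] {f : α → ℝ} {C : ℝ}
    (hf : Measurable f) (hC : ∀ x, |f x| ≤ C) : (∫ x, f x ∂μ) ^ 2 ≤ ∫ x, f x ^ 2 ∂μ := by
  have i1 : Integrable f μ := Integrable.of_bound hf.aestronglyMeasurable C (ae_of_all _ hC)
  have i2 : Integrable (fun x => f x ^ 2) μ := Integrable.of_bound (hf.pow_const 2).aestronglyMeasurable (C ^ 2)
    (ae_of_all _ fun x => by
      rw [Real.norm_eq_abs, abs_pow]; exact pow_le_pow_left₀ (abs_nonneg _) (hC x) 2)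
  set m := ∫ x, f x ∂μ with hm
  have h : 0 ≤ ∫ x, (f x - m) ^ 2 ∂μ := integral_nonneg fun x => sq_nonneg _
  have e : ∫ x, (f x - m) ^ 2 ∂μ = ∫ x, f x ^ 2 ∂μ - m ^ 2 := by
    have : ∀ x, (f x - m) ^ 2 = f x ^ 2 - (2 * m) * f x + m ^ 2 := fun x => by ring
    simp_rw [this]
    have i3 : Integrable (fun x => f x ^ 2 - (2 * m) * f x) μ := i2.sub (i1.const_mul _)
    rw [integral_add i3 (integrable_const _), integral_sub i2 (i1.const_mul _), integral_const_mul, ← hm]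
    simp; ring
  linarith

def ffn (N : Measure ℂ) (Φ : ℝ → ℂ) (C : ℝ) (v z : ℂ) : ℝ≥0∞ := ENNReal.ofReal ((‖FF N Φ v z‖ / C) ^ 2)

lemma ffn_sub {μ N} (S : Stp μ N) {Φ : ℝ → ℂ} (hΦ : Measurable Φ) {C : ℝ} (hC0 : 0 < C) (hC : ∀ y, ‖Φ y‖ ≤ C) (v z : ℂ) :
    ffn N Φ C v z ≤ ∫⁻ h, ffn N Φ C (ra v h) (ra z h) ∂μ := by
  haveI := S.pmu
  haveI := S.pN
  have hm := (FF_meas N hΦ v z).norm.div_const C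
  have hb : ∀ h, |‖FF N Φ (ra v h) (ra z h)‖ / C| ≤ 1 := fun h => by
    rw [abs_of_nonneg (by positivity), div_le_one hC0]; exact FF_le N hC _ _
  unfold ffn
  rw [← ofReal_integral_eq_lintegral_ofReal _ (ae_of_all _ fun h => by positivity)]
  · apply ENNReal.ofReal_le_ofReal
    refine le_trans ?_ (sq_int_le μ hm hb)
    apply pow_le_pow_left₀ (by positivity)
    rw [integral_div]
    apply div_le_div_of_nonneg_right _ hC0.le
    rw [FF_harm S hΦ hC]
    exact norm_integral_le_integral_norm _
  · refine Integrable.of_bound (hm.pow_const 2).aestronglyMeasurable 1 (ae_of_all _ fun x => ?_)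
    rw [Real.norm_eq_abs, abs_pow]; exact pow_le_one₀ (abs_nonneg _) (hb x)

lemma ffn_le_one (N : Measure ℂ) [IsProbabilityMeasure N] {Φ : ℝ → ℂ} {C : ℝ} (hC0 : 0 < C) (hC : ∀ y, ‖Φ y‖ ≤ C) (v z : ℂ) :
    ffn N Φ C v z ≤ 1 := by
  unfold ffn
  rw [← ENNReal.ofReal_one]
  apply ENNReal.ofReal_le_ofReal
  exact pow_le_one₀ (by positivity) ((div_le_one hC0).2 (FF_le N hC _ _))

lemma ffn_meas (N : Measure ℂ) [IsProbabilityMeasure N] {Φ : ℝ → ℂ} (hΦ : Measurable Φ) (C : ℝ) (v z : ℂ) :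
    Measurable fun g => ffn N Φ C (ra v g) (ra z g) :=
  (((FF_meas N hΦ v z).norm.div_const C).pow_const 2).ennreal_ofReal

lemma ffn_mun {μ N} (S : Stp μ N) {Φ : ℝ → ℂ} (hΦ : Measurable Φ) {C : ℝ} (hC0 : 0 < C) (hC : ∀ y, ‖Φ y‖ ≤ C) (v z : ℂ)
    (n : ℕ) : ffn N Φ C v z ≤ ∫⁻ g, ffn N Φ C (ra v g) (ra z g) ∂(mun μ n) := by
  haveI := S.pmu
  haveI := S.pN
  induction n with
  | zero =>
    rw [mun, lintegral_dirac' _ (ffn_meas N hΦ C v z), ra_one, ra_one]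
  | succ n ih =>
    rw [lint_mun μ n (ffn_meas N hΦ C v z)]
    refine ih.trans (lintegral_mono fun g => ?_)
    simp only [ra_mul]
    exact ffn_sub S hΦ hC0 hC _ _

lemma expI_sub (s t : ℝ) : ‖Complex.exp (Complex.I * (s:ℝ)) - Complex.exp (Complex.I * (t:ℝ))‖ ≤ |s - t| := by
  have e : Complex.exp (Complex.I * (s:ℝ)) - Complex.exp (Complex.I * (t:ℝ)) =
      Complex.exp (Complex.I * (t:ℝ)) * (Complex.exp (Complex.I * ((s - t : ℝ) : ℂ)) - 1) := by
    rw [mul_sub, mul_one, ← Complex.exp_add]; congr 2; push_cast; ring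
  rw [e, norm_mul, norm_expI, one_mul]
  exact Real.norm_exp_I_mul_ofReal_sub_one_le

lemma y_eq {v z x : ℂ} (hv : v ≠ 0) (hcr : cr v z = 1) (hx : dt v x ≠ 0) : dt z x / dt v x = bet v z + ph v x := by
  have hd := decomp hv z
  rw [hcr] at hd
  have : dt z x = bet v z * dt v x + (1 / ‖v‖ ^ 2) * cr v x := by
    conv_lhs => rw [hd]
    rw [← dt_I]; simp only [dt, Complex.add_re, Complex.add_im, Complex.smul_re, Complex.smul_im, smul_eq_mul]; ring
  rw [this, ph, add_div, mul_div_assoc, div_self hx]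
  ring

lemma kI_sign (N : Measure ℂ) (σ : ℝ) (hσ : σ = 1 ∨ σ = -1) (v : ℂ) :
    ‖∫ x, Complex.exp (Complex.I * ((σ * ph v x : ℝ) : ℂ)) ∂N‖ = ‖kI N v‖ := by
  rcases hσ with rfl | rfl
  · simp [kI]
  · have : ∀ x, Complex.exp (Complex.I * ((-1 * ph v x : ℝ) : ℂ)) = (starRingEnd ℂ) (Complex.exp (Complex.I * (ph v x : ℝ))) := by
      intro x
      rw [← Complex.exp_conj]; congr 1; simp
    simp_rw [this]
    rw [integral_conj, RCLike.norm_conj, kI]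

/-- slope at base point -/
def slp (r dφ : ℝ → ℝ) (b : ℝ) : ℝ := if r b = 0 then 1 else dφ b

lemma slp_low {C : ℝ} (hC : 1 ≤ C) {r φ dφ : ℝ → ℝ} (A : AP C r φ dφ) (b : ℝ) : 1 / C ≤ |slp r dφ b| := by
  unfold slp
  split_ifs with h
  · rw [abs_one]; exact (div_le_one (by linarith)).2 hC
  · exact A.low b h

def Cst (C δ s : ℝ) : ℝ := C + C * (C / (δ * s ^ 2)) + C ^ 2 * (C / (δ * s ^ 2)) + C ^ 2 * (C / (δ * s ^ 2)) ^ 2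

lemma one_le_Cst {C δ s : ℝ} (hC : 1 ≤ C) (hδ : 0 < δ) (hs : 0 < s) : 1 ≤ Cst C δ s := by
  unfold Cst
  have : 0 ≤ C * (C / (δ * s ^ 2)) + C ^ 2 * (C / (δ * s ^ 2)) + C ^ 2 * (C / (δ * s ^ 2)) ^ 2 := by positivity
  linarith

lemma pb {μ N} (S : Stp μ N) {C : ℝ} (hC : 1 ≤ C) {δ η s : ℝ} (hδ : 0 < δ) (hη : 0 < η) (hs : 0 < s)
    (hom : ∀ v : ℂ, v ≠ 0 → N {x | |dt v x| ≤ δ * ‖v‖ * ‖x‖} ≤ ENNReal.ofReal η)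
    {r φ dφ : ℝ → ℝ} (A : AP C r φ dφ) {ξ : ℝ} (hξ : ξ ≠ 0) (b0 : ℝ) {v' z : ℂ} (hv' : s ≤ ‖v'‖) {q : ℝ}
    (hq : q = Real.sqrt |ξ * slp r dφ b0|) (hcr : cr (q • v') z = 1) :
    ‖FF N (Ph ξ r φ) (q • v') z‖ ≤ C * ‖kI N v'‖ + 2 * C * η + Cst C δ s * (|bet (q • v') z - b0| + 1 / |ξ|) := by
  haveI := S.pN
  have hC0 : 0 < C := by linarith
  have hξ0 : 0 < |ξ| := abs_pos.2 hξ
  set p := slp r dφ b0 with hp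
  have hpl : 1 / C ≤ |p| := slp_low hC A b0
  have hp0 : 0 < |p| := lt_of_lt_of_le (by positivity) hpl
  have hq2 : q ^ 2 = |ξ * p| := by rw [hq, Real.sq_sqrt (abs_nonneg _)]
  have hqp : 0 < q := by rw [hq]; apply Real.sqrt_pos.2; rw [abs_mul]; positivity
  have hv'0 : v' ≠ 0 := norm_pos_iff.1 (lt_of_lt_of_le hs hv')
  set v := q • v' with hv
  have hv0 : v ≠ 0 := smul_ne_zero hqp.ne' hv'0
  set β := bet v z with hβ
  set τ := C / (δ * s ^ 2) with hτ
  have hτ0 : 0 < τ := by positivity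
  have hnv : |ξ| * s ^ 2 / C ≤ ‖v‖ ^ 2 := by
    rw [hv, norm_smul, mul_pow, Real.norm_eq_abs, sq_abs, hq2, abs_mul]
    calc |ξ| * s ^ 2 / C = |ξ| * (1 / C) * s ^ 2 := by ring
      _ ≤ |ξ| * |p| * ‖v'‖ ^ 2 := by gcongr
  have hvn : 0 < ‖v‖ := norm_pos_iff.2 hv0
  set Bd : Set ℂ := {x | |dt v x| ≤ δ * ‖v‖ * ‖x‖} with hBd
  have hBm : MeasurableSet Bd := measurableSet_le ((measurable_const.dt' measurable_id).abs)
    (measurable_const.mul measurable_norm)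
  have hph : ∀ x ∉ Bd, |ph v x| ≤ τ / |ξ| := by
    intro x hx
    have hx' : δ * ‖v‖ * ‖x‖ < |dt v x| := not_le.1 hx
    have hd : 0 < |dt v x| := lt_of_le_of_lt (by positivity) hx'
    have h1 : |cr v x / dt v x| ≤ 1 / δ := by
      rw [abs_div, div_le_div_iff₀ hd hδ]
      nlinarith [abs_cr_le v x]
    rw [ph, abs_div, abs_of_pos (by positivity : 0 < ‖v‖ ^ 2)]
    calc |cr v x / dt v x| / ‖v‖ ^ 2 ≤ (1 / δ) / (|ξ| * s ^ 2 / C) := by gcongr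
      _ = τ / |ξ| := by rw [hτ]; field_simp
  set md : ℂ → ℂ := fun x => Complex.exp (Complex.I * ((ξ * φ β + ξ * p * ph v x : ℝ) : ℂ)) * (r b0 : ℂ) with hmd
  have hmdm : Measurable md := by
    have := meas_ph1 v
    rw [hmd]; fun_prop
  have hmdn : ∀ x, ‖md x‖ ≤ C := fun x => by
    rw [hmd]; simp only [norm_mul, norm_expI, one_mul, Complex.norm_real, Real.norm_eq_abs]; exact A.rb _
  set E := Cst C δ s * (|β - b0| + 1 / |ξ|) with hE
  have hCst := one_le_Cst hC hδ hs
  have hE0 : 0 ≤ E := by positivity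
  have hgood : ∀ x ∉ Bd, dt v x ≠ 0 → ‖Ph ξ r φ (dt z x / dt v x) - md x‖ ≤ E := by
    intro x hx hdx
    rw [y_eq hv0 hcr hdx]
    have h1 := hph x hx
    set t := ph v x with ht
    have e : Ph ξ r φ (β + t) - md x = Complex.exp (Complex.I * ((ξ * φ (β + t) : ℝ) : ℂ)) * ((r (β + t) - r b0 : ℝ) : ℂ) +
        (Complex.exp (Complex.I * ((ξ * φ (β + t) : ℝ) : ℂ)) - Complex.exp (Complex.I * ((ξ * φ β + ξ * p * t : ℝ) : ℂ))) * (r b0 : ℂ) := by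
      rw [Ph, hmd]; push_cast; ring
    have h2 : |r (β + t) - r b0| ≤ C * (|β - b0| + τ / |ξ|) := by
      refine (A.rl _ _).trans (mul_le_mul_of_nonneg_left ?_ hC0.le)
      calc |β + t - b0| = |(β - b0) + t| := by congr 1; ring
        _ ≤ |β - b0| + |t| := abs_add_le _ _
        _ ≤ _ := by linarith
    have h3 : ‖(Complex.exp (Complex.I * ((ξ * φ (β + t) : ℝ) : ℂ)) - Complex.exp (Complex.I * ((ξ * φ β + ξ * p * t : ℝ) : ℂ))) * (r b0 : ℂ)‖
        ≤ (C * τ ^ 2 / |ξ| + C * |β - b0| * τ) * C := by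
      by_cases hr : r b0 = 0
      · rw [hr]; simp; positivity
      · rw [norm_mul, Complex.norm_real, Real.norm_eq_abs]
        refine mul_le_mul ((expI_sub _ _).trans ?_) (A.rb _) (abs_nonneg _) (by positivity)
        have hpe : p = dφ b0 := by rw [hp, slp, if_neg hr]
        have e2 : ξ * φ (β + t) - (ξ * φ β + ξ * p * t) =
            ξ * (φ (β + t) - φ β - dφ β * (β + t - β)) + ξ * ((dφ β - dφ b0) * t) := by rw [hpe]; ring
        rw [e2]
        refine (abs_add_le _ _).trans ?_
        rw [abs_mul, abs_mul, abs_mul]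
        have t1 := A.tay β (β + t)
        have t2 := A.dl β b0
        have t3 : (β + t - β) ^ 2 ≤ (τ / |ξ|) ^ 2 := by
          rw [add_sub_cancel_left, ← sq_abs]; exact pow_le_pow_left₀ (abs_nonneg _) h1 2
        have t4 : |ξ| * |φ (β + t) - φ β - dφ β * (β + t - β)| ≤ C * τ ^ 2 / |ξ| := by
          calc _ ≤ |ξ| * (C * (τ / |ξ|) ^ 2) := by
                apply mul_le_mul_of_nonneg_left _ hξ0.le
                exact t1.trans (mul_le_mul_of_nonneg_left t3 hC0.le)
            _ = _ := by field_simp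
        have t5 : |ξ| * (|dφ β - dφ b0| * |t|) ≤ C * |β - b0| * τ := by
          calc _ ≤ |ξ| * ((C * |β - b0|) * (τ / |ξ|)) := by gcongr
            _ = _ := by field_simp
        linarith
    rw [e]
    refine (norm_add_le _ _).trans ?_
    rw [norm_mul, norm_expI, one_mul, Complex.norm_real, Real.norm_eq_abs]
    have e3 : E = C * (|β - b0| + τ / |ξ|) + (C * τ ^ 2 / |ξ| + C * |β - b0| * τ) * C +
        (C * τ * |β - b0| + C ^ 2 * τ ^ 2 * |β - b0| + C * (1 / |ξ|) + C ^ 2 * τ * (1 / |ξ|)) := by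
      rw [hE, Cst, ← hτ]; ring
    rw [e3]
    have : 0 ≤ C * τ * |β - b0| + C ^ 2 * τ ^ 2 * |β - b0| + C * (1 / |ξ|) + C ^ 2 * τ * (1 / |ξ|) := by positivity
    linarith
  have hΦn : ∀ y, ‖Ph ξ r φ y‖ ≤ C := fun y => by rw [Ph_norm]; exact A.rb y
  have hΦm : Measurable fun x => Ph ξ r φ (dt z x / dt v x) :=
    (Ph_cont A ξ).measurable.comp ((measurable_const.dt' measurable_id).div (measurable_const.dt' measurable_id))
  have i1 : Integrable (fun x => Ph ξ r φ (dt z x / dt v x)) N :=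
    Integrable.of_bound hΦm.aestronglyMeasurable C (ae_of_all _ fun x => hΦn _)
  have i2 : Integrable md N := Integrable.of_bound hmdm.aestronglyMeasurable C (ae_of_all _ hmdn)
  have h0 : ∀ᵐ x ∂N, dt v x ≠ 0 := by
    rw [ae_iff]; simpa using dt_null S hv0
  have hdiff : ‖(∫ x, Ph ξ r φ (dt z x / dt v x) ∂N) - ∫ x, md x ∂N‖ ≤ 2 * C * η + E := by
    rw [← integral_sub i1 i2]
    have hintg : Integrable (fun x => Bd.indicator (fun _ => 2 * C) x + E) N :=
      ((integrable_const _).indicator hBm).add (integrable_const _)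
    refine (norm_integral_le_of_norm_le hintg ?_).trans ?_
    · filter_upwards [h0] with x hx
      by_cases hxB : x ∈ Bd
      · rw [Set.indicator_of_mem hxB]
        have := norm_sub_le (Ph ξ r φ (dt z x / dt v x)) (md x)
        have := hΦn (dt z x / dt v x)
        have := hmdn x
        linarith
      · rw [Set.indicator_of_notMem hxB, zero_add]; exact hgood x hxB hx
    · rw [integral_add ((integrable_const _).indicator hBm) (integrable_const _), integral_indicator_const _ hBm]
      have h5 : N.real Bd ≤ η := ENNReal.toReal_le_of_le_ofReal hη.le (hom v hv0)
      simp only [smul_eq_mul, integral_const, probReal_univ, one_mul]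
      nlinarith
  have hmi : ‖∫ x, md x ∂N‖ ≤ C * ‖kI N v'‖ := by
    obtain ⟨σ, hσ, hσe⟩ : ∃ σ : ℝ, (σ = 1 ∨ σ = -1) ∧ ξ * p = σ * |ξ * p| := by
      rcases le_total 0 (ξ * p) with h | h
      · exact ⟨1, Or.inl rfl, by rw [abs_of_nonneg h, one_mul]⟩
      · exact ⟨-1, Or.inr rfl, by rw [abs_of_nonpos h]; ring⟩
    have e4 : ∀ x, md x = (Complex.exp (Complex.I * ((ξ * φ β : ℝ) : ℂ)) * (r b0 : ℂ)) *
        Complex.exp (Complex.I * ((σ * ph v' x : ℝ) : ℂ)) := by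
      intro x
      have : ξ * p * ph v x = σ * ph v' x := by
        have h1 : |ξ * p| ≠ 0 := by rw [abs_mul]; positivity
        rw [hv, ph_smul _ hqp.ne', hq2]
        generalize |ξ * p| = A1 at h1 hσe
        rw [hσe]; field_simp
      rw [hmd]
      simp only
      rw [this]
      push_cast
      rw [mul_add, Complex.exp_add]; ring
    simp_rw [e4]
    rw [integral_const_mul, norm_mul, kI_sign N σ hσ, norm_mul, norm_expI, one_mul, Complex.norm_real, Real.norm_eq_abs]
    exact mul_le_mul_of_nonneg_right (A.rb _) (norm_nonneg _)
  have := norm_sub_norm_le (∫ x, Ph ξ r φ (dt z x / dt v x) ∂N) (∫ x, md x ∂N)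
  rw [FF]
  linarith

end

noncomputable section
open scoped ENNReal NNReal Topology

lemma sq_aux {x k E B : ℝ} (h0 : 0 ≤ x) (h1 : x ≤ 1) (hE0 : 0 ≤ E) (h2 : x ≤ k + E) (hB : 2 * E ≤ B) :
    x ^ 2 ≤ 2 * k ^ 2 + B := by
  have hx1 : x ^ 2 ≤ 1 := pow_le_one₀ h0 h1
  by_cases hE1 : E ≤ 1
  · have : x ^ 2 ≤ (k + E) ^ 2 := pow_le_pow_left₀ h0 h2 2
    have : E ^ 2 ≤ E := by nlinarith
    nlinarith [sq_nonneg (k - E)]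
  · have := sq_nonneg k
    linarith

lemma pb2 {μ N} (S : Stp μ N) {C : ℝ} (hC : 1 ≤ C) {δ η s a : ℝ} (hδ : 0 < δ) (hη : 0 < η) (hs : 0 < s)
    (ha : 0 < a) (ha1 : a ≤ 1)
    (hom : ∀ v : ℂ, v ≠ 0 → N {x | |dt v x| ≤ δ * ‖v‖ * ‖x‖} ≤ ENNReal.ofReal η)
    {r φ dφ : ℝ → ℝ} (A : AP C r φ dφ) {ξ : ℝ} (hξ : ξ ≠ 0) (b0 : ℝ) {v' z : ℂ} (hv' : s ≤ ‖v'‖) {q : ℝ}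
    (hq : q = Real.sqrt |ξ * slp r dφ b0|) (hcr : cr (q • v') z = 1) :
    (‖FF N (Ph ξ r φ) (q • v') z‖ / C) ^ 2 ≤ 2 * kk N v' + (4 * η + 2 * Cst C δ s * (1 / |ξ|)) +
      2 * Cst C δ s * |bet (q • v') z - b0| ^ (a / 2) := by
  haveI := S.pN
  have hC0 : 0 < C := by linarith
  have h := pb S hC hδ hη hs hom A hξ b0 hv' hq hcr
  have hK := one_le_Cst hC hδ hs
  have h1 : ‖FF N (Ph ξ r φ) (q • v') z‖ / C ≤ 1 :=
    (div_le_one hC0).2 (FF_le N (fun y => by rw [Ph_norm]; exact A.rb y) _ _)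
  have h0 : 0 ≤ ‖FF N (Ph ξ r φ) (q • v') z‖ / C := by positivity
  set d := |bet (q • v') z - b0| with hd
  have hd0 : 0 ≤ d := abs_nonneg _
  have hξ0 : 0 < |ξ| := abs_pos.2 hξ
  have hi : 0 ≤ 1 / |ξ| := by positivity
  have h2 : ‖FF N (Ph ξ r φ) (q • v') z‖ / C ≤ ‖kI N v'‖ + (2 * η + Cst C δ s * (d + 1 / |ξ|)) := by
    rw [div_le_iff₀ hC0]
    have h3 : Cst C δ s * (d + 1 / |ξ|) ≤ Cst C δ s * (d + 1 / |ξ|) * C := le_mul_of_one_le_right (by positivity) hC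
    linarith
  set x := ‖FF N (Ph ξ r φ) (q • v') z‖ / C
  set k := ‖kI N v'‖ with hk
  have hk0 : 0 ≤ k := norm_nonneg _
  have hkk : kk N v' = k ^ 2 := rfl
  set Q := Cst C δ s
  have hda : 0 ≤ d ^ (a / 2) := Real.rpow_nonneg hd0 _
  have hx1 : x ^ 2 ≤ 1 := pow_le_one₀ h0 h1
  rw [hkk]
  have hQi : 0 ≤ Q * (1 / |ξ|) := by positivity
  have hQd : 0 ≤ Q * d ^ (a / 2) := by positivity
  by_cases hd1 : d ≤ 1
  · have h4 : d ≤ d ^ (a / 2) := by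
      rcases hd0.eq_or_lt with h5 | h5
      · rw [← h5]; positivity
      · calc d = d ^ (1:ℝ) := (Real.rpow_one d).symm
          _ ≤ _ := Real.rpow_le_rpow_of_exponent_ge h5 hd1 (by linarith)
    have h5 : Q * d ≤ Q * d ^ (a / 2) := by gcongr
    set E := 2 * η + Q * (d + 1 / |ξ|) with hE
    have hE0 : 0 ≤ E := by positivity
    have hEE : 2 * E ≤ (4 * η + 2 * Q * (1 / |ξ|)) + 2 * Q * d ^ (a / 2) := by rw [hE]; linarith
    have := sq_aux h0 h1 hE0 h2 hEE
    linarith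
  · have h4 : 1 ≤ d ^ (a / 2) := Real.one_le_rpow (not_le.1 hd1).le (by positivity)
    have : 1 ≤ Q * d ^ (a / 2) := one_le_mul_of_one_le_of_one_le hK h4
    have := sq_nonneg k
    linarith

lemma main_ineq {μ N} (S : Stp μ N) {a : ℝ} {CP Dt : ℝ≥0} (P : Pot μ a CP)
    (hDt : ∀ (R0 K : ℝ) (v : ℂ), 0 < R0 →
    ∫⁻ g, (if ‖ra v g‖ < R0 then μ {h | R0 * Real.exp K < ‖ra (ra v g) h‖} else 0) ∂(GG μ) ≤
      Dt * ENNReal.ofReal (Real.exp (-(a * K))))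
    {C : ℝ} (hC : 1 ≤ C) {δ η s : ℝ} (hδ : 0 < δ) (hη : 0 < η) (hs : 0 < s) (K : ℕ)
    (hom : ∀ v : ℂ, v ≠ 0 → N {x | |dt v x| ≤ δ * ‖v‖ * ‖x‖} ≤ ENNReal.ofReal η)
    {r φ dφ : ℝ → ℝ} (A : AP C r φ dφ) {ξ : ℝ} (hξ : ξ ≠ 0) {v0 z0 : ℂ} (hv0 : v0 ≠ 0) (hcr : cr v0 z0 = 1) {q : ℝ}
    (hq : q = Real.sqrt |ξ * slp r dφ (bet v0 z0)|) (hvs : ‖v0‖ < q * s) :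
    ffn N (Ph ξ r φ) C v0 z0 ≤ 2 * UL μ (ww N s (s * Real.exp K)) (q⁻¹ • v0) +
      ENNReal.ofReal (4 * η + 2 * Cst C δ s * (1 / |ξ|)) * ((K + 1) * (3 * CP)) +
      ENNReal.ofReal (2 * Cst C δ s) * ((K + 1) * (3 * CP) * CP * (CP * Na a v0)) +
      Dt * ENNReal.ofReal (Real.exp (-(a * K))) := by
  haveI := S.pN
  haveI := S.pmu
  have hC0 : 0 < C := by linarith
  have hΦ := (Ph_cont A ξ).measurable
  have hΦn : ∀ y, ‖Ph ξ r φ y‖ ≤ C := fun y => by rw [Ph_norm]; exact A.rb y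
  have hqp : 0 < q := by
    rw [hq]; apply Real.sqrt_pos.2; rw [abs_mul]
    exact mul_pos (abs_pos.2 hξ) (lt_of_lt_of_le (by positivity) (slp_low hC A _))
  have hR0 : 0 < q * s := by positivity
  have hR : q * s ≤ q * s * Real.exp K := le_mul_of_one_le_right hR0.le (Real.one_le_exp (by positivity))
  have h := sub_rep P hR hv0 hvs (ffn_meas N hΦ C v0 z0) (fun g => ffn_le_one N hC0 hΦn _ _)
    (fun g => by simpa only [ra_mul] using ffn_sub S hΦ hC0 hΦn (ra v0 g) (ra z0 g))
  rw [ra_one, ra_one] at h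
  refine h.trans ?_
  have hm1 : Measurable fun g => iA (q * s) (q * s * Real.exp K) (ra v0 g) := (meas_iA _ _).comp (mra v0)
  have hm2 : Measurable fun g => iA (q * s) (q * s * Real.exp K) (ra v0 g) * ffn N (Ph ξ r φ) C (ra v0 g) (ra z0 g) :=
    hm1.mul (ffn_meas N hΦ C v0 z0)
  rw [lintegral_add_left hm2]
  refine add_le_add ?_ (hDt _ _ _ hR0)
  set b0 := bet v0 z0 with hb0
  set c1 := 4 * η + 2 * Cst C δ s * (1 / |ξ|) with hc1
  set c2 := 2 * Cst C δ s with hc2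
  have hK := one_le_Cst hC hδ hs
  have hc10 : 0 ≤ c1 := by positivity
  have hc20 : 0 ≤ c2 := by positivity
  set t := s * Real.exp K with ht
  have ht0 : 0 < t := by positivity
  have hpt : ∀ g, iA (q * s) (q * s * Real.exp K) (ra v0 g) * ffn N (Ph ξ r φ) C (ra v0 g) (ra z0 g) ≤
      2 * ENNReal.ofReal (ww N s t (ra (q⁻¹ • v0) g)) + (ENNReal.ofReal c1 * iA (q * s) (q * s * Real.exp K) (ra v0 g) +
       ENNReal.ofReal c2 * (iA (q * s) (q * s * Real.exp K) (ra v0 g) *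
        ENNReal.ofReal (|bet (ra v0 g) (ra z0 g) - b0| ^ (a/2)))) := by
    intro g
    by_cases hg : ra v0 g ∈ An (q * s) (q * s * Real.exp K)
    · rw [iA_mem hg, one_mul, one_mul, mul_one]
      have e1 : ra v0 g = q • ra (q⁻¹ • v0) g := by
        rw [ra_smul, smul_smul, mul_inv_cancel₀ hqp.ne', one_smul]
      set v' := ra (q⁻¹ • v0) g with hv'
      have e2 : ‖ra v0 g‖ = q * ‖v'‖ := by rw [e1, norm_smul, Real.norm_of_nonneg hqp.le]
      have h3 : s ≤ ‖v'‖ := by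
        have := hg.1; rw [e2] at this; exact le_of_mul_le_mul_left this hqp
      have h4 : ‖v'‖ ≤ t := by
        have := hg.2; rw [e2, mul_assoc] at this; exact le_of_mul_le_mul_left this hqp
      have e3 : ww N s t v' = kk N v' := by rw [ww, cut_one hs ht0 h3 h4, one_mul]
      have h5 := pb2 S hC hδ hη hs P.pos P.le hom A hξ b0 h3 hq (z := ra z0 g) (by rw [← e1, cr_ra, hcr])
      rw [← e1] at h5
      rw [e3, ffn]
      refine (ENNReal.ofReal_le_ofReal h5).trans ?_
      rw [ENNReal.ofReal_add (add_nonneg (mul_nonneg zero_le_two (kk_nonneg _ _)) hc10) (by positivity), ENNReal.ofReal_add (mul_nonneg zero_le_two (kk_nonneg _ _)) hc10,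
        ENNReal.ofReal_mul zero_le_two, ENNReal.ofReal_mul hc20, add_assoc]
      simp
    · rw [iA_not hg, zero_mul]; exact zero_le
  refine (lintegral_mono hpt).trans ?_
  have hD := fun v => U_An P hR0 K v
  have hmw : Measurable fun g => ENNReal.ofReal (ww N s t (ra (q⁻¹ • v0) g)) :=
    meas_wra (Wt_ww S hs ht0).cont.measurable _
  have hm3 : Measurable fun g => iA (q * s) (q * s * Real.exp K) (ra v0 g) *
      ENNReal.ofReal (|bet (ra v0 g) (ra z0 g) - b0| ^ (a/2)) :=
    hm1.mul (((meas_bet v0 z0).sub_const b0).abs.pow_const _).ennreal_ofReal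
  rw [lintegral_add_left (hmw.const_mul 2), lintegral_const_mul _ hmw, lintegral_add_left (hm1.const_mul _),
    lintegral_const_mul _ hm1, lintegral_const_mul _ hm3]
  have hcoe : (((K + 1) * (3 * CP) : ℝ≥0) : ℝ≥0∞) = (K + 1) * (3 * CP) := by push_cast; ring
  have hB := U_bet P (D := (K + 1) * (3 * CP)) (fun v => by rw [hcoe]; exact hD v) hv0 z0 b0
  rw [hcoe, ← hb0, sub_self, abs_zero, Real.zero_rpow (by have := P.pos; positivity), ENNReal.ofReal_zero, zero_mul, zero_add, hcr,
    abs_one, Real.one_rpow, ENNReal.ofReal_one, one_mul] at hB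
  rw [← add_assoc]
  exact add_le_add (add_le_add le_rfl (mul_le_mul_right (hD v0) _)) (mul_le_mul_right hB _)

end

noncomputable section
open scoped ENNReal NNReal Topology

lemma exists_n0 {μ : Measure SL2} {a : ℝ} {CP : ℝ≥0} (P : Pot μ a CP) (X : ℝ≥0) {e : ℝ} (he : 0 < e) :
    ∃ n, X * ∫⁻ g, Na a (ra 1 g) ∂(mun μ n) ≤ ENNReal.ofReal e := by
  have h := P.gr 1
  rw [lint_GG] at h
  have hfin : ∑' n, ∫⁻ g, Na a (ra 1 g) ∂(mun μ n) ≠ ⊤ :=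
    (h.trans_lt (ENNReal.mul_lt_top ENNReal.coe_lt_top (Na_ne_top _ _).lt_top)).ne
  have h1 := ENNReal.tendsto_atTop_zero_of_tsum_ne_top hfin
  have h2 := ENNReal.Tendsto.const_mul (a := (X:ℝ≥0∞)) h1 (Or.inr ENNReal.coe_ne_top)
  rw [mul_zero] at h2
  exact (h2.eventually (ge_mem_nhds (ENNReal.ofReal_pos.2 he))).exists

lemma exists_K {a : ℝ} (ha : 0 < a) (Dt : ℝ≥0) {e : ℝ} (he : 0 < e) :
    ∃ K : ℕ, (Dt : ℝ≥0∞) * ENNReal.ofReal (Real.exp (-(a * K))) ≤ ENNReal.ofReal e := by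
  have h1 : Tendsto (fun K : ℕ => (Dt : ℝ) * Real.exp (-(a * K))) atTop (𝓝 (Dt * 0)) := by
    refine Tendsto.const_mul _ (Real.tendsto_exp_neg_atTop_nhds_zero.comp ?_)
    exact Tendsto.const_mul_atTop ha tendsto_natCast_atTop_atTop
  rw [mul_zero] at h1
  obtain ⟨K, hK⟩ := (h1.eventually (ge_mem_nhds he)).exists
  refine ⟨K, ?_⟩
  rw [← ENNReal.ofReal_coe_nnreal, ← ENNReal.ofReal_mul (by positivity)]
  exact ENNReal.ofReal_le_ofReal hK

theorem core {μ N} (S : Stp μ N) {C : ℝ} (hC : 1 ≤ C) {ε : ℝ} (hε : 0 < ε) :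
    ∃ Ξ > (0:ℝ), ∀ ξ : ℝ, Ξ ≤ |ξ| → ∀ r φ dφ : ℝ → ℝ, AP C r φ dφ → ‖FF N (Ph ξ r φ) 1 Complex.I‖ ≤ ε := by
  haveI := S.pN
  haveI := S.pmu
  have hC0 : 0 < C := by linarith
  obtain ⟨a, CP, P⟩ := exists_Pot S
  obtain ⟨Dt, hDt⟩ := U_tail P
  set e := (ε / C) ^ 2 / 8 with he
  have he0 : 0 < e := by positivity
  obtain ⟨K, hK⟩ := exists_K P.pos Dt he0
  obtain ⟨s, hs, s', hs', h8⟩ := P8 S P K (half_pos he0)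
  set D : ℝ≥0 := (K + 1) * (3 * CP) with hD
  have hcoe : (D : ℝ≥0∞) = (K + 1) * (3 * CP) := by rw [hD]; push_cast; ring
  set η : ℝ := e / (4 * (D + 1)) with hη
  have hη0 : 0 < η := by positivity
  obtain ⟨δ, hδ, hom⟩ := omega_small S hη0
  have hCst := one_le_Cst hC hδ hs
  set Q : ℝ≥0 := Real.toNNReal (2 * Cst C δ s) * (D * CP * CP) with hQ
  obtain ⟨n0, hn0⟩ := exists_n0 P Q he0
  haveI := mun_prob μ n0
  obtain ⟨M, hM, hMt⟩ := fr_tail (mun μ n0) he0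
  set m := min s s' with hm
  have hm0 : 0 < m := lt_min hs hs'
  refine ⟨max (C * (M / m + 1) ^ 2) (2 * Cst C δ s * (D + 1) / e), lt_max_of_lt_left (by positivity), ?_⟩
  intro ξ hξ r φ dφ A
  have hξ1 : C * (M / m + 1) ^ 2 ≤ |ξ| := (le_max_left _ _).trans hξ
  have hξ2 : 2 * Cst C δ s * (D + 1) / e ≤ |ξ| := (le_max_right _ _).trans hξ
  have hξp : 0 < |ξ| := lt_of_lt_of_le (by positivity) hξ1
  have hξ0 : ξ ≠ 0 := abs_pos.1 hξp
  have hΦ := (Ph_cont A ξ).measurable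
  have hΦn : ∀ y, ‖Ph ξ r φ y‖ ≤ C := fun y => by rw [Ph_norm]; exact A.rb y
  have hpt : ∀ g, ffn N (Ph ξ r φ) C (ra 1 g) (ra Complex.I g) ≤
      ENNReal.ofReal (4 * e) + Q * Na a (ra 1 g) + {g | M < fr g}.indicator 1 g := by
    intro g
    by_cases hg : M < fr g
    · rw [Set.indicator_of_mem (by exact hg)]
      exact (ffn_le_one N hC0 hΦn _ _).trans le_add_self
    · refine le_trans ?_ le_self_add
      have hg' : fr g ≤ M := not_lt.1 hg
      set v0 := ra 1 g with hv0
      have hv00 : v0 ≠ 0 := ra_ne_zero one_ne_zero g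
      have hvn : ‖v0‖ ≤ M := by
        have := norm_ra_le 1 g; rw [norm_one, one_mul] at this; exact this.trans hg'
      have hcr : cr v0 (ra Complex.I g) = 1 := by rw [hv0, cr_ra]; simp [cr]
      set b0 := bet v0 (ra Complex.I g) with hb0
      set q := Real.sqrt |ξ * slp r dφ b0| with hq
      have hqM : M / m + 1 ≤ q := by
        apply Real.le_sqrt_of_sq_le
        rw [abs_mul]
        calc (M / m + 1) ^ 2 = (C * (M / m + 1) ^ 2) * (1 / C) := by field_simp
          _ ≤ |ξ| * |slp r dφ b0| := by
            apply mul_le_mul hξ1 (slp_low hC A b0) (by positivity) hξp.le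
      have hqp : 0 < q := lt_of_lt_of_le (by positivity) hqM
      have hqm : ‖v0‖ < q * m := by
        have : (M / m + 1) * m ≤ q * m := by gcongr
        have e1 : (M / m + 1) * m = M + m := by field_simp
        linarith
      have h1 : ‖v0‖ < q * s := hqm.trans_le (by gcongr; exact min_le_left _ _)
      have h2 : ‖q⁻¹ • v0‖ < s' := by
        rw [norm_smul, norm_inv, Real.norm_of_nonneg hqp.le, inv_mul_lt_iff₀ hqp]
        exact hqm.trans_le (by gcongr; exact min_le_right _ _)
      have h3 := main_ineq S P hDt hC hδ hη0 hs K hom A hξ0 hv00 hcr hq h1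
      have h4 := h8 (q⁻¹ • v0) (smul_ne_zero (inv_ne_zero hqp.ne') hv00) h2
      refine h3.trans ?_
      rw [← hcoe]
      have t1 : 2 * UL μ (ww N s (s * Real.exp K)) (q⁻¹ • v0) ≤ ENNReal.ofReal e := by
        calc _ ≤ 2 * ENNReal.ofReal (e / 2) := by gcongr
          _ = ENNReal.ofReal e := by
            rw [show (2:ℝ≥0∞) = ENNReal.ofReal 2 by simp, ← ENNReal.ofReal_mul zero_le_two]; congr 1; ring
      have t2 : ENNReal.ofReal (4 * η + 2 * Cst C δ s * (1 / |ξ|)) * D ≤ ENNReal.ofReal (2 * e) := by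
        rw [← ENNReal.ofReal_coe_nnreal, ← ENNReal.ofReal_mul (by positivity)]
        apply ENNReal.ofReal_le_ofReal
        have a1 : 4 * η = e / (D + 1) := by rw [hη]; field_simp
        have a2 : 2 * Cst C δ s * (1 / |ξ|) ≤ e / (D + 1) := by
          rw [mul_one_div, div_le_div_iff₀ hξp (by positivity)]
          rw [div_le_iff₀ he0] at hξ2
          linarith
        calc _ ≤ (e / (D + 1) + e / (D + 1)) * ((D:ℝ) + 1) := by
              rw [a1]; gcongr; linarith
          _ = 2 * e := by field_simp; ring
      have t3 : ENNReal.ofReal (2 * Cst C δ s) * (D * CP * (CP * Na a v0)) = Q * Na a v0 := by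
        have : (Q:ℝ≥0∞) = ENNReal.ofReal (2 * Cst C δ s) * ((D:ℝ≥0∞) * CP * CP) := by
          rw [hQ, ENNReal.coe_mul, ENNReal.coe_mul (_ * _), ENNReal.coe_mul D]; rfl
        rw [this]; ring
      rw [t3]
      have t5 : ENNReal.ofReal (4 * e) = ENNReal.ofReal e + ENNReal.ofReal (2 * e) + ENNReal.ofReal e := by
        rw [← ENNReal.ofReal_add he0.le (by positivity), ← ENNReal.ofReal_add (by positivity) he0.le]; congr 1; ring
      rw [t5]
      calc _ ≤ ENNReal.ofReal e + ENNReal.ofReal (2 * e) + Q * Na a v0 + ENNReal.ofReal e := by gcongr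
        _ = _ := by ring
  have hms : MeasurableSet {g : SL2 | M < fr g} := measurableSet_lt measurable_const cont_fr.measurable
  have hmN : Measurable fun g => Na a (ra 1 g) := (meas_Na a).comp (mra 1)
  have hfin : ffn N (Ph ξ r φ) C 1 Complex.I ≤ ENNReal.ofReal ((ε / C) ^ 2) := by
    refine (ffn_mun S hΦ hC0 hΦn 1 Complex.I n0).trans ((lintegral_mono hpt).trans ?_)
    rw [lintegral_add_right _ (measurable_one.indicator hms), lintegral_add_left measurable_const,
      lintegral_const_mul _ hmN, lintegral_indicator_one hms, lintegral_const, measure_univ, mul_one]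
    have t6 : mun μ n0 {g | M < fr g} ≤ ENNReal.ofReal e := by
      rw [← ofReal_measureReal]; exact ENNReal.ofReal_le_ofReal hMt
    refine (add_le_add (add_le_add le_rfl hn0) t6).trans ?_
    rw [← ENNReal.ofReal_add (by positivity) he0.le, ← ENNReal.ofReal_add (by positivity) he0.le]
    apply ENNReal.ofReal_le_ofReal
    linarith
  rw [ffn, ENNReal.ofReal_le_ofReal_iff (by positivity)] at hfin
  have := (sq_le_sq₀ (by positivity) (by positivity)).1 hfin
  exact (div_le_div_iff_of_pos_right hC0).1 this

end

noncomputable section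
open scoped ENNReal NNReal Topology

def toC (v : Fin 2 → ℝ) : ℂ := ⟨v 0, v 1⟩

lemma sq_pos2 {v : Fin 2 → ℝ} (hv : v ≠ 0) : 0 < v 0 ^ 2 + v 1 ^ 2 := by
  by_contra h
  apply hv
  have h0 := sq_nonneg (v 0)
  have h1 := sq_nonneg (v 1)
  funext i
  fin_cases i
  · exact pow_eq_zero_iff (two_ne_zero) |>.1 (by linarith : v 0 ^ 2 = 0)
  · exact pow_eq_zero_iff (two_ne_zero) |>.1 (by linarith : v 1 ^ 2 = 0)

def AA : PX → ℝ := Projectivization.lift (fun v => v.1 0 ^ 2 / (v.1 0 ^ 2 + v.1 1 ^ 2)) (by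
  rintro ⟨a, ha⟩ ⟨b, hb⟩ t h
  simp only at h ⊢
  have h1 := (sq_pos2 ha).ne'
  have h2 := (sq_pos2 hb).ne'
  rw [div_eq_div_iff h1 h2, h]; simp; ring)

def BB : PX → ℝ := Projectivization.lift (fun v => v.1 0 * v.1 1 / (v.1 0 ^ 2 + v.1 1 ^ 2)) (by
  rintro ⟨a, ha⟩ ⟨b, hb⟩ t h
  simp only at h ⊢
  have h1 := (sq_pos2 ha).ne'
  have h2 := (sq_pos2 hb).ne'
  rw [div_eq_div_iff h1 h2, h]; simp; ring)

lemma cont_coord (i : Fin 2) : Continuous fun v : {v : Fin 2 → ℝ // v ≠ 0} => v.1 i :=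
  (continuous_apply i).comp continuous_subtype_val

lemma cont_AA : Continuous AA := by
  refine Continuous.quotient_lift (f := fun v : {v : Fin 2 → ℝ // v ≠ 0} => v.1 0 ^ 2 / (v.1 0 ^ 2 + v.1 1 ^ 2)) ?_ _
  have c0 := cont_coord 0
  have c1 := cont_coord 1
  exact Continuous.div (c0.pow 2) ((c0.pow 2).add (c1.pow 2)) fun v => (sq_pos2 v.2).ne'

lemma cont_BB : Continuous BB := by
  refine Continuous.quotient_lift (f := fun v : {v : Fin 2 → ℝ // v ≠ 0} => v.1 0 * v.1 1 / (v.1 0 ^ 2 + v.1 1 ^ 2)) ?_ _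
  have c0 := cont_coord 0
  have c1 := cont_coord 1
  exact Continuous.div (c0.mul c1) ((c0.pow 2).add (c1.pow 2)) fun v => (sq_pos2 v.2).ne'

lemma AA_mk {v : Fin 2 → ℝ} (hv : v ≠ 0) : AA (Projectivization.mk ℝ v hv) = v 0 ^ 2 / (v 0 ^ 2 + v 1 ^ 2) := rfl
lemma BB_mk {v : Fin 2 → ℝ} (hv : v ≠ 0) : BB (Projectivization.mk ℝ v hv) = v 0 * v 1 / (v 0 ^ 2 + v 1 ^ 2) := rfl

def sec (x : PX) : ℂ := if AA x = 0 then Complex.I else ⟨1, BB x / AA x⟩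

lemma meas_sec : Measurable sec := by
  unfold sec
  refine Measurable.ite (measurableSet_eq_fun cont_AA.measurable measurable_const) measurable_const ?_
  have h : Measurable fun x => BB x / AA x := cont_BB.measurable.div cont_AA.measurable
  have : (fun x => (⟨1, BB x / AA x⟩ : ℂ)) = fun x => (1 : ℂ) + ((BB x / AA x : ℝ) : ℂ) * Complex.I := by
    funext x; apply Complex.ext <;> simp
  rw [this]
  exact measurable_const.add ((Complex.measurable_ofReal.comp h).mul_const _)

lemma sec_mk0 {v : Fin 2 → ℝ} (hv : v ≠ 0) (h : v 0 = 0) : sec (Projectivization.mk ℝ v hv) = Complex.I := by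
  rw [sec, if_pos (by rw [AA_mk, h]; simp)]

lemma sec_mk1 {v : Fin 2 → ℝ} (hv : v ≠ 0) (h : v 0 ≠ 0) : sec (Projectivization.mk ℝ v hv) = ⟨1, v 1 / v 0⟩ := by
  have := (sq_pos2 hv).ne'
  rw [sec, if_neg (by rw [AA_mk]; positivity), AA_mk, BB_mk]
  congr 1
  field_simp

lemma sec_par {v : Fin 2 → ℝ} (hv : v ≠ 0) : ∃ c : ℝ, c ≠ 0 ∧ sec (Projectivization.mk ℝ v hv) = c • toC v := by
  by_cases h : v 0 = 0
  · have h1 : v 1 ≠ 0 := by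
      intro h1; have := sq_pos2 hv; rw [h, h1] at this; simp at this
    refine ⟨(v 1)⁻¹, inv_ne_zero h1, ?_⟩
    rw [sec_mk0 hv h]
    apply Complex.ext <;> simp [toC, h, h1]
  · refine ⟨(v 0)⁻¹, inv_ne_zero h, ?_⟩
    rw [sec_mk1 hv h]
    apply Complex.ext <;> simp [toC, h]
    field_simp

lemma sec_cases (x : PX) : (sec x).re = 1 ∨ sec x = Complex.I := by
  rw [sec]; split_ifs
  · right; rfl
  · left; rfl

lemma act_mk (g : SL2) {v : Fin 2 → ℝ} (hv : v ≠ 0) : ∃ hw : (g : Matrix (Fin 2) (Fin 2) ℝ).mulVec v ≠ 0,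
    act g (Projectivization.mk ℝ v hv) = Projectivization.mk ℝ ((g : Matrix (Fin 2) (Fin 2) ℝ).mulVec v) hw := by
  refine ⟨?_, ?_⟩
  · intro h
    apply hv
    have : (Matrix.SpecialLinearGroup.toLin' g) v = 0 := h
    exact (LinearEquiv.map_eq_zero_iff _).1 this
  · rfl

lemma toC_mul (g : SL2) (v : Fin 2 → ℝ) : toC ((g : Matrix (Fin 2) (Fin 2) ℝ).mulVec v) = ca g (toC v) := by
  apply Complex.ext <;> simp [toC, ca_re, ca_im, Matrix.mulVec, dotProduct, Fin.sum_univ_two]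

lemma sec_act {β : Type*} {f : ℂ → β} (hf : ∀ (c : ℝ) (x : ℂ), c ≠ 0 → f (c • x) = f x) (g : SL2) (x : PX) :
    f (sec (act g x)) = f (ca g (sec x)) := by
  induction x using Projectivization.ind with
  | h v hv =>
    obtain ⟨hw, e⟩ := act_mk g hv
    obtain ⟨c, hc, e1⟩ := sec_par hv
    obtain ⟨d, hd, e2⟩ := sec_par hw
    rw [e, e1, e2, hf _ _ hd, toC_mul, ca_smul, hf _ _ hc]

lemma cont_act (g : SL2) : Continuous (act g) := by
  have h : Continuous fun v : {v : Fin 2 → ℝ // v ≠ 0} =>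
      (⟨(g : Matrix (Fin 2) (Fin 2) ℝ).mulVec v.1, (act_mk g v.2).1⟩ : {v : Fin 2 → ℝ // v ≠ 0}) := by
    apply Continuous.subtype_mk
    exact Continuous.matrix_mulVec continuous_const continuous_subtype_val
  exact continuous_quot_lift _ (continuous_quot_mk.comp h)

lemma fr_le_op (g : SL2) : fr g ≤ 2 * opNorm g := by
  have h : ∀ i j, |g.1 i j| ≤ opNorm g := by
    intro i j
    have h1 := (Matrix.toEuclideanCLM (𝕜 := ℝ) (n := Fin 2) (g : Matrix (Fin 2) (Fin 2) ℝ)).le_opNorm (EuclideanSpace.single j (1:ℝ))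
    rw [EuclideanSpace.norm_single, norm_one, mul_one] at h1
    have h2 := PiLp.norm_apply_le (Matrix.toEuclideanCLM (𝕜 := ℝ) (n := Fin 2) (g : Matrix (Fin 2) (Fin 2) ℝ) (EuclideanSpace.single j (1:ℝ))) i
    have h3 : (Matrix.toEuclideanCLM (𝕜 := ℝ) (n := Fin 2) (g : Matrix (Fin 2) (Fin 2) ℝ) (EuclideanSpace.single j (1:ℝ))) i = g.1 i j := by
      rw [EuclideanSpace.single, Matrix.ofLp_toEuclideanCLM]; simp
    rw [h3] at h2
    exact h2.trans h1
  have h0 : 0 ≤ opNorm g := norm_nonneg _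
  apply abs_le_of_sq_le_sq' _ (by positivity) |>.2
  have hs : ∀ i j, g.1 i j ^ 2 ≤ opNorm g ^ 2 := fun i j => sq_le_sq' (by have := abs_le.1 (h i j); linarith) (abs_le.1 (h i j)).2
  rw [fr_sq]
  nlinarith [hs 0 0, hs 0 1, hs 1 0, hs 1 1]

lemma stp_of {μ : Measure SL2} [IsProbabilityMeasure μ] (hmom : HasExpMoment μ) (hzd : ZariskiDense μ)
    {ν : Measure PX} [IsProbabilityMeasure ν] (hstat : IsMuStationary μ ν) : Stp μ (ν.map sec) where
  pmu := inferInstance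
  pN := Measure.isProbabilityMeasure_map meas_sec.aemeasurable
  sect := by
    rw [ae_map_iff meas_sec.aemeasurable]
    · exact ae_of_all _ sec_cases
    · exact ((measurableSet_eq_fun Complex.measurable_re measurable_const).union (measurableSet_singleton _))
  stat f hf hh := by
    have hae : AEMeasurable (fun g => ν.map (act g)) μ := by
      by_contra h
      have h1 : μ.bind (fun g => ν.map (act g)) = 0 := by
        rw [Measure.bind, Measure.map_of_not_aemeasurable h, Measure.join_zero]
      have h2 : ν = 0 := hstat.symm.trans h1
      exact IsProbabilityMeasure.ne_zero ν h2
    have hfs : Measurable fun x => f (sec x) := hf.comp meas_sec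
    rw [lintegral_map hf meas_sec]
    conv_lhs => rw [← (hstat : μ.bind (fun g => ν.map (act g)) = ν)]
    rw [Measure.lintegral_bind hae hfs.aemeasurable]
    refine lintegral_congr fun g => ?_
    have hfg : Measurable fun x => f (ca g x) := hf.comp (measurable_id.ca' measurable_const)
    rw [lintegral_map hfs (cont_act g).measurable, lintegral_map hfg meas_sec]
    refine lintegral_congr fun x => ?_
    exact sec_act hh g x
  mom := by
    obtain ⟨e, he, h⟩ := hmom
    refine ⟨e, he, ?_⟩
    calc ∫⁻ g, ENNReal.ofReal (fr g ^ e) ∂μ ≤ ∫⁻ g, ENNReal.ofReal (2 ^ e) * ENNReal.ofReal (opNorm g ^ e) ∂μ := by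
          refine lintegral_mono fun g => ?_
          rw [← ENNReal.ofReal_mul (by positivity), ← Real.mul_rpow zero_le_two (show 0 ≤ opNorm g from norm_nonneg _)]
          exact ENNReal.ofReal_le_ofReal (Real.rpow_le_rpow (fr_nonneg g) (fr_le_op g) he.le)
      _ = ENNReal.ofReal (2 ^ e) * ∫⁻ g, ENNReal.ofReal (opNorm g ^ e) ∂μ := lintegral_const_mul' _ _ ENNReal.ofReal_ne_top
      _ < ⊤ := ENNReal.mul_lt_top ENNReal.ofReal_lt_top h
  ns := hzd

end

noncomputable section
open scoped ENNReal NNReal Topology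

lemma exists_rho (κ : Measure ℝ) [IsProbabilityMeasure κ] {D : Set ℝ} (hD : MeasurableSet D) {e : ℝ} (he : 0 < e) :
    ∃ (ρ : ℝ → ℝ) (L M : ℝ), 0 ≤ L ∧ 0 ≤ M ∧ (∀ y, 0 ≤ ρ y) ∧ (∀ y, ρ y ≤ 1) ∧ (∀ y z, |ρ y - ρ z| ≤ L * |y - z|) ∧
      (∀ y, ρ y ≠ 0 → |y| ≤ M) ∧ ∫ y, |D.indicator (fun _ => (1:ℝ)) y - ρ y| ∂κ ≤ e := by
  obtain ⟨K, hKD, hK, hKm⟩ := hD.exists_isCompact_sdiff_lt (μ := κ) (measure_ne_top _ _) (ε := ENNReal.ofReal (e / 2))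
    (by rw [Ne, ENNReal.ofReal_eq_zero, not_le]; positivity)
  have ht := tendsto_measure_cthickening_of_isCompact (μ := κ) hK
  have h1 : ∀ᶠ r in 𝓝 (0:ℝ), κ (Metric.cthickening r K) < κ K + ENNReal.ofReal (e / 2) :=
    ht.eventually (gt_mem_nhds (ENNReal.lt_add_right (measure_ne_top _ _)
      (by rw [Ne, ENNReal.ofReal_eq_zero, not_le]; positivity)))
  obtain ⟨r, hr, hrp⟩ := ((h1.filter_mono nhdsWithin_le_nhds).and (self_mem_nhdsWithin (s := Set.Ioi (0:ℝ)))).exists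
  have hrp : 0 < r := hrp
  have hbd : Bornology.IsBounded (Metric.cthickening r K) := hK.isBounded.cthickening
  obtain ⟨M, hM⟩ := hbd.exists_norm_le
  set T := Metric.cthickening r K
  have hTm : MeasurableSet T := Metric.isClosed_cthickening.measurableSet
  have hKT : K ⊆ T := Metric.self_subset_cthickening K
  set ρ : ℝ → ℝ := fun y => (thickenedIndicator hrp K y : ℝ) with hρ
  have hρ0 : ∀ y, 0 ≤ ρ y := fun y => NNReal.coe_nonneg _
  have hρ1 : ∀ y, ρ y ≤ 1 := fun y => by
    have := thickenedIndicator_le_one hrp K y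
    exact_mod_cast this
  have hz : ∀ y, y ∉ T → ρ y = 0 := fun y hy => by
    have : y ∉ Metric.thickening r K := fun h => hy (Metric.thickening_subset_cthickening _ _ h)
    rw [hρ]; simp only; rw [thickenedIndicator_zero hrp K this]; rfl
  have hk : ∀ y ∈ K, ρ y = 1 := fun y hy => by
    rw [hρ]; simp only; rw [thickenedIndicator_one hrp K hy]; rfl
  refine ⟨ρ, ((r.toNNReal⁻¹ : ℝ≥0) : ℝ), |M|, NNReal.coe_nonneg _, abs_nonneg _, hρ0, hρ1, ?_, ?_, ?_⟩
  · intro y z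
    have := (lipschitzWith_thickenedIndicator hrp K).dist_le_mul y z
    rwa [NNReal.dist_eq, Real.dist_eq] at this
  · intro y hy
    have : y ∈ T := by by_contra h; exact hy (hz y h)
    exact (hM y this).trans (le_abs_self _)
  · have hm1 : MeasurableSet (D \ K) := hD.diff hK.measurableSet
    have hm2 : MeasurableSet (T \ K) := hTm.diff hK.measurableSet
    calc ∫ y, |D.indicator (fun _ => (1:ℝ)) y - ρ y| ∂κ
        ≤ ∫ y, ((D \ K).indicator (fun _ => (1:ℝ)) y + (T \ K).indicator (fun _ => (1:ℝ)) y) ∂κ := by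
          refine integral_mono_of_nonneg (ae_of_all _ fun y => abs_nonneg _)
            (((integrable_const _).indicator hm1).add ((integrable_const _).indicator hm2)) (ae_of_all _ fun y => ?_)
          have a0 := hρ0 y
          have a1 := hρ1 y
          by_cases hyK : y ∈ K
          · have : y ∈ D := hKD hyK
            simp [hk y hyK, hyK, this]
          · by_cases hyD : y ∈ D
            · have hn : 0 ≤ (T \ K).indicator (fun _ => (1:ℝ)) y := Set.indicator_nonneg (fun _ _ => zero_le_one) _
              have : y ∈ D \ K := ⟨hyD, hyK⟩
              simp only [Set.indicator_of_mem hyD, Set.indicator_of_mem this]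
              rw [abs_of_nonneg (by linarith)]; linarith
            · have : y ∉ D \ K := fun h => hyD h.1
              simp only [Set.indicator_of_notMem hyD, Set.indicator_of_notMem this]
              by_cases hyT : y ∈ T
              · have : y ∈ T \ K := ⟨hyT, hyK⟩
                rw [Set.indicator_of_mem this, zero_sub, abs_neg, abs_of_nonneg a0]; linarith
              · rw [hz y hyT]; simp; exact Set.indicator_nonneg (fun _ _ => zero_le_one) _
      _ = κ.real (D \ K) + κ.real (T \ K) := by
          rw [integral_add ((integrable_const _).indicator hm1) ((integrable_const _).indicator hm2),
            integral_indicator_const _ hm1, integral_indicator_const _ hm2]; simp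
      _ ≤ e / 2 + e / 2 := by
          apply add_le_add
          · exact ENNReal.toReal_le_of_le_ofReal (by positivity) hKm.le
          · apply ENNReal.toReal_le_of_le_ofReal (by positivity)
            rw [measure_diff hKT hK.measurableSet.nullMeasurableSet (measure_ne_top _ _)]
            exact tsub_le_iff_left.2 hr.le
      _ = e := by ring

/-- hypotheses on (r, φ) -/
structure HR (C : ℝ) (r φ : ℝ → ℝ) : Prop where
  rd : ContDiff ℝ 1 r
  pd : ContDiff ℝ 2 φ
  rb : ∀ θ, |r θ| ≤ C
  r1 : ∀ θ, |deriv r θ| ≤ C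
  p1 : ∀ θ, |deriv φ θ| ≤ C
  p2 : ∀ θ, |deriv (deriv φ) θ| ≤ C
  low : ∀ θ ∈ Function.support r, 1 / C ≤ |deriv φ θ|

lemma lip_of_deriv {f f' : ℝ → ℝ} {C : ℝ} (hf : ∀ x, HasDerivAt f (f' x) x) (hb : ∀ x, |f' x| ≤ C) (x y : ℝ) :
    |f x - f y| ≤ C * |x - y| :=
  Convex.norm_image_sub_le_of_norm_hasDerivWithin_le (f := f) (f' := f') (s := Set.univ)
    (fun x _ => (hf x).hasDerivWithinAt) (fun x _ => hb x) convex_univ (Set.mem_univ y) (Set.mem_univ x)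

lemma tay_of_lip {f f' : ℝ → ℝ} {C : ℝ} (hC : 0 ≤ C) (hf : ∀ x, HasDerivAt f (f' x) x) (hb : ∀ x y, |f' x - f' y| ≤ C * |x - y|)
    (b y : ℝ) : |f y - f b - f' b * (y - b)| ≤ C * (y - b) ^ 2 := by
  have h := Convex.norm_image_sub_le_of_norm_hasDerivWithin_le (f := fun t => f t - f' b * t) (f' := fun t => f' t - f' b)
    (s := Set.uIcc b y) (C := C * |y - b|) (x := b) (y := y)
    (fun x _ => ((hf x).sub (by simpa using (hasDerivAt_id x).const_mul (f' b))).hasDerivWithinAt)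
    (fun x hx => (hb x b).trans (mul_le_mul_of_nonneg_left (Set.abs_sub_left_of_mem_uIcc hx) hC))
    (convex_uIcc b y) Set.left_mem_uIcc Set.right_mem_uIcc
  rw [Real.norm_eq_abs, Real.norm_eq_abs] at h
  calc |f y - f b - f' b * (y - b)| = |f y - f' b * y - (f b - f' b * b)| := by congr 1; ring
    _ ≤ _ := h
    _ = C * (y - b) ^ 2 := by rw [← sq_abs (y - b)]; ring

def CC (C L M : ℝ) : ℝ := 1 + 3 * C + L * C + C * (1 + M ^ 2)

lemma AP_of {C : ℝ} (hC : 0 < C) {r φ : ℝ → ℝ} (H : HR C r φ) {ρ : ℝ → ℝ} {L M : ℝ} (hL : 0 ≤ L) (hM : 0 ≤ M)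
    (h0 : ∀ y, 0 ≤ ρ y) (h1 : ∀ y, ρ y ≤ 1) (hl : ∀ y z, |ρ y - ρ z| ≤ L * |y - z|) (hm : ∀ y, ρ y ≠ 0 → |y| ≤ M) (c : ℝ) :
    AP (CC C L M) (fun y => ρ y * r (Real.arctan y + c)) (fun y => φ (Real.arctan y + c))
      (fun y => deriv φ (Real.arctan y + c) * (1 / (1 + y ^ 2))) := by
  have hCC : 3 * C ≤ CC C L M := by unfold CC; nlinarith [mul_nonneg hL hC.le, mul_nonneg hC.le (sq_nonneg M)]
  have hCC2 : L * C + C ≤ CC C L M := by unfold CC; nlinarith [mul_nonneg hL hC.le, mul_nonneg hC.le (sq_nonneg M)]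
  have hCC3 : C * (1 + M ^ 2) ≤ CC C L M := by unfold CC; nlinarith [mul_nonneg hL hC.le, mul_nonneg hC.le (sq_nonneg M)]
  have hCC0 : 0 < CC C L M := by linarith
  have hat : ∀ y, HasDerivAt (fun y => Real.arctan y + c) (1 / (1 + y ^ 2)) y := fun y => (Real.hasDerivAt_arctan y).add_const c
  have hw : ∀ y : ℝ, |1 / (1 + y ^ 2)| ≤ 1 := fun y => by
    rw [abs_of_nonneg (by positivity), div_le_one (by positivity)]; nlinarith [sq_nonneg y]
  have hφd : ∀ θ, HasDerivAt φ (deriv φ θ) θ := fun θ => (H.pd.differentiable (by norm_num) θ).hasDerivAt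
  have hφ1 : ContDiff ℝ 1 (deriv φ) := by
    have := H.pd
    rw [show (2 : WithTop ℕ∞) = 1 + 1 by norm_num, contDiff_succ_iff_deriv] at this
    exact this.2.2
  have hφdd : ∀ θ, HasDerivAt (deriv φ) (deriv (deriv φ) θ) θ := fun θ => (hφ1.differentiable (by norm_num) θ).hasDerivAt
  have hrd : ∀ θ, HasDerivAt r (deriv r θ) θ := fun θ => (H.rd.differentiable (by norm_num) θ).hasDerivAt
  have hD1 : ∀ y, HasDerivAt (fun y => φ (Real.arctan y + c)) (deriv φ (Real.arctan y + c) * (1 / (1 + y ^ 2))) y :=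
    fun y => (hφd _).comp y (hat y)
  have hD2 : ∀ y, HasDerivAt (fun y : ℝ => 1 / (1 + y ^ 2)) (-(2 * y) / (1 + y ^ 2) ^ 2) y := fun y => by
    have h : HasDerivAt (fun y : ℝ => 1 + y ^ 2) (2 * y) y := by simpa using ((hasDerivAt_pow 2 y).const_add 1)
    have h2 := h.inv (by positivity)
    have e : (fun y : ℝ => 1 / (1 + y ^ 2)) = (fun y : ℝ => 1 + y ^ 2)⁻¹ := by funext y; simp
    rw [e]; exact h2
  have hD3 : ∀ y, HasDerivAt (fun y => deriv φ (Real.arctan y + c) * (1 / (1 + y ^ 2)))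
      (deriv (deriv φ) (Real.arctan y + c) * (1 / (1 + y ^ 2)) * (1 / (1 + y ^ 2)) +
        deriv φ (Real.arctan y + c) * (-(2 * y) / (1 + y ^ 2) ^ 2)) y :=
    fun y => ((hφdd _).comp y (hat y)).mul (hD2 y)
  have hw2 : ∀ y : ℝ, |-(2 * y) / (1 + y ^ 2) ^ 2| ≤ 1 := fun y => by
    rw [abs_div, abs_of_pos (by positivity : (0:ℝ) < (1 + y ^ 2) ^ 2), div_le_one (by positivity), abs_neg, abs_mul, abs_two]
    nlinarith [sq_nonneg (|y| - 1), sq_abs y, sq_nonneg (y ^ 2)]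
  have hdl : ∀ y z, |deriv φ (Real.arctan y + c) * (1 / (1 + y ^ 2)) - deriv φ (Real.arctan z + c) * (1 / (1 + z ^ 2))| ≤
      CC C L M * |y - z| := by
    apply lip_of_deriv hD3
    intro y
    refine le_trans ?_ hCC
    refine (abs_add_le _ _).trans ?_
    rw [abs_mul, abs_mul, abs_mul]
    have e1 : |deriv (deriv φ) (Real.arctan y + c)| * |1 / (1 + y ^ 2)| * |1 / (1 + y ^ 2)| ≤ C * 1 * 1 := by
      gcongr
      · exact H.p2 _
      · exact hw y
      · exact hw y
    have e2 : |deriv φ (Real.arctan y + c)| * |-(2 * y) / (1 + y ^ 2) ^ 2| ≤ C * 1 :=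
      mul_le_mul (H.p1 _) (hw2 y) (abs_nonneg _) hC.le
    linarith
  have hrl : ∀ y z, |r (Real.arctan y + c) - r (Real.arctan z + c)| ≤ C * |y - z| := by
    refine lip_of_deriv (f := fun y => r (Real.arctan y + c)) (fun y => (hrd _).comp y (hat y)) fun y => ?_
    rw [abs_mul]
    calc _ ≤ C * 1 := mul_le_mul (H.r1 _) (hw y) (abs_nonneg _) hC.le
      _ = C := mul_one C
  have hrl2 : ∀ y z, |ρ y * r (Real.arctan y + c) - ρ z * r (Real.arctan z + c)| ≤ CC C L M * |y - z| := by
    intro y z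
    have e : ρ y * r (Real.arctan y + c) - ρ z * r (Real.arctan z + c) =
        (ρ y - ρ z) * r (Real.arctan y + c) + ρ z * (r (Real.arctan y + c) - r (Real.arctan z + c)) := by ring
    rw [e]
    refine (abs_add_le _ _).trans ?_
    rw [abs_mul, abs_mul]
    have e1 : |ρ y - ρ z| * |r (Real.arctan y + c)| ≤ (L * |y - z|) * C :=
      mul_le_mul (hl y z) (H.rb _) (abs_nonneg _) (by positivity)
    have e2 : |ρ z| * |r (Real.arctan y + c) - r (Real.arctan z + c)| ≤ 1 * (C * |y - z|) :=
      mul_le_mul (by rw [abs_of_nonneg (h0 z)]; exact h1 z) (hrl y z) (abs_nonneg _) zero_le_one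
    calc _ ≤ (L * |y - z|) * C + 1 * (C * |y - z|) := add_le_add e1 e2
      _ = (L * C + C) * |y - z| := by ring
      _ ≤ _ := by gcongr
  refine ⟨?_, ?_, ?_, hrl2, tay_of_lip hCC0.le hD1 hdl, hdl, ?_⟩
  · have : LipschitzWith (CC C L M).toNNReal (fun y => ρ y * r (Real.arctan y + c)) :=
      LipschitzWith.of_dist_le_mul fun y z => by
        rw [Real.dist_eq, Real.dist_eq, Real.coe_toNNReal _ hCC0.le]; exact hrl2 y z
    exact this.continuous
  · exact continuous_iff_continuousAt.2 fun y => (hD1 y).continuousAt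
  · intro y
    rw [abs_mul, abs_of_nonneg (h0 y)]
    calc _ ≤ 1 * C := mul_le_mul (h1 y) (H.rb _) (abs_nonneg _) zero_le_one
      _ ≤ _ := by linarith
  · intro y hy
    have hρy : ρ y ≠ 0 := left_ne_zero_of_mul hy
    have hry : r (Real.arctan y + c) ≠ 0 := right_ne_zero_of_mul hy
    have hl1 := H.low _ hry
    have hyM : y ^ 2 ≤ M ^ 2 := by rw [← sq_abs]; exact pow_le_pow_left₀ (abs_nonneg _) (hm y hρy) 2
    rw [abs_mul, abs_of_nonneg (by positivity : 0 ≤ 1 / (1 + y ^ 2))]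
    calc 1 / CC C L M ≤ 1 / (C * (1 + M ^ 2)) := one_div_le_one_div_of_le (by positivity) hCC3
      _ = (1 / C) * (1 / (1 + M ^ 2)) := by field_simp
      _ ≤ _ := mul_le_mul hl1 (one_div_le_one_div_of_le (by positivity) (by linarith)) (by positivity) (abs_nonneg _)

/-- slope coordinate -/
def mm (x : PX) : ℝ := dt Complex.I (sec x) / dt 1 (sec x)

lemma meas_mm : Measurable mm :=
  (measurable_const.dt' meas_sec).div (measurable_const.dt' meas_sec)

lemma FF_mm (ν : Measure PX) {Φ : ℝ → ℂ} (hΦ : Measurable Φ) : FF (ν.map sec) Φ 1 Complex.I = ∫ t, Φ t ∂(ν.map mm) := by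
  have h1 : Measurable fun x => Φ (dt Complex.I x / dt 1 x) :=
    hΦ.comp ((measurable_const.dt' measurable_id).div (measurable_const.dt' measurable_id))
  rw [FF, integral_map meas_sec.aemeasurable h1.aestronglyMeasurable, integral_map meas_mm.aemeasurable hΦ.aestronglyMeasurable]
  rfl

lemma half {μ : Measure SL2} {ν : Measure PX} [IsProbabilityMeasure ν] (S : Stp μ (ν.map sec)) {D : Set ℝ} (hD : MeasurableSet D) (c : ℝ)
    {C : ℝ} (hC : 0 < C) {ε : ℝ} (hε : 0 < ε) :
    ∃ Ξ > (0:ℝ), ∀ ξ : ℝ, Ξ ≤ |ξ| → ∀ r φ : ℝ → ℝ, HR C r φ →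
      ‖∫ t, D.indicator (fun t => Ph ξ r φ (Real.arctan t + c)) t ∂(ν.map mm)‖ ≤ ε := by
  haveI : IsProbabilityMeasure (ν.map mm) := Measure.isProbabilityMeasure_map meas_mm.aemeasurable
  obtain ⟨ρ, L, M, hL, hM, h0, h1, hl, hm, hintg⟩ := exists_rho (ν.map mm) hD (e := ε / (2 * C)) (by positivity)
  have hCC : 1 ≤ CC C L M := by
    unfold CC
    have : 0 ≤ 3 * C + L * C + C * (1 + M ^ 2) := by positivity
    linarith
  obtain ⟨Ξ, hΞ, hc⟩ := core S hCC (half_pos hε)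
  refine ⟨Ξ, hΞ, fun ξ hξ r φ H => ?_⟩
  have A := AP_of hC H hL hM h0 h1 hl hm c
  have h2 := hc ξ hξ _ _ _ A
  rw [FF_mm ν (Ph_cont A ξ).measurable] at h2
  set κ := ν.map mm
  have hρc : Continuous ρ := by
    have : LipschitzWith L.toNNReal ρ := LipschitzWith.of_dist_le_mul fun y z => by
        rw [Real.dist_eq, Real.dist_eq, Real.coe_toNNReal _ hL]; exact hl y z
    exact this.continuous
  have hPm : Measurable fun t => Ph ξ r φ (Real.arctan t + c) := by
    have c1 := H.rd.continuous
    have c2 := H.pd.continuous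
    have c3 := Real.continuous_arctan
    have : Continuous fun t => Ph ξ r φ (Real.arctan t + c) := by unfold Ph; fun_prop
    exact this.measurable
  have hPn : ∀ t, ‖Ph ξ r φ (Real.arctan t + c)‖ ≤ C := fun t => by rw [Ph_norm]; exact H.rb _
  have e1 : ∀ t, Ph ξ (fun y => ρ y * r (Real.arctan y + c)) (fun y => φ (Real.arctan y + c)) t =
      (ρ t : ℂ) * Ph ξ r φ (Real.arctan t + c) := fun t => by
    unfold Ph; push_cast; ring
  have i1 : Integrable (fun t => D.indicator (fun t => Ph ξ r φ (Real.arctan t + c)) t) κ :=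
    (Integrable.of_bound hPm.aestronglyMeasurable C (ae_of_all _ hPn)).indicator hD
  have i2 : Integrable (fun t => (ρ t : ℂ) * Ph ξ r φ (Real.arctan t + c)) κ := by
    refine Integrable.of_bound ((Complex.measurable_ofReal.comp hρc.measurable).mul hPm).aestronglyMeasurable C (ae_of_all _ fun t => ?_)
    rw [norm_mul, Complex.norm_real, Real.norm_of_nonneg (h0 t)]
    calc _ ≤ 1 * C := mul_le_mul (h1 t) (hPn t) (norm_nonneg _) zero_le_one
      _ = C := one_mul C
  simp_rw [e1] at h2
  have h3 : ‖(∫ t, D.indicator (fun t => Ph ξ r φ (Real.arctan t + c)) t ∂κ) - ∫ t, (ρ t : ℂ) * Ph ξ r φ (Real.arctan t + c) ∂κ‖ ≤ ε / 2 := by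
    rw [← integral_sub i1 i2]
    have i3 : Integrable (fun y => |D.indicator (fun _ => (1:ℝ)) y - ρ y|) κ := by
      have j1 : Integrable (fun y => D.indicator (fun _ => (1:ℝ)) y) κ := (integrable_const _).indicator hD
      have j2 : Integrable ρ κ := Integrable.of_bound hρc.measurable.aestronglyMeasurable 1
        (ae_of_all _ fun t => by rw [Real.norm_of_nonneg (h0 t)]; exact h1 t)
      exact (j1.sub j2).abs
    refine (norm_integral_le_of_norm_le (i3.mul_const C) (ae_of_all _ fun t => ?_)).trans ?_
    · have e2 : D.indicator (fun t => Ph ξ r φ (Real.arctan t + c)) t - (ρ t : ℂ) * Ph ξ r φ (Real.arctan t + c) =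
          ((D.indicator (fun _ => (1:ℝ)) t - ρ t : ℝ) : ℂ) * Ph ξ r φ (Real.arctan t + c) := by
        by_cases ht : t ∈ D
        · simp only [Set.indicator_of_mem ht]; push_cast; ring
        · simp only [Set.indicator_of_notMem ht]; push_cast; ring
      rw [e2, norm_mul, Complex.norm_real, Real.norm_eq_abs]
      exact mul_le_mul_of_nonneg_left (hPn t) (abs_nonneg _)
    · rw [integral_mul_const]
      calc _ ≤ ε / (2 * C) * C := by gcongr
        _ = ε / 2 := by field_simp
  have := norm_sub_norm_le (∫ t, D.indicator (fun t => Ph ξ r φ (Real.arctan t + c)) t ∂κ) (∫ t, (ρ t : ℂ) * Ph ξ r φ (Real.arctan t + c) ∂κ)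
  linarith

end

noncomputable section
open scoped ENNReal NNReal Topology

lemma vec1_ne (t : ℝ) : (![1, t] : Fin 2 → ℝ) ≠ 0 := fun h => by
  have := congrFun h 0
  simp at this

def sgm (t : ℝ) : PX := Projectivization.mk ℝ ![1, t] (vec1_ne t)

lemma cont_sgm : Continuous sgm := by
  have h : Continuous fun t : ℝ => (⟨![1, t], vec1_ne t⟩ : {v : Fin 2 → ℝ // v ≠ 0}) := by
    apply Continuous.subtype_mk
    fun_prop
  exact continuous_quot_mk.comp h

lemma mm_mk {v : Fin 2 → ℝ} (hv : v ≠ 0) (h : v 0 ≠ 0) : mm (Projectivization.mk ℝ v hv) = v 1 / v 0 := by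
  rw [mm, sec_mk1 hv h]; simp [dt]

lemma AA_ne {v : Fin 2 → ℝ} (hv : v ≠ 0) (h : AA (Projectivization.mk ℝ v hv) ≠ 0) : v 0 ≠ 0 := by
  intro h0; apply h; rw [AA_mk, h0]; simp

lemma sgm_mm {x : PX} (h : AA x ≠ 0) : sgm (mm x) = x := by
  induction x using Projectivization.ind with
  | h v hv =>
    have h0 := AA_ne hv h
    rw [mm_mk hv h0, sgm, Projectivization.mk_eq_mk_iff']
    refine ⟨(v 0)⁻¹, ?_⟩
    funext i
    fin_cases i
    · simp [h0]
    · simp [div_eq_inv_mul]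

lemma pangle_cases {x : PX} (h : AA x ≠ 0) : pangle x = Real.arctan (mm x) ∨
    (mm x ≤ 0 ∧ pangle x = Real.arctan (mm x) + Real.pi) ∨ (0 < mm x ∧ pangle x = Real.arctan (mm x) + -Real.pi) := by
  have hx : Projectivization.mk ℝ x.rep x.rep_nonzero = x := x.mk_rep
  have h0 : x.rep 0 ≠ 0 := AA_ne x.rep_nonzero (by rw [hx]; exact h)
  have hm : mm x = x.rep 1 / x.rep 0 := by conv_lhs => rw [← hx, mm_mk _ h0]
  set z : ℂ := (x.rep 0 : ℂ) + (x.rep 1 : ℂ) * Complex.I with hz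
  have hre : z.re = x.rep 0 := by simp [hz]
  have him : z.im = x.rep 1 := by simp [hz]
  have hz0 : z ≠ 0 := fun hh => h0 (by rw [← hre, hh]; rfl)
  have hp : pangle x = z.arg := rfl
  have ht : Real.tan z.arg = mm x := by rw [Complex.tan_arg, hre, him, hm]
  have hc : Real.cos z.arg ≠ 0 := by
    rw [Complex.cos_arg hz0, hre]; exact div_ne_zero h0 (norm_ne_zero_iff.2 hz0)
  have l1 := Complex.neg_pi_lt_arg z
  have l2 := Complex.arg_le_pi z
  have hpi := Real.pi_pos
  rw [hp]
  set θ := z.arg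
  have n1 : θ ≠ Real.pi / 2 := fun hh => hc (by rw [hh, Real.cos_pi_div_two])
  have n2 : θ ≠ -(Real.pi / 2) := fun hh => hc (by rw [hh, Real.cos_neg, Real.cos_pi_div_two])
  rcases lt_or_gt_of_ne n1 with c1 | c1
  · rcases lt_or_gt_of_ne n2 with c2 | c2
    · right; right
      have e : Real.arctan (mm x) = θ + Real.pi := by
        rw [← ht, ← Real.tan_add_pi θ]; exact Real.arctan_tan (by linarith) (by linarith)
      refine ⟨?_, by rw [e]; ring⟩
      by_contra hneg
      have : Real.arctan (mm x) ≤ Real.arctan 0 := Real.arctan_mono (not_lt.1 hneg)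
      rw [Real.arctan_zero] at this
      linarith
    · left; rw [← ht]; exact (Real.arctan_tan c2 c1).symm
  · right; left
    have e : Real.arctan (mm x) = θ - Real.pi := by
      rw [← ht, ← Real.tan_sub_pi θ]; exact Real.arctan_tan (by linarith) (by linarith)
    refine ⟨?_, by rw [e]; ring⟩
    by_contra hneg
    have : Real.arctan 0 < Real.arctan (mm x) := Real.arctan_strictMono (not_le.1 hneg)
    rw [Real.arctan_zero] at this
    linarith

lemma AA_ae {μ : Measure SL2} {ν : Measure PX} (S : Stp μ (ν.map sec)) : ∀ᵐ x ∂ν, AA x ≠ 0 := by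
  have h := dt_null S (one_ne_zero : (1:ℂ) ≠ 0)
  have hms : MeasurableSet {x : ℂ | dt 1 x = 0} := measurableSet_eq_fun (measurable_const.dt' measurable_id) measurable_const
  rw [Measure.map_apply meas_sec hms] at h
  rw [ae_iff]
  refine measure_mono_null (fun x hx => ?_) h
  have hx' : AA x = 0 := not_not.1 hx
  show dt 1 (sec x) = 0
  rw [sec, if_pos hx']; simp [dt]

lemma two_valued {α : Type*} [MeasurableSpace α] (ν : Measure α) [IsProbabilityMeasure ν] {A : Set α} {F fa fb : α → ℂ}
    (hF : AEStronglyMeasurable F ν) (hfb : Measurable fb)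
    (ha : ∀ᵐ x ∂ν, x ∉ A → F x = fa x) (hb : ∀ᵐ x ∂ν, x ∈ A → F x = fb x) :
    ∀ᵐ x ∂ν, (x ∉ toMeasurable ν A → F x = fa x) ∧ (x ∈ toMeasurable ν A → F x = fb x) := by
  set G := hF.mk F
  have hG : Measurable G := hF.stronglyMeasurable_mk.measurable
  have hFG : ∀ᵐ x ∂ν, F x = G x := hF.ae_eq_mk
  have hS : MeasurableSet {x | G x ≠ fb x} := (measurableSet_eq_fun hG hfb).compl
  have h0 : ν (A ∩ {x | G x ≠ fb x}) = 0 := by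
    refine measure_mono_null ?_ (ae_iff.1 (hFG.and hb))
    rintro x ⟨hxA, hx⟩ ⟨h1, h2⟩
    exact hx (h1.symm.trans (h2 hxA))
  rw [← Measure.measure_toMeasurable_inter_of_sFinite hS] at h0
  have h1 : ∀ᵐ x ∂ν, ¬ (x ∈ toMeasurable ν A ∧ G x ≠ fb x) := by
    rw [ae_iff]; simpa [Set.inter_def] using h0
  filter_upwards [h1, hFG, ha] with x x1 x2 x3
  refine ⟨fun hx => x3 fun h => hx (subset_toMeasurable ν A h), fun hx => ?_⟩
  by_contra hne
  exact x1 ⟨hx, fun h => hne (x2.trans h)⟩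

theorem final_red {μ : Measure SL2} {ν : Measure PX} [IsProbabilityMeasure ν] (S : Stp μ (ν.map sec))
    {C : ℝ} (hC : 0 < C) {ε : ℝ} (hε : 0 < ε) :
    ∃ Ξ > (0:ℝ), ∀ ξ : ℝ, Ξ ≤ |ξ| → ∀ r φ : ℝ → ℝ, HR C r φ → ‖∫ x, Ph ξ r φ (pangle x) ∂ν‖ ≤ ε := by
  have hε3 : 0 < ε / 3 := by positivity
  set A : Set PX := {x | pangle x ≠ Real.arctan (mm x)} with hA
  set B := toMeasurable ν A with hB
  have hBm : MeasurableSet B := measurableSet_toMeasurable _ _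
  have hT : MeasurableSet (sgm ⁻¹' B) := cont_sgm.measurable hBm
  set D0 := (sgm ⁻¹' B)ᶜ with hD0
  set D1 := (sgm ⁻¹' B) ∩ Set.Iic 0 with hD1
  set D2 := (sgm ⁻¹' B) ∩ Set.Ioi 0 with hD2
  have m0 : MeasurableSet D0 := hT.compl
  have m1 : MeasurableSet D1 := hT.inter measurableSet_Iic
  have m2 : MeasurableSet D2 := hT.inter measurableSet_Ioi
  obtain ⟨X0, p0, h0⟩ := half S m0 0 hC hε3
  obtain ⟨X1, p1, h1⟩ := half S m1 Real.pi hC hε3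
  obtain ⟨X2, p2, h2⟩ := half S m2 (-Real.pi) hC hε3
  refine ⟨max X0 (max X1 X2), lt_max_of_lt_left p0, fun ξ hξ r φ H => ?_⟩
  have g0 := h0 ξ ((le_max_left _ _).trans hξ) r φ H
  have g1 := h1 ξ (((le_max_left _ _).trans (le_max_right _ _)).trans hξ) r φ H
  have g2 := h2 ξ (((le_max_right _ _).trans (le_max_right _ _)).trans hξ) r φ H
  by_cases hF : AEStronglyMeasurable (fun x => Ph ξ r φ (pangle x)) ν
  swap
  · rw [integral_undef (fun h => hF h.1), norm_zero]; exact hε.le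
  have hPm : ∀ c, Measurable fun t => Ph ξ r φ (Real.arctan t + c) := by
    intro c
    have c1 := H.rd.continuous
    have c2 := H.pd.continuous
    have c3 := Real.continuous_arctan
    have : Continuous fun t => Ph ξ r φ (Real.arctan t + c) := by unfold Ph; fun_prop
    exact this.measurable
  have hPn : ∀ c t, ‖Ph ξ r φ (Real.arctan t + c)‖ ≤ C := fun c t => by rw [Ph_norm]; exact H.rb _
  haveI : IsProbabilityMeasure (ν.map mm) := Measure.isProbabilityMeasure_map meas_mm.aemeasurable
  have hI : ∀ (c : ℝ) (D : Set ℝ), MeasurableSet D → Integrable (fun t => D.indicator (fun t => Ph ξ r φ (Real.arctan t + c)) t) (ν.map mm) :=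
    fun c D hD => (Integrable.of_bound (hPm c).aestronglyMeasurable C (ae_of_all _ (hPn c))).indicator hD
  set fa : PX → ℂ := fun x => Ph ξ r φ (Real.arctan (mm x) + 0) with hfa
  set fb : PX → ℂ := fun x => if mm x ≤ 0 then Ph ξ r φ (Real.arctan (mm x) + Real.pi) else
    Ph ξ r φ (Real.arctan (mm x) + -Real.pi) with hfb
  have hfbm : Measurable fb :=
    Measurable.ite (measurableSet_le meas_mm measurable_const) ((hPm _).comp meas_mm) ((hPm _).comp meas_mm)
  have hAA := AA_ae S
  have key := two_valued ν (A := A) (fa := fa) hF hfbm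
    (ae_of_all _ fun x hx => by
      have hx' : pangle x = Real.arctan (mm x) := not_not.1 hx
      simp only [hfa, hx', add_zero])
    (by
      filter_upwards [hAA] with x hx hxA
      rcases pangle_cases hx with e | ⟨hs, e⟩ | ⟨hs, e⟩
      · exact absurd e hxA
      · simp only [hfb, if_pos hs, e]
      · simp only [hfb, if_neg (not_le.2 hs), e])
  set u : ℝ → ℂ := fun t => D0.indicator (fun t => Ph ξ r φ (Real.arctan t + 0)) t +
    D1.indicator (fun t => Ph ξ r φ (Real.arctan t + Real.pi)) t + D2.indicator (fun t => Ph ξ r φ (Real.arctan t + -Real.pi)) t with hu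
  have hum : Measurable u := (((hPm 0).indicator m0).add ((hPm _).indicator m1)).add ((hPm _).indicator m2)
  have hae : ∀ᵐ x ∂ν, Ph ξ r φ (pangle x) = u (mm x) := by
    filter_upwards [hAA, key] with x hx hk
    have hs := sgm_mm hx
    by_cases hxB : x ∈ B
    · rw [hk.2 hxB]
      have n0 : mm x ∉ D0 := fun h => h (by show sgm (mm x) ∈ B; rw [hs]; exact hxB)
      have hb' : mm x ∈ sgm ⁻¹' B := by show sgm (mm x) ∈ B; rw [hs]; exact hxB
      by_cases hm : mm x ≤ 0
      · have n1 : mm x ∈ D1 := ⟨hb', hm⟩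
        have n2 : mm x ∉ D2 := fun h => absurd h.2 (not_lt.2 hm)
        simp only [hu, hfb, Set.indicator_of_notMem n0, Set.indicator_of_mem n1, Set.indicator_of_notMem n2, if_pos hm, zero_add, add_zero]
      · have n1 : mm x ∉ D1 := fun h => hm h.2
        have n2 : mm x ∈ D2 := ⟨hb', not_le.1 hm⟩
        simp only [hu, hfb, Set.indicator_of_notMem n0, Set.indicator_of_notMem n1, Set.indicator_of_mem n2, if_neg hm, zero_add]
    · rw [hk.1 hxB]
      have hb' : mm x ∉ sgm ⁻¹' B := by show sgm (mm x) ∉ B; rw [hs]; exact hxB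
      have n0 : mm x ∈ D0 := hb'
      have n1 : mm x ∉ D1 := fun h => hb' h.1
      have n2 : mm x ∉ D2 := fun h => hb' h.1
      simp only [hu, hfa, Set.indicator_of_mem n0, Set.indicator_of_notMem n1, Set.indicator_of_notMem n2, add_zero]
  have hI01 : Integrable (fun t => D0.indicator (fun t => Ph ξ r φ (Real.arctan t + 0)) t +
      D1.indicator (fun t => Ph ξ r φ (Real.arctan t + Real.pi)) t) (ν.map mm) := (hI _ _ m0).add (hI _ _ m1)
  have e1 : ∫ y, u y ∂(ν.map mm) = ∫ y, D0.indicator (fun t => Ph ξ r φ (Real.arctan t + 0)) y ∂(ν.map mm) +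
      ∫ y, D1.indicator (fun t => Ph ξ r φ (Real.arctan t + Real.pi)) y ∂(ν.map mm) +
      ∫ y, D2.indicator (fun t => Ph ξ r φ (Real.arctan t + -Real.pi)) y ∂(ν.map mm) := by
    rw [← integral_add (hI _ _ m0) (hI _ _ m1), ← integral_add hI01 (hI _ _ m2)]
  rw [integral_congr_ae hae, ← integral_map meas_mm.aemeasurable hum.aestronglyMeasurable, e1]
  refine (norm_add₃_le).trans ?_
  linarith

end

theorem oscillatory_integral_decay
    {π : ℝ} (μ : Measure SL2) [IsProbabilityMeasure μ]
    (hmom : HasExpMoment μ) (hzd : ZariskiDense μ)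
    (ν : Measure PX) [IsProbabilityMeasure ν] (hstat : IsMuStationary μ ν)
    (C₁ : ℝ) (hC₁ : 0 < C₁) :
    ∀ ε > (0 : ℝ), ∃ Ξ > (0 : ℝ), ∀ ξ : ℝ, Ξ ≤ |ξ| →
      ∀ r φ : ℝ → ℝ,
        Function.Periodic r π → Function.Periodic φ π →
        ContDiff ℝ 1 r → ContDiff ℝ 2 φ →
        (∀ θ, |r θ| ≤ C₁) → (∀ θ, |deriv r θ| ≤ C₁) →
        (∀ θ, |φ θ| ≤ C₁) → (∀ θ, |deriv φ θ| ≤ C₁) →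
        (∀ θ, |deriv (deriv φ) θ| ≤ C₁) →
        (∀ θ ∈ Function.support r, 1 / C₁ ≤ |deriv φ θ|) →
        ‖∫ x : PX, Complex.exp (Complex.I * ξ * φ (pangle x)) * (r (pangle x) : ℂ) ∂ν‖ ≤ ε := by
  intro ε hε
  obtain ⟨Ξ, hΞ, h⟩ := final_red (stp_of hmom hzd hstat) hC₁ hε
  refine ⟨Ξ, hΞ, fun ξ hξ r φ _ _ hr hφ hrb hr1 _ hp1 hp2 hlow => ?_⟩
  have := h ξ hξ r φ ⟨hr, hφ, hrb, hr1, hp1, hp2, hlow⟩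
  have e : (fun x : PX => Complex.exp (Complex.I * ξ * φ (pangle x)) * (r (pangle x) : ℂ)) =
      fun x => Ph ξ r φ (pangle x) := by
    funext x
    unfold Ph
    push_cast
    rw [mul_assoc]
  rw [e]
  exact this

end
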